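/- For any p > 1 and any Jordan domain Ω in the extended complex plane, the homogeneous Sobolev space D_p(Ω) admits the topological direct sum decomposition D_p(Ω) = HD_p(Ω) ⊕ closure(C_0^∞(Ω)), where the closure of the smooth compactly supported functions is taken with respect to the norm ‖·‖_{D_p}. -/

import Mathlib

/-!
Common definitions used to formalize the statements of
"Transmission of harmonic functions through quasicircles on compact Riemann surfaces".

We model the extended plane by working with planar representations of sphere
self-homeomorphisms (recording the preimage/image of `∞` as `Option ℂ` data,
`none` standing for `∞` itself).
-/

open Complex MeasureTheory Metric Set Filter Topology Bornology
open scoped Real ENNReal ComplexConjugate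

noncomputable section

namespace WPPaper

/-! ### Basic sets and curves -/

def unitCircleSet : Set ℂ := Metric.sphere (0 : ℂ) 1

def unitDiskSet : Set ℂ := Metric.ball (0 : ℂ) 1

def extDiskSet : Set ℂ := {z : ℂ | 1 < ‖z‖}

/-- Arc-length (angle) parametrization of the unit circle. -/
def circlePt (θ : ℝ) : ℂ := Complex.exp (θ * Complex.I)

/-- A closed Jordan curve in `ℂ`: a homeomorphic image of the unit circle. -/
def IsJordanCurve (Γ : Set ℂ) : Prop :=
  ∃ f : ℂ → ℂ, ContinuousOn f unitCircleSet ∧ InjOn f unitCircleSet ∧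
    f '' unitCircleSet = Γ

/-- `A` and `B` are the two complementary subarcs of the Jordan curve `Γ`
between the points `z₁, z₂ ∈ Γ`. -/
def IsArcPair (Γ : Set ℂ) (z₁ z₂ : ℂ) (A B : Set ℂ) : Prop :=
  A ∪ B = Γ ∧ A ∩ B = {z₁, z₂} ∧ IsClosed A ∧ IsClosed B ∧
    IsConnected A ∧ IsConnected B

/-- `Ω` is one of the two complementary (Jordan) domains of the Jordan curve `Γ`
(as a planar set; the unbounded component represents the component of
`Ĉ ∖ Γ` containing `∞` with the point `∞` removed). -/
def IsJordanComplComponent (Ω Γ : Set ℂ) : Prop :=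
  IsJordanCurve Γ ∧ IsOpen Ω ∧ IsPreconnected Ω ∧ Ω ∩ Γ = ∅ ∧ frontier Ω = Γ

/-! ### Hyperbolic densities -/

/-- Hyperbolic density of the unit disk (normalized to curvature `-4`). -/
def rhoD (z : ℂ) : ℝ := (1 - ‖z‖ ^ 2)⁻¹

/-- Hyperbolic density of the exterior disk `𝔻* = {|z| > 1} ∪ {∞}`. -/
def rhoDStar (z : ℂ) : ℝ := (‖z‖ ^ 2 - 1)⁻¹

/-- Hyperbolic (Poincaré) density of a hyperbolic planar domain `Ω`, normalized so that
`hypDensity unitDiskSet = rhoD`; defined via the extremal (covering) map from the disk. -/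
def hypDensity (Ω : Set ℂ) (z : ℂ) : ℝ :=
  (sSup {r : ℝ | ∃ f : ℂ → ℂ, DifferentiableOn ℂ f unitDiskSet ∧
    MapsTo f unitDiskSet Ω ∧ f 0 = z ∧ r = ‖deriv f 0‖})⁻¹

/-- The constant weight `1`; for `p = 2` the hyperbolic weights in the Dirichlet
integral cancel, so the `2`-Dirichlet integral is the unweighted one. -/
def constOne : ℂ → ℝ := fun _ => 1

/-! ### Harmonic functions and Dirichlet integrals -/

/-- `|∇f(z)|`. -/
def gradNorm (f : ℂ → ℂ) (z : ℂ) : ℝ :=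
  Real.sqrt (‖fderiv ℝ f z 1‖ ^ 2 + ‖fderiv ℝ f z Complex.I‖ ^ 2)

/-- `|∇f(z)|` computed from a given (weak) derivative. -/
def gradNormL (L : ℂ →L[ℝ] ℂ) : ℝ := Real.sqrt (‖L 1‖ ^ 2 + ‖L Complex.I‖ ^ 2)

/-- `f` is (complex-valued) harmonic on `Ω`: it is `C²` there and its Laplacian vanishes. -/
def IsHarmonicOn (f : ℂ → ℂ) (Ω : Set ℂ) : Prop :=
  ContDiffOn ℝ 2 f Ω ∧ ∀ z ∈ Ω,
    fderiv ℝ (fun w => fderiv ℝ f w 1) z 1 +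
      fderiv ℝ (fun w => fderiv ℝ f w Complex.I) z Complex.I = 0

/-- The `p`-Dirichlet energy `∫_Ω (|∇f| ρ⁻¹)^p ρ² dxdy` with weight `ρ`. -/
def dirichletEnergy (p : ℝ) (ρ : ℂ → ℝ) (f : ℂ → ℂ) (Ω : Set ℂ) : ℝ≥0∞ :=
  ∫⁻ z in Ω, ENNReal.ofReal ((gradNorm f z * (ρ z)⁻¹) ^ p * (ρ z) ^ 2)

/-- The `p`-Dirichlet norm `‖f‖_{D_p}` with weight `ρ`. -/
def dirichletNorm (p : ℝ) (ρ : ℂ → ℝ) (f : ℂ → ℂ) (Ω : Set ℂ) : ℝ≥0∞ :=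
  dirichletEnergy p ρ f Ω ^ (1 / p)

/-- `f ∈ HD_p(Ω)`: a `p`-Dirichlet finite harmonic function on `Ω` (weight `ρ`). -/
def MemHD (p : ℝ) (ρ : ℂ → ℝ) (f : ℂ → ℂ) (Ω : Set ℂ) : Prop :=
  IsHarmonicOn f Ω ∧ dirichletEnergy p ρ f Ω < ⊤

/-! ### Weak derivatives, Sobolev energies -/

/-- `f'` is a weak (distributional) derivative of `f` on `Ω`. -/
def HasWeakFDerivOn (f : ℂ → ℂ) (f' : ℂ → ℂ →L[ℝ] ℂ) (Ω : Set ℂ) : Prop :=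
  LocallyIntegrableOn f Ω volume ∧
  (∀ v : ℂ, LocallyIntegrableOn (fun z => f' z v) Ω volume) ∧
  ∀ ψ : ℂ → ℝ, ContDiff ℝ (⊤ : ℕ∞) ψ → HasCompactSupport ψ → tsupport ψ ⊆ Ω →
    ∀ v : ℂ, ∫ z in Ω, ψ z • f' z v = -∫ z in Ω, fderiv ℝ ψ z v • f z

/-- The derivative `f'` is locally square integrable on `Ω` (`W^{1,2}_loc`). -/
def W12locOn (f' : ℂ → ℂ →L[ℝ] ℂ) (Ω : Set ℂ) : Prop :=
  ∀ K : Set ℂ, K ⊆ Ω → IsCompact K → (∫⁻ z in K, (‖f' z‖₊ : ℝ≥0∞) ^ 2) < ⊤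

/-- The weighted `p`-Sobolev (Dirichlet) energy computed from a weak derivative. -/
def sobolevEnergyW (p : ℝ) (ρ : ℂ → ℝ) (f' : ℂ → ℂ →L[ℝ] ℂ) (Ω : Set ℂ) : ℝ≥0∞ :=
  ∫⁻ z in Ω, ENNReal.ofReal ((gradNormL (f' z) * (ρ z)⁻¹) ^ p * (ρ z) ^ 2)

/-- The function with weak derivative `g'` can be approximated, in the weighted
`p`-Dirichlet seminorm, by smooth compactly supported functions on `Ω`;
i.e. it lies in the closure of `C₀^∞(Ω)`. -/
def ApproxByTest (p : ℝ) (ρ : ℂ → ℝ) (g' : ℂ → ℂ →L[ℝ] ℂ) (Ω : Set ℂ) : Prop :=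
  ∀ ε : ℝ, 0 < ε → ∃ ψ : ℂ → ℂ, ContDiff ℝ (⊤ : ℕ∞) ψ ∧ HasCompactSupport ψ ∧ tsupport ψ ⊆ Ω ∧
    sobolevEnergyW p ρ (fun z => g' z - fderiv ℝ ψ z) Ω < ENNReal.ofReal ε

/-! ### Wirtinger derivatives and quasiconformal maps -/

def wirtingerD (L : ℂ →L[ℝ] ℂ) : ℂ := (L 1 - Complex.I * L Complex.I) / 2

def wirtingerDBar (L : ℂ →L[ℝ] ℂ) : ℂ := (L 1 + Complex.I * L Complex.I) / 2

/-- `f` is a `K`-quasiconformal homeomorphism of `Ω` onto `Ω'`: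
an orientation-preserving homeomorphism in `W^{1,2}_loc` whose Beltrami coefficient
satisfies `|μ| ≤ (K-1)/(K+1)` a.e. -/
def IsQCOn (f : ℂ → ℂ) (Ω Ω' : Set ℂ) (K : ℝ) : Prop :=
  1 ≤ K ∧ ContinuousOn f Ω ∧ BijOn f Ω Ω' ∧
  (∃ g : ℂ → ℂ, ContinuousOn g Ω' ∧ InvOn g f Ω Ω') ∧
  ∃ f' : ℂ → ℂ →L[ℝ] ℂ, HasWeakFDerivOn f f' Ω ∧ W12locOn f' Ω ∧
    ∀ᵐ z ∂volume.restrict Ω,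
      ‖wirtingerDBar (f' z)‖ ≤ (K - 1) / (K + 1) * ‖wirtingerD (f' z)‖

/-- `f` is a quasiconformal homeomorphism of `Ω` onto `Ω'` with complex dilatation
(Beltrami coefficient) `μ`. -/
def IsQCWithBeltrami (f : ℂ → ℂ) (Ω Ω' : Set ℂ) (μ : ℂ → ℂ) : Prop :=
  ContinuousOn f Ω ∧ BijOn f Ω Ω' ∧
  (∃ g : ℂ → ℂ, ContinuousOn g Ω' ∧ InvOn g f Ω Ω') ∧
  ∃ f' : ℂ → ℂ →L[ℝ] ℂ, HasWeakFDerivOn f f' Ω ∧ W12locOn f' Ω ∧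
    ∀ᵐ z ∂volume.restrict Ω, wirtingerDBar (f' z) = μ z * wirtingerD (f' z)

/-- `Γ` is a `K`-quasicircle: the image of the unit circle under a `K`-quasiconformal
self-homeomorphism of `ℂ`. -/
def IsKQuasicircle (Γ : Set ℂ) (K : ℝ) : Prop :=
  ∃ f : ℂ → ℂ, IsQCOn f univ univ K ∧ f '' unitCircleSet = Γ

def IsQuasicircle (Γ : Set ℂ) : Prop := ∃ K : ℝ, IsKQuasicircle Γ K

/-- `Γ` is a chord-arc curve: the image of the unit circle under a bi-Lipschitz
self-homeomorphism of `ℂ`. -/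
def IsChordArcCurve (Γ : Set ℂ) : Prop :=
  ∃ f : ℂ → ℂ, Function.Bijective f ∧
    (∃ L : ℝ, 1 ≤ L ∧ (∀ z w : ℂ, ‖f z - f w‖ ≤ L * ‖z - w‖) ∧
      (∀ z w : ℂ, ‖z - w‖ ≤ L * ‖f z - f w‖)) ∧
    f '' unitCircleSet = Γ

/-! ### Circle homeomorphisms and quasisymmetry -/

/-- `h` is an orientation-preserving homeomorphism of the unit circle onto itself
(encoded by a continuous strictly increasing degree-one lift). -/
def IsCircleHomeo (h : ℂ → ℂ) : Prop :=
  ∃ H : ℝ → ℝ, Continuous H ∧ StrictMono H ∧ (∀ θ, H (θ + 2 * π) = H θ + 2 * π) ∧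
    ∀ θ, h (circlePt θ) = circlePt (H θ)

/-- `h` is a quasisymmetric homeomorphism of the unit circle: an orientation-preserving
circle homeomorphism extending to a quasiconformal self-homeomorphism of the disk. -/
def IsQuasisymmetric (h : ℂ → ℂ) : Prop :=
  IsCircleHomeo h ∧
  ∃ (Hext : ℂ → ℂ) (K : ℝ), IsQCOn Hext unitDiskSet unitDiskSet K ∧
    ContinuousOn Hext (closure unitDiskSet) ∧ ∀ ζ ∈ unitCircleSet, Hext ζ = h ζ

/-- Normalization: fixing the three boundary points `1`, `i`, `-i`. -/
def FixesNormalization (f : ℂ → ℂ) : Prop :=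
  f 1 = 1 ∧ f Complex.I = Complex.I ∧ f (-Complex.I) = -Complex.I

/-! ### Besov spaces on the circle and on rectifiable curves -/

def besovEnergy (p : ℝ) (φ : ℂ → ℂ) : ℝ≥0∞ :=
  ∫⁻ x in Ioc (0 : ℝ) (2 * π), ∫⁻ y in Ioc (0 : ℝ) (2 * π),
    ENNReal.ofReal (‖φ (circlePt x) - φ (circlePt y)‖ ^ p
      / ‖circlePt x - circlePt y‖ ^ (2 : ℕ))

def besovNorm (p : ℝ) (φ : ℂ → ℂ) : ℝ≥0∞ := besovEnergy p φ ^ (1 / p)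

/-- `φ ∈ B_p(𝕊)`: the homogeneous `p`-Besov space on the unit circle. -/
def MemBesov (p : ℝ) (φ : ℂ → ℂ) : Prop :=
  IntegrableOn (fun θ : ℝ => φ (circlePt θ)) (Ioc 0 (2 * π)) volume ∧
  besovEnergy p φ < ⊤

/-- Besov energy on a rectifiable curve `Γ`, with respect to arc length
(one-dimensional Hausdorff measure). -/
def besovEnergyCurve (p : ℝ) (Γ : Set ℂ) (φ : ℂ → ℂ) : ℝ≥0∞ :=
  ∫⁻ x in Γ, ∫⁻ y in Γ,
    ENNReal.ofReal (‖φ x - φ y‖ ^ p / ‖x - y‖ ^ (2 : ℕ)) ∂μH[1] ∂μH[1]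

def besovNormCurve (p : ℝ) (Γ : Set ℂ) (φ : ℂ → ℂ) : ℝ≥0∞ :=
  besovEnergyCurve p Γ φ ^ (1 / p)

/-- `φ ∈ B_p(Γ)`: `φ ∈ L_p(Γ)` with finite Besov energy on `Γ`. -/
def MemBesovCurve (p : ℝ) (Γ : Set ℂ) (φ : ℂ → ℂ) : Prop :=
  (∫⁻ x in Γ, ENNReal.ofReal (‖φ x‖ ^ p) ∂μH[1]) < ⊤ ∧ besovEnergyCurve p Γ φ < ⊤

/-! ### Nontangential limits and Poisson integrals -/

/-- Nontangential approach region in `Ω` at the boundary point `ζ` with aperture `M`. -/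
def ntRegion (Ω : Set ℂ) (ζ : ℂ) (M : ℝ) : Set ℂ :=
  {z ∈ Ω | ‖z - ζ‖ < M * Metric.infDist z (frontier Ω)}

/-- `f` has nontangential limit `L` at the boundary point `ζ` of `Ω`. -/
def HasNTLimAt (f : ℂ → ℂ) (Ω : Set ℂ) (L : ℂ) (ζ : ℂ) : Prop :=
  ∀ M : ℝ, 1 < M → Tendsto f (𝓝[ntRegion Ω ζ M] ζ) (𝓝 L)

/-- `φ` is the nontangential boundary-value function on `Γ` of `f : Ω → ℂ`
(a.e. with respect to arc length on `Γ`). -/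
def IsNTBoundaryFun (f : ℂ → ℂ) (Ω Γ : Set ℂ) (φ : ℂ → ℂ) : Prop :=
  ∀ᵐ ζ ∂(μH[1] : Measure ℂ).restrict Γ, HasNTLimAt f Ω (φ ζ) ζ

/-- The Poisson integral on the unit disk:
`P(φ)(z) = (1/2π) ∫_𝕊 (1-|z|²)/|ζ-z|² φ(ζ) |dζ|`. -/
def poissonDisk (φ : ℂ → ℂ) (z : ℂ) : ℂ :=
  (2 * π)⁻¹ • ∫ θ in Ioc (0 : ℝ) (2 * π),
    ((1 - ‖z‖ ^ 2) / ‖circlePt θ - z‖ ^ 2) • φ (circlePt θ)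

/-- The Poisson integral on the exterior disk. -/
def poissonExt (φ : ℂ → ℂ) (z : ℂ) : ℂ :=
  (2 * π)⁻¹ • ∫ θ in Ioc (0 : ℝ) (2 * π),
    ((‖z‖ ^ 2 - 1) / ‖circlePt θ - z‖ ^ 2) • φ (circlePt θ)

/-! ### Integrable Beltrami coefficients -/

/-- `μ ∈ M_p(Ω)`: a Beltrami coefficient on `Ω` (`‖μ‖_∞ < 1`) that is `p`-integrable
with respect to the hyperbolic metric with density `ρ`. -/
def MemMp (p : ℝ) (μ : ℂ → ℂ) (Ω : Set ℂ) (ρ : ℂ → ℝ) : Prop :=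
  AEStronglyMeasurable μ (volume.restrict Ω) ∧
  (∃ k : ℝ, k < 1 ∧ ∀ᵐ z ∂volume.restrict Ω, ‖μ z‖ ≤ k) ∧
  (∫⁻ z in Ω, ENNReal.ofReal (‖μ z‖ ^ p * (ρ z) ^ 2)) < ⊤

/-! ### Self-maps of the Riemann sphere, in planar representation -/

/-- The filter of neighborhoods of `∞` in `Ĉ`, restricted to `ℂ`. -/
def cobdd : Filter ℂ := Bornology.cobounded ℂ

/-- The planar set attached to an `Option ℂ` datum (`none` stands for `∞`). -/
def optSet (o : Option ℂ) : Set ℂ := o.elim ∅ (fun a => {a})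

/-- `f : ℂ → ℂ` is the planar representation of a self-homeomorphism of the Riemann
sphere `Ĉ`, where `zP` is the preimage of `∞` and `wP` the image of `∞`
(`none` standing for `∞`). The value of `f` on its pole is irrelevant. -/
def IsSphereHomeo (f : ℂ → ℂ) (zP wP : Option ℂ) : Prop :=
  match zP, wP with
  | none, none =>
      Continuous f ∧ Function.Bijective f ∧
      (∃ g : ℂ → ℂ, Continuous g ∧ Function.LeftInverse g f ∧ Function.RightInverse g f) ∧
      Tendsto f cobdd cobdd
  | some a, some b =>
      ContinuousOn f {a}ᶜ ∧ BijOn f {a}ᶜ {b}ᶜ ∧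
      (∃ g : ℂ → ℂ, ContinuousOn g {b}ᶜ ∧ InvOn g f {a}ᶜ {b}ᶜ) ∧
      Tendsto f (𝓝[≠] a) cobdd ∧ Tendsto f cobdd (𝓝 b)
  | _, _ => False

/-- The (planar representation of the) sphere homeomorphism `f` has complex
dilatation `μ` a.e. on the planar set `A` (away from its pole `zP`). -/
def SphereBeltramiOn (f : ℂ → ℂ) (zP : Option ℂ) (μ : ℂ → ℂ) (A : Set ℂ) : Prop :=
  ∃ f' : ℂ → ℂ →L[ℝ] ℂ, HasWeakFDerivOn f f' (A \ optSet zP) ∧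
    W12locOn f' (A \ optSet zP) ∧
    ∀ᵐ z ∂volume.restrict (A \ optSet zP),
      wirtingerDBar (f' z) = μ z * wirtingerD (f' z)

/-- The sphere homeomorphism `f` is `K`-quasiconformal on the planar set `A`. -/
def SphereQCBddOn (f : ℂ → ℂ) (zP : Option ℂ) (K : ℝ) (A : Set ℂ) : Prop :=
  ∃ f' : ℂ → ℂ →L[ℝ] ℂ, HasWeakFDerivOn f f' (A \ optSet zP) ∧
    W12locOn f' (A \ optSet zP) ∧
    ∀ᵐ z ∂volume.restrict (A \ optSet zP),
      ‖wirtingerDBar (f' z)‖ ≤ (K - 1) / (K + 1) * ‖wirtingerD (f' z)‖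

/-- Planar representation of a quasiconformal self-homeomorphism of `Ĉ` fixing
`1, i, -i`, with complex dilatation `μ₁` on the unit disk and `μ₂` on the exterior disk. -/
def IsGMap (f : ℂ → ℂ) (zP wP : Option ℂ) (μ₁ μ₂ : ℂ → ℂ) : Prop :=
  IsSphereHomeo f zP wP ∧
  SphereBeltramiOn f zP μ₁ unitDiskSet ∧
  SphereBeltramiOn f zP μ₂ extDiskSet ∧
  FixesNormalization f

/-- `Γ ⊂ ℂ` is a `p`-Weil–Petersson curve: the image of the unit circle under the
normalized quasiconformal self-map `F_μ` of `Ĉ` with dilatation `μ ∈ M_p(𝔻*)` on `𝔻*`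
and `0` on `𝔻`. -/
def IsWPCurve (p : ℝ) (Γ : Set ℂ) : Prop :=
  ∃ μ : ℂ → ℂ, MemMp p μ extDiskSet rhoDStar ∧
  ∃ (f : ℂ → ℂ) (zP wP : Option ℂ), IsGMap f zP wP (fun _ => 0) μ ∧
    optSet zP ∩ unitCircleSet = ∅ ∧ f '' unitCircleSet = Γ

/-- The reflection of a Beltrami coefficient on `𝔻*` to one on `𝔻`
under `z ↦ 1/z̄`. -/
def reflectBeltrami (ν : ℂ → ℂ) : ℂ → ℂ :=
  fun z => conj (ν ((conj z)⁻¹)) * z ^ 2 / (conj z) ^ 2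

/-- `H = H^ν`: the quasiconformal self-homeomorphism of the unit disk with complex
dilatation `ν`, extended homeomorphically to the closed disk, fixing `1, i, -i`. -/
def IsNormalizedQCDisk (H : ℂ → ℂ) (ν : ℂ → ℂ) : Prop :=
  IsQCWithBeltrami H unitDiskSet unitDiskSet ν ∧
  ContinuousOn H (closure unitDiskSet) ∧
  BijOn H (closure unitDiskSet) (closure unitDiskSet) ∧
  (∃ g : ℂ → ℂ, ContinuousOn g (closure unitDiskSet) ∧
    InvOn g H (closure unitDiskSet) (closure unitDiskSet)) ∧
  FixesNormalization H

/-! ### Riemann mappings of the complementary domains of a Jordan curve -/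

/-- Normalized Riemann mapping from the unit disk onto the complementary domain `Ω`
(planar part) of the Jordan curve `Γ`, extended by Carathéodory to the boundary and
fixing `1, i, -i`; `zP` records a possible pole (when `∞ ∈ Ω` as a `Ĉ`-domain). -/
def IsDiskRiemannTo (F : ℂ → ℂ) (zP : Option ℂ) (Ω Γ : Set ℂ) : Prop :=
  DifferentiableOn ℂ F (unitDiskSet \ optSet zP) ∧
  optSet zP ⊆ unitDiskSet ∧
  ContinuousOn F (closure unitDiskSet \ optSet zP) ∧
  InjOn F (closure unitDiskSet \ optSet zP) ∧
  F '' unitCircleSet = Γ ∧ FixesNormalization F ∧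
  (match zP with
   | none => BijOn F unitDiskSet Ω
   | some a => BijOn F (unitDiskSet \ {a}) Ω ∧ Tendsto F (𝓝[≠] a) cobdd)

/-- Normalized Riemann mapping from the exterior disk `𝔻* = {|z|>1} ∪ {∞}` onto the
complementary domain `Ω` (planar part) of the Jordan curve `Γ`; `zP` records a possible
pole in `{|z|>1}` and `wP` the (finite) image of `∞`, `none` standing for `∞`. -/
def IsExtRiemannTo (F : ℂ → ℂ) (zP wP : Option ℂ) (Ω Γ : Set ℂ) : Prop :=
  DifferentiableOn ℂ F (extDiskSet \ optSet zP) ∧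
  optSet zP ⊆ extDiskSet ∧
  ContinuousOn F ((unitCircleSet ∪ extDiskSet) \ optSet zP) ∧
  InjOn F ((unitCircleSet ∪ extDiskSet) \ optSet zP) ∧
  F '' unitCircleSet = Γ ∧ FixesNormalization F ∧
  (match zP, wP with
   | none, none => BijOn F extDiskSet Ω ∧ Tendsto F cobdd cobdd
   | none, some b => b ∈ Ω ∧ BijOn F extDiskSet (Ω \ {b}) ∧ Tendsto F cobdd (𝓝 b)
   | some a, some b => b ∈ Ω ∧ BijOn F (extDiskSet \ {a}) (Ω \ {b}) ∧
       Tendsto F (𝓝[≠] a) cobdd ∧ Tendsto F cobdd (𝓝 b)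
   | some _, none => False)

/-- The transmission relation across `Γ`: `Φ₂` is obtained from `Φ₁` by the composition
`(F₂)_* ∘ P₂ ∘ C_{h_Γ} ∘ E₁ ∘ (F₁)^*`, i.e. `Φ₂ ∘ F₂ = P₂(E₁(Φ₁ ∘ F₁) ∘ h_Γ)` on the
exterior disk (away from the pole of `F₂`). -/
def TransRel (F₁ F₂ h : ℂ → ℂ) (zP : Option ℂ) (Φ₁ Φ₂ : ℂ → ℂ) : Prop :=
  ∃ φ : ℂ → ℂ,
    IsNTBoundaryFun (fun z => Φ₁ (F₁ z)) unitDiskSet unitCircleSet φ ∧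
    ∀ z ∈ extDiskSet \ optSet zP, Φ₂ (F₂ z) = poissonExt (fun ζ => φ (h ζ)) z

/-! ### Hilbert transform, Szegő projection, analytic Besov space -/

/-- Truncated Hilbert transform on the circle (for the principal value). -/
def hilbertTrunc (φ : ℂ → ℂ) (θ ε : ℝ) : ℂ :=
  (π * Complex.I)⁻¹ * ∫ t in Ioc (θ - π) (θ + π) \ Ioo (θ - ε) (θ + ε),
    φ (circlePt t) / (circlePt t - circlePt θ) * (Complex.I * circlePt t)

/-- `ψ = 𝓗(φ)` a.e. on the circle: `ψ` is the principal-value Hilbert transform of `φ`. -/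
def IsHilbertTransformOf (ψ φ : ℂ → ℂ) : Prop :=
  ∀ᵐ θ ∂volume.restrict (Ioc (0 : ℝ) (2 * π)),
    Tendsto (fun ε : ℝ => hilbertTrunc φ θ ε) (𝓝[>] (0 : ℝ)) (𝓝 (ψ (circlePt θ)))

/-- The Szegő projection (Cauchy integral) `𝓢(φ)(z) = (1/2πi) ∫_𝕊 φ(ζ)/(ζ-z) dζ`. -/
def szego (φ : ℂ → ℂ) (z : ℂ) : ℂ :=
  (2 * π * Complex.I)⁻¹ * ∫ t in Ioc (0 : ℝ) (2 * π),
    φ (circlePt t) / (circlePt t - z) * (Complex.I * circlePt t)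

/-- Energy of the `p`-analytic Besov space `𝓑_p(𝔻)`. -/
def analyticBesovEnergy (p : ℝ) (f : ℂ → ℂ) : ℝ≥0∞ :=
  ∫⁻ z in unitDiskSet, ENNReal.ofReal ((‖deriv f z‖ * (rhoD z)⁻¹) ^ p * (rhoD z) ^ 2)

def analyticBesovNorm (p : ℝ) (f : ℂ → ℂ) : ℝ≥0∞ := analyticBesovEnergy p f ^ (1 / p)

/-- `f ∈ 𝓑_p(𝔻)`: holomorphic on the unit disk with finite `p`-Besov energy. -/
def MemAnalyticBesov (p : ℝ) (f : ℂ → ℂ) : Prop :=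
  DifferentiableOn ℂ f unitDiskSet ∧ analyticBesovEnergy p f < ⊤

/-! ### The p-integrable Teichmüller space -/

/-- Distance `‖μ - ν‖_p + ‖μ - ν‖_∞` on Beltrami coefficients of the disk. -/
def mpDist (p : ℝ) (μ ν : ℂ → ℂ) : ℝ :=
  ((∫⁻ z in unitDiskSet, ENNReal.ofReal (‖μ z - ν z‖ ^ p * (rhoD z) ^ 2)) ^ (1 / p)).toReal +
  (essSup (fun z => (‖μ z - ν z‖₊ : ℝ≥0∞)) (volume.restrict unitDiskSet)).toReal

/-- The space `M_p(𝔻)` of `p`-integrable Beltrami coefficients on the disk. -/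
def MpD (p : ℝ) : Type := {μ : ℂ → ℂ // MemMp p μ unitDiskSet rhoD}

/-- The topology induced by the norm `‖·‖_p + ‖·‖_∞` on `M_p(𝔻)`. -/
instance (p : ℝ) : TopologicalSpace (MpD p) :=
  TopologicalSpace.generateFrom
    {U | ∃ (μ₀ : MpD p) (ε : ℝ), U = {μ : MpD p | mpDist p μ.1 μ₀.1 < ε}}

/-- Teichmüller equivalence: the normalized quasiconformal extensions have the same
boundary values on the circle. -/
def teichRel (p : ℝ) (μ ν : MpD p) : Prop :=
  ∃ H₁ H₂ : ℂ → ℂ, IsNormalizedQCDisk H₁ μ.1 ∧ IsNormalizedQCDisk H₂ ν.1 ∧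
    EqOn H₁ H₂ unitCircleSet

/-- The `p`-integrable Teichmüller space `T_p` with the quotient topology. -/
def TeichSpace (p : ℝ) : Type := Quot (teichRel p)

def TeichSpace.mk (p : ℝ) (μ : MpD p) : TeichSpace p := Quot.mk (teichRel p) μ

instance (p : ℝ) : TopologicalSpace (TeichSpace p) :=
  TopologicalSpace.coinduced (TeichSpace.mk p) inferInstance

/-! ### Arc-length parametrizations and inscribed polygons -/

/-- `γ` is an (L-periodic) arc-length parametrization of the rectifiable Jordan
curve `Γ` of length `L`. -/
def IsArcLengthParam (γ : ℝ → ℂ) (Γ : Set ℂ) (L : ℝ) : Prop :=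
  0 < L ∧ ENNReal.ofReal L = μH[1] Γ ∧ Continuous γ ∧ (∀ s, γ (s + L) = γ s) ∧
  γ '' Ico 0 L = Γ ∧ InjOn γ (Ico 0 L) ∧
  ∀ s t : ℝ, s ≤ t → t ≤ s + L → μH[1] (γ '' Icc s t) = ENNReal.ofReal (t - s)

/-- The length of the inscribed polygon with `2ⁿ` vertices evenly distributed with
respect to arc length, starting at `γ s₀`. -/
def inscribedPolygonLength (γ : ℝ → ℂ) (L s₀ : ℝ) (n : ℕ) : ℝ :=
  ∑ k ∈ Finset.range (2 ^ n),
    ‖γ (s₀ + (k + 1) * (L / 2 ^ n)) - γ (s₀ + k * (L / 2 ^ n))‖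

/-! ### The Cauchy transform -/

/-- The pointwise `∂̄`-derivative. -/
def dbar (f : ℂ → ℂ) (z : ℂ) : ℂ := wirtingerDBar (fderiv ℝ f z)

lemma wirtinger_apply (L : ℂ →L[ℝ] ℂ) (v : ℂ) :
    L v = wirtingerD L * v + wirtingerDBar L * conj v := by
  have h : L v = v.re * L 1 + v.im * L I := by
    conv_lhs => rw [← re_add_im v]
    have h1 : (v.re : ℂ) = v.re • (1 : ℂ) := by simp
    have h2 : (v.im : ℂ) * I = v.im • I := by simp
    rw [map_add, h1, h2, map_smul, map_smul]; simp
  have h3 : conj v = v.re - v.im * I := by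
    apply Complex.ext <;> simp
  rw [h, h3, wirtingerD, wirtingerDBar]
  conv_rhs => rw [← re_add_im v]
  simp only [add_re, ofReal_re, mul_re, I_re, mul_zero, ofReal_im, I_im, mul_one, sub_self,
    add_zero, add_im, mul_im, zero_add]
  linear_combination ((v.im : ℂ) * L I) * I_sq

lemma continuous_wirtingerDBar : Continuous wirtingerDBar := by
  unfold wirtingerDBar; fun_prop

lemma wirtingerDBar_smul (c : ℂ) (L : ℂ →L[ℝ] ℂ) :
    wirtingerDBar (c • L) = c * wirtingerDBar L := by
  simp [wirtingerDBar]; ring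

lemma dbar_continuous {f : ℂ → ℂ} (hf : ContDiff ℝ 1 f) : Continuous (dbar f) :=
  continuous_wirtingerDBar.comp (hf.continuous_fderiv one_ne_zero)

lemma dbar_hasCompactSupport {f : ℂ → ℂ} (hf : HasCompactSupport f) :
    HasCompactSupport (dbar f) :=
  (hf.fderiv (𝕜 := ℝ)).comp_left (g := wirtingerDBar) (by simp [wirtingerDBar])

lemma tsupport_dbar_subset (f : ℂ → ℂ) : tsupport (dbar f) ⊆ tsupport f := by
  refine (closure_mono ?_).trans (tsupport_fderiv_subset ℝ (f := f))
  intro z hz hz'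
  apply hz
  simp [dbar, hz', wirtingerDBar]

lemma dbar_mul {f g : ℂ → ℂ} {z : ℂ} (hf : DifferentiableAt ℝ f z) (hg : DifferentiableAt ℝ g z) :
    dbar (fun w => f w * g w) z = f z * dbar g z + dbar f z * g z := by
  have := fderiv_fun_mul hf hg
  simp only [dbar, wirtingerDBar] at *
  rw [this]
  simp; ring

lemma integrableOn_box {F : ℝ × ℝ → ℂ} (hF : Continuous F) {R : ℝ}
    (h0 : ∀ q : ℝ × ℝ, R ≤ q.1 → F q = 0) :
    IntegrableOn F (Ioi (0 : ℝ) ×ˢ Ioo (-π) π) := by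
  have h1 : IntegrableOn F (Icc (0 : ℝ) R ×ˢ Icc (-π) π) :=
    hF.continuousOn.integrableOn_compact (isCompact_Icc.prod isCompact_Icc)
  have h2 : IntegrableOn F (Ici R ×ˢ Ioo (-π) π) := by
    apply IntegrableOn.congr_fun (f := fun _ => 0) (integrableOn_zero)
    · intro q hq; exact (h0 q hq.1).symm
    · exact measurableSet_Ici.prod measurableSet_Ioo
  refine (h1.union h2).mono_set ?_
  rintro ⟨r, θ⟩ ⟨hr, hθ⟩
  rcases le_total r R with h | h
  · left; exact ⟨⟨le_of_lt hr, h⟩, ⟨hθ.1.le, hθ.2.le⟩⟩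
  · right; exact ⟨h, hθ⟩

/-- Cauchy–Pompeiu formula at the origin, for compactly supported functions. -/
lemma integral_dbar_div {φ : ℂ → ℂ} (hφ : ContDiff ℝ 1 φ) (hc : HasCompactSupport φ) :
    ∫ w, dbar φ w / w = -(π * φ 0) := by
  obtain ⟨R, hR, hRs⟩ : ∃ R : ℝ, 0 < R ∧ ∀ w, R ≤ ‖w‖ → φ w = 0 ∧ fderiv ℝ φ w = 0 := by
    obtain ⟨R, hR⟩ := hc.isCompact.isBounded.subset_ball 0
    refine ⟨max R 1, by positivity, fun w hw => ?_⟩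
    have : w ∉ tsupport φ := fun h => by
      have := hR h
      simp at this
      exact absurd (le_trans (le_max_left _ _) hw) (not_le.2 this)
    exact ⟨image_eq_zero_of_notMem_tsupport this,
      image_eq_zero_of_notMem_tsupport (fun h => this (tsupport_fderiv_subset ℝ h))⟩
  let e : ℝ → ℂ := fun θ => exp (θ * I)
  have he : Continuous e := by fun_prop
  have hne : ∀ θ, ‖e θ‖ = 1 := fun θ => norm_exp_ofReal_mul_I θ
  have hsymm : ∀ q : ℝ × ℝ, Complex.polarCoord.symm q = q.1 * e q.2 := fun q => by
    rw [Complex.polarCoord_symm_apply, show e q.2 = cos q.2 + sin q.2 * I from exp_mul_I _]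
    simp
  rw [← Complex.integral_comp_polarCoord_symm]
  have htgt : Complex.polarCoord.target = Ioi (0 : ℝ) ×ˢ Ioo (-π) π := rfl
  rw [show polarCoord.target = Ioi (0 : ℝ) ×ˢ Ioo (-π) π from rfl]
  let D : ℝ × ℝ → (ℂ →L[ℝ] ℂ) := fun q => fderiv ℝ φ (q.1 * e q.2)
  have hD : Continuous D := (hφ.continuous_fderiv one_ne_zero).comp (by fun_prop)
  let A : ℝ × ℝ → ℂ := fun q => D q (e q.2)
  let B : ℝ × ℝ → ℂ := fun q => I * D q (I * e q.2)
  have hA : Continuous A := hD.clm_apply (by fun_prop)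
  have hB : Continuous B := continuous_const.mul (hD.clm_apply (by fun_prop))
  have hD0 : ∀ q : ℝ × ℝ, R ≤ q.1 → D q = 0 := fun q hq => by
    refine (hRs _ ?_).2
    rw [norm_mul, hne, mul_one, norm_real]; exact hq.trans (le_abs_self _)
  have hAi := integrableOn_box hA (R := R) (fun q hq => by simp [A, hD0 q hq])
  have hBi := integrableOn_box hB (R := R) (fun q hq => by simp [B, hD0 q hq])
  have hkey : EqOn (fun q : ℝ × ℝ => q.1 • (dbar φ (Complex.polarCoord.symm q) /
      Complex.polarCoord.symm q)) (fun q => (A q + B q) / 2) (Ioi (0 : ℝ) ×ˢ Ioo (-π) π) := by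
    rintro q ⟨hq, -⟩
    have hq0 : (q.1 : ℂ) ≠ 0 := by exact_mod_cast (ne_of_gt hq)
    have he0 : e q.2 ≠ 0 := by
      intro h; have := hne q.2; simp [h] at this
    have hce : e q.2 * conj (e q.2) = 1 := by rw [mul_conj, normSq_eq_norm_sq, hne]; simp
    simp only [hsymm, A, B, dbar, D]
    rw [wirtinger_apply _ (e q.2), wirtinger_apply _ (I * e q.2)]
    simp only [map_mul, conj_I, real_smul]
    field_simp
    linear_combination (-2 * wirtingerDBar (fderiv ℝ φ (q.1 * e q.2))) * hce + (e q.2 * (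
      wirtingerD (fderiv ℝ φ (q.1 * e q.2)) * e q.2 -
      wirtingerDBar (fderiv ℝ φ (q.1 * e q.2)) * conj (e q.2))) * (-I_sq)
  rw [setIntegral_congr_fun (measurableSet_Ioi.prod measurableSet_Ioo) hkey, integral_div,
    integral_add hAi hBi]
  have h1 : ∫ q in Ioi (0 : ℝ) ×ˢ Ioo (-π) π, A q = -(2 * π * φ 0) := by
    rw [Measure.volume_eq_prod, ← Measure.prod_restrict, integral_prod_symm _ (by
      rw [Measure.prod_restrict, ← Measure.volume_eq_prod]; exact hAi)]
    have : ∀ θ : ℝ, ∫ r in Ioi (0 : ℝ), A (r, θ) = -φ 0 := fun θ => by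
      have hder : ∀ r : ℝ, HasDerivAt (fun r : ℝ => φ (r * e θ)) (A (r, θ)) r := fun r => by
        have h1 : HasDerivAt (fun r : ℝ => (r : ℂ) * e θ) (e θ) r := by
          simpa using (Complex.ofRealCLM.hasDerivAt (x := r)).mul_const (e θ)
        exact ((hφ.differentiable one_ne_zero _).hasFDerivAt).comp_hasDerivAt r h1
      have := integral_Ioi_of_hasDerivAt_of_tendsto (a := 0) (f := fun r : ℝ => φ (r * e θ))
        (f' := fun r => A (r, θ)) (m := 0) (hder 0).continuousAt.continuousWithinAt
        (fun r _ => hder r) ?_ ?_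
      · simpa using this
      · have hc1 : Continuous fun r => A (r, θ) := by fun_prop
        have := (hc1.continuousOn (s := Icc 0 R)).integrableOn_compact isCompact_Icc (μ := volume)
        have h2 : IntegrableOn (fun r => A (r, θ)) (Ici R) := by
          apply IntegrableOn.congr_fun (f := fun _ => 0) (integrableOn_zero) _ measurableSet_Ici
          intro r hr; simp [A, hD0 (r, θ) hr]
        refine (this.union h2).mono_set fun r hr => ?_
        rcases le_total r R with h | h
        · exact Or.inl ⟨le_of_lt hr, h⟩
        · exact Or.inr h
      · refine tendsto_const_nhds.congr' ?_
        filter_upwards [eventually_ge_atTop R] with r hr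
        refine ((hRs _ ?_).1).symm
        rw [norm_mul, hne, mul_one, norm_real]; exact hr.trans (le_abs_self _)
    simp only [this]
    rw [setIntegral_const]
    simp only [Real.volume_real_Ioo, sub_neg_eq_add, real_smul]
    rw [max_eq_left (by linarith [Real.pi_pos])]
    push_cast; ring
  have h2 : ∫ q in Ioi (0 : ℝ) ×ˢ Ioo (-π) π, B q = 0 := by
    rw [Measure.volume_eq_prod, setIntegral_prod _ (by
      rw [← Measure.volume_eq_prod]; exact hBi)]
    have : ∀ r ∈ Ioi (0 : ℝ), ∫ θ in Ioo (-π) π, B (r, θ) = 0 := fun r hr => by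
      rw [← integral_Ioc_eq_integral_Ioo, ← intervalIntegral.integral_of_le (by linarith [Real.pi_pos])]
      have hr0 : (r : ℂ) ≠ 0 := by exact_mod_cast (ne_of_gt hr)
      have hder : ∀ θ : ℝ, HasDerivAt (fun θ : ℝ => I / r * φ (r * e θ)) (B (r, θ)) θ := fun θ => by
        have h0 : HasDerivAt (fun θ : ℝ => (θ : ℂ) * I) I θ := by
          simpa using (Complex.ofRealCLM.hasDerivAt (x := θ)).mul_const I
        have h1 : HasDerivAt (fun θ : ℝ => (r : ℂ) * e θ) (r • (I * e θ)) θ := by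
          have := (h0.cexp).const_mul (r : ℂ)
          refine this.congr_deriv ?_
          simp only [e, real_smul]; ring
        have h2 := (((hφ.differentiable one_ne_zero (r * e θ)).hasFDerivAt).comp_hasDerivAt θ h1).const_mul (I / r)
        refine h2.congr_deriv ?_
        rw [map_smul]
        simp only [B, D, real_smul]
        field_simp
      rw [intervalIntegral.integral_eq_sub_of_hasDerivAt (fun θ _ => hder θ)
        ((show Continuous fun θ => B (r, θ) by fun_prop).intervalIntegrable _ _)]
      have : e π = e (-π) := by
        simp only [e]; push_cast
        rw [exp_pi_mul_I, neg_mul, Complex.exp_neg, exp_pi_mul_I]; norm_num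
      simp [this]
    rw [setIntegral_congr_fun measurableSet_Ioi this]; simp
  rw [h1, h2]; ring

/-- The Cauchy transform `π⁻¹ ∫ g(w) / (z - w) dw`. -/
def cauchyT (g : ℂ → ℂ) (z : ℂ) : ℂ := (π : ℂ)⁻¹ * ∫ w, g w * (z - w)⁻¹

lemma lintegral_inv_unit_ball : ∫⁻ w in ball (0 : ℂ) 1, ‖w⁻¹‖ₑ < ⊤ := by
  rw [← lintegral_indicator measurableSet_ball, ← Complex.lintegral_comp_polarCoord_symm,
    show polarCoord.target = Ioi (0 : ℝ) ×ˢ Ioo (-π) π from rfl]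
  calc _ ≤ ∫⁻ q in Ioi (0 : ℝ) ×ˢ Ioo (-π) π, (Ioo (0 : ℝ) 1 ×ˢ Ioo (-π) π).indicator 1 q := by
        refine setLIntegral_mono' (measurableSet_Ioi.prod measurableSet_Ioo) ?_
        rintro ⟨r, θ⟩ ⟨hr, hθ⟩
        have hr : (0 : ℝ) < r := hr
        have hn : ‖Complex.polarCoord.symm (r, θ)‖ = r := by
          rw [Complex.norm_polarCoord_symm]; exact abs_of_pos hr
        by_cases h : r < 1
        · rw [indicator_of_mem (show Complex.polarCoord.symm (r, θ) ∈ ball (0 : ℂ) 1 by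
            rw [mem_ball_zero_iff, hn]; exact h),
            indicator_of_mem (show (r, θ) ∈ Ioo (0 : ℝ) 1 ×ˢ Ioo (-π) π from ⟨⟨hr, h⟩, hθ⟩)]
          rw [← ofReal_norm, norm_inv, hn, smul_eq_mul, ← ENNReal.ofReal_mul hr.le,
            mul_inv_cancel₀ hr.ne']
          simp
        · rw [indicator_of_notMem (show Complex.polarCoord.symm (r, θ) ∉ ball (0 : ℂ) 1 by
            rw [mem_ball_zero_iff, hn]; exact h)]
          simp
    _ ≤ volume (Ioo (0 : ℝ) 1 ×ˢ Ioo (-π) π) := by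
        refine (setLIntegral_le_lintegral _ _).trans ?_
        rw [lintegral_indicator_one (measurableSet_Ioo.prod measurableSet_Ioo)]
    _ < ⊤ := by
        rw [Measure.volume_eq_prod, Measure.prod_prod]
        simp [Real.volume_Ioo]

/-- The kernel `1 / (z - w)` is integrable in `w` over bounded sets, uniformly in `z`. -/
lemma exists_lintegral_cauchy_bound (R : ℝ) :
    ∃ C : ℝ≥0∞, C < ⊤ ∧ ∀ z : ℂ, ∫⁻ w in ball (0 : ℂ) R, ‖(z - w)⁻¹‖ₑ ≤ C := by
  refine ⟨(∫⁻ w in ball (0 : ℂ) 1, ‖w⁻¹‖ₑ) + volume (ball (0 : ℂ) R),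
    ENNReal.add_lt_top.2 ⟨lintegral_inv_unit_ball, measure_ball_lt_top⟩, fun z => ?_⟩
  have h1 : ∀ w : ℂ, ‖(z - w)⁻¹‖ₑ ≤ (ball (0 : ℂ) 1).indicator (fun v => ‖v⁻¹‖ₑ) (z - w) + 1 := by
    intro w
    by_cases h : z - w ∈ ball (0 : ℂ) 1
    · rw [indicator_of_mem h]; exact le_self_add
    · rw [indicator_of_notMem h, zero_add, ← ofReal_norm, norm_inv]
      rw [mem_ball_zero_iff, not_lt] at h
      exact ENNReal.ofReal_le_one.2 (inv_le_one_of_one_le₀ h)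
  calc _ ≤ ∫⁻ w in ball (0 : ℂ) R,
        ((ball (0 : ℂ) 1).indicator (fun v => ‖v⁻¹‖ₑ) (z - w) + 1) := lintegral_mono fun w => h1 w
    _ = (∫⁻ w in ball (0 : ℂ) R, (ball (0 : ℂ) 1).indicator (fun v => ‖v⁻¹‖ₑ) (z - w))
        + volume (ball (0 : ℂ) R) := by
        rw [lintegral_add_right _ measurable_const]; simp
    _ ≤ _ := by
        refine add_le_add ((setLIntegral_le_lintegral _ _).trans ?_) le_rfl
        rw [lintegral_sub_left_eq_self (fun v => (ball (0 : ℂ) 1).indicator (fun v => ‖v⁻¹‖ₑ) v) z,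
          lintegral_indicator measurableSet_ball]

lemma locallyIntegrable_inv : LocallyIntegrable (fun w : ℂ => w⁻¹) := by
  rw [locallyIntegrable_iff]
  intro K hK
  obtain ⟨R, hR⟩ := hK.isBounded.subset_ball 0
  obtain ⟨C, hC, h⟩ := exists_lintegral_cauchy_bound R
  refine IntegrableOn.mono_set ⟨measurable_inv.aestronglyMeasurable, ?_⟩ hR
  refine lt_of_le_of_lt (le_of_eq ?_) ((h 0).trans_lt hC)
  simp

lemma integrable_cauchy_prod {ψ G : ℂ → ℂ} {M R : ℝ} (hm : AEStronglyMeasurable ψ)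
    (hM : ∀ z, ‖ψ z‖ ≤ M) (hR : ∀ z, z ∉ ball (0 : ℂ) R → ψ z = 0) (hG : Integrable G) :
    Integrable (fun q : ℂ × ℂ => ψ q.2 * (q.1 - q.2)⁻¹ * G q.1) (volume.prod volume) := by
  have hms : AEStronglyMeasurable (fun q : ℂ × ℂ => ψ q.2 * (q.1 - q.2)⁻¹ * G q.1)
      (volume.prod volume) :=
    (hm.comp_snd.mul (by fun_prop : Measurable fun q : ℂ × ℂ =>
      (q.1 - q.2)⁻¹).aestronglyMeasurable).mul hG.aestronglyMeasurable.comp_fst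
  refine ⟨hms, ?_⟩
  obtain ⟨C, hC, h⟩ := exists_lintegral_cauchy_bound R
  rw [HasFiniteIntegral, lintegral_prod _ hms.enorm]
  calc _ ≤ ∫⁻ z : ℂ, ENNReal.ofReal M * C * ‖G z‖ₑ := by
        refine lintegral_mono fun z => ?_
        calc _ ≤ ∫⁻ w, (ENNReal.ofReal M * ‖G z‖ₑ) *
              (ball (0 : ℂ) R).indicator (fun w => ‖(z - w)⁻¹‖ₑ) w := by
              refine lintegral_mono fun w => ?_
              by_cases hw : w ∈ ball (0 : ℂ) R
              · rw [indicator_of_mem hw, enorm_mul, enorm_mul]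
                have : ‖ψ w‖ₑ ≤ ENNReal.ofReal M := by
                  rw [← ofReal_norm]; exact ENNReal.ofReal_le_ofReal (hM w)
                calc _ = ‖ψ w‖ₑ * ‖G z‖ₑ * ‖(z - w)⁻¹‖ₑ := by ring
                  _ ≤ _ := by gcongr
              · simp [hR w hw]
          _ ≤ ENNReal.ofReal M * ‖G z‖ₑ * C := by
              rw [lintegral_const_mul' _ _ (ENNReal.mul_ne_top ENNReal.ofReal_ne_top enorm_ne_top),
                lintegral_indicator measurableSet_ball]
              gcongr
              exact h z
          _ = _ := by ring
    _ < ⊤ := by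
        rw [lintegral_const_mul' _ _ (ENNReal.mul_ne_top ENNReal.ofReal_ne_top hC.ne)]
        exact ENNReal.mul_lt_top (ENNReal.mul_lt_top ENNReal.ofReal_lt_top hC) hG.2

lemma locallyIntegrable_cauchyT {G : ℂ → ℂ} (hG : Integrable G) :
    LocallyIntegrable (cauchyT G) := by
  rw [locallyIntegrable_iff]
  intro K hK
  obtain ⟨R, hR⟩ := hK.isBounded.subset_ball 0
  refine IntegrableOn.mono_set ?_ hR
  have := (integrable_cauchy_prod (ψ := (ball (0 : ℂ) R).indicator 1) (M := 1) (R := R)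
    ((measurable_one.indicator measurableSet_ball).aestronglyMeasurable)
    (fun z => (norm_indicator_le_norm_self _ _).trans (by simp))
    (fun z hz => indicator_of_notMem hz _) hG).integral_prod_right
  rw [← integrable_indicator_iff measurableSet_ball]
  refine (this.const_mul (-(π : ℂ)⁻¹)).congr (Eventually.of_forall fun z => ?_)
  by_cases hz : z ∈ ball (0 : ℂ) R
  · simp only [indicator_of_mem hz, cauchyT]
    rw [neg_mul, ← mul_neg, ← integral_neg]
    congr 2; ext w
    rw [← neg_sub, inv_neg]; simp; ring
  · simp [indicator_of_notMem hz]

/-- For test functions the Cauchy transform is smooth and inverts `∂̄`. -/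
lemma cauchyT_test {ψ : ℂ → ℂ} (hψ : ContDiff ℝ (⊤ : ℕ∞) ψ) (hc : HasCompactSupport ψ) :
    ContDiff ℝ (⊤ : ℕ∞) (cauchyT ψ) ∧ ∀ z, dbar (cauchyT ψ) z = ψ z := by
  let L := ContinuousLinearMap.mul ℝ ℂ
  have hψ1 : ContDiff ℝ 1 ψ := hψ.of_le (by exact_mod_cast le_top)
  have hconv : cauchyT ψ = fun z => (π : ℂ)⁻¹ * (convolution (fun w : ℂ => w⁻¹) ψ L volume) z := by
    ext z
    rw [cauchyT, convolution]
    congr 1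
    rw [← integral_sub_left_eq_self (fun w => ψ w * (z - w)⁻¹) volume z]
    congr 1; ext w; simp [L, mul_comm]
  constructor
  · rw [hconv]
    exact contDiff_const.mul (hc.contDiff_convolution_right L locallyIntegrable_inv hψ)
  · intro z
    have h1 := (hc.hasFDerivAt_convolution_right L locallyIntegrable_inv hψ1 z).const_mul
      ((π : ℂ)⁻¹)
    rw [dbar, hconv, h1.fderiv, wirtingerDBar_smul]
    have hcont : ConvolutionExistsAt (fun w : ℂ => w⁻¹) (fderiv ℝ ψ) z (L.precompR ℂ) volume :=
      (HasCompactSupport.convolutionExists_right (L.precompR ℂ) (hc.fderiv ℝ)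
        locallyIntegrable_inv (hψ1.continuous_fderiv one_ne_zero)) z
    rw [convolution, wirtingerDBar, ContinuousLinearMap.integral_apply hcont,
      ContinuousLinearMap.integral_apply hcont]
    have hI : ∀ v : ℂ, Integrable fun t => ((L.precompR ℂ) t⁻¹ (fderiv ℝ ψ (z - t))) v :=
      fun v => hcont.apply_continuousLinearMap v
    rw [← integral_const_mul, ← integral_add (hI 1) ((hI I).const_mul I), ← integral_div]
    have h2 : ContDiff ℝ 1 fun w => ψ (z - w) := hψ1.comp (contDiff_const.sub contDiff_id)
    have h3 : HasCompactSupport fun w => ψ (z - w) :=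
      hc.comp_homeomorph (Homeomorph.subLeft z)
    have h4 := integral_dbar_div h2 h3
    have h5 : ∀ w, dbar (fun w => ψ (z - w)) w / w =
        - ((((L.precompR ℂ) w⁻¹ (fderiv ℝ ψ (z - w))) 1 +
        I * ((L.precompR ℂ) w⁻¹ (fderiv ℝ ψ (z - w))) I) / 2) := by
      intro w
      have h6 := ((hψ1.differentiable one_ne_zero (z - w)).hasFDerivAt).comp w
        ((hasFDerivAt_const z w).sub (hasFDerivAt_id w))
      have h7 : fderiv ℝ (fun w => ψ (z - w)) w = _ := h6.fderiv
      rw [dbar, h7, wirtingerDBar]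
      simp [L]; ring
    simp only [h5, integral_neg] at h4
    rw [neg_inj] at h4
    rw [h4, sub_zero, ← mul_assoc, inv_mul_cancel₀ (by exact_mod_cast Real.pi_ne_zero), one_mul]

/-- A compactly supported integrable weak solution of `∂̄w = G` is the Cauchy transform of `G`. -/
lemma ae_eq_cauchyT {w G : ℂ → ℂ} (hw : Integrable w) (hG : Integrable G) {R : ℝ}
    (hwR : ∀ z, z ∉ ball (0 : ℂ) R → w z = 0) (hGR : ∀ z, z ∉ ball (0 : ℂ) R → G z = 0)
    (h : ∀ ψ : ℂ → ℂ, ContDiff ℝ (⊤ : ℕ∞) ψ → HasCompactSupport ψ →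
      ∫ z, dbar ψ z * w z = -∫ z, ψ z * G z) :
    w =ᵐ[volume] cauchyT G := by
  refine ae_eq_of_integral_contDiff_smul_eq hw.locallyIntegrable (locallyIntegrable_cauchyT hG)
    fun g hg hgc => ?_
  let ψ : ℂ → ℂ := fun z => g z
  have hψ : ContDiff ℝ (⊤ : ℕ∞) ψ := ofRealCLM.contDiff.comp hg
  have hψc : HasCompactSupport ψ := hgc.comp_left (g := fun x : ℝ => (x : ℂ)) (by simp)
  obtain ⟨hs, hd⟩ := cauchyT_test hψ hψc
  let b : ContDiffBump (0 : ℂ) := ⟨max R 1, max R 1 + 1, by positivity, by linarith⟩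
  let χ : ℂ → ℂ := fun z => b z
  have hχ : ContDiff ℝ (⊤ : ℕ∞) χ := ofRealCLM.contDiff.comp b.contDiff
  have hχc : HasCompactSupport χ := b.hasCompactSupport.comp_left (g := fun x : ℝ => (x : ℂ)) (by simp)
  have hχ1 : ∀ z ∈ ball (0 : ℂ) R, χ =ᶠ[𝓝 z] 1 := by
    intro z hz
    filter_upwards [isOpen_ball.mem_nhds hz] with y hy
    have : b y = 1 := b.one_of_mem_closedBall
      (ball_subset_closedBall (ball_subset_ball (le_max_left R 1) hy))
    simp [χ, this]
  have key := h (fun z => χ z * cauchyT ψ z) (hχ.mul hs) (hχc.mul_right)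
  have e1 : ∀ z, dbar (fun z => χ z * cauchyT ψ z) z * w z = g z • w z := by
    intro z
    by_cases hz : z ∈ ball (0 : ℂ) R
    · have : (fun z => χ z * cauchyT ψ z) =ᶠ[𝓝 z] cauchyT ψ := by
        filter_upwards [hχ1 z hz] with y hy
        simp [hy]
      rw [dbar, this.fderiv_eq, ← dbar, hd]; simp [ψ]
    · simp [hwR z hz]
  have e2 : ∀ z, χ z * cauchyT ψ z * G z = cauchyT ψ z * G z := by
    intro z
    by_cases hz : z ∈ ball (0 : ℂ) R
    · simp [(hχ1 z hz).self_of_nhds]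
    · simp [hGR z hz]
  simp only [e1, e2] at key
  rw [key]
  obtain ⟨M, hM⟩ := hψ.continuous.bounded_above_of_compact_support hψc
  obtain ⟨R', hR'⟩ := hψc.isCompact.isBounded.subset_ball 0
  have hF := integrable_cauchy_prod hψ.continuous.aestronglyMeasurable hM
    (fun z hz => image_eq_zero_of_notMem_tsupport fun h => hz (hR' h)) hG
  have hsw := integral_integral_swap (f := fun z ζ => ψ ζ * (z - ζ)⁻¹ * G z) hF
  have l1 : ∫ z, cauchyT ψ z * G z = (π : ℂ)⁻¹ * ∫ z, ∫ ζ, ψ ζ * (z - ζ)⁻¹ * G z := by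
    rw [← integral_const_mul]
    congr 1; ext z
    rw [integral_mul_const, cauchyT, mul_assoc]
  have l2 : ∫ z, g z • cauchyT G z = -((π : ℂ)⁻¹ * ∫ ζ, ∫ z, ψ ζ * (z - ζ)⁻¹ * G z) := by
    rw [← mul_neg, ← integral_neg, ← integral_const_mul]
    congr 1; ext ζ
    rw [cauchyT, real_smul, ← integral_neg, mul_left_comm]
    congr 1
    rw [← integral_const_mul]
    congr 1; ext z
    rw [← neg_sub, inv_neg]; simp only [ψ]; ring
  rw [l1, l2, hsw]

/-- `g` is the weak `∂̄`-derivative of `u` on `U`. -/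
def WeakDbar (u g : ℂ → ℂ) (U : Set ℂ) : Prop :=
  LocallyIntegrableOn u U ∧ LocallyIntegrableOn g U ∧
  ∀ ψ : ℂ → ℂ, ContDiff ℝ (⊤ : ℕ∞) ψ → HasCompactSupport ψ → tsupport ψ ⊆ U →
    ∫ z, dbar ψ z * u z = -∫ z, ψ z * g z

lemma integrable_mul_of_tsupport {θ u : ℂ → ℂ} {U : Set ℂ} (hθ : Continuous θ)
    (hc : HasCompactSupport θ) (hs : tsupport θ ⊆ U) (hu : LocallyIntegrableOn u U) :
    Integrable (fun z => θ z * u z) := by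
  have h1 : IntegrableOn u (tsupport θ) := hu.integrableOn_compact_subset hs hc
  have h2 : IntegrableOn (fun z => θ z * u z) (tsupport θ) :=
    h1.continuousOn_mul hθ.continuousOn hc
  refine (integrableOn_iff_integrable_of_support_subset fun z hz => ?_).1 h2
  by_contra h
  exact hz (by simp [image_eq_zero_of_notMem_tsupport h])

lemma setIntegral_eq_of_tsupport {E E' : Type*} [NormedAddCommGroup E] [NormedSpace ℝ E]
    [Zero E'] {θ : ℂ → E'} {F : ℂ → E} {U : Set ℂ} (hs : tsupport θ ⊆ U)
    (h : ∀ z, θ z = 0 → F z = 0) : ∫ z in U, F z = ∫ z, F z :=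
  setIntegral_eq_integral_of_forall_compl_eq_zero fun z hz =>
    h z (image_eq_zero_of_notMem_tsupport fun h => hz (hs h))

lemma HasWeakFDerivOn.integral_complex {f : ℂ → ℂ} {f' : ℂ → ℂ →L[ℝ] ℂ} {U : Set ℂ}
    (h : HasWeakFDerivOn f f' U) {ψ : ℂ → ℂ} (hψ : ContDiff ℝ (⊤ : ℕ∞) ψ)
    (hc : HasCompactSupport ψ) (hs : tsupport ψ ⊆ U) (v : ℂ) :
    ∫ z, ψ z * f' z v = -∫ z, fderiv ℝ ψ z v * f z := by
  obtain ⟨hf, hf', hw⟩ := h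
  have hreal : ∀ T : ℂ →L[ℝ] ℝ,
      Integrable (fun z => ((T (ψ z) : ℝ) : ℂ) * f' z v) ∧
      Integrable (fun z => ((T (fderiv ℝ ψ z v) : ℝ) : ℂ) * f z) ∧
      ∫ z, ((T (ψ z) : ℝ) : ℂ) * f' z v = -∫ z, ((T (fderiv ℝ ψ z v) : ℝ) : ℂ) * f z := by
    intro T
    have hTc : ContDiff ℝ (⊤ : ℕ∞) fun z => T (ψ z) := T.contDiff.comp hψ
    have hTs : HasCompactSupport fun z => T (ψ z) := hc.comp_left (g := T) (by simp)
    have hts : tsupport (fun z => T (ψ z)) ⊆ U :=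
      (closure_mono fun z hz => by
        intro h0; apply hz; simp [h0]).trans hs
    have hfd : ∀ z, fderiv ℝ (fun z => T (ψ z)) z v = T (fderiv ℝ ψ z v) := fun z => by
      have := T.hasFDerivAt.comp z (hψ.differentiable (by simp) z).hasFDerivAt
      have h2 : fderiv ℝ (fun z => T (ψ z)) z = _ := this.fderiv
      rw [h2]; rfl
    have := hw _ hTc hTs hts v
    rw [setIntegral_eq_of_tsupport hs (by intro z hz; simp [hz]),
      setIntegral_eq_of_tsupport (θ := fun z => fderiv ℝ ψ z)
        ((tsupport_fderiv_subset ℝ).trans hs)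
        (by intro z hz; simp [hfd, hz])] at this
    simp only [hfd, real_smul] at this
    refine ⟨?_, ?_, this⟩
    · refine integrable_mul_of_tsupport (U := U) (by have := hψ.continuous; fun_prop)
        (hTs.comp_left (g := fun x : ℝ => (x : ℂ)) (by simp)) ?_ (hf' v)
      refine (closure_mono fun z hz => ?_).trans hts
      intro h0; apply hz; simp [h0]
    · have hcd : Continuous fun z => fderiv ℝ ψ z v :=
        (hψ.continuous_fderiv (by simp)).clm_apply continuous_const
      refine integrable_mul_of_tsupport (U := U) (by fun_prop)
        ((hc.fderiv_apply (𝕜 := ℝ) v).comp_left (g := fun x : ℂ => ((T x : ℝ) : ℂ)) (by simp)) ?_ hf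
      refine (closure_mono fun z hz => ?_).trans ((tsupport_fderiv_subset ℝ (f := ψ)).trans hs)
      intro h0; apply hz; simp [h0]
  obtain ⟨i1, i2, e1⟩ := hreal reCLM
  obtain ⟨j1, j2, e2⟩ := hreal imCLM
  have s1 : ∀ z, ψ z * f' z v = ((reCLM (ψ z) : ℝ) : ℂ) * f' z v + I * (((imCLM (ψ z) : ℝ) : ℂ) * f' z v) := by
    intro z
    have := re_add_im (ψ z)
    simp only [reCLM_apply, imCLM_apply]
    linear_combination (-(f' z v)) * this
  have s2 : ∀ z, fderiv ℝ ψ z v * f z = ((reCLM (fderiv ℝ ψ z v) : ℝ) : ℂ) * f z +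
      I * (((imCLM (fderiv ℝ ψ z v) : ℝ) : ℂ) * f z) := by
    intro z
    have := re_add_im (fderiv ℝ ψ z v)
    simp only [reCLM_apply, imCLM_apply]
    linear_combination (-(f z)) * this
  simp only [s1, s2]
  rw [integral_add i1 (j1.const_mul I), integral_add i2 (j2.const_mul I), integral_const_mul,
    integral_const_mul, e1, e2]
  ring

lemma HasWeakFDerivOn.weakDbar {f : ℂ → ℂ} {f' : ℂ → ℂ →L[ℝ] ℂ} {U : Set ℂ}
    (hU : IsOpen U) (h : HasWeakFDerivOn f f' U) : WeakDbar f (fun z => wirtingerDBar (f' z)) U := by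
  refine ⟨h.1, ?_, fun ψ hψ hc hs => ?_⟩
  · have h1 := ((h.2.1 I).continuousOn_mul (g := fun _ => I) continuousOn_const hU.isLocallyClosed)
    have h2 := ((h.2.1 1).add h1).continuousOn_mul (g := fun _ => (2 : ℂ)⁻¹) continuousOn_const
      hU.isLocallyClosed
    refine h2.congr (Eventually.of_forall fun z => ?_)
    simp only [wirtingerDBar, Pi.add_apply]; ring
  · have h1 := h.integral_complex hψ hc hs 1
    have h2 := h.integral_complex hψ hc hs I
    have hcd : ∀ v, Continuous fun z => fderiv ℝ ψ z v := fun v =>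
        (hψ.continuous_fderiv (by simp)).clm_apply continuous_const
    have hts : ∀ v : ℂ, tsupport (fun z => fderiv ℝ ψ z v) ⊆ U := fun v => by
      refine (closure_mono fun z hz => ?_).trans ((tsupport_fderiv_subset ℝ (f := ψ)).trans hs)
      intro h0; apply hz; simp [h0]
    have i : ∀ v, Integrable fun z => ψ z * f' z v := fun v =>
      integrable_mul_of_tsupport hψ.continuous hc hs (h.2.1 v)
    have j : ∀ v, Integrable fun z => fderiv ℝ ψ z v * f z := fun v =>
      integrable_mul_of_tsupport (hcd v) (hc.fderiv_apply (𝕜 := ℝ) v) (hts v) h.1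
    have s1 : ∀ z, dbar ψ z * f z = (2 : ℂ)⁻¹ * (fderiv ℝ ψ z 1 * f z + I * (fderiv ℝ ψ z I * f z)) := by
      intro z; simp [dbar, wirtingerDBar]; ring
    have s2 : ∀ z, ψ z * wirtingerDBar (f' z) = (2 : ℂ)⁻¹ * (ψ z * f' z 1 + I * (ψ z * f' z I)) := by
      intro z; simp [wirtingerDBar]; ring
    simp only [s1, s2]
    rw [integral_const_mul, integral_const_mul, integral_add (i 1) ((i I).const_mul I),
      integral_add (j 1) ((j I).const_mul I), integral_const_mul, integral_const_mul, h1, h2]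
    ring

lemma ae_integrable_cauchy {G : ℂ → ℂ} (hG : Integrable G) :
    ∀ᵐ z : ℂ, Integrable fun w => G w * (z - w)⁻¹ := by
  have : ∀ n : ℕ, ∀ᵐ z : ℂ, z ∈ ball (0 : ℂ) n → Integrable fun w => G w * (z - w)⁻¹ := by
    intro n
    have := (integrable_cauchy_prod (ψ := (ball (0 : ℂ) n).indicator 1) (M := 1) (R := n)
      ((measurable_one.indicator measurableSet_ball).aestronglyMeasurable)
      (fun z => (norm_indicator_le_norm_self _ _).trans (by simp))
      (fun z hz => indicator_of_notMem hz _) hG).prod_left_ae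
    filter_upwards [this] with z hz hzn
    refine hz.neg.congr (Eventually.of_forall fun w => ?_)
    simp only [indicator_of_mem hzn, Pi.one_apply, Pi.neg_apply]
    rw [← neg_sub, inv_neg]; ring
  filter_upwards [ae_all_iff.2 this] with z hz
  obtain ⟨n, hn⟩ := exists_nat_gt ‖z‖
  exact hz n (by simpa using hn)

lemma cauchyT_sub_ae {G H : ℂ → ℂ} (hG : Integrable G) (hH : Integrable H) :
    ∀ᵐ z : ℂ, cauchyT (fun w => G w - H w) z = cauchyT G z - cauchyT H z := by
  filter_upwards [ae_integrable_cauchy hG, ae_integrable_cauchy hH] with z h1 h2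
  simp only [cauchyT, sub_mul]
  rw [integral_sub h1 h2, mul_sub]

lemma differentiableOn_cauchyT {H : ℂ → ℂ} (hH : Integrable H) {c : ℂ} {r : ℝ}
    (h0 : ∀ w ∈ ball c r, H w = 0) : DifferentiableOn ℂ (cauchyT H) (ball c r) := by
  intro z hz
  rw [mem_ball, dist_eq_norm] at hz
  set ε := (r - ‖z - c‖) / 2 with hε
  have hε0 : 0 < ε := by rw [hε]; linarith
  have hlow : ∀ y ∈ ball z ε, ∀ w, H w ≠ 0 → ε ≤ ‖y - w‖ := by
    intro y hy w hw
    have h1 : r ≤ ‖w - c‖ := by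
      by_contra h; exact hw (h0 w (by rw [mem_ball, dist_eq_norm]; linarith))
    rw [mem_ball, dist_eq_norm] at hy
    have : ‖w - c‖ ≤ ‖y - w‖ + ‖y - z‖ + ‖z - c‖ := by
      have e : w - c = -(y - w) + (y - z) + (z - c) := by ring
      calc _ = ‖-(y - w) + (y - z) + (z - c)‖ := by rw [← e]
        _ ≤ ‖-(y - w)‖ + ‖y - z‖ + ‖z - c‖ := norm_add₃_le
        _ = _ := by rw [norm_neg]
    linarith
  have hm : ∀ y : ℂ, AEStronglyMeasurable (fun w => H w * (y - w)⁻¹) := fun y =>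
    hH.aestronglyMeasurable.mul (by fun_prop : Measurable fun w : ℂ => (y - w)⁻¹).aestronglyMeasurable
  have key := hasDerivAt_integral_of_dominated_loc_of_deriv_le (μ := volume)
    (F := fun y w => H w * (y - w)⁻¹)
    (F' := fun y w => H w * (-1 / (y - w) ^ 2)) (x₀ := z) (s := ball z ε)
    (bound := fun w => ‖H w‖ * (ε ^ 2)⁻¹) (ball_mem_nhds z hε0)
    (Eventually.of_forall hm) ?_ ?_ ?_ ?_ ?_
  · exact ((key.2.const_mul ((π : ℂ)⁻¹)).differentiableAt).differentiableWithinAt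
  · refine (hH.norm.mul_const ε⁻¹).mono' (hm z) (Eventually.of_forall fun w => ?_)
    rw [norm_mul, norm_inv]
    by_cases hw : H w = 0
    · simp [hw]
    · gcongr; exact hlow z (mem_ball_self hε0) w hw
  · exact hH.aestronglyMeasurable.mul
      (by fun_prop : Measurable fun w : ℂ => -1 / (z - w) ^ 2).aestronglyMeasurable
  · refine Eventually.of_forall fun w y hy => ?_
    rw [norm_mul, norm_div, norm_pow, norm_neg, norm_one, one_div]
    by_cases hw : H w = 0
    · simp [hw]
    · gcongr; exact hlow y hy w hw
  · exact hH.norm.mul_const _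
  · refine Eventually.of_forall fun w y hy => ?_
    by_cases hw : H w = 0
    · simp only [hw, zero_mul]; exact hasDerivAt_const _ _
    · have : y - w ≠ 0 := by
        have := hlow y hy w hw
        exact norm_pos_iff.1 (hε0.trans_le this)
      exact (((hasDerivAt_id y).sub_const w).fun_inv this).const_mul (H w)

/-- Local holomorphic representatives glue to a global one. -/
lemma exists_holomorphic_of_local {v : ℂ → ℂ} {U : Set ℂ}
    (h : ∀ z ∈ U, ∃ r > 0, ball z r ⊆ U ∧ ∃ A : ℂ → ℂ, DifferentiableOn ℂ A (ball z r) ∧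
      ∀ᵐ w, w ∈ ball z r → A w = v w) :
    ∃ A : ℂ → ℂ, DifferentiableOn ℂ A U ∧ ∀ᵐ w, w ∈ U → A w = v w := by
  choose! r hr hrU A hA hAv using h
  have heq : ∀ z ∈ U, ∀ w ∈ ball z (r z), A w w = A z w := by
    intro z hz w hw
    have hwU := hrU z hz hw
    have hopen : IsOpen (ball z (r z) ∩ ball w (r w)) := isOpen_ball.inter isOpen_ball
    refine Measure.eqOn_open_of_ae_eq (μ := volume) (f := A w) (g := A z) ?_ hopen
      ((hA w hwU).continuousOn.mono inter_subset_right)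
      ((hA z hz).continuousOn.mono inter_subset_left) ⟨hw, mem_ball_self (hr w hwU)⟩
    rw [EventuallyEq, ae_restrict_iff' hopen.measurableSet]
    filter_upwards [hAv z hz, hAv w hwU] with y h1 h2 hy
    rw [h1 hy.1, h2 hy.2]
  have hloc : ∀ z ∈ U, (fun w => A w w) =ᶠ[𝓝 z] A z := fun z hz => by
    filter_upwards [ball_mem_nhds z (hr z hz)] with w hw using heq z hz w hw
  refine ⟨fun w => A w w, fun z hz => ?_, ?_⟩
  · exact ((hloc z hz).differentiableAt_iff.2 ((hA z hz).differentiableAt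
      (ball_mem_nhds z (hr z hz)))).differentiableWithinAt
  · rw [ae_iff]
    refine measure_null_of_locally_null _ fun z hz => ?_
    simp only [mem_ofPred_eq, not_forall] at hz
    obtain ⟨hzU, -⟩ := hz
    refine ⟨_, inter_mem_nhdsWithin _ (ball_mem_nhds z (hr z hzU)), ?_⟩
    have := hAv z hzU
    rw [ae_iff] at this
    refine measure_mono_null ?_ this
    rintro w ⟨hw, hwb⟩
    simp only [mem_ofPred_eq, not_forall] at hw ⊢
    obtain ⟨_, hw⟩ := hw
    exact ⟨hwb, by rwa [← heq z hzU w hwb]⟩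

lemma WeakDbar.exists_holomorphic {u g : ℂ → ℂ} {U : Set ℂ} (hU : IsOpen U)
    (h : WeakDbar u g U) (hg : Integrable (U.indicator g)) :
    ∃ A : ℂ → ℂ, DifferentiableOn ℂ A U ∧
      ∀ᵐ w, w ∈ U → A w = u w - cauchyT (U.indicator g) w := by
  apply exists_holomorphic_of_local
  intro c hc
  obtain ⟨r, hr, hrU⟩ := Metric.isOpen_iff.1 hU c hc
  let b : ContDiffBump c := ⟨r / 4, r / 2, by positivity, by linarith⟩
  let χ : ℂ → ℂ := fun z => b z
  have hχ : ContDiff ℝ (⊤ : ℕ∞) χ := ofRealCLM.contDiff.comp b.contDiff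
  have hχ1 : ContDiff ℝ 1 χ := hχ.of_le (by exact_mod_cast le_top)
  have hχc : HasCompactSupport χ := b.hasCompactSupport.comp_left (g := fun x : ℝ => (x : ℂ)) (by simp)
  have hχs : tsupport χ ⊆ closedBall c (r / 2) := by
    refine (closure_mono fun z hz => ?_).trans b.tsupport_eq.subset
    intro h0; apply hz; simp [χ, h0]
  have hχU : tsupport χ ⊆ U :=
    hχs.trans ((closedBall_subset_ball (by linarith)).trans hrU)
  have hdU : tsupport (dbar χ) ⊆ U := (tsupport_dbar_subset χ).trans hχU
  have hdc : HasCompactSupport (dbar χ) := dbar_hasCompactSupport hχc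
  have i1 : Integrable fun z => χ z * u z := integrable_mul_of_tsupport hχ.continuous hχc hχU h.1
  have i2 : Integrable fun z => χ z * g z := integrable_mul_of_tsupport hχ.continuous hχc hχU h.2.1
  have i3 : Integrable fun z => dbar χ z * u z :=
    integrable_mul_of_tsupport (dbar_continuous hχ1) hdc hdU h.1
  obtain ⟨R, hR⟩ := hχc.isCompact.isBounded.subset_ball 0
  have hz1 : ∀ z, z ∉ ball (0 : ℂ) R → χ z = 0 := fun z hz =>
    image_eq_zero_of_notMem_tsupport fun h => hz (hR h)
  have hz2 : ∀ z, z ∉ ball (0 : ℂ) R → dbar χ z = 0 := fun z hz =>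
    image_eq_zero_of_notMem_tsupport fun h => hz (hR (tsupport_dbar_subset χ h))
  have key := ae_eq_cauchyT (w := fun z => χ z * u z) (G := fun z => χ z * g z + dbar χ z * u z)
    i1 (i2.add i3) (R := R) (fun z hz => by simp [hz1 z hz])
    (fun z hz => by simp [hz1 z hz, hz2 z hz]) ?_
  · refine ⟨r / 4, by positivity, (ball_subset_ball (by linarith)).trans hrU,
      cauchyT (fun w => (χ w * g w + dbar χ w * u w) - U.indicator g w),
      differentiableOn_cauchyT ((i2.add i3).sub hg) ?_, ?_⟩
    · intro w hw
      have hwU : w ∈ U := hrU (ball_subset_ball (by linarith) hw)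
      have hev : χ =ᶠ[𝓝 w] fun _ => 1 := by
        filter_upwards [isOpen_ball.mem_nhds hw] with y hy
        have : b y = 1 := b.one_of_mem_closedBall (ball_subset_closedBall hy)
        simp [χ, this]
      simp only [Pi.sub_apply, Pi.add_apply]
      rw [show dbar χ w = wirtingerDBar (fderiv ℝ χ w) from rfl, hev.fderiv_eq, hev.self_of_nhds,
        indicator_of_mem hwU]
      simp [wirtingerDBar]
    · filter_upwards [key, cauchyT_sub_ae (i2.add i3) hg] with w h1 h2 hw
      have : b w = 1 := b.one_of_mem_closedBall (ball_subset_closedBall hw)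
      have h3 : χ w = 1 := by simp [χ, this]
      rw [h3, one_mul] at h1
      rw [h1]; exact h2
  · intro ψ hψ hc
    have hψ1 : ContDiff ℝ 1 ψ := hψ.of_le (by exact_mod_cast le_top)
    have hsub : tsupport (fun z => ψ z * χ z) ⊆ U := (tsupport_mul_subset_right).trans hχU
    have := h.2.2 (fun z => ψ z * χ z) (hψ.mul hχ) hc.mul_right hsub
    have e1 : ∀ z, dbar (fun z => ψ z * χ z) z * u z =
        dbar ψ z * (χ z * u z) + ψ z * (dbar χ z * u z) := fun z => by
      rw [dbar_mul (hψ1.differentiable one_ne_zero z) (hχ1.differentiable one_ne_zero z)]; ring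
    obtain ⟨M, hM⟩ := hψ1.continuous.bounded_above_of_compact_support hc
    obtain ⟨M', hM'⟩ := (dbar_continuous hψ1).bounded_above_of_compact_support
      (dbar_hasCompactSupport hc)
    have j1 : Integrable fun z => dbar ψ z * (χ z * u z) :=
      i1.bdd_mul (dbar_continuous hψ1).aestronglyMeasurable (Eventually.of_forall hM')
    have j2 : Integrable fun z => ψ z * (dbar χ z * u z) :=
      i3.bdd_mul hψ.continuous.aestronglyMeasurable (Eventually.of_forall hM)
    have j3 : Integrable fun z => ψ z * (χ z * g z) :=
      i2.bdd_mul hψ.continuous.aestronglyMeasurable (Eventually.of_forall hM)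
    simp only [e1] at this
    rw [integral_add j1 j2] at this
    simp only [mul_add]
    rw [integral_add j3 j2]
    simp only [mul_assoc] at this
    linear_combination this

/-! ### Kernel estimates -/

lemma lintegral_inv_sqrt_mul_inv_add {δ : ℝ} (hδ : 0 < δ) :
    ∫⁻ θ in Ioi (0 : ℝ), ENNReal.ofReal ((√θ)⁻¹ * (δ + θ)⁻¹) = ENNReal.ofReal (π * (√δ)⁻¹) := by
  let g : ℝ → ℝ := fun θ => 2 / √δ * Real.arctan (√θ / √δ)
  have hs : 0 < √δ := Real.sqrt_pos.2 hδ
  have hc : ContinuousWithinAt g (Ici 0) 0 := by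
    apply Continuous.continuousWithinAt
    exact continuous_const.mul (Real.continuous_arctan.comp (Real.continuous_sqrt.div_const _))
  have hd : ∀ θ ∈ Ioi (0 : ℝ), HasDerivAt g ((√θ)⁻¹ * (δ + θ)⁻¹) θ := by
    intro θ hθ
    have hθ : 0 < θ := hθ
    have ht : 0 < √θ := Real.sqrt_pos.2 hθ
    have h1 := (((Real.hasDerivAt_sqrt hθ.ne').div_const (√δ)).arctan).const_mul (2 / √δ)
    refine h1.congr_deriv ?_
    have e1 : √θ ^ 2 = θ := Real.sq_sqrt hθ.le
    have e2 : √δ ^ 2 = δ := Real.sq_sqrt hδ.le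
    have h3 : 1 + (√θ / √δ) ^ 2 = (δ + θ) / δ := by
      rw [div_pow, e1, e2]; field_simp
    rw [h3]
    field_simp
    rw [e2]
  have hp : ∀ θ ∈ Ioi (0 : ℝ), 0 ≤ (√θ)⁻¹ * (δ + θ)⁻¹ := fun θ hθ => by
    have hθ : 0 < θ := hθ
    positivity
  have hl : Tendsto g atTop (𝓝 (2 / √δ * (π / 2))) := by
    refine Tendsto.const_mul _ ?_
    refine (tendsto_nhds_of_tendsto_nhdsWithin Real.tendsto_arctan_atTop).comp ?_
    exact Tendsto.atTop_div_const hs Real.tendsto_sqrt_atTop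
  have hint := integrableOn_Ioi_deriv_of_nonneg hc hd hp hl
  rw [← ofReal_integral_eq_lintegral_ofReal hint
    ((ae_restrict_iff' measurableSet_Ioi).2 (Eventually.of_forall hp)),
    integral_Ioi_of_hasDerivAt_of_nonneg hc hd hp hl]
  congr 1
  simp [g]; ring

lemma norm_sub_exp_sq (r t θ : ℝ) :
    ‖(r : ℂ) - t * exp (θ * I)‖ ^ 2 = (r - t) ^ 2 + 2 * r * t * (1 - Real.cos θ) := by
  rw [← normSq_eq_norm_sq, normSq_apply]
  have h1 : (exp (θ * I)).re = Real.cos θ := exp_ofReal_mul_I_re θ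
  have h2 : (exp (θ * I)).im = Real.sin θ := exp_ofReal_mul_I_im θ
  simp only [sub_re, sub_im, mul_re, mul_im, ofReal_re, ofReal_im, h1, h2]
  have := Real.sin_sq_add_cos_sq θ
  linear_combination (t ^ 2) * this

lemma norm_sub_exp_ge {r t θ : ℝ} (hr : 0 ≤ r) (ht : 0 ≤ t) (hθ : |θ| ≤ π) :
    |r - t| ≤ ‖(r : ℂ) - t * exp (θ * I)‖ ∧
    max r t * (|θ| / π) ≤ ‖(r : ℂ) - t * exp (θ * I)‖ := by
  have hsq := norm_sub_exp_sq r t θ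
  have hcos := Real.cos_le_one_sub_mul_cos_sq hθ
  have hq : 2 / π ^ 2 * θ ^ 2 = 2 * (|θ| / π) ^ 2 := by rw [div_pow, sq_abs]; ring
  rw [hq] at hcos
  set q := |θ| / π with hqd
  have hq0 : 0 ≤ q := by positivity
  have hq1 : q ≤ 1 := by rw [hqd, div_le_one Real.pi_pos]; exact hθ
  have hrt : 0 ≤ r * t := mul_nonneg hr ht
  have hge : (r - t) ^ 2 + 4 * (r * t) * q ^ 2 ≤ ‖(r : ℂ) - t * exp (θ * I)‖ ^ 2 := by
    rw [hsq]; nlinarith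
  constructor
  · refine abs_le_of_sq_le_sq' ?_ (norm_nonneg _) |> fun h => abs_le.2 h
    nlinarith [mul_nonneg hrt (sq_nonneg q)]
  · refine (abs_le_of_sq_le_sq' ?_ (norm_nonneg _)).2
    have h1 : q ^ 2 ≤ 1 := by nlinarith
    have h2 : max r t ≤ r + t := max_le (by linarith) (by linarith)
    have h3 : max r t ^ 2 ≤ (r + t) ^ 2 := by
      have : 0 ≤ max r t := le_max_of_le_left hr
      gcongr
    have h4 : max r t ^ 2 * q ^ 2 ≤ (r + t) ^ 2 * q ^ 2 := by gcongr
    have h5 : 0 ≤ (r - t) ^ 2 * (1 - q ^ 2) := mul_nonneg (sq_nonneg _) (by linarith)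
    nlinarith

lemma lintegral_angular {r t : ℝ} (hr : 0 < r) (hr1 : r < 1) (ht : 0 < t) (ht1 : t < 1)
    (hne : r ≠ t) :
    ∫⁻ θ in Ioo (-π) π, ENNReal.ofReal
      ((‖(r : ℂ) - t * exp (θ * I)‖ * ‖1 - (r : ℂ) * (t * exp (θ * I))‖)⁻¹) ≤
    ENNReal.ofReal (4 * π ^ 2 * √π * (√(max r t * (1 - r * t) * |r - t|))⁻¹) := by
  set m := max r t with hm
  set a := |r - t| with ha
  set δ := 1 - r * t with hδ
  have hm0 : 0 < m := lt_max_of_lt_left hr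
  have ha0 : 0 < a := abs_pos.2 (sub_ne_zero.2 hne)
  have hδ0 : 0 < δ := by rw [hδ]; nlinarith
  have hpi := Real.pi_pos
  let F : ℝ → ℝ := fun θ => 2 * π * √π * (√(m * a))⁻¹ * ((√θ)⁻¹ * (δ + θ)⁻¹)
  have hpt : ∀ θ : ℝ, |θ| ≤ π → θ ≠ 0 →
      (‖(r : ℂ) - t * exp (θ * I)‖ * ‖1 - (r : ℂ) * (t * exp (θ * I))‖)⁻¹ ≤ F |θ| := by
    intro θ hθ hθ0
    have hθp : 0 < |θ| := abs_pos.2 hθ0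
    obtain ⟨h1, h2⟩ := norm_sub_exp_ge hr.le ht.le hθ
    have h34 := norm_sub_exp_ge zero_le_one (mul_pos hr ht).le hθ
    have e : ((1 : ℝ) : ℂ) - (r * t : ℝ) * exp (θ * I) = 1 - (r : ℂ) * (t * exp (θ * I)) := by
      push_cast; ring
    rw [e] at h34
    obtain ⟨h3, h4⟩ := h34
    rw [abs_of_pos hδ0] at h3
    set X := ‖(r : ℂ) - t * exp (θ * I)‖
    set Y := ‖1 - (r : ℂ) * (t * exp (θ * I))‖
    have h5 : |θ| / π ≤ Y := by
      refine le_trans ?_ h4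
      have : (1 : ℝ) ≤ max 1 (r * t) := le_max_left _ _
      have h0 : 0 ≤ |θ| / π := by positivity
      nlinarith
    have h6 : (δ + |θ|) / (2 * π) ≤ Y := by
      rw [div_le_iff₀ (by positivity)]
      rw [div_le_iff₀ hpi] at h5
      have : (1 : ℝ) ≤ π := by linarith [Real.pi_gt_three]
      nlinarith
    have h7 : √(a * (m * (|θ| / π))) ≤ X := by
      refine Real.sqrt_le_iff.2 ⟨norm_nonneg _, ?_⟩
      rw [sq]; gcongr
    have h8 : (√(a * (m * (|θ| / π)))) * ((δ + |θ|) / (2 * π)) ≤ X * Y := by gcongr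
    have h9 : 0 < (√(a * (m * (|θ| / π)))) * ((δ + |θ|) / (2 * π)) := by positivity
    refine (inv_anti₀ h9 h8).trans (le_of_eq ?_)
    have e2 : √(a * (m * (|θ| / π))) = √(m * a) * √|θ| / √π := by
      rw [← Real.sqrt_mul (by positivity), ← Real.sqrt_div (by positivity)]
      congr 1; ring
    simp only [F]
    rw [e2]
    field_simp
  have hF : ∫⁻ θ in Ioi (0 : ℝ), ENNReal.ofReal (F θ) =
      ENNReal.ofReal (2 * π ^ 2 * √π * (√(m * δ * a))⁻¹) := by
    have : ∀ θ, ENNReal.ofReal (F θ) = ENNReal.ofReal (2 * π * √π * (√(m * a))⁻¹) *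
        ENNReal.ofReal ((√θ)⁻¹ * (δ + θ)⁻¹) := fun θ => ENNReal.ofReal_mul (by positivity)
    simp only [this]
    rw [lintegral_const_mul' _ _ ENNReal.ofReal_ne_top, lintegral_inv_sqrt_mul_inv_add hδ0,
      ← ENNReal.ofReal_mul (by positivity)]
    congr 1
    rw [show m * δ * a = (m * a) * δ by ring, Real.sqrt_mul (x := m * a) (by positivity)]
    field_simp
  calc _ ≤ ∫⁻ θ, ((Ioi (0 : ℝ)).indicator (fun θ => ENNReal.ofReal (F θ)) θ +
        (Ioi (0 : ℝ)).indicator (fun θ => ENNReal.ofReal (F θ)) (-θ)) := by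
        rw [← lintegral_indicator measurableSet_Ioo]
        have h0 : ∀ᵐ θ : ℝ, θ ≠ 0 := by simp [ae_iff]
        refine lintegral_mono_ae ?_
        filter_upwards [h0] with θ hθ
        by_cases h : θ ∈ Ioo (-π) π
        · rw [indicator_of_mem h]
          have := ENNReal.ofReal_le_ofReal (hpt θ (abs_le.2 ⟨h.1.le, h.2.le⟩) hθ)
          refine this.trans ?_
          rcases lt_or_gt_of_ne hθ with h1 | h1
          · rw [indicator_of_mem (show -θ ∈ Ioi (0 : ℝ) from neg_pos.2 h1), abs_of_neg h1]
            exact le_add_self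
          · rw [indicator_of_mem (show θ ∈ Ioi (0 : ℝ) from h1), abs_of_pos h1]
            exact le_self_add
        · rw [indicator_of_notMem h]; exact zero_le
    _ = 2 * ∫⁻ θ in Ioi (0 : ℝ), ENNReal.ofReal (F θ) := by
        have hmeas : Measurable ((Ioi (0 : ℝ)).indicator (fun θ => ENNReal.ofReal (F θ))) := by
          refine Measurable.indicator ?_ measurableSet_Ioi
          simp only [F]; fun_prop
        rw [lintegral_add_left hmeas,
          lintegral_neg_eq_self ((Ioi (0 : ℝ)).indicator (fun θ => ENNReal.ofReal (F θ))),
          lintegral_indicator measurableSet_Ioi, two_mul]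
    _ = _ := by
        rw [hF, ← ENNReal.ofReal_ofNat, ← ENNReal.ofReal_mul (by norm_num)]
        congr 1; ring

/-- The homogeneous model kernel on the half-line. -/
def halfKer (x y : ℝ) : ℝ := (√(max x y * |x - y|))⁻¹

lemma halfKer_nonneg (x y : ℝ) : 0 ≤ halfKer x y := inv_nonneg.2 (Real.sqrt_nonneg _)

lemma halfKer_comm (x y : ℝ) : halfKer x y = halfKer y x := by
  simp only [halfKer, max_comm, abs_sub_comm]

lemma halfKer_mul {x : ℝ} (hx : 0 < x) (τ : ℝ) : halfKer x (x * τ) = x⁻¹ * halfKer 1 τ := by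
  unfold halfKer
  have h1 : max x (x * τ) = x * max 1 τ := by
    rw [mul_max_of_nonneg _ _ hx.le, mul_one]
  have h2 : |x - x * τ| = x * |1 - τ| := by
    rw [← abs_of_pos hx, ← abs_mul, abs_of_pos hx]; congr 1; ring
  rw [h1, h2, show x * max 1 τ * (x * |1 - τ|) = x ^ 2 * (max 1 τ * |1 - τ|) by ring,
    Real.sqrt_mul (sq_nonneg x), Real.sqrt_sq hx.le, mul_inv]

lemma lintegral_halfKer_one_lt_top {s : ℝ} (hs : 0 < s) (hs1 : s < 1) :
    ∫⁻ τ in Ioi (0 : ℝ), ENNReal.ofReal (halfKer 1 τ * τ ^ (s - 1)) < ⊤ := by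
  have i1 : IntegrableOn (fun τ : ℝ => 2 * τ ^ (s - 1)) (Ioc 0 1) := by
    have := intervalIntegral.intervalIntegrable_rpow' (a := 0) (b := 1) (r := s - 1) (by linarith)
    rw [intervalIntegrable_iff_integrableOn_Ioc_of_le zero_le_one] at this
    exact this.const_mul 2
  have i0 : IntervalIntegrable (fun τ : ℝ => 2 * τ ^ (-(1 / 2) : ℝ)) volume 0 1 :=
    (intervalIntegral.intervalIntegrable_rpow' (by norm_num)).const_mul 2
  have i2 : IntegrableOn (fun τ : ℝ => 2 * (1 - τ) ^ (-(1 / 2) : ℝ)) (Ioc 0 1) := by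
    have := (i0.comp_sub_left 1).symm
    norm_num at this
    rw [intervalIntegrable_iff_integrableOn_Ioc_of_le zero_le_one] at this
    exact this.congr_fun (fun τ _ => by norm_num) measurableSet_Ioc
  have i3 : IntegrableOn (fun τ : ℝ => 2 * (τ - 1) ^ (-(1 / 2) : ℝ)) (Ioc 1 2) := by
    have := (i0.comp_sub_right 1)
    norm_num at this
    rw [intervalIntegrable_iff_integrableOn_Ioc_of_le one_le_two] at this
    exact this.congr_fun (fun τ _ => by norm_num) measurableSet_Ioc
  have i4 : IntegrableOn (fun τ : ℝ => 2 * τ ^ (s - 2)) (Ioi 2) :=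
    (integrableOn_Ioi_rpow_of_lt (by linarith) (by norm_num)).const_mul 2
  have key : ∀ τ : ℝ, 0 < τ → ∀ b c : ℝ, 0 < b → b * τ ^ (s - 1) ≤ c * √(max 1 τ * |1 - τ|) →
     0 < √(max 1 τ * |1 - τ|) →  halfKer 1 τ * τ ^ (s - 1) ≤ c / b := by
    intro τ hτ b c hb h h0
    unfold halfKer
    rw [le_div_iff₀ hb, ← div_eq_inv_mul, div_mul_eq_mul_div, div_le_iff₀ h0]
    linarith
  have hmid : ∀ τ : ℝ, 1 / 2 ≤ τ → halfKer 1 τ * τ ^ (s - 1) ≤ 2 * |1 - τ| ^ (-(1 / 2) : ℝ) := by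
    intro τ hτ
    have h1 : τ ^ (s - 1) ≤ 2 := by
      calc τ ^ (s - 1) ≤ (1 / 2 : ℝ) ^ (s - 1) :=
            Real.rpow_le_rpow_of_nonpos (by norm_num) hτ (by linarith)
        _ ≤ (1 / 2 : ℝ) ^ (-1 : ℝ) :=
            Real.rpow_le_rpow_of_exponent_ge (by norm_num) (by norm_num) (by linarith)
        _ = 2 := by rw [Real.rpow_neg_one]; norm_num
    have h2 : halfKer 1 τ ≤ |1 - τ| ^ (-(1 / 2) : ℝ) := by
      rw [Real.rpow_neg (abs_nonneg _), ← Real.sqrt_eq_rpow]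
      unfold halfKer
      rcases eq_or_ne τ 1 with rfl | h
      · simp
      have : 0 < |1 - τ| := abs_pos.2 (sub_ne_zero.2 h.symm)
      apply inv_anti₀ (Real.sqrt_pos.2 this)
      apply Real.sqrt_le_sqrt
      have : (1 : ℝ) ≤ max 1 τ := le_max_left _ _
      nlinarith [abs_nonneg (1 - τ)]
    have h3 : 0 ≤ |1 - τ| ^ (-(1 / 2) : ℝ) := by positivity
    have h4 : 0 ≤ τ ^ (s - 1) := Real.rpow_nonneg (by linarith) _
    nlinarith [halfKer_nonneg 1 τ]
  let f : ℝ → ℝ≥0∞ := fun τ => ENNReal.ofReal (halfKer 1 τ * τ ^ (s - 1))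
  have hsub : Ioi (0 : ℝ) ⊆ (Ioc 0 1 ∪ Ioc 1 2) ∪ Ioi 2 := by
    intro τ hτ
    have hτ : 0 < τ := hτ
    rcases le_or_gt τ 1 with h | h
    · exact Or.inl (Or.inl ⟨hτ, h⟩)
    · rcases le_or_gt τ 2 with h' | h'
      · exact Or.inl (Or.inr ⟨h, h'⟩)
      · exact Or.inr h'
  have fin : ∀ (A : Set ℝ) (g : ℝ → ℝ), MeasurableSet A → IntegrableOn g A →
      (∀ τ ∈ A, halfKer 1 τ * τ ^ (s - 1) ≤ g τ) → ∫⁻ τ in A, f τ < ⊤ := by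
    intro A g hA hg h
    refine lt_of_le_of_lt (setLIntegral_mono_ae' hA (Eventually.of_forall fun τ hτ => ?_))
      hg.lintegral_lt_top
    exact ENNReal.ofReal_le_ofReal (h τ hτ)
  have f1 : ∫⁻ τ in Ioc 0 1, f τ < ⊤ := by
    refine fin _ _ measurableSet_Ioc (i1.add i2) fun τ hτ => ?_
    have hp2 : 0 ≤ 2 * (1 - τ) ^ (-(1 / 2) : ℝ) := by
      have := Real.rpow_nonneg (sub_nonneg.2 hτ.2) (-(1 / 2) : ℝ); linarith
    have hp1 : 0 ≤ 2 * τ ^ (s - 1) := by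
      have := Real.rpow_nonneg hτ.1.le (s - 1); linarith
    simp only [Pi.add_apply]
    rcases le_or_gt (1 / 2) τ with h | h
    · have := hmid τ h
      rw [abs_of_nonneg (sub_nonneg.2 hτ.2)] at this
      linarith
    · have h2 : halfKer 1 τ ≤ 2 := by
        unfold halfKer
        rw [inv_le_comm₀ (Real.sqrt_pos.2 _) (by norm_num)]
        · apply Real.le_sqrt_of_sq_le
          rw [max_eq_left hτ.2, abs_of_nonneg (sub_nonneg.2 hτ.2)]
          norm_num; linarith
        · rw [max_eq_left hτ.2, abs_of_nonneg (sub_nonneg.2 hτ.2)]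
          linarith
      have := mul_le_mul_of_nonneg_right h2 (Real.rpow_nonneg hτ.1.le (s - 1))
      linarith
  have f2 : ∫⁻ τ in Ioc 1 2, f τ < ⊤ := by
    refine fin _ _ measurableSet_Ioc i3 fun τ hτ => ?_
    have := hmid τ (by linarith [hτ.1])
    rwa [abs_sub_comm, abs_of_nonneg (sub_nonneg.2 hτ.1.le)] at this
  have f3 : ∫⁻ τ in Ioi 2, f τ < ⊤ := by
    refine fin _ _ measurableSet_Ioi i4 fun τ hτ => ?_
    have hτ : 2 < τ := hτ
    have hτ0 : 0 < τ := by linarith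
    have h2 : halfKer 1 τ ≤ 2 * τ⁻¹ := by
      unfold halfKer
      rw [show 2 * τ⁻¹ = (τ / 2)⁻¹ by field_simp]
      apply inv_anti₀ (by linarith)
      apply Real.le_sqrt_of_sq_le
      rw [max_eq_right (by linarith), abs_sub_comm, abs_of_nonneg (by linarith)]
      nlinarith
    have h3 : τ ^ (s - 2) = τ⁻¹ * τ ^ (s - 1) := by
      rw [← Real.rpow_neg_one, ← Real.rpow_add hτ0]; congr 1; ring
    rw [h3]
    have := mul_le_mul_of_nonneg_right h2 (Real.rpow_nonneg hτ0.le (s - 1))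
    linarith
  calc ∫⁻ τ in Ioi (0 : ℝ), f τ ≤ ∫⁻ τ in (Ioc 0 1 ∪ Ioc 1 2) ∪ Ioi 2, f τ :=
        lintegral_mono_set hsub
    _ ≤ (∫⁻ τ in Ioc 0 1 ∪ Ioc 1 2, f τ) + ∫⁻ τ in Ioi 2, f τ := lintegral_union_le _ _ _
    _ ≤ (∫⁻ τ in Ioc 0 1, f τ) + (∫⁻ τ in Ioc 1 2, f τ) + ∫⁻ τ in Ioi 2, f τ := by
        gcongr; exact lintegral_union_le _ _ _
    _ < ⊤ := by
        rw [ENNReal.add_lt_top, ENNReal.add_lt_top]; exact ⟨⟨f1, f2⟩, f3⟩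

lemma exists_lintegral_halfKer {s : ℝ} (hs : 0 < s) (hs1 : s < 1) :
    ∃ C : ℝ≥0∞, C < ⊤ ∧ ∀ x : ℝ, 0 < x →
      ∫⁻ y in Ioi (0 : ℝ), ENNReal.ofReal (halfKer x y * y ^ (s - 1)) ≤
        C * ENNReal.ofReal (x ^ (s - 1)) := by
  refine ⟨_, lintegral_halfKer_one_lt_top hs hs1, fun x hx => le_of_eq ?_⟩
  have himg : (fun τ : ℝ => x * τ) '' Ioi 0 = Ioi 0 := by
    rw [image_mul_left_Ioi hx, mul_zero]
  conv_lhs => rw [← himg]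
  rw [lintegral_image_eq_lintegral_abs_deriv_mul measurableSet_Ioi (f' := fun _ => x)
    (fun τ _ => by simpa using ((hasDerivAt_id τ).const_mul x).hasDerivWithinAt)
    (fun a _ b _ h => mul_left_cancel₀ hx.ne' h), ← lintegral_mul_const' _ _ ENNReal.ofReal_ne_top]
  refine setLIntegral_congr_fun measurableSet_Ioi fun τ hτ => ?_
  have hτ : 0 < τ := hτ
  rw [← ENNReal.ofReal_mul (abs_nonneg _), ← ENNReal.ofReal_mul
    (mul_nonneg (halfKer_nonneg _ _) (Real.rpow_nonneg hτ.le _)), halfKer_mul hx,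
    Real.mul_rpow hx.le hτ.le, abs_of_pos hx]
  congr 1
  field_simp

def ker0 (z w : ℂ) : ℝ := (‖z - w‖ * ‖1 - conj z * w‖)⁻¹

lemma ker0_nonneg (z w : ℂ) : 0 ≤ ker0 z w := by unfold ker0; positivity

lemma ker0_comm (z w : ℂ) : ker0 z w = ker0 w z := by
  unfold ker0
  rw [norm_sub_rev z w]
  congr 2
  rw [← Complex.norm_conj (1 - conj z * w)]
  simp [mul_comm]

lemma measurable_ker0 : Measurable (fun p : ℂ × ℂ => ker0 p.1 p.2) := by
  unfold ker0
  fun_prop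

lemma lintegral_ker0_radial {z : ℂ} (hz : z ≠ 0) (hz1 : ‖z‖ < 1) (F : ℝ → ℝ)
    (hF : ∀ t, 0 < t → t < 1 → 0 ≤ F t) :
    ∫⁻ w in ball (0 : ℂ) 1, ENNReal.ofReal (ker0 z w * F ‖w‖) ≤
      ENNReal.ofReal (4 * π ^ 2 * √π) * ∫⁻ t in Ioo (0 : ℝ) 1,
        ENNReal.ofReal (t * F t * (√(max ‖z‖ t * (1 - ‖z‖ * t) * |‖z‖ - t|))⁻¹) := by
  set r := ‖z‖ with hr
  have hr0 : 0 < r := norm_pos_iff.2 hz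
  have hc : ‖z / (r : ℂ)‖ = 1 := by
    rw [norm_div, norm_real, norm_norm, div_self hr0.ne']
  obtain ⟨c, hcz⟩ : ∃ c : Circle, (c : ℂ) * r = z := by
    refine ⟨⟨z / (r : ℂ), by simpa [Submonoid.unitSphere] using hc⟩, ?_⟩
    change z / (r : ℂ) * r = z
    have : (r : ℂ) ≠ 0 := ofReal_ne_zero.2 hr0.ne'
    field_simp
  have hnc : ‖(c : ℂ)‖ = 1 := Circle.norm_coe c
  have hcc : conj (c : ℂ) * c = 1 := by
    rw [mul_comm, Complex.mul_conj, normSq_eq_norm_sq, hnc]; simp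
  have hmp := (rotation c).measurePreserving
  have hker : ∀ w : ℂ, ker0 z (rotation c w) = ker0 r w := by
    intro w
    unfold ker0
    rw [rotation_apply, ← hcz, ← mul_sub, norm_mul, Circle.norm_coe, one_mul]
    congr 3
    rw [map_mul]
    linear_combination (-(conj (r : ℂ) * w)) * hcc
  let G : ℂ → ℝ≥0∞ := (ball (0 : ℂ) 1).indicator fun w => ENNReal.ofReal (ker0 z w * F ‖w‖)
  have e1 : ∫⁻ w in ball (0 : ℂ) 1, ENNReal.ofReal (ker0 z w * F ‖w‖) =
      ∫⁻ w, (ball (0 : ℂ) 1).indicator (fun w => ENNReal.ofReal (ker0 r w * F ‖w‖)) w := by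
    rw [← lintegral_indicator measurableSet_ball]
    rw [← hmp.lintegral_comp_emb (rotation c).toHomeomorph.measurableEmbedding]
    congr 1; ext w
    by_cases hw : w ∈ ball (0 : ℂ) 1
    · rw [indicator_of_mem hw, indicator_of_mem (by simpa [hnc] using hw)]
      rw [hker, LinearIsometryEquiv.norm_map]
    · rw [indicator_of_notMem hw, indicator_of_notMem (by simpa [hnc] using hw)]
  rw [e1, ← Complex.lintegral_comp_polarCoord_symm]
  rw [show polarCoord.target = Ioi (0 : ℝ) ×ˢ Ioo (-π) π from rfl, Measure.volume_eq_prod,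
    ← Measure.prod_restrict]
  refine (lintegral_prod_le _).trans ?_
  rw [← lintegral_const_mul' _ _ ENNReal.ofReal_ne_top]
  rw [← lintegral_indicator measurableSet_Ioi, ← lintegral_indicator measurableSet_Ioo]
  have hne : ∀ᵐ t : ℝ, t ≠ r := by simp [ae_iff]
  refine lintegral_mono_ae ?_
  filter_upwards [hne] with t htr
  by_cases ht : t ∈ Ioi (0 : ℝ)
  swap
  · rw [indicator_of_notMem ht]; exact zero_le
  have ht0 : 0 < t := ht
  rw [indicator_of_mem ht]
  have hnorm : ∀ θ : ℝ, Complex.polarCoord.symm (t, θ) = t * exp (θ * I) := by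
    intro θ
    rw [Complex.polarCoord_symm_apply, exp_mul_I, ofReal_cos, ofReal_sin]
  have hn2 : ∀ θ : ℝ, ‖(t : ℂ) * exp (θ * I)‖ = t := by
    intro θ
    rw [norm_mul, norm_exp_ofReal_mul_I, mul_one, norm_real, Real.norm_of_nonneg ht0.le]
  by_cases ht1 : t < 1
  · rw [indicator_of_mem (show t ∈ Ioo (0 : ℝ) 1 from ⟨ht0, ht1⟩)]
    have hm : ∀ θ : ℝ, (t : ℂ) * exp (θ * I) ∈ ball (0 : ℂ) 1 := by
      intro θ; rw [mem_ball_zero_iff, hn2]; exact ht1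
    simp only [hnorm, indicator_of_mem (hm _), hn2, smul_eq_mul]
    have hh : ∀ θ : ℝ, ENNReal.ofReal t * ENNReal.ofReal (ker0 r (t * exp (θ * I)) * F t) =
        ENNReal.ofReal (t * F t) * ENNReal.ofReal
        ((‖(r : ℂ) - t * exp (θ * I)‖ * ‖1 - (r : ℂ) * (t * exp (θ * I))‖)⁻¹) := by
      intro θ
      rw [← ENNReal.ofReal_mul ht0.le, ← ENNReal.ofReal_mul (mul_nonneg ht0.le (hF t ht0 ht1))]
      unfold ker0
      rw [conj_ofReal]; congr 1; ring
    simp only [hh]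
    rw [lintegral_const_mul' _ _ ENNReal.ofReal_ne_top]
    refine (mul_le_mul_right (lintegral_angular hr0 hz1 ht0 ht1 htr.symm) _).trans ?_
    rw [← ENNReal.ofReal_mul (mul_nonneg ht0.le (hF t ht0 ht1)),
      ← ENNReal.ofReal_mul (by positivity)]
    apply ENNReal.ofReal_le_ofReal (le_of_eq _)
    ring
  · have hm : ∀ θ : ℝ, (t : ℂ) * exp (θ * I) ∉ ball (0 : ℂ) 1 := by
      intro θ; rw [mem_ball_zero_iff, hn2]; exact ht1
    simp [hnorm, indicator_of_notMem (hm _)]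

def kern (z w : ℂ) : ℝ := (1 - ‖z‖ ^ 2) * ker0 z w

def SchurLeft (U : Set ℂ) (σ x : ℂ → ℝ) : Prop :=
  ∀ s : ℝ, 0 < s → s < 1 → ∃ C : ℝ≥0∞, C < ⊤ ∧ ∀ᵐ z : ℂ, z ∈ U →
    ∫⁻ w in U, ENNReal.ofReal (kern z w * ((σ w)⁻¹ * x w ^ s)) ≤ C * ENNReal.ofReal (x z ^ s)

def SchurRight (U : Set ℂ) (σ x : ℂ → ℝ) : Prop :=
  ∀ s : ℝ, 0 < s → s < 1 → ∃ C : ℝ≥0∞, C < ⊤ ∧ ∀ᵐ w : ℂ, w ∈ U →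
    ∫⁻ z in U, ENNReal.ofReal (kern z w * (x z ^ s * ((σ z) ^ 2)⁻¹)) ≤
      C * ENNReal.ofReal (x w ^ s * (σ w)⁻¹)

lemma lintegral_comp_le_Ioi {Y Y' : ℝ → ℝ} (hY : ∀ t ∈ Ioo (0 : ℝ) 1, HasDerivAt Y (Y' t) t)
    (hinj : InjOn Y (Ioo 0 1)) (hpos : ∀ t ∈ Ioo (0 : ℝ) 1, 0 < Y t) (g : ℝ → ℝ) :
    ∫⁻ t in Ioo (0 : ℝ) 1, ENNReal.ofReal (|Y' t| * g (Y t)) ≤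
      ∫⁻ y in Ioi (0 : ℝ), ENNReal.ofReal (g y) := by
  have := lintegral_image_eq_lintegral_abs_deriv_mul measurableSet_Ioo
    (fun t ht => (hY t ht).hasDerivWithinAt) hinj (fun y => ENNReal.ofReal (g y))
  simp only [← ENNReal.ofReal_mul (abs_nonneg _)] at this
  rw [← this]
  exact lintegral_mono_set (by rintro _ ⟨t, ht, rfl⟩; exact hpos t ht)

lemma inv_sqrt_le_of_sq {a b P Q : ℝ} (hb : 0 ≤ b) (hP : 0 < P) (hQ : 0 < Q)
    (h : a ^ 2 * Q ≤ b ^ 2 * P) : a * (√P)⁻¹ ≤ b * (√Q)⁻¹ := by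
  rw [← div_eq_mul_inv, ← div_eq_mul_inv, div_le_div_iff₀ (Real.sqrt_pos.2 hP) (Real.sqrt_pos.2 hQ)]
  refine (abs_le_of_sq_le_sq' ?_ (by positivity)).2
  rw [mul_pow, mul_pow, Real.sq_sqrt hP.le, Real.sq_sqrt hQ.le]
  exact h

lemma disk_radial_le {r t : ℝ} (hr : 0 < r) (hr1 : r < 1) (ht : 0 < t) (ht1 : t < 1)
    (hne : r ≠ t) :
    (√(max r t * (1 - r * t) * |r - t|))⁻¹ ≤ 2 * halfKer (1 - r ^ 2) (1 - t ^ 2) := by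
  have ha : 0 < |r - t| := abs_pos.2 (sub_ne_zero.2 hne)
  have h1 : 0 < 1 - r * t := by nlinarith
  have hx : 0 < 1 - r ^ 2 := by nlinarith
  have hy : 0 < 1 - t ^ 2 := by nlinarith
  have hm : 0 < max r t := lt_max_of_lt_left hr
  have hM : 0 < max (1 - r ^ 2) (1 - t ^ 2) := lt_max_of_lt_left hx
  have hxy : |1 - r ^ 2 - (1 - t ^ 2)| = (r + t) * |r - t| := by
    rw [show 1 - r ^ 2 - (1 - t ^ 2) = -((r + t) * (r - t)) by ring, abs_neg, abs_mul,
      abs_of_pos (by linarith : 0 < r + t)]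
  have hmM : max (1 - r ^ 2) (1 - t ^ 2) ≤ 2 * (1 - r * t) := by
    apply max_le <;> nlinarith [sq_nonneg (r - t)]
  have hrt : r + t ≤ 2 * max r t := by linarith [le_max_left r t, le_max_right r t]
  have := inv_sqrt_le_of_sq (a := 1) (b := 2) zero_le_two
    (P := max r t * (1 - r * t) * |r - t|)
    (Q := max (1 - r ^ 2) (1 - t ^ 2) * |1 - r ^ 2 - (1 - t ^ 2)|) (by positivity)
    (by rw [hxy]; have : 0 < r + t := by linarith
        positivity) ?_
  · simpa [halfKer] using this
  · rw [hxy]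
    have := mul_le_mul hmM hrt (by linarith) (by linarith)
    have := mul_le_mul_of_nonneg_right this ha.le
    linarith

lemma div_one_add_le_one_sub_exp_neg {τ : ℝ} (hτ : 0 ≤ τ) : τ / (1 + τ) ≤ 1 - Real.exp (-τ) := by
  have h1 : 1 + τ ≤ Real.exp τ := by linarith [Real.add_one_le_exp τ]
  have h2 : Real.exp (-τ) ≤ (1 + τ)⁻¹ := by
    rw [Real.exp_neg]; exact inv_anti₀ (by linarith) h1
  have h3 : τ / (1 + τ) = 1 - (1 + τ)⁻¹ := by
    have : 1 + τ ≠ 0 := by linarith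
    field_simp; ring
  linarith

lemma punctured_aux_one {x τ : ℝ} (hx : 0 < x) (hτ : 0 < τ) :
    (Real.exp (-τ) * (1 - Real.exp (-(2 * x)))) ^ 2 * ((x + τ) * τ) ≤
      (3 * x) ^ 2 * ((1 - Real.exp (-(2 * x + τ))) * (1 - Real.exp (-τ))) := by
  have c1 := div_one_add_le_one_sub_exp_neg hτ.le
  have c2 := div_one_add_le_one_sub_exp_neg (τ := 2 * x + τ) (by linarith)
  have c3 : 1 - Real.exp (-(2 * x)) ≤ 2 * x := by linarith [Real.add_one_le_exp (-(2 * x))]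
  have c4 : 1 - Real.exp (-(2 * x)) ≤ 1 := by linarith [Real.exp_pos (-(2 * x))]
  have c0 : 0 ≤ 1 - Real.exp (-(2 * x)) := by
    have : Real.exp (-(2 * x)) ≤ 1 := Real.exp_le_one_iff.2 (by linarith)
    linarith
  have c5 : Real.exp (-τ) * (1 + τ) ≤ 1 := by
    rw [Real.exp_neg, inv_mul_le_iff₀ (Real.exp_pos _)]; linarith [Real.add_one_le_exp τ]
  set c := 1 - Real.exp (-(2 * x))
  set e := Real.exp (-τ)
  have he : 0 < e := Real.exp_pos _
  have c6 : (e * (1 + τ)) ^ 2 ≤ 1 := by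
    have : 0 ≤ e * (1 + τ) := by positivity
    nlinarith
  have c7 : c ^ 2 * (1 + 2 * x) ≤ 9 * x ^ 2 := by
    have h1 : c ^ 2 ≤ (2 * x) ^ 2 := by gcongr
    have h2 : c ^ 2 ≤ 2 * x * 1 := by rw [sq]; gcongr
    nlinarith
  have hgoal : (e * c) ^ 2 * ((x + τ) * τ) ≤
      (3 * x) ^ 2 * ((2 * x + τ) / (1 + (2 * x + τ)) * (τ / (1 + τ))) := by
    rw [div_mul_div_comm, mul_div_assoc', le_div_iff₀ (by positivity)]
    have k1 : (1 + (2 * x + τ)) ≤ (1 + 2 * x) * (1 + τ) := by nlinarith [mul_pos hx hτ]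
    calc (e * c) ^ 2 * ((x + τ) * τ) * ((1 + (2 * x + τ)) * (1 + τ))
        ≤ (e * c) ^ 2 * ((x + τ) * τ) * (((1 + 2 * x) * (1 + τ)) * (1 + τ)) := by gcongr
      _ = (e * (1 + τ)) ^ 2 * (c ^ 2 * (1 + 2 * x)) * ((x + τ) * τ) := by ring
      _ ≤ 1 * (9 * x ^ 2) * ((2 * x + τ) * τ) := by gcongr; linarith
      _ = _ := by ring
  refine hgoal.trans ?_
  gcongr
  exact (div_nonneg (by linarith) (by linarith)).trans c2

lemma punctured_aux_two {y τ : ℝ} (hy : 0 < y) (hτ : 0 < τ) :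
    (1 - Real.exp (-(2 * (y + τ)))) ^ 2 * ((y + τ) * τ) ≤
      (3 * (y + τ)) ^ 2 * ((1 - Real.exp (-(2 * y + τ))) * (1 - Real.exp (-τ))) := by
  have c1 := div_one_add_le_one_sub_exp_neg hτ.le
  have c2 := div_one_add_le_one_sub_exp_neg (τ := 2 * y + τ) (by linarith)
  set x := y + τ with hx
  have c3 : 1 - Real.exp (-(2 * x)) ≤ 2 * x := by linarith [Real.add_one_le_exp (-(2 * x))]
  have c4 : 1 - Real.exp (-(2 * x)) ≤ 1 := by linarith [Real.exp_pos (-(2 * x))]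
  have hx0 : 0 < x := by linarith
  have c0 : 0 ≤ 1 - Real.exp (-(2 * x)) := by
    have : Real.exp (-(2 * x)) ≤ 1 := Real.exp_le_one_iff.2 (by linarith)
    linarith
  set c := 1 - Real.exp (-(2 * x))
  have c7 : (c * (1 + x)) ^ 2 ≤ (3 * x) ^ 2 := by
    apply pow_le_pow_left₀ (by positivity)
    nlinarith
  have hgoal : c ^ 2 * (x * τ) ≤
      (3 * x) ^ 2 * ((2 * y + τ) / (1 + (2 * y + τ)) * (τ / (1 + τ))) := by
    rw [div_mul_div_comm, mul_div_assoc', le_div_iff₀ (by positivity)]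
    have k1 : (1 + (2 * y + τ)) * (1 + τ) ≤ (1 + x) ^ 2 := by rw [hx]; nlinarith [sq_nonneg y]
    calc c ^ 2 * (x * τ) * ((1 + (2 * y + τ)) * (1 + τ))
        ≤ c ^ 2 * (x * τ) * (1 + x) ^ 2 := by gcongr
      _ = (c * (1 + x)) ^ 2 * (x * τ) := by ring
      _ ≤ (3 * x) ^ 2 * ((2 * y + τ) * τ) := by gcongr; linarith
  refine hgoal.trans ?_
  gcongr
  exact (div_nonneg (by linarith) (by linarith)).trans c2

lemma punctured_radial_le {r t : ℝ} (hr : 0 < r) (hr1 : r < 1) (ht : 0 < t) (ht1 : t < 1)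
    (hne : r ≠ t) :
    t * (1 - r ^ 2) * (√(max r t * (1 - r * t) * |r - t|))⁻¹ ≤
      3 * (-Real.log r) * halfKer (-Real.log r) (-Real.log t) := by
  obtain ⟨x, rfl⟩ : ∃ x, r = Real.exp (-x) := ⟨-Real.log r, by rw [neg_neg, Real.exp_log hr]⟩
  obtain ⟨y, rfl⟩ : ∃ x, t = Real.exp (-x) := ⟨-Real.log t, by rw [neg_neg, Real.exp_log ht]⟩
  simp only [Real.log_exp, neg_neg]
  have hx : 0 < x := by rw [Real.exp_lt_one_iff] at hr1; linarith
  have hy : 0 < y := by rw [Real.exp_lt_one_iff] at ht1; linarith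
  have hxy : x ≠ y := fun h => hne (by rw [h])
  have h1 : 0 < 1 - Real.exp (-x) * Real.exp (-y) := by nlinarith
  have ha : 0 < |Real.exp (-x) - Real.exp (-y)| := abs_pos.2 (sub_ne_zero.2 hne)
  have ha' : 0 < |x - y| := abs_pos.2 (sub_ne_zero.2 hxy)
  unfold halfKer
  refine inv_sqrt_le_of_sq (by positivity) ?_ ?_ ?_
  · have : 0 < max (Real.exp (-x)) (Real.exp (-y)) := lt_max_of_lt_left hr
    positivity
  · have : 0 < max x y := lt_max_of_lt_left hx
    positivity
  rcases lt_or_gt_of_ne hxy with h | h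
  · obtain ⟨τ, hτ, rfl⟩ : ∃ τ, 0 < τ ∧ y = x + τ := ⟨y - x, by linarith, by ring⟩
    have hlt : Real.exp (-(x + τ)) < Real.exp (-x) := Real.exp_lt_exp.2 (by linarith)
    rw [max_eq_left hlt.le, max_eq_right h.le, abs_of_pos (sub_pos.2 hlt),
      abs_of_neg (by linarith)]
    have key := punctured_aux_one hx hτ
    have e1 : Real.exp (-(x + τ)) = Real.exp (-x) * Real.exp (-τ) := by
      rw [← Real.exp_add]; congr 1; ring
    have e2 : Real.exp (-(2 * x)) = Real.exp (-x) ^ 2 := by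
      rw [← Real.exp_nat_mul]; congr 1; push_cast; ring
    have e3 : Real.exp (-(2 * x + τ)) = Real.exp (-x) ^ 2 * Real.exp (-τ) := by
      rw [← e2, ← Real.exp_add]; congr 1; ring
    rw [e2, e3] at key
    rw [e1]
    have := mul_le_mul_of_nonneg_left key (sq_nonneg (Real.exp (-x)))
    linarith
  · obtain ⟨τ, hτ, rfl⟩ : ∃ τ, 0 < τ ∧ x = y + τ := ⟨x - y, by linarith, by ring⟩
    have hlt : Real.exp (-(y + τ)) < Real.exp (-y) := Real.exp_lt_exp.2 (by linarith)
    rw [max_eq_right hlt.le, max_eq_left h.le, abs_of_neg (sub_neg.2 hlt),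
      abs_of_pos (by linarith)]
    have key := punctured_aux_two hy hτ
    have e1 : Real.exp (-(y + τ)) = Real.exp (-y) * Real.exp (-τ) := by
      rw [← Real.exp_add]; congr 1; ring
    have e2 : Real.exp (-(2 * (y + τ))) = (Real.exp (-y) * Real.exp (-τ)) ^ 2 := by
      rw [← e1, ← Real.exp_nat_mul]; congr 1; push_cast; ring
    have e3 : Real.exp (-(2 * y + τ)) = Real.exp (-y) ^ 2 * Real.exp (-τ) := by
      rw [← Real.exp_nat_mul, ← Real.exp_add]; congr 1; push_cast; ring
    rw [e2, e3] at key
    rw [e1]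
    have := mul_le_mul_of_nonneg_left key (sq_nonneg (Real.exp (-y)))
    linarith

def diskX (z : ℂ) : ℝ := 1 - ‖z‖ ^ 2

def punctX (z : ℂ) : ℝ := -Real.log ‖z‖

def punctSigma (z : ℂ) : ℝ := ‖z‖ * punctX z

lemma disk_radial_integral {s : ℝ} (hs : 0 < s) (hs1 : s < 1) :
    ∃ C : ℝ≥0∞, C < ⊤ ∧ ∀ z : ℂ, z ≠ 0 → ‖z‖ < 1 →
      ∫⁻ w in ball (0 : ℂ) 1, ENNReal.ofReal (ker0 z w * (diskX w) ^ (s - 1)) ≤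
        C * ENNReal.ofReal ((diskX z) ^ (s - 1)) := by
  obtain ⟨C, hC, h⟩ := exists_lintegral_halfKer hs hs1
  refine ⟨ENNReal.ofReal (4 * π ^ 2 * √π) * C, ENNReal.mul_lt_top ENNReal.ofReal_lt_top hC,
    fun z hz hz1 => ?_⟩
  refine (lintegral_ker0_radial hz hz1 (fun t => (1 - t ^ 2) ^ (s - 1)) fun t ht ht1 =>
    Real.rpow_nonneg (by nlinarith) _).trans ?_
  rw [mul_assoc (ENNReal.ofReal _)]
  refine mul_le_mul_right ?_ _
  have hr0 : 0 < ‖z‖ := norm_pos_iff.2 hz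
  have hX : 0 < 1 - ‖z‖ ^ 2 := by nlinarith
  refine le_trans ?_ (h _ hX)
  refine le_trans ?_ (lintegral_comp_le_Ioi (Y := fun t => 1 - t ^ 2) (Y' := fun t => -(2 * t))
    (fun t _ => ?_) ?_ ?_ _)
  · have hne : ∀ᵐ t : ℝ, t ≠ ‖z‖ := by simp [ae_iff]
    refine setLIntegral_mono_ae' measurableSet_Ioo ?_
    filter_upwards [hne] with t htr ht
    apply ENNReal.ofReal_le_ofReal
    have := disk_radial_le hr0 hz1 ht.1 ht.2 htr.symm
    have hp : 0 ≤ (1 - t ^ 2) ^ (s - 1) := Real.rpow_nonneg (by nlinarith [ht.1, ht.2]) _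
    rw [abs_neg, abs_of_pos (show (0 : ℝ) < 2 * t by linarith [ht.1])]
    have := mul_le_mul_of_nonneg_left this (mul_nonneg ht.1.le hp)
    rw [show diskX z = 1 - ‖z‖ ^ 2 from rfl]
    linarith
  · simpa using ((hasDerivAt_id t).pow 2).const_sub 1
  · intro a ha b hb hab
    have : a ^ 2 = b ^ 2 := by simp only at hab; linarith
    exact (pow_left_inj₀ ha.1.le hb.1.le two_ne_zero).1 this
  · intro t ht; nlinarith [ht.1, ht.2]

lemma ae_ne_zero_complex : ∀ᵐ z : ℂ, z ≠ 0 := by simp [ae_iff]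

lemma disk_schurLeft : SchurLeft (ball (0 : ℂ) 1) diskX diskX := by
  intro s hs hs1
  obtain ⟨C, hC, h⟩ := disk_radial_integral hs hs1
  refine ⟨C, hC, ?_⟩
  filter_upwards [ae_ne_zero_complex] with z hz hz1
  rw [mem_ball_zero_iff] at hz1
  have hX : 0 < diskX z := by unfold diskX; nlinarith [norm_nonneg z]
  have e : ∀ w ∈ ball (0 : ℂ) 1, ENNReal.ofReal (kern z w * ((diskX w)⁻¹ * diskX w ^ s)) =
      ENNReal.ofReal (diskX z) * ENNReal.ofReal (ker0 z w * (diskX w) ^ (s - 1)) := by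
    intro w hw
    rw [mem_ball_zero_iff] at hw
    have hW : 0 < diskX w := by unfold diskX; nlinarith [norm_nonneg w]
    rw [← ENNReal.ofReal_mul hX.le, Real.rpow_sub_one hW.ne']
    congr 1
    unfold kern
    change diskX z * ker0 z w * _ = _
    ring
  rw [setLIntegral_congr_fun measurableSet_ball e, lintegral_const_mul' _ _ ENNReal.ofReal_ne_top]
  refine (mul_le_mul_right (h z hz hz1) _).trans (le_of_eq ?_)
  rw [mul_left_comm, ← ENNReal.ofReal_mul hX.le, Real.rpow_sub_one hX.ne']
  congr 2
  field_simp

lemma disk_schurRight : SchurRight (ball (0 : ℂ) 1) diskX diskX := by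
  intro s hs hs1
  obtain ⟨C, hC, h⟩ := disk_radial_integral hs hs1
  refine ⟨C, hC, ?_⟩
  filter_upwards [ae_ne_zero_complex] with z hz hz1
  rw [mem_ball_zero_iff] at hz1
  have hX : 0 < diskX z := by unfold diskX; nlinarith [norm_nonneg z]
  have e : ∀ w ∈ ball (0 : ℂ) 1, ENNReal.ofReal (kern w z * (diskX w ^ s * ((diskX w) ^ 2)⁻¹)) =
      ENNReal.ofReal (ker0 z w * (diskX w) ^ (s - 1)) := by
    intro w hw
    rw [mem_ball_zero_iff] at hw
    have hW : 0 < diskX w := by unfold diskX; nlinarith [norm_nonneg w]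
    rw [Real.rpow_sub_one hW.ne']
    congr 1
    unfold kern
    change diskX w * ker0 w z * _ = _
    rw [ker0_comm w z]
    field_simp
  rw [setLIntegral_congr_fun measurableSet_ball e]
  refine (h z hz hz1).trans (le_of_eq ?_)
  rw [Real.rpow_sub_one hX.ne', div_eq_mul_inv]

lemma punct_radial_integral {s : ℝ} (hs : 0 < s) (hs1 : s < 1) :
    ∃ C : ℝ≥0∞, C < ⊤ ∧ ∀ r : ℝ, 0 < r → r < 1 →
      ∫⁻ t in Ioo (0 : ℝ) 1, ENNReal.ofReal
        (t⁻¹ * (halfKer (-Real.log r) (-Real.log t) * (-Real.log t) ^ (s - 1))) ≤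
        C * ENNReal.ofReal ((-Real.log r) ^ (s - 1)) := by
  obtain ⟨C, hC, h⟩ := exists_lintegral_halfKer hs hs1
  refine ⟨C, hC, fun r hr hr1 => ?_⟩
  refine le_trans ?_ (h _ (neg_pos.2 (Real.log_neg hr hr1)))
  refine le_trans ?_ (lintegral_comp_le_Ioi (Y := fun t => -Real.log t) (Y' := fun t => -t⁻¹)
    (fun t ht => (Real.hasDerivAt_log ht.1.ne').neg) ?_ ?_ _)
  · refine setLIntegral_mono' measurableSet_Ioo fun t ht => ?_
    rw [abs_neg, abs_of_pos (inv_pos.2 ht.1)]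
  · intro a ha b hb hab
    exact Real.log_injOn_pos ha.1 hb.1 (neg_injective hab)
  · intro t ht; exact neg_pos.2 (Real.log_neg ht.1 ht.2)

lemma punctX_pos {z : ℂ} (hz : z ∈ ball (0 : ℂ) 1 \ {0}) : 0 < punctX z := by
  have h1 := mem_ball_zero_iff.1 hz.1
  have h0 : 0 < ‖z‖ := norm_pos_iff.2 hz.2
  exact neg_pos.2 (Real.log_neg h0 h1)

lemma punct_schurLeft : SchurLeft (ball (0 : ℂ) 1 \ {0}) punctSigma punctX := by
  intro s hs hs1
  obtain ⟨C, hC, h⟩ := punct_radial_integral hs hs1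
  refine ⟨ENNReal.ofReal (4 * π ^ 2 * √π) * (3 * C), ENNReal.mul_lt_top ENNReal.ofReal_lt_top
    (ENNReal.mul_lt_top (by simp) hC), Eventually.of_forall fun z hz => ?_⟩
  have hX := punctX_pos hz
  have hz1 := mem_ball_zero_iff.1 hz.1
  have hr0 : 0 < ‖z‖ := norm_pos_iff.2 hz.2
  have hq : 0 ≤ 1 - ‖z‖ ^ 2 := by nlinarith
  have e : ∀ w ∈ ball (0 : ℂ) 1, ENNReal.ofReal (kern z w * ((punctSigma w)⁻¹ * punctX w ^ s)) ≤
      ENNReal.ofReal (ker0 z w *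
        ((1 - ‖z‖ ^ 2) * ((‖w‖ * -Real.log ‖w‖)⁻¹ * (-Real.log ‖w‖) ^ s))) := by
    intro w hw
    apply ENNReal.ofReal_le_ofReal (le_of_eq _)
    simp only [kern, punctSigma, punctX]; ring
  refine (lintegral_mono_set sdiff_subset).trans
    ((setLIntegral_mono' measurableSet_ball e).trans ?_)
  refine (lintegral_ker0_radial hz.2 hz1
    (fun t => (1 - ‖z‖ ^ 2) * ((t * -Real.log t)⁻¹ * (-Real.log t) ^ s)) fun t ht ht1 => ?_).trans ?_
  · have : 0 < -Real.log t := neg_pos.2 (Real.log_neg ht ht1)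
    positivity
  rw [mul_assoc (ENNReal.ofReal _)]
  refine mul_le_mul_right ?_ _
  calc _ ≤ ∫⁻ t in Ioo (0 : ℝ) 1, ENNReal.ofReal (3 * punctX z) * ENNReal.ofReal
        (t⁻¹ * (halfKer (-Real.log ‖z‖) (-Real.log t) * (-Real.log t) ^ (s - 1))) := by
        have hne : ∀ᵐ t : ℝ, t ≠ ‖z‖ := by simp [ae_iff]
        refine setLIntegral_mono_ae' measurableSet_Ioo ?_
        filter_upwards [hne] with t htr ht
        have hl : 0 < -Real.log t := neg_pos.2 (Real.log_neg ht.1 ht.2)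
        rw [← ENNReal.ofReal_mul (by positivity)]
        apply ENNReal.ofReal_le_ofReal
        have := punctured_radial_le hr0 hz1 ht.1 ht.2 htr.symm
        rw [Real.rpow_sub_one hl.ne']
        have hp : 0 ≤ t⁻¹ * ((-Real.log t) ^ s / (-Real.log t)) := by
          have := ht.1; positivity
        have := mul_le_mul_of_nonneg_left this hp
        have ht0 := ht.1.ne'
        have hl0 := hl.ne'
        refine le_trans (le_of_eq ?_) (this.trans (le_of_eq ?_))
        · generalize (√_)⁻¹ = q
          generalize -Real.log t = l at *
          field_simp
        · simp only [punctX]; ring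
    _ ≤ _ := by
        rw [lintegral_const_mul' _ _ ENNReal.ofReal_ne_top]
        refine (mul_le_mul_right (h _ hr0 hz1) _).trans (le_of_eq ?_)
        rw [mul_left_comm, ← ENNReal.ofReal_mul (by positivity), mul_comm (3 : ℝ≥0∞), mul_assoc C]
        congr 1
        rw [← ENNReal.ofReal_ofNat, ← ENNReal.ofReal_mul (by norm_num)]
        change ENNReal.ofReal (3 * punctX z * (punctX z) ^ (s - 1)) = _
        rw [Real.rpow_sub_one hX.ne']
        congr 1
        field_simp

lemma punct_schurRight : SchurRight (ball (0 : ℂ) 1 \ {0}) punctSigma punctX := by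
  intro s hs hs1
  obtain ⟨C, hC, h⟩ := punct_radial_integral hs hs1
  refine ⟨ENNReal.ofReal (4 * π ^ 2 * √π) * (3 * C), ENNReal.mul_lt_top ENNReal.ofReal_lt_top
    (ENNReal.mul_lt_top (by simp) hC), Eventually.of_forall fun z hz => ?_⟩
  have hX := punctX_pos hz
  have hz1 := mem_ball_zero_iff.1 hz.1
  have hr0 : 0 < ‖z‖ := norm_pos_iff.2 hz.2
  have e : ∀ w ∈ ball (0 : ℂ) 1,
      ENNReal.ofReal (kern w z * (punctX w ^ s * ((punctSigma w) ^ 2)⁻¹)) ≤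
      ENNReal.ofReal (ker0 z w *
        ((1 - ‖w‖ ^ 2) * (((‖w‖ * -Real.log ‖w‖) ^ 2)⁻¹ * (-Real.log ‖w‖) ^ s))) := by
    intro w hw
    apply ENNReal.ofReal_le_ofReal (le_of_eq _)
    simp only [kern, punctSigma, punctX, ker0_comm w z]; ring
  refine (lintegral_mono_set sdiff_subset).trans
    ((setLIntegral_mono' measurableSet_ball e).trans ?_)
  refine (lintegral_ker0_radial hz.2 hz1
    (fun t => (1 - t ^ 2) * (((t * -Real.log t) ^ 2)⁻¹ * (-Real.log t) ^ s))
      fun t ht ht1 => ?_).trans ?_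
  · have : 0 < -Real.log t := neg_pos.2 (Real.log_neg ht ht1)
    have : 0 ≤ 1 - t ^ 2 := by nlinarith
    positivity
  rw [mul_assoc (ENNReal.ofReal _)]
  refine mul_le_mul_right ?_ _
  calc _ ≤ ∫⁻ t in Ioo (0 : ℝ) 1, ENNReal.ofReal (3 * ‖z‖⁻¹) * ENNReal.ofReal
        (t⁻¹ * (halfKer (-Real.log ‖z‖) (-Real.log t) * (-Real.log t) ^ (s - 1))) := by
        have hne : ∀ᵐ t : ℝ, t ≠ ‖z‖ := by simp [ae_iff]
        refine setLIntegral_mono_ae' measurableSet_Ioo ?_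
        filter_upwards [hne] with t htr ht
        have hl : 0 < -Real.log t := neg_pos.2 (Real.log_neg ht.1 ht.2)
        rw [← ENNReal.ofReal_mul (by positivity)]
        apply ENNReal.ofReal_le_ofReal
        have := punctured_radial_le ht.1 ht.2 hr0 hz1 htr
        rw [max_comm, mul_comm t, abs_sub_comm, halfKer_comm] at this
        rw [Real.rpow_sub_one hl.ne']
        have hp : 0 ≤ ‖z‖⁻¹ * t⁻¹ * ((-Real.log t) ^ s / (-Real.log t) ^ 2) := by
          have := ht.1; positivity
        have := mul_le_mul_of_nonneg_left this hp
        have ht0 := ht.1.ne'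
        have hl0 := hl.ne'
        have hr1 := hr0.ne'
        refine le_trans (le_of_eq ?_) (this.trans (le_of_eq ?_))
        · generalize (√_)⁻¹ = q
          generalize -Real.log t = l at *
          field_simp
        · generalize halfKer _ _ = q
          generalize -Real.log t = l at *
          field_simp
    _ ≤ _ := by
        rw [lintegral_const_mul' _ _ ENNReal.ofReal_ne_top]
        refine (mul_le_mul_right (h _ hr0 hz1) _).trans (le_of_eq ?_)
        rw [mul_left_comm, ← ENNReal.ofReal_mul (by positivity), mul_comm (3 : ℝ≥0∞), mul_assoc C]
        congr 1
        rw [← ENNReal.ofReal_ofNat, ← ENNReal.ofReal_mul (by norm_num)]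
        change ENNReal.ofReal (3 * ‖z‖⁻¹ * (punctX z) ^ (s - 1)) = _
        rw [Real.rpow_sub_one hX.ne']
        congr 1
        unfold punctSigma
        field_simp

lemma schur_test {α : Type*} [MeasurableSpace α] {μ : Measure α} [SFinite μ] {p q : ℝ}
    (hpq : p.HolderConjugate q) {k : α → α → ℝ≥0∞} (hk : Measurable (Function.uncurry k))
    {g A B D F X S N : α → ℝ≥0∞} (hA : AEMeasurable A μ) (hB : AEMeasurable B μ)
    (hD : AEMeasurable D μ) {C₁ C₂ : ℝ≥0∞} (hC₂ : C₂ ≠ ⊤)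
    (h1 : ∀ᵐ z ∂μ, ∫⁻ w, k z w * A w ∂μ ≤ C₁ * X z)
    (h2 : ∀ᵐ w ∂μ, ∫⁻ z, k z w * D z ∂μ ≤ C₂ * F w)
    (hg : ∀ᵐ w ∂μ, g w ≤ A w ^ (1 / q) * B w ^ (1 / p))
    (hX : ∀ᵐ z ∂μ, X z ^ (p / q) * S z ≤ D z) (hN : ∀ᵐ w ∂μ, B w * F w ≤ N w) :
    ∫⁻ z, (∫⁻ w, k z w * g w ∂μ) ^ p * S z ∂μ ≤ C₁ ^ (p / q) * C₂ * ∫⁻ w, N w ∂μ := by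
  have hp := hpq.pos
  have hq := hpq.symm.pos
  have hkz : ∀ z, Measurable (k z) := fun z => hk.of_uncurry_left
  have step1 : ∀ᵐ z ∂μ, (∫⁻ w, k z w * g w ∂μ) ^ p * S z ≤
      C₁ ^ (p / q) * (∫⁻ w, k z w * B w * D z ∂μ) := by
    filter_upwards [h1, hX] with z h1z hXz
    have hol : ∫⁻ w, k z w * g w ∂μ ≤
        (∫⁻ w, k z w * A w ∂μ) ^ (1 / q) * (∫⁻ w, k z w * B w ∂μ) ^ (1 / p) := by
      calc ∫⁻ w, k z w * g w ∂μ
          ≤ ∫⁻ w, ((fun w => (k z w * A w) ^ (1 / q)) * fun w => (k z w * B w) ^ (1 / p)) w ∂μ := by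
            refine lintegral_mono_ae ?_
            filter_upwards [hg] with w hgw
            simp only [Pi.mul_apply]
            rw [ENNReal.mul_rpow_of_nonneg _ _ (by positivity),
              ENNReal.mul_rpow_of_nonneg _ _ (by positivity)]
            have : k z w = k z w ^ (1 / q) * k z w ^ (1 / p) := by
              rw [← ENNReal.rpow_add_of_nonneg _ _ (by positivity) (by positivity)]
              have : 1 / q + 1 / p = 1 := by
                have := hpq.inv_add_inv_eq_one; rw [one_div, one_div]; linarith
              rw [this, ENNReal.rpow_one]
            calc k z w * g w ≤ k z w * (A w ^ (1 / q) * B w ^ (1 / p)) := by gcongr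
              _ = (k z w ^ (1 / q) * k z w ^ (1 / p)) * (A w ^ (1 / q) * B w ^ (1 / p)) := by
                  rw [← this]
              _ = _ := by ring
        _ ≤ _ := by
            refine (ENNReal.lintegral_mul_le_Lp_mul_Lq μ hpq.symm
              (((hkz z).aemeasurable.mul hA).pow_const _)
              (((hkz z).aemeasurable.mul hB).pow_const _)).trans (le_of_eq ?_)
            simp only [← ENNReal.rpow_mul, one_div, inv_mul_cancel₀ hq.ne', inv_mul_cancel₀ hp.ne',
              ENNReal.rpow_one]
            rfl
    calc (∫⁻ w, k z w * g w ∂μ) ^ p * S z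
        ≤ ((C₁ * X z) ^ (1 / q) * (∫⁻ w, k z w * B w ∂μ) ^ (1 / p)) ^ p * S z := by
          gcongr; exact hol.trans (by gcongr)
      _ = C₁ ^ (p / q) * ((∫⁻ w, k z w * B w ∂μ) * (X z ^ (p / q) * S z)) := by
          rw [ENNReal.mul_rpow_of_nonneg _ _ hp.le, ← ENNReal.rpow_mul, ← ENNReal.rpow_mul,
            show 1 / q * p = p / q by ring, one_div_mul_cancel hp.ne', ENNReal.rpow_one,
            ENNReal.mul_rpow_of_nonneg _ _ (by positivity)]
          ring
      _ ≤ C₁ ^ (p / q) * ((∫⁻ w, k z w * B w ∂μ) * D z) := by gcongr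
      _ = _ := by
          rw [lintegral_mul_const'' (f := fun w => k z w * B w) _ ((hkz z).aemeasurable.mul hB)]
  have hm : AEMeasurable (fun r : α × α => k r.1 r.2 * B r.2 * D r.1) (μ.prod μ) :=
    (hk.aemeasurable.mul hB.comp_snd).mul hD.comp_fst
  calc ∫⁻ z, (∫⁻ w, k z w * g w ∂μ) ^ p * S z ∂μ
      ≤ ∫⁻ z, C₁ ^ (p / q) * (∫⁻ w, k z w * B w * D z ∂μ) ∂μ := lintegral_mono_ae step1
    _ = C₁ ^ (p / q) * ∫⁻ z, (∫⁻ w, k z w * B w * D z ∂μ) ∂μ :=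
        lintegral_const_mul'' _ hm.lintegral_prod_right'
    _ = C₁ ^ (p / q) * ∫⁻ w, (∫⁻ z, k z w * B w * D z ∂μ) ∂μ := by
        rw [lintegral_lintegral_swap hm]
    _ ≤ C₁ ^ (p / q) * ∫⁻ w, C₂ * N w ∂μ := by
        gcongr 1
        refine lintegral_mono_ae ?_
        filter_upwards [h2, hN] with w h2w hNw
        calc ∫⁻ z, k z w * B w * D z ∂μ = ∫⁻ z, B w * (k z w * D z) ∂μ := by
              congr 1; ext z; ring
          _ = B w * ∫⁻ z, k z w * D z ∂μ := by
              have : Measurable fun z => k z w := hk.of_uncurry_right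
              rw [lintegral_const_mul'' (f := fun z => k z w * D z) _ (this.aemeasurable.mul hD)]
          _ ≤ B w * (C₂ * F w) := by gcongr
          _ = C₂ * (B w * F w) := by ring
          _ ≤ C₂ * N w := by gcongr
    _ ≤ _ := by
        rw [mul_assoc]
        gcongr 1
        rw [lintegral_const_mul' _ _ hC₂]

lemma measurable_kern : Measurable (Function.uncurry kern) := by
  have := measurable_ker0
  unfold kern Function.uncurry
  fun_prop

lemma schur_weighted {U : Set ℂ} (hU : IsOpen U) {σ x : ℂ → ℝ} (hσ : ContinuousOn σ U)
    (hσ0 : ∀ z ∈ U, 0 < σ z) (hx : ContinuousOn x U) (hx0 : ∀ z ∈ U, 0 < x z)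
    (hl : SchurLeft U σ x) (hr : SchurRight U σ x) {p : ℝ} (hp : 1 < p) :
    ∃ C : ℝ≥0∞, C < ⊤ ∧ ∀ g : ℂ → ℂ, AEStronglyMeasurable g (volume.restrict U) →
      ∫⁻ z in U, (∫⁻ w in U, ENNReal.ofReal (kern z w) * ENNReal.ofReal ‖g w‖) ^ p *
          ENNReal.ofReal (((σ z) ^ 2)⁻¹) ≤
        C * ∫⁻ w in U, ENNReal.ofReal ((‖g w‖ * σ w) ^ p * ((σ w) ^ 2)⁻¹) := by
  have hp0 : 0 < p := by linarith
  obtain ⟨q, hpq⟩ : ∃ q, p.HolderConjugate q := ⟨_, Real.HolderConjugate.conjExponent hp⟩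
  have hq1 : 1 < q := hpq.symm.lt
  have hq0 : 0 < q := by linarith
  obtain ⟨C₁, hC₁, h1⟩ := hl (1 / (2 * p)) (by positivity)
    (by rw [div_lt_one (by positivity)]; linarith)
  obtain ⟨C₂, hC₂, h2⟩ := hr (1 / (2 * q)) (by positivity)
    (by rw [div_lt_one (by positivity)]; linarith)
  refine ⟨C₁ ^ (p / q) * C₂, ENNReal.mul_lt_top
    (ENNReal.rpow_lt_top_of_nonneg (by positivity) hC₁.ne) hC₂, fun g hg => ?_⟩
  have hmU := hU.measurableSet
  have mσ : AEMeasurable σ (volume.restrict U) := hσ.aemeasurable hmU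
  have mx : AEMeasurable x (volume.restrict U) := hx.aemeasurable hmU
  have mg : AEMeasurable (fun w => ‖g w‖) (volume.restrict U) := hg.norm.aemeasurable
  have inU : ∀ {P : ℂ → Prop}, (∀ z ∈ U, P z) → ∀ᵐ z ∂(volume.restrict U), P z := fun h =>
    (ae_restrict_iff' hmU).2 (Eventually.of_forall h)
  refine schur_test hpq (k := fun z w => ENNReal.ofReal (kern z w))
    measurable_kern.ennreal_ofReal
    (A := fun w => ENNReal.ofReal ((σ w)⁻¹ * x w ^ (1 / (2 * p))))
    (B := fun w => ENNReal.ofReal ((σ w)⁻¹ * (‖g w‖ * σ w) ^ p * x w ^ (-(1 / (2 * q)))))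
    (D := fun z => ENNReal.ofReal (x z ^ (1 / (2 * q)) * ((σ z) ^ 2)⁻¹))
    (F := fun w => ENNReal.ofReal (x w ^ (1 / (2 * q)) * (σ w)⁻¹))
    (X := fun z => ENNReal.ofReal (x z ^ (1 / (2 * p))))
    (mσ.inv.mul (mx.pow_const _)).ennreal_ofReal
    ((mσ.inv.mul ((mg.mul mσ).pow_const _)).mul (mx.pow_const _)).ennreal_ofReal
    ((mx.pow_const _).mul (mσ.pow_const 2).inv).ennreal_ofReal hC₂.ne ?_ ?_ ?_ ?_ ?_
  · filter_upwards [ae_restrict_of_ae h1, inU fun z hz => hz] with z h1z hz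
    refine le_trans (le_of_eq ?_) (h1z hz)
    refine setLIntegral_congr_fun hmU fun w hw => ?_
    have := hσ0 w hw
    have := hx0 w hw
    exact (ENNReal.ofReal_mul' (by positivity)).symm
  · filter_upwards [ae_restrict_of_ae h2, inU fun z hz => hz] with z h1z hz
    refine le_trans (le_of_eq ?_) (h1z hz)
    refine setLIntegral_congr_fun hmU fun w hw => ?_
    have := hσ0 w hw
    have := hx0 w hw
    exact (ENNReal.ofReal_mul' (by positivity)).symm
  · refine inU fun w hw => ?_
    have hs := hσ0 w hw
    have hxw := hx0 w hw
    rw [ENNReal.ofReal_rpow_of_nonneg (by positivity) (by positivity),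
      ENNReal.ofReal_rpow_of_nonneg (by positivity) (by positivity),
      ← ENNReal.ofReal_mul (by positivity)]
    apply ENNReal.ofReal_le_ofReal (le_of_eq _)
    rw [Real.mul_rpow (by positivity) (by positivity), Real.mul_rpow (by positivity) (by positivity),
      Real.mul_rpow (by positivity) (by positivity), ← Real.rpow_mul hxw.le, ← Real.rpow_mul hxw.le,
      ← Real.rpow_mul (by positivity), mul_one_div_cancel hp0.ne', Real.rpow_one]
    have e1 : (σ w)⁻¹ ^ (1 / q) * (σ w)⁻¹ ^ (1 / p) = (σ w)⁻¹ := by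
      rw [← Real.rpow_add (by positivity)]
      have : 1 / q + 1 / p = 1 := by
        have := hpq.inv_add_inv_eq_one; rw [one_div, one_div]; linarith
      rw [this, Real.rpow_one]
    have e2 : x w ^ (1 / (2 * p) * (1 / q)) * x w ^ (-(1 / (2 * q)) * (1 / p)) = 1 := by
      rw [← Real.rpow_add hxw, show 1 / (2 * p) * (1 / q) + -(1 / (2 * q)) * (1 / p) = 0 by
        field_simp; ring, Real.rpow_zero]
    calc ‖g w‖ = (σ w)⁻¹ * (‖g w‖ * σ w) * 1 := by field_simp
      _ = ((σ w)⁻¹ ^ (1 / q) * (σ w)⁻¹ ^ (1 / p)) * (‖g w‖ * σ w) *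
          (x w ^ (1 / (2 * p) * (1 / q)) * x w ^ (-(1 / (2 * q)) * (1 / p))) := by rw [e1, e2]
      _ = _ := by ring
  · refine inU fun z hz => ?_
    have hs := hσ0 z hz
    have hxw := hx0 z hz
    rw [ENNReal.ofReal_rpow_of_nonneg (by positivity) (by positivity),
      ← ENNReal.ofReal_mul (by positivity), ← Real.rpow_mul hxw.le]
    rw [show 1 / (2 * p) * (p / q) = 1 / (2 * q) by field_simp]
  · refine inU fun w hw => ?_
    have hs := hσ0 w hw
    have hxw := hx0 w hw
    rw [← ENNReal.ofReal_mul (by positivity)]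
    apply ENNReal.ofReal_le_ofReal (le_of_eq _)
    rw [Real.rpow_neg hxw.le]
    have : x w ^ (1 / (2 * q)) ≠ 0 := (Real.rpow_pos_of_pos hxw _).ne'
    generalize (‖g w‖ * σ w) ^ p = G
    field_simp

/-- A planar model domain with a conformal scale `σ` comparable to the reciprocal of its hyperbolic
density and an exhaustion function `y` whose gradient is dominated by `σ⁻¹`. -/
structure IsModel (U : Set ℂ) (σ y : ℂ → ℝ) : Prop where
  isOpen : IsOpen U
  preconn : IsPreconnected U
  subset : U ⊆ ball (0 : ℂ) 1
  scale_cont : ContinuousOn σ U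
  scale_pos : ∀ z ∈ U, 0 < σ z
  scale_le : ∃ C : ℝ, 0 < C ∧ ∀ z ∈ U, σ z ≤ C * (1 - ‖z‖ ^ 2)
  smooth : ContDiffOn ℝ (⊤ : ℕ∞) y U
  grad_le : ∃ C : ℝ, 0 < C ∧ ∀ z ∈ U, ‖fderiv ℝ y z‖ * σ z ≤ C
  compact : ∀ n : ℝ, IsCompact {z | z ∈ U ∧ |y z| ≤ n}
  left : SchurLeft U σ (fun z => Real.exp (y z))
  right : SchurRight U σ (fun z => Real.exp (y z))

lemma contDiff_of_contDiffAt_tsupport {f : ℂ → ℝ} {n : WithTop ℕ∞}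
    (h : ∀ z ∈ tsupport f, ContDiffAt ℝ n f z) : ContDiff ℝ n f := by
  rw [contDiff_iff_contDiffAt]
  intro z
  by_cases hz : z ∈ tsupport f
  · exact h z hz
  · exact (contDiffAt_const (c := (0 : ℝ))).congr_of_eventuallyEq
      (notMem_tsupport_iff_eventuallyEq.1 hz)

lemma IsModel.exists_cutoff {U : Set ℂ} {σ y : ℂ → ℝ} (hM : IsModel U σ y) :
    ∃ C : ℝ, 0 < C ∧ ∀ n : ℕ, 0 < n → ∃ χ : ℂ → ℝ, ContDiff ℝ (⊤ : ℕ∞) χ ∧ HasCompactSupport χ ∧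
      tsupport χ ⊆ U ∧ (∀ z, 0 ≤ χ z) ∧ (∀ z, χ z ≤ 1) ∧ (∀ z ∈ U, |y z| ≤ n → χ z = 1) ∧
      ∀ z ∈ U, ‖fderiv ℝ χ z‖ * σ z ≤ C / n := by
  let Q : ContDiffBump (0 : ℝ) := ⟨1, 2, by norm_num, by norm_num⟩
  obtain ⟨C₀, hC₀⟩ : ∃ C₀ : ℝ, ∀ t, ‖fderiv ℝ Q t‖ ≤ C₀ := by
    have h1 : HasCompactSupport (fderiv ℝ Q) := Q.hasCompactSupport.fderiv ℝ
    have h2 : Continuous (fderiv ℝ Q) := (Q.contDiff (n := 1)).continuous_fderiv (by norm_num)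
    obtain ⟨C, hC⟩ := h1.exists_bound_of_continuous h2
    exact ⟨C, hC⟩
  obtain ⟨C₁, hC₁0, hC₁⟩ := hM.grad_le
  have hC₀0 : 0 ≤ C₀ := (norm_nonneg _).trans (hC₀ 0)
  refine ⟨(C₀ + 1) * C₁, by positivity, fun n hn => ?_⟩
  have hn' : (0 : ℝ) < n := by exact_mod_cast hn
  let χ : ℂ → ℝ := U.indicator fun z => Q (y z / n)
  have hsupp : tsupport χ ⊆ {z | z ∈ U ∧ |y z| ≤ 2 * n} := by
    refine closure_minimal ?_ (hM.compact _).isClosed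
    intro z hz
    have hzU : z ∈ U := by
      by_contra h; exact hz (indicator_of_notMem h _)
    refine ⟨hzU, ?_⟩
    have hz2 : Q (y z / n) ≠ 0 := by
      have := hz; simpa only [Function.mem_support, χ, indicator_of_mem hzU] using this
    have h3 : y z / n ∈ Function.support Q := hz2
    rw [Q.support_eq, mem_ball_zero_iff, Real.norm_eq_abs, abs_div, abs_of_pos hn',
      div_lt_iff₀ hn'] at h3
    exact h3.le
  have hloc : ∀ z ∈ U, χ =ᶠ[𝓝 z] fun z => Q (y z / n) := fun z hz => by
    filter_upwards [hM.isOpen.mem_nhds hz] with w hw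
    exact indicator_of_mem hw _
  have hsm : ContDiff ℝ (⊤ : ℕ∞) χ := by
    refine contDiff_of_contDiffAt_tsupport fun z hz => ?_
    have hzU := (hsupp hz).1
    refine ContDiffAt.congr_of_eventuallyEq ?_ (hloc z hzU)
    exact Q.contDiff.contDiffAt.comp z
      ((hM.smooth.contDiffAt (hM.isOpen.mem_nhds hzU)).div_const _)
  refine ⟨χ, hsm, (hM.compact _).of_isClosed_subset (isClosed_tsupport _) hsupp,
    fun z hz => (hsupp hz).1, fun z => indicator_nonneg (fun _ _ => Q.nonneg) _,
    fun z => ?_, fun z hz hyz => ?_, fun z hz => ?_⟩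
  · by_cases h : z ∈ U
    · simp only [χ, indicator_of_mem h]; exact Q.le_one
    · simp [χ, indicator_of_notMem h]
  · simp only [χ, indicator_of_mem hz]
    apply Q.one_of_mem_closedBall
    rw [mem_closedBall_zero_iff, Real.norm_eq_abs, abs_div, abs_of_pos hn', div_le_one hn']
    exact hyz
  · rw [(hloc z hz).fderiv_eq]
    have hy : DifferentiableAt ℝ y z :=
      (hM.smooth.contDiffAt (hM.isOpen.mem_nhds hz)).differentiableAt (by norm_num)
    have hd : HasFDerivAt (fun z => Q (y z / n)) ((fderiv ℝ Q (y z / n)).comp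
        ((n : ℝ)⁻¹ • fderiv ℝ y z)) z := by
      have h1 : HasFDerivAt (fun z => y z / n) ((n : ℝ)⁻¹ • fderiv ℝ y z) z := by
        simpa only [div_eq_inv_mul] using hy.hasFDerivAt.const_mul ((n : ℝ)⁻¹)
      have h2 : HasFDerivAt Q (fderiv ℝ Q (y z / n)) (y z / n) :=
        ((Q.contDiff (n := 1)).differentiable (by norm_num) _).hasFDerivAt
      exact HasFDerivAt.comp (g := (Q : ℝ → ℝ)) (f := fun z => y z / n) z h2 h1
    rw [hd.fderiv]
    have h3 := hM.scale_pos z hz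
    calc _ ≤ ‖fderiv ℝ Q (y z / n)‖ * ‖(n : ℝ)⁻¹ • fderiv ℝ y z‖ * σ z := by
          gcongr; exact ContinuousLinearMap.opNorm_comp_le _ _
      _ = ‖fderiv ℝ Q (y z / n)‖ * (‖fderiv ℝ y z‖ * σ z) / n := by
          rw [norm_smul, norm_inv, Real.norm_of_nonneg hn'.le]; ring
      _ ≤ (C₀ + 1) * C₁ / n := by
          have := hC₁ z hz
          gcongr
          exact (hC₀ _).trans (by linarith)

/-- The power type nonlinearity used in the Caccioppoli inequality. -/
lemma exists_power_nonlinearity {p : ℝ} (hp : 1 < p) : ∃ (Θ Θ' : ℝ → ℝ) (C : ℝ), 0 < C ∧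
    (∀ t, HasDerivAt Θ (Θ' t) t) ∧ Continuous Θ' ∧ (∀ t, 0 ≤ Θ' t) ∧ (∀ t, Θ' t = 0 → t = 0) ∧
    ∀ t, Θ t ^ 2 ≤ C * |t| ^ p * Θ' t := by
  obtain ⟨m, hm⟩ := exists_nat_ge p
  set N : ℕ := 2 * (m + 1) with hN
  have hN0 : (0 : ℝ) < N := by rw [hN]; positivity
  have hpN : p ≤ N := by rw [hN]; push_cast; linarith
  have hev : ∀ t : ℝ, 0 ≤ t ^ N := fun t => (even_two_mul (m + 1)).pow_nonneg t
  have hev2 : ∀ t : ℝ, 0 ≤ t ^ (2 * m) := fun t => (even_two_mul m).pow_nonneg t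
  have hpos : ∀ t : ℝ, 0 < 1 + t ^ N := fun t => by linarith [hev t]
  set e : ℝ := (p - N) / N with he
  let Θ : ℝ → ℝ := fun t => t ^ (2 * m + 1) * (1 + t ^ N) ^ e
  let Θ' : ℝ → ℝ := fun t => t ^ (2 * m) * (1 + t ^ N) ^ (e - 1) *
    ((N - 1 : ℝ) + (p - 1) * t ^ N)
  have hNe : (N : ℝ) = 2 * m + 2 := by rw [hN]; push_cast; ring
  have hm0 : (0 : ℝ) ≤ m := Nat.cast_nonneg m
  refine ⟨Θ, Θ', (p - 1)⁻¹, inv_pos.2 (by linarith), fun t => ?_, ?_, fun t => ?_,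
    fun t ht => ?_, fun t => ?_⟩
  · have h1 : HasDerivAt (fun t : ℝ => t ^ (2 * m + 1)) ((2 * m + 1 : ℕ) * t ^ (2 * m)) t := by
      simpa using hasDerivAt_pow (2 * m + 1) t
    have h2 : HasDerivAt (fun t : ℝ => 1 + t ^ N) ((N : ℝ) * t ^ (2 * m + 1)) t := by
      have := (hasDerivAt_pow N t).const_add 1
      rwa [show N - 1 = 2 * m + 1 by omega] at this
    have h3 := h1.mul (h2.rpow_const (p := e) (Or.inl (hpos t).ne'))
    refine h3.congr_deriv ?_
    simp only [Θ']
    have h4 : (1 + t ^ N) ^ e = (1 + t ^ N) ^ (e - 1) * (1 + t ^ N) := by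
      rw [Real.rpow_sub_one (hpos t).ne']; field_simp [(hpos t).ne']
    have h5 : (N : ℝ) * e = p - N := by rw [he]; field_simp
    have h6 : t ^ N = t ^ (2 * m) * t ^ 2 := by rw [hN, ← pow_add]; congr 1
    have h7 : (p : ℝ) = N * e + N := by linarith
    rw [h4]
    generalize (1 + t ^ N) ^ (e - 1) = q
    rw [h7, h6, hNe, pow_succ]; push_cast
    ring
  · simp only [Θ']
    refine Continuous.mul (Continuous.mul (by fun_prop) ?_) (by fun_prop)
    exact Continuous.rpow_const (by fun_prop) fun t => Or.inl (hpos t).ne'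
  · have h1 := hev t
    have h2 := hev2 t
    have h3 := (hpos t).le
    have h4 : 0 ≤ (N - 1 : ℝ) + (p - 1) * t ^ N := by
      have : 0 ≤ (p - 1) * t ^ N := mul_nonneg (by linarith) h1
      linarith
    simp only [Θ']; positivity
  · have h4 : 0 < (N - 1 : ℝ) + (p - 1) * t ^ N := by
      have : 0 ≤ (p - 1) * t ^ N := mul_nonneg (by linarith) (hev t)
      linarith
    have h5 : 0 < (1 + t ^ N) ^ (e - 1) := Real.rpow_pos_of_pos (hpos t) _
    have h6 : t ^ (2 * m) = 0 := by
      rcases mul_eq_zero.1 ht with h | h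
      · rcases mul_eq_zero.1 h with h | h
        · exact h
        · exact absurd h h5.ne'
      · exact absurd h h4.ne'
    exact eq_zero_of_pow_eq_zero h6
  · rcases eq_or_ne t 0 with rfl | ht
    · have h0 : (0 : ℝ) ^ p = 0 := Real.zero_rpow (by linarith)
      simp [Θ, h0]
    have hq0 : 0 < (1 + t ^ N) ^ e := Real.rpow_pos_of_pos (hpos t) _
    have habs : |t| ^ (N : ℝ) = t ^ N := by
      rw [Real.rpow_natCast, ← abs_pow, abs_of_nonneg (hev t)]
    have h1 : t ^ N * (1 + t ^ N) ^ e ≤ |t| ^ p := by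
      have h2 : (1 + t ^ N) ^ e ≤ (t ^ N) ^ e := by
        apply Real.rpow_le_rpow_of_nonpos
        · rw [← habs]; exact Real.rpow_pos_of_pos (abs_pos.2 ht) _
        · linarith
        · rw [he]; exact div_nonpos_of_nonpos_of_nonneg (by linarith) hN0.le
      calc t ^ N * (1 + t ^ N) ^ e ≤ t ^ N * (t ^ N) ^ e := mul_le_mul_of_nonneg_left h2 (hev t)
        _ = |t| ^ p := by
          rw [← habs, ← Real.rpow_mul (abs_nonneg t), ← Real.rpow_add (abs_pos.2 ht)]
          congr 1; rw [he]; field_simp; ring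
    have h3 : t ^ (2 * m) * (1 + t ^ N) ^ e ≤ (p - 1)⁻¹ * Θ' t := by
      have h4 : (1 + t ^ N) ^ e = (1 + t ^ N) ^ (e - 1) * (1 + t ^ N) := by
        rw [Real.rpow_sub_one (hpos t).ne']; field_simp [(hpos t).ne']
      have h5 : 0 < (1 + t ^ N) ^ (e - 1) := Real.rpow_pos_of_pos (hpos t) _
      simp only [Θ']
      rw [← div_eq_inv_mul, le_div_iff₀ (by linarith), h4]
      have h6 : (1 + t ^ N) * (p - 1) ≤ (N - 1 : ℝ) + (p - 1) * t ^ N := by linarith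
      calc t ^ (2 * m) * ((1 + t ^ N) ^ (e - 1) * (1 + t ^ N)) * (p - 1)
          = t ^ (2 * m) * (1 + t ^ N) ^ (e - 1) * ((1 + t ^ N) * (p - 1)) := by ring
        _ ≤ _ := mul_le_mul_of_nonneg_left h6 (mul_nonneg (hev2 t) h5.le)
    have h7 : Θ t ^ 2 = (t ^ N * (1 + t ^ N) ^ e) * (t ^ (2 * m) * (1 + t ^ N) ^ e) := by
      simp only [Θ]; rw [hN]; ring
    rw [h7]
    calc _ ≤ |t| ^ p * ((p - 1)⁻¹ * Θ' t) := by
          refine mul_le_mul h1 h3 (mul_nonneg (hev2 t) hq0.le) (by positivity)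
      _ = _ := by ring

lemma integral_fderiv_eq_zero {F : ℂ → ℝ} (hF : ContDiff ℝ 1 F) (hc : HasCompactSupport F)
    (v : ℂ) : ∫ z, fderiv ℝ F z v = 0 := by
  have h1 : Continuous fun z => fderiv ℝ F z v :=
    (hF.continuous_fderiv (by norm_num)).clm_apply continuous_const
  have h2 : Integrable fun z => fderiv ℝ F z v :=
    h1.integrable_of_hasCompactSupport (hc.fderiv_apply (𝕜 := ℝ) v)
  have h3 : Integrable F := hF.continuous.integrable_of_hasCompactSupport hc
  have := integral_mul_fderiv_eq_neg_fderiv_mul_of_integrable (𝕜 := ℝ) (f := fun _ : ℂ => (1 : ℝ))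
    (g := F) (v := v) (μ := volume) (by simp) (by simpa using h2) (by simpa using h3)
    (fun z _ => by fun_prop) (fun z _ => hF.differentiable (by norm_num) z)
  simpa using this

lemma continuous_of_continuousAt_tsupport {f χ : ℂ → ℝ} (hs : tsupport f ⊆ tsupport χ)
    (h : ∀ z ∈ tsupport χ, ContinuousAt f z) : Continuous f := by
  rw [continuous_iff_continuousAt]
  intro z
  by_cases hz : z ∈ tsupport f
  · exact h z (hs hz)
  · exact (continuousAt_const (y := (0 : ℝ))).congr
      (notMem_tsupport_iff_eventuallyEq.1 hz).symm

/-- Real valued harmonic functions. -/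
def IsHarmonicRe (κ : ℂ → ℝ) (U : Set ℂ) : Prop :=
  ContDiffOn ℝ 2 κ U ∧ ∀ z ∈ U, fderiv ℝ (fun w => fderiv ℝ κ w 1) z 1 +
    fderiv ℝ (fun w => fderiv ℝ κ w Complex.I) z Complex.I = 0

lemma IsHarmonicOn.comp_clm {f : ℂ → ℂ} {U : Set ℂ} (hU : IsOpen U) (hf : IsHarmonicOn f U)
    (L : ℂ →L[ℝ] ℝ) : IsHarmonicRe (fun z => L (f z)) U := by
  refine ⟨L.contDiff.comp_contDiffOn hf.1, fun z hz => ?_⟩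
  have h1 : ∀ v : ℂ, (fun w => fderiv ℝ (fun z => L (f z)) w v) =ᶠ[𝓝 z]
      fun w => L (fderiv ℝ f w v) := fun v => by
    filter_upwards [hU.mem_nhds hz] with w hw
    have hd : DifferentiableAt ℝ f w :=
      (hf.1.contDiffAt (hU.mem_nhds hw)).differentiableAt (by norm_num)
    have := (L.hasFDerivAt.comp w hd.hasFDerivAt).fderiv
    simp only [Function.comp_def] at this
    rw [this]; rfl
  have h2 : ∀ v : ℂ, fderiv ℝ (fun w => L (fderiv ℝ f w v)) z v =
      L (fderiv ℝ (fun w => fderiv ℝ f w v) z v) := fun v => by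
    have hd : DifferentiableAt ℝ (fun w => fderiv ℝ f w v) z :=
      (((hf.1.contDiffAt (hU.mem_nhds hz)).fderiv_right (m := 1) (by norm_num)).clm_apply
        contDiffAt_const).differentiableAt (by norm_num)
    have := (L.hasFDerivAt.comp z hd.hasFDerivAt).fderiv
    simp only [Function.comp_def] at this
    rw [this]; rfl
  rw [(h1 1).fderiv_eq, (h1 I).fderiv_eq, h2, h2, ← map_add, hf.2 z hz, map_zero]

lemma caccioppoli {p : ℝ} (hp : 1 < p) : ∃ (Θ' : ℝ → ℝ) (C : ℝ), 0 < C ∧ (∀ t, 0 ≤ Θ' t) ∧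
    (∀ t, Θ' t = 0 → t = 0) ∧ ∀ (U : Set ℂ) (κ χ : ℂ → ℝ), IsOpen U → IsHarmonicRe κ U →
      ContDiff ℝ (⊤ : ℕ∞) χ → HasCompactSupport χ → tsupport χ ⊆ U →
      Continuous (fun z => χ z ^ 2 * Θ' (κ z) * (fderiv ℝ κ z 1 ^ 2 + fderiv ℝ κ z I ^ 2)) ∧
      Integrable (fun z => |κ z| ^ p * (fderiv ℝ χ z 1 ^ 2 + fderiv ℝ χ z I ^ 2)) ∧
      ∫ z, χ z ^ 2 * Θ' (κ z) * (fderiv ℝ κ z 1 ^ 2 + fderiv ℝ κ z I ^ 2) ≤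
        C * ∫ z, |κ z| ^ p * (fderiv ℝ χ z 1 ^ 2 + fderiv ℝ χ z I ^ 2) := by
  obtain ⟨Θ, Θ', C, hC, hΘ, hΘc, hΘ0, hΘz, hΘC⟩ := exists_power_nonlinearity hp
  refine ⟨Θ', 4 * C, by positivity, hΘ0, hΘz, fun U κ χ hU hκ hχ hχc hχU => ?_⟩
  have hΘ1 : ContDiff ℝ 1 Θ := by
    rw [contDiff_one_iff_deriv]
    refine ⟨fun t => (hΘ t).differentiableAt, ?_⟩
    rwa [show deriv Θ = Θ' from funext fun t => (hΘ t).deriv]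
  have hκd : ∀ z ∈ tsupport χ, ContDiffAt ℝ 2 κ z := fun z hz =>
    hκ.1.contDiffAt (hU.mem_nhds (hχU hz))
  have hκv : ∀ (v : ℂ), ∀ z ∈ tsupport χ, ContDiffAt ℝ 1 (fun w => fderiv ℝ κ w v) z :=
    fun v z hz => ((hκd z hz).fderiv_right (m := 1) (by norm_num)).clm_apply contDiffAt_const
  have hχ1 : ContDiff ℝ 1 χ := hχ.of_le (by simp)
  have hχv : ∀ v : ℂ, Continuous fun z => fderiv ℝ χ z v := fun v =>
    (hχ1.continuous_fderiv (by norm_num)).clm_apply continuous_const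
  have hsupp : ∀ f : ℂ → ℝ, (∀ z, χ z = 0 → f z = 0) → tsupport f ⊆ tsupport χ := fun f hf =>
    closure_mono fun z hz h => hz (hf z h)
  let F : ℂ → ℂ → ℝ := fun v z => χ z ^ 2 * Θ (κ z) * fderiv ℝ κ z v
  have hFs : ∀ v, tsupport (F v) ⊆ tsupport χ := fun v => hsupp _ fun z hz => by simp [F, hz]
  have hFc : ∀ v, HasCompactSupport (F v) := fun v =>
    IsCompact.of_isClosed_subset hχc (isClosed_tsupport _) (hFs v)
  have hF : ∀ v, ContDiff ℝ 1 (F v) := fun v => contDiff_of_contDiffAt_tsupport fun z hz =>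
    ((hχ1.contDiffAt.pow 2).mul (hΘ1.contDiffAt.comp z ((hκd z (hFs v hz)).of_le
      (by norm_num)))).mul (hκv v z (hFs v hz))
  have hFI : ∀ v, Integrable fun z => fderiv ℝ (F v) z v := fun v =>
    (((hF v).continuous_fderiv (by norm_num)).clm_apply
      continuous_const).integrable_of_hasCompactSupport ((hFc v).fderiv_apply (𝕜 := ℝ) v)
  set X : ℂ → ℝ := fun z => χ z ^ 2 * Θ' (κ z) * (fderiv ℝ κ z 1 ^ 2 + fderiv ℝ κ z I ^ 2) with hX
  set R : ℂ → ℝ := fun z => |κ z| ^ p * (fderiv ℝ χ z 1 ^ 2 + fderiv ℝ χ z I ^ 2) with hR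
  have hXs : tsupport X ⊆ tsupport χ := hsupp _ fun z hz => by simp [X, hz]
  have hXc : Continuous X := continuous_of_continuousAt_tsupport hXs fun z hz =>
    ((hχ.continuous.continuousAt.pow 2).mul (hΘc.continuousAt.comp (hκd z hz).continuousAt)).mul
      (((hκv 1 z hz).continuousAt.pow 2).add ((hκv I z hz).continuousAt.pow 2))
  have hXI : Integrable X := hXc.integrable_of_hasCompactSupport
    (IsCompact.of_isClosed_subset hχc (isClosed_tsupport _) hXs)
  have hχoff : ∀ z ∉ tsupport χ, ∀ v, fderiv ℝ χ z v = 0 := fun z hz v => by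
    rw [fderiv_of_notMem_tsupport ℝ hz]; rfl
  have hRs : tsupport R ⊆ tsupport χ := closure_minimal (fun z hz => by
    by_contra h; exact hz (by simp [R, hχoff z h])) (isClosed_tsupport _)
  have hRc : Continuous R := continuous_of_continuousAt_tsupport hRs fun z hz =>
    ((hκd z hz).continuousAt.abs.rpow_const (Or.inr (by linarith))).mul
      (((hχv 1).continuousAt.pow 2).add ((hχv I).continuousAt.pow 2))
  have hRI : Integrable R := hRc.integrable_of_hasCompactSupport
    (IsCompact.of_isClosed_subset hχc (isClosed_tsupport _) hRs)
  refine ⟨hXc, hRI, ?_⟩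
  have hFd : ∀ v, ∀ z ∈ tsupport χ, fderiv ℝ (F v) z v =
      χ z ^ 2 * Θ (κ z) * fderiv ℝ (fun w => fderiv ℝ κ w v) z v +
        χ z ^ 2 * Θ' (κ z) * fderiv ℝ κ z v ^ 2 +
        2 * χ z * Θ (κ z) * fderiv ℝ χ z v * fderiv ℝ κ z v := fun v z hz => by
    have h1 : HasFDerivAt χ (fderiv ℝ χ z) z :=
      (hχ1.differentiable (by norm_num) z).hasFDerivAt
    have h2 : HasFDerivAt κ (fderiv ℝ κ z) z :=
      ((hκd z hz).differentiableAt (by norm_num)).hasFDerivAt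
    have h3 : HasFDerivAt (fun w => fderiv ℝ κ w v) (fderiv ℝ (fun w => fderiv ℝ κ w v) z) z :=
      ((hκv v z hz).differentiableAt (by norm_num)).hasFDerivAt
    have h4 : HasFDerivAt (fun w => Θ (κ w)) (Θ' (κ z) • fderiv ℝ κ z) z :=
      (hΘ (κ z)).comp_hasFDerivAt z h2
    have h5 := ((h1.pow 2).mul h4).mul h3
    have h6 : fderiv ℝ (F v) z = _ := h5.fderiv
    rw [h6]
    simp
    ring
  have hpt : ∀ z, X z / 2 - 2 * C * R z ≤ fderiv ℝ (F 1) z 1 + fderiv ℝ (F I) z I := fun z => by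
    by_cases hz : z ∈ tsupport χ
    · rw [hFd 1 z hz, hFd I z hz]
      have hh := hκ.2 z (hχU hz)
      have key : ∀ a b : ℝ, -(χ z ^ 2 * Θ' (κ z) * b ^ 2 / 2 + 2 * (C * |κ z| ^ p * a ^ 2)) ≤
          2 * χ z * Θ (κ z) * a * b := fun a b => by
        have h1 := hΘ0 (κ z)
        have hP : 0 ≤ |κ z| ^ p := by positivity
        have h2 := hΘC (κ z)
        refine (abs_le.1 (abs_le_of_sq_le_sq ?_ (by positivity))).1
        have h3 : χ z ^ 2 * a ^ 2 * b ^ 2 * Θ (κ z) ^ 2 ≤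
            χ z ^ 2 * a ^ 2 * b ^ 2 * (C * |κ z| ^ p * Θ' (κ z)) :=
          mul_le_mul_of_nonneg_left h2 (by positivity)
        nlinarith [sq_nonneg (χ z ^ 2 * Θ' (κ z) * b ^ 2 / 2 - 2 * (C * |κ z| ^ p * a ^ 2))]
      have k1 := key (fderiv ℝ χ z 1) (fderiv ℝ κ z 1)
      have k2 := key (fderiv ℝ χ z I) (fderiv ℝ κ z I)
      have h7 : χ z ^ 2 * Θ (κ z) * fderiv ℝ (fun w => fderiv ℝ κ w 1) z 1 +
          χ z ^ 2 * Θ (κ z) * fderiv ℝ (fun w => fderiv ℝ κ w I) z I = 0 := by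
        rw [← mul_add, hh, mul_zero]
      have h8 : 0 ≤ X z := by
        have := hΘ0 (κ z)
        simp only [hX]; positivity
      simp only [hX, hR] at h8 ⊢
      nlinarith
    · have h1 : X z = 0 := image_eq_zero_of_notMem_tsupport fun h => hz (hXs h)
      have h2 : R z = 0 := image_eq_zero_of_notMem_tsupport fun h => hz (hRs h)
      rw [h1, h2, fderiv_of_notMem_tsupport ℝ fun h => hz (hFs 1 h),
        fderiv_of_notMem_tsupport ℝ fun h => hz (hFs I h)]
      simp
  have hint := integral_mono ((hXI.div_const 2).sub (hRI.const_mul (2 * C)))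
    ((hFI 1).add (hFI I)) hpt
  simp only [Pi.add_apply, Pi.sub_apply] at hint
  rw [integral_sub (hXI.div_const 2) (hRI.const_mul (2 * C)), integral_add (hFI 1) (hFI I),
    integral_fderiv_eq_zero (hF 1) (hFc 1), integral_fderiv_eq_zero (hF I) (hFc I),
    integral_div, integral_const_mul] at hint
  linarith

lemma clm_eq_zero_of_apply {L : ℂ →L[ℝ] ℝ} (h1 : L 1 = 0) (hI : L I = 0) : L = 0 := by
  ext v
  have : v = v.re • (1 : ℂ) + v.im • I := by
    apply Complex.ext <;> simp
  rw [this, map_add, map_smul, map_smul, h1, hI]; simp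

lemma IsModel.liouville_real {U : Set ℂ} {σ y : ℂ → ℝ} (hM : IsModel U σ y) {p : ℝ} (hp : 1 < p)
    {κ : ℂ → ℝ} (hκ : IsHarmonicRe κ U)
    (hfin : ∫⁻ z in U, ENNReal.ofReal (|κ z| ^ p * (σ z ^ 2)⁻¹) < ⊤) :
    ∃ c, ∀ z ∈ U, κ z = c := by
  obtain ⟨Θ', C, hC, hΘ0, hΘz, hcac⟩ := caccioppoli hp
  obtain ⟨C₁, hC₁, hcut⟩ := hM.exists_cutoff
  have hκc : ContinuousOn κ U := hκ.1.continuousOn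
  have hWc : ContinuousOn (fun z => |κ z| ^ p * (σ z ^ 2)⁻¹) U :=
    (hκc.abs.rpow_const fun _ _ => Or.inr (by linarith)).mul
      ((hM.scale_cont.pow 2).inv₀ fun z hz => (pow_pos (hM.scale_pos z hz) 2).ne')
  have hWI : IntegrableOn (fun z => |κ z| ^ p * (σ z ^ 2)⁻¹) U := by
    refine ⟨hWc.aestronglyMeasurable hM.isOpen.measurableSet, ?_⟩
    rw [hasFiniteIntegral_iff_ofReal]
    · exact hfin
    · exact Eventually.of_forall fun z => by positivity
  set W : ℝ := ∫ z in U, |κ z| ^ p * (σ z ^ 2)⁻¹ with hW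
  choose! χ hχ hχc hχU hχ0 hχ1 hχn hχg using hcut
  let Y : ℂ → ℝ := fun z => Θ' (κ z) * (fderiv ℝ κ z 1 ^ 2 + fderiv ℝ κ z I ^ 2)
  have hY0 : ∀ z, 0 ≤ Y z := fun z => mul_nonneg (hΘ0 _) (by positivity)
  have hXeq : ∀ n z, χ n z ^ 2 * Θ' (κ z) * (fderiv ℝ κ z 1 ^ 2 + fderiv ℝ κ z I ^ 2) =
      χ n z ^ 2 * Y z := fun n z => by simp only [Y]; ring
  have hXc : ∀ n, 0 < n → Continuous fun z => χ n z ^ 2 * Y z := fun n hn => by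
    simpa only [hXeq] using (hcac U κ (χ n) hM.isOpen hκ (hχ n hn) (hχc n hn) (hχU n hn)).1
  have hXcs : ∀ n, 0 < n → HasCompactSupport fun z => χ n z ^ 2 * Y z := fun n hn => by
    refine (hχc n hn).mono fun z hz h => hz (by simp [h])
  have hbound : ∀ n : ℕ, 0 < n → ∫ z, χ n z ^ 2 * Y z ≤ C * (2 * C₁ ^ 2 * W) / n ^ 2 :=
    fun n hn => by
    obtain ⟨-, h2, h3⟩ := hcac U κ (χ n) hM.isOpen hκ (hχ n hn) (hχc n hn) (hχU n hn)
    simp only [hXeq] at h3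
    refine h3.trans ?_
    rw [mul_div_assoc]
    refine mul_le_mul_of_nonneg_left ?_ hC.le
    have hn' : (0 : ℝ) < n := by exact_mod_cast hn
    have h4 : ∫ z, |κ z| ^ p * (fderiv ℝ (χ n) z 1 ^ 2 + fderiv ℝ (χ n) z I ^ 2) =
        ∫ z in U, |κ z| ^ p * (fderiv ℝ (χ n) z 1 ^ 2 + fderiv ℝ (χ n) z I ^ 2) := by
      symm
      refine setIntegral_eq_integral_of_forall_compl_eq_zero fun z hz => ?_
      rw [fderiv_of_notMem_tsupport ℝ fun h => hz (hχU n hn h)]; simp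
    rw [h4]
    calc _ ≤ ∫ z in U, 2 * C₁ ^ 2 / n ^ 2 * (|κ z| ^ p * (σ z ^ 2)⁻¹) := by
          refine setIntegral_mono_on h2.integrableOn (hWI.const_mul _) hM.isOpen.measurableSet
            fun z hz => ?_
          have hs := hM.scale_pos z hz
          have hg : ‖fderiv ℝ (χ n) z‖ ≤ C₁ / n / σ z := by
            rw [le_div_iff₀ hs]; exact hχg n hn z hz
          have hv : ∀ v : ℂ, ‖v‖ = 1 → fderiv ℝ (χ n) z v ^ 2 ≤ (C₁ / n / σ z) ^ 2 :=
            fun v hv => by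
            have := (fderiv ℝ (χ n) z).le_opNorm v
            rw [hv, mul_one, Real.norm_eq_abs] at this
            exact sq_le_sq.2 ((this.trans hg).trans (le_abs_self _))
          have h1 := hv 1 (by simp)
          have hI := hv I (by simp)
          calc _ ≤ |κ z| ^ p * ((C₁ / n / σ z) ^ 2 + (C₁ / n / σ z) ^ 2) := by gcongr
            _ = _ := by field_simp; ring
      _ = _ := by rw [integral_const_mul]; ring
  have hY : ∀ z ∈ U, Y z = 0 := fun z hz => by
    obtain ⟨n₀, hn₀⟩ := exists_nat_ge (|y z| + 1)
    have hn₀0 : 0 < n₀ := by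
      have : (0 : ℝ) < n₀ := by linarith [abs_nonneg (y z)]
      exact_mod_cast this
    have h1 : χ n₀ z = 1 := hχn n₀ hn₀0 z hz (by linarith)
    obtain ⟨B, hB⟩ := (hχc n₀ hn₀0).isCompact.exists_bound_of_continuousOn
      (hM.smooth.continuousOn.mono (hχU n₀ hn₀0))
    obtain ⟨n₁, hn₁⟩ := exists_nat_ge B
    have hle : ∀ n : ℕ, n₁ + 1 ≤ n → ∫ z, χ n₀ z ^ 2 * Y z ≤ C * (2 * C₁ ^ 2 * W) / n ^ 2 :=
      fun n hn => by
      have hn0 : 0 < n := by omega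
      refine le_trans ?_ (hbound n hn0)
      refine integral_mono ((hXc n₀ hn₀0).integrable_of_hasCompactSupport (hXcs n₀ hn₀0))
        ((hXc n hn0).integrable_of_hasCompactSupport (hXcs n hn0)) fun w => ?_
      by_cases hw : w ∈ tsupport (χ n₀)
      · have h2 : χ n w = 1 := by
          refine hχn n hn0 w (hχU n₀ hn₀0 hw) ?_
          have h3 := hB w hw
          rw [Real.norm_eq_abs] at h3
          have h4 : ((n₁ + 1 : ℕ) : ℝ) ≤ n := by exact_mod_cast hn
          push_cast at h4
          linarith
        have h5 : χ n₀ w ^ 2 ≤ 1 := by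
          have h6 := hχ0 n₀ hn₀0 w
          have h7 := hχ1 n₀ hn₀0 w
          nlinarith
        simp only [h2, one_pow]
        exact mul_le_mul_of_nonneg_right h5 (hY0 w)
      · have : χ n₀ w = 0 := image_eq_zero_of_notMem_tsupport hw
        have h6 := hY0 w
        simp only [this]
        have : 0 ≤ χ n w ^ 2 * Y w := by positivity
        simpa using this
    have hlim : Tendsto (fun n : ℕ => C * (2 * C₁ ^ 2 * W) / (n : ℝ) ^ 2) atTop (𝓝 0) :=
      tendsto_const_nhds.div_atTop
        ((tendsto_pow_atTop two_ne_zero).comp tendsto_natCast_atTop_atTop)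
    have hzero : ∫ z, χ n₀ z ^ 2 * Y z ≤ 0 :=
      ge_of_tendsto hlim (eventually_atTop.2 ⟨n₁ + 1, hle⟩)
    by_contra hne
    have := (hXc n₀ hn₀0).integral_pos_of_hasCompactSupport_nonneg_nonzero (μ := volume)
      (hXcs n₀ hn₀0)
      (fun w => mul_nonneg (sq_nonneg _) (hY0 w)) (x := z) (by simpa [h1] using hne)
    linarith
  have hd : ∀ z ∈ U, DifferentiableAt ℝ κ z := fun z hz =>
    (hκ.1.contDiffAt (hM.isOpen.mem_nhds hz)).differentiableAt (by norm_num)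
  obtain ⟨c, hc⟩ := hM.isOpen.exists_is_const_of_fderiv_eq_zero (𝕜 := ℝ) hM.preconn
    (f := fun z => κ z ^ 2) (fun z hz => ((hd z hz).pow 2).differentiableWithinAt) (fun z hz => by
      have h1 : fderiv ℝ (fun z => κ z ^ 2) z = _ := ((hd z hz).hasFDerivAt.pow 2).fderiv
      rw [h1]
      rcases mul_eq_zero.1 (hY z hz) with h | h
      · simp [hΘz _ h]
      · have h2 : fderiv ℝ κ z = 0 := clm_eq_zero_of_apply
          (by nlinarith [sq_nonneg (fderiv ℝ κ z 1), sq_nonneg (fderiv ℝ κ z I)])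
          (by nlinarith [sq_nonneg (fderiv ℝ κ z 1), sq_nonneg (fderiv ℝ κ z I)])
        simp [h2])
  rcases eq_or_ne c 0 with rfl | hc0
  · exact ⟨0, fun z hz => pow_eq_zero_iff two_ne_zero |>.1 (hc z hz)⟩
  · have hκ0 : ∀ z ∈ U, κ z ≠ 0 := fun z hz h => hc0 (by rw [← hc z hz, h]; simp)
    rcases U.eq_empty_or_nonempty with hU | ⟨z₀, hz₀⟩
    · exact ⟨0, by simp [hU]⟩
    refine ⟨κ z₀, fun z hz => ?_⟩
    rcases hM.preconn.eq_or_eq_neg_of_sq_eq hκc (continuousOn_const (c := κ z₀))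
      (fun w hw => by
        have := hc w hw; have h2 := hc z₀ hz₀; simp only [Pi.pow_apply] at *; rw [this, h2])
      (fun {w} hw => hκ0 z₀ hz₀) with h | h
    · exact h hz
    · have := h hz₀
      simp only [Pi.neg_apply] at this
      exact absurd (by linarith) (hκ0 z₀ hz₀)

lemma IsModel.liouville {U : Set ℂ} {σ y : ℂ → ℝ} (hM : IsModel U σ y) {p : ℝ} (hp : 1 < p)
    {k : ℂ → ℂ} (hk : IsHarmonicOn k U)
    (hfin : ∫⁻ z in U, ENNReal.ofReal (‖k z‖ ^ p * (σ z ^ 2)⁻¹) < ⊤) :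
    ∃ c, ∀ z ∈ U, k z = c := by
  have key : ∀ L : ℂ →L[ℝ] ℝ, (∀ z, |L z| ≤ ‖z‖) → ∃ c, ∀ z ∈ U, L (k z) = c := fun L hL => by
    refine hM.liouville_real hp (hk.comp_clm hM.isOpen L) (lt_of_le_of_lt ?_ hfin)
    refine lintegral_mono fun z => ENNReal.ofReal_le_ofReal ?_
    exact mul_le_mul_of_nonneg_right (Real.rpow_le_rpow (abs_nonneg _) (hL _) (by linarith))
      (by positivity)
  obtain ⟨a, ha⟩ := key reCLM fun z => abs_re_le_norm z
  obtain ⟨b, hb⟩ := key imCLM fun z => abs_im_le_norm z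
  exact ⟨⟨a, b⟩, fun z hz => Complex.ext (ha z hz) (hb z hz)⟩

/-- Derivative of `A + conj B` for holomorphic `A`, `B`. -/
lemma hasFDerivAt_add_conj {A B : ℂ → ℂ} {a b z : ℂ} (hA : HasDerivAt A a z)
    (hB : HasDerivAt B b z) :
    HasFDerivAt (fun w => A w + conj (B w))
      ((a • (1 : ℂ →L[ℂ] ℂ)).restrictScalars ℝ +
        (conjCLE : ℂ →L[ℝ] ℂ).comp ((b • (1 : ℂ →L[ℂ] ℂ)).restrictScalars ℝ)) z := by
  have h1 : HasFDerivAt A ((a • (1 : ℂ →L[ℂ] ℂ)).restrictScalars ℝ) z := by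
    have := hA.hasFDerivAt.restrictScalars ℝ
    refine this.congr_fderiv ?_
    ext v; simp [mul_comm]
  have h2 : HasFDerivAt B ((b • (1 : ℂ →L[ℂ] ℂ)).restrictScalars ℝ) z := by
    have := hB.hasFDerivAt.restrictScalars ℝ
    refine this.congr_fderiv ?_
    ext v; simp [mul_comm]
  exact h1.add ((conjCLE : ℂ →L[ℝ] ℂ).hasFDerivAt.comp z h2)

lemma fderiv_add_conj {A B : ℂ → ℂ} {a b z : ℂ} (hA : HasDerivAt A a z)
    (hB : HasDerivAt B b z) (v : ℂ) :
    fderiv ℝ (fun w => A w + conj (B w)) z v = a * v + conj (b * v) := by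
  rw [(hasFDerivAt_add_conj hA hB).fderiv]; simp

lemma dbar_add_conj {A B : ℂ → ℂ} {a b z : ℂ} (hA : HasDerivAt A a z) (hB : HasDerivAt B b z) :
    dbar (fun w => A w + conj (B w)) z = conj b := by
  simp only [dbar, wirtingerDBar, fderiv_add_conj hA hB]
  simp only [map_mul, conj_I, mul_one]
  linear_combination (a / 2 - conj b / 2) * I_sq

lemma isHarmonicOn_add_conj {A B : ℂ → ℂ} {U : Set ℂ} (hU : IsOpen U)
    (hA : DifferentiableOn ℂ A U) (hB : DifferentiableOn ℂ B U) :
    IsHarmonicOn (fun w => A w + conj (B w)) U := by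
  have hcd : ∀ {F : ℂ → ℂ}, DifferentiableOn ℂ F U → ContDiffOn ℝ 2 F U := fun h =>
    (h.contDiffOn hU).restrict_scalars ℝ
  refine ⟨(hcd hA).add ((conjCLE : ℂ →L[ℝ] ℂ).contDiff.comp_contDiffOn (hcd hB)),
    fun z hz => ?_⟩
  have hd : ∀ {F : ℂ → ℂ}, DifferentiableOn ℂ F U → ∀ w ∈ U, HasDerivAt F (deriv F w) w :=
    fun h w hw => (h.differentiableAt (hU.mem_nhds hw)).hasDerivAt
  have h1 : ∀ v : ℂ, (fun w => fderiv ℝ (fun w => A w + conj (B w)) w v) =ᶠ[𝓝 z]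
      fun w => deriv A w * v + conj (deriv B w * v) := fun v => by
    filter_upwards [hU.mem_nhds hz] with w hw
    exact fderiv_add_conj (hd hA w hw) (hd hB w hw) v
  have h2 : ∀ v : ℂ, fderiv ℝ (fun w => deriv A w * v + conj (deriv B w * v)) z v =
      deriv (deriv A) z * v * v + conj (deriv (deriv B) z * v * v) := fun v => by
    exact fderiv_add_conj ((hd (hA.deriv hU) z hz).mul_const v)
      ((hd (hB.deriv hU) z hz).mul_const v) v
  rw [(h1 1).fderiv_eq, (h1 I).fderiv_eq, h2, h2]
  simp only [map_mul, conj_I, mul_one]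
  linear_combination (deriv (deriv A) z + conj (deriv (deriv B) z)) * I_sq

lemma norm_wirtingerDBar_le (L : ℂ →L[ℝ] ℂ) : ‖wirtingerDBar L‖ ≤ gradNormL L := by
  have h1 : ‖wirtingerDBar L‖ ≤ (‖L 1‖ + ‖L I‖) / 2 := by
    rw [wirtingerDBar, norm_div]
    simp only [RCLike.norm_ofNat]
    gcongr
    refine (norm_add_le _ _).trans ?_
    simp
  refine h1.trans (Real.le_sqrt_of_sq_le ?_)
  nlinarith [sq_nonneg (‖L 1‖ - ‖L I‖), sq_nonneg ‖L 1‖, sq_nonneg ‖L I‖]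

lemma gradNormL_le (L : ℂ →L[ℝ] ℂ) : gradNormL L ≤ 2 * (‖wirtingerD L‖ + ‖wirtingerDBar L‖) := by
  have h : ∀ v : ℂ, ‖v‖ = 1 → ‖L v‖ ≤ ‖wirtingerD L‖ + ‖wirtingerDBar L‖ := fun v hv => by
    rw [wirtinger_apply L v]
    refine (norm_add_le _ _).trans ?_
    rw [norm_mul, norm_mul, RCLike.norm_conj, hv, mul_one, mul_one]
  have h1 := h 1 (by simp)
  have hI := h I (by simp)
  apply Real.sqrt_le_iff.2
  have := norm_nonneg (L 1)
  have := norm_nonneg (L I)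
  constructor
  · positivity
  · nlinarith

lemma gradNorm_eq (f : ℂ → ℂ) (z : ℂ) : gradNorm f z = gradNormL (fderiv ℝ f z) := rfl

lemma gradNormL_nonneg (L : ℂ →L[ℝ] ℂ) : 0 ≤ gradNormL L := Real.sqrt_nonneg _

lemma norm_apply_le_gradNormL (L : ℂ →L[ℝ] ℂ) : ‖L 1‖ ≤ gradNormL L ∧ ‖L I‖ ≤ gradNormL L :=
  ⟨Real.le_sqrt_of_sq_le (by nlinarith [sq_nonneg ‖L I‖]),
    Real.le_sqrt_of_sq_le (by nlinarith [sq_nonneg ‖L 1‖])⟩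

lemma norm_le_gradNormL (L : ℂ →L[ℝ] ℂ) : ‖L‖ ≤ 2 * gradNormL L := by
  refine L.opNorm_le_bound (by linarith [gradNormL_nonneg L]) fun v => ?_
  have hv : v = v.re • (1 : ℂ) + v.im • I := by
    apply Complex.ext <;> simp
  obtain ⟨h1, h2⟩ := norm_apply_le_gradNormL L
  calc ‖L v‖ = ‖v.re • L 1 + v.im • L I‖ := by
        conv_lhs => rw [hv]
        rw [map_add, map_smul, map_smul]
    _ ≤ |v.re| * ‖L 1‖ + |v.im| * ‖L I‖ := by
        refine (norm_add_le _ _).trans ?_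
        rw [norm_smul, norm_smul, Real.norm_eq_abs, Real.norm_eq_abs]
    _ ≤ ‖v‖ * gradNormL L + ‖v‖ * gradNormL L := by
        gcongr
        · exact abs_re_le_norm v
        · exact abs_im_le_norm v
    _ = _ := by ring

lemma gradNormL_le_norm (L : ℂ →L[ℝ] ℂ) : gradNormL L ≤ 2 * ‖L‖ := by
  have h1 : ‖L 1‖ ≤ ‖L‖ := by simpa using L.le_opNorm 1
  have h2 : ‖L I‖ ≤ ‖L‖ := by simpa using L.le_opNorm I
  apply Real.sqrt_le_iff.2
  have := norm_nonneg (L 1)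
  have := norm_nonneg (L I)
  exact ⟨by positivity, by nlinarith⟩

lemma pseudo_dist_le {z w : ℂ} (hz : ‖z‖ < 1) (hw : ‖w‖ < 1) :
    ‖z - w‖ ≤ ‖1 - conj z * w‖ ∧ 1 - ‖z‖ ≤ ‖1 - conj z * w‖ := by
  constructor
  · refine (sq_le_sq₀ (norm_nonneg _) (norm_nonneg _)).1 ?_
    have h1 : ‖1 - conj z * w‖ ^ 2 - ‖z - w‖ ^ 2 = (1 - ‖z‖ ^ 2) * (1 - ‖w‖ ^ 2) := by
      simp only [← normSq_eq_norm_sq, normSq_apply]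
      simp; ring
    have : 0 ≤ (1 - ‖z‖ ^ 2) * (1 - ‖w‖ ^ 2) :=
      mul_nonneg (by nlinarith [norm_nonneg z]) (by nlinarith [norm_nonneg w])
    linarith
  · have h1 : 1 - ‖conj z * w‖ ≤ ‖1 - conj z * w‖ := by
      simpa using norm_sub_norm_le (1 : ℂ) (conj z * w)
    rw [norm_mul, RCLike.norm_conj] at h1
    nlinarith [norm_nonneg z, norm_nonneg w]

/-- Antiderivative of the conjugate Bergman transform on the unit disk. -/
def bergT (G : ℂ → ℂ) (z : ℂ) : ℂ := (π : ℂ)⁻¹ * ∫ w, conj (G w) * (z / (1 - z * conj w))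

lemma norm_one_sub_mul_conj (z w : ℂ) : ‖1 - z * conj w‖ = ‖1 - conj z * w‖ := by
  rw [← RCLike.norm_conj (1 - z * conj w)]; simp

lemma measurable_one_sub_mul_conj (z : ℂ) : Measurable fun w : ℂ => 1 - z * conj w :=
  (by fun_prop : Continuous fun w : ℂ => 1 - z * conj w).measurable

lemma integrable_bergT {G : ℂ → ℂ} (hG : Integrable G) (h0 : ∀ w ∉ ball (0 : ℂ) 1, G w = 0)
    {z : ℂ} (hz : ‖z‖ < 1) : Integrable fun w => conj (G w) * (z / (1 - z * conj w)) := by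
  have hGc : AEStronglyMeasurable (fun w => conj (G w)) volume :=
    continuous_conj.comp_aestronglyMeasurable hG.aestronglyMeasurable
  refine (hG.norm.mul_const (‖z‖ * (1 - ‖z‖)⁻¹)).mono' (hGc.mul
    (measurable_const.div (measurable_one_sub_mul_conj z)).aestronglyMeasurable)
    (Eventually.of_forall fun w => ?_)
  rw [norm_mul, RCLike.norm_conj, norm_div, norm_one_sub_mul_conj, div_eq_mul_inv]
  by_cases hw : w ∈ ball (0 : ℂ) 1
  · have h1 := (pseudo_dist_le hz (mem_ball_zero_iff.1 hw)).2
    have h2 : 0 < 1 - ‖z‖ := by linarith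
    gcongr
  · simp [h0 w hw]

lemma hasDerivAt_bergT {G : ℂ → ℂ} (hG : Integrable G) (h0 : ∀ w ∉ ball (0 : ℂ) 1, G w = 0)
    {z : ℂ} (hz : ‖z‖ < 1) : HasDerivAt (bergT G)
      ((π : ℂ)⁻¹ * ∫ w, conj (G w) * ((1 - z * conj w) ^ 2)⁻¹) z := by
  set ε := (1 - ‖z‖) / 2 with hε
  have hε0 : 0 < ε := by rw [hε]; linarith
  have hlow : ∀ y ∈ ball z ε, ∀ w, G w ≠ 0 → ε ≤ ‖1 - y * conj w‖ := by
    intro y hy w hw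
    have hw1 : w ∈ ball (0 : ℂ) 1 := by by_contra h; exact hw (h0 w h)
    rw [mem_ball, dist_eq_norm] at hy
    have hy1 : ‖y‖ ≤ ‖z‖ + ‖y - z‖ := by
      simpa using norm_add_le z (y - z)
    rw [norm_one_sub_mul_conj]
    have := (pseudo_dist_le (z := y) (by linarith) (mem_ball_zero_iff.1 hw1)).2
    linarith
  have hGc : AEStronglyMeasurable (fun w => conj (G w)) volume :=
    continuous_conj.comp_aestronglyMeasurable hG.aestronglyMeasurable
  have hm : ∀ y : ℂ, AEStronglyMeasurable (fun w => conj (G w) * (y / (1 - y * conj w))) :=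
    fun y => hGc.mul (measurable_const.div (measurable_one_sub_mul_conj y)).aestronglyMeasurable
  have key := hasDerivAt_integral_of_dominated_loc_of_deriv_le (μ := volume)
    (F := fun y w => conj (G w) * (y / (1 - y * conj w)))
    (F' := fun y w => conj (G w) * ((1 - y * conj w) ^ 2)⁻¹) (x₀ := z) (s := ball z ε)
    (bound := fun w => ‖G w‖ * (ε ^ 2)⁻¹) (ball_mem_nhds z hε0)
    (Eventually.of_forall hm) (integrable_bergT hG h0 hz) ?_ ?_ ?_ ?_
  · exact key.2.const_mul ((π : ℂ)⁻¹)
  · exact hGc.mul ((measurable_one_sub_mul_conj z).pow_const 2).inv.aestronglyMeasurable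
  · refine Eventually.of_forall fun w y hy => ?_
    rw [norm_mul, norm_inv, norm_pow, RCLike.norm_conj]
    by_cases hw : G w = 0
    · simp [hw]
    · gcongr; exact hlow y hy w hw
  · exact hG.norm.mul_const _
  · refine Eventually.of_forall fun w y hy => ?_
    by_cases hw : G w = 0
    · simp only [hw, map_zero, zero_mul]; exact hasDerivAt_const _ _
    · have hne : 1 - y * conj w ≠ 0 := norm_pos_iff.1 (hε0.trans_le (hlow y hy w hw))
      have h1 : HasDerivAt (fun y : ℂ => 1 - y * conj w) (-(conj w)) y := by
        simpa using ((hasDerivAt_id y).mul_const (conj w)).const_sub 1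
      have h2 := (((hasDerivAt_id y).div h1 hne)).const_mul (conj (G w))
      refine h2.congr_deriv ?_
      simp only [id]
      field_simp
      ring

lemma enorm_cauchyT_sub_bergT_le {G : ℂ → ℂ} (hG : Integrable G)
    (h0 : ∀ w ∉ ball (0 : ℂ) 1, G w = 0) :
    ∀ᵐ z : ℂ, ‖z‖ < 1 → ‖cauchyT G z - conj (bergT G z)‖ₑ ≤
      ∫⁻ w, ENNReal.ofReal (kern z w) * ENNReal.ofReal ‖G w‖ := by
  filter_upwards [ae_integrable_cauchy hG] with z hz hz1
  have hI2 : Integrable fun w => G w * (conj z / (1 - conj z * w)) := by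
    have h := (conjCLE : ℂ →L[ℝ] ℂ).integrable_comp (integrable_bergT hG h0 hz1)
    refine h.congr (Eventually.of_forall fun w => ?_)
    simp
  have hconj : conj (bergT G z) = (π : ℂ)⁻¹ * ∫ w, G w * (conj z / (1 - conj z * w)) := by
    rw [bergT, map_mul, map_inv₀, conj_ofReal, ← integral_conj]
    simp
  rw [hconj, cauchyT, ← mul_sub, ← integral_sub hz hI2, enorm_mul]
  have hpi : ‖(π : ℂ)⁻¹‖ₑ ≤ 1 := by
    rw [← ofReal_norm, ENNReal.ofReal_le_one, norm_inv, norm_real, Real.norm_of_nonneg Real.pi_pos.le]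
    exact inv_le_one_of_one_le₀ (by linarith [Real.pi_gt_three])
  refine (mul_le_mul_left hpi _).trans ?_
  rw [one_mul]
  refine (enorm_integral_le_lintegral_enorm _).trans ?_
  have hae : ∀ᵐ w : ℂ, w ≠ z := by
    simp [ae_iff]
  refine lintegral_mono_ae ?_
  filter_upwards [hae] with w hwz
  by_cases hw : w ∈ ball (0 : ℂ) 1
  · have h1 := (pseudo_dist_le hz1 (mem_ball_zero_iff.1 hw)).2
    have h2 : 1 - conj z * w ≠ 0 := norm_pos_iff.1 (by linarith)
    have h3 : z - w ≠ 0 := sub_ne_zero.2 hwz.symm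
    have h4 : G w * (z - w)⁻¹ - G w * (conj z / (1 - conj z * w)) =
        G w * (((1 - ‖z‖ ^ 2 : ℝ) : ℂ) * ((z - w) * (1 - conj z * w))⁻¹) := by
      have h5 : ((1 - ‖z‖ ^ 2 : ℝ) : ℂ) = 1 - z * conj z := by
        rw [mul_conj, normSq_eq_norm_sq]; push_cast; ring
      rw [h5]
      generalize conj z = c at h2
      rw [mul_inv]
      have e1 : (z - w) * (z - w)⁻¹ = 1 := mul_inv_cancel₀ h3
      have e2 : (1 - c * w) * (1 - c * w)⁻¹ = 1 := mul_inv_cancel₀ h2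
      rw [div_eq_mul_inv]
      linear_combination (G w * c * (1 - c * w)⁻¹) * e1 - (G w * (z - w)⁻¹) * e2
    have hk : 0 ≤ 1 - ‖z‖ ^ 2 := by nlinarith [norm_nonneg z]
    rw [h4, ← ofReal_norm, ← ENNReal.ofReal_mul (by unfold kern; have := ker0_nonneg z w; positivity)]
    apply ENNReal.ofReal_le_ofReal
    rw [norm_mul, norm_mul, norm_inv, norm_mul, norm_real, Real.norm_of_nonneg hk, kern, ker0]
    exact le_of_eq (by ring)
  · simp [h0 w hw]

lemma enorm_deriv_bergT_le {G : ℂ → ℂ}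
    (h0 : ∀ w ∉ ball (0 : ℂ) 1, G w = 0) {z : ℂ} (hz1 : ‖z‖ < 1) :
    ENNReal.ofReal (1 - ‖z‖ ^ 2) * ‖(π : ℂ)⁻¹ * ∫ w, conj (G w) * ((1 - z * conj w) ^ 2)⁻¹‖ₑ ≤
      ∫⁻ w, ENNReal.ofReal (kern z w) * ENNReal.ofReal ‖G w‖ := by
  have hpi : ‖(π : ℂ)⁻¹‖ₑ ≤ 1 := by
    rw [← ofReal_norm, ENNReal.ofReal_le_one, norm_inv, norm_real, Real.norm_of_nonneg Real.pi_pos.le]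
    exact inv_le_one_of_one_le₀ (by linarith [Real.pi_gt_three])
  rw [enorm_mul]
  have h := mul_le_mul_left hpi (‖∫ w, conj (G w) * ((1 - z * conj w) ^ 2)⁻¹‖ₑ)
  rw [one_mul] at h
  refine (mul_le_mul_right (h.trans (enorm_integral_le_lintegral_enorm _)) _).trans ?_
  rw [← lintegral_const_mul' _ _ ENNReal.ofReal_ne_top]
  have hae : ∀ᵐ w : ℂ, w ≠ z := by
    simp [ae_iff]
  refine lintegral_mono_ae ?_
  filter_upwards [hae] with w hwz
  by_cases hw : w ∈ ball (0 : ℂ) 1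
  · obtain ⟨h2, h1⟩ := (pseudo_dist_le hz1 (mem_ball_zero_iff.1 hw))
    have h3 : 0 < ‖z - w‖ := norm_pos_iff.2 (sub_ne_zero.2 hwz.symm)
    have hk : 0 ≤ 1 - ‖z‖ ^ 2 := by nlinarith [norm_nonneg z]
    rw [← ofReal_norm, ← ENNReal.ofReal_mul hk,
      ← ENNReal.ofReal_mul (by unfold kern; have := ker0_nonneg z w; positivity)]
    apply ENNReal.ofReal_le_ofReal
    rw [norm_mul, norm_inv, norm_pow, RCLike.norm_conj, norm_one_sub_mul_conj, kern, ker0, mul_assoc,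
      mul_comm ‖G w‖]
    gcongr
    · exact mul_pos h3 (h3.trans_le h2)
    · rw [sq]
      gcongr
  · simp [h0 w hw]

lemma ofReal_mul_rpow {a b p : ℝ} (ha : 0 ≤ a) (hb : 0 ≤ b) (hp : 0 ≤ p) :
    ENNReal.ofReal (a ^ p * b) = ENNReal.ofReal a ^ p * ENNReal.ofReal b := by
  rw [ENNReal.ofReal_mul' hb, ENNReal.ofReal_rpow_of_nonneg ha hp]

lemma IsModel.half {U : Set ℂ} {σ y : ℂ → ℝ} (hM : IsModel U σ y) {p : ℝ} (hp : 1 < p) :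
    ∃ C : ℝ≥0∞, C < ⊤ ∧ ∀ (u : ℂ → ℂ) (u' : ℂ → ℂ →L[ℝ] ℂ), HasWeakFDerivOn u u' U →
      sobolevEnergyW p (fun z => (σ z)⁻¹) u' U < ⊤ → ∃ h : ℂ → ℂ, IsHarmonicOn h U ∧
        ∫⁻ z in U, ENNReal.ofReal ((‖dbar h z‖ * σ z) ^ p * (σ z ^ 2)⁻¹) ≤
          C * sobolevEnergyW p (fun z => (σ z)⁻¹) u' U ∧
        ∫⁻ z in U, ENNReal.ofReal (‖u z - h z‖ ^ p * (σ z ^ 2)⁻¹) < ⊤ := by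
  have hp0 : 0 < p := by linarith
  obtain ⟨C, hC, hschur⟩ := schur_weighted hM.isOpen hM.scale_cont hM.scale_pos
    (hM.smooth.continuousOn.rexp) (fun z _ => Real.exp_pos _) hM.left hM.right hp
  obtain ⟨C₀, hC₀, hσ⟩ := hM.scale_le
  have hms := hM.isOpen.measurableSet
  refine ⟨ENNReal.ofReal C₀ ^ p * C, ENNReal.mul_lt_top
    (ENNReal.rpow_lt_top_of_nonneg hp0.le ENNReal.ofReal_ne_top) hC, fun u u' hu hE => ?_⟩
  set g : ℂ → ℂ := fun z => wirtingerDBar (u' z) with hg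
  have hW := hu.weakDbar hM.isOpen
  have hgm : AEStronglyMeasurable g (volume.restrict U) := hW.2.1.aestronglyMeasurable
  set M : ℂ → ℝ≥0∞ := fun z => ∫⁻ w in U, ENNReal.ofReal (kern z w) * ENNReal.ofReal ‖g w‖ with hMd
  have hME : ∫⁻ z in U, M z ^ p * ENNReal.ofReal ((σ z ^ 2)⁻¹) ≤
      C * sobolevEnergyW p (fun z => (σ z)⁻¹) u' U := by
    refine (hschur g hgm).trans (mul_le_mul_right ?_ _)
    refine setLIntegral_mono' hms fun z hz => ENNReal.ofReal_le_ofReal ?_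
    have := hM.scale_pos z hz
    rw [inv_inv, inv_pow]
    gcongr
    exact norm_wirtingerDBar_le _
  have hMfin : ∫⁻ z in U, M z ^ p * ENNReal.ofReal ((σ z ^ 2)⁻¹) < ⊤ :=
    hME.trans_lt (ENNReal.mul_lt_top hC hE)
  set G : ℂ → ℂ := U.indicator g with hG
  have hG0 : ∀ w ∉ ball (0 : ℂ) 1, G w = 0 := fun w hw =>
    indicator_of_notMem (fun h => hw (hM.subset h)) _
  have hMG : ∀ z, M z = ∫⁻ w, ENNReal.ofReal (kern z w) * ENNReal.ofReal ‖G w‖ := fun z => by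
    rw [hMd]; simp only
    rw [← lintegral_indicator hms]
    refine lintegral_congr fun w => ?_
    by_cases hw : w ∈ U
    · simp [hG, hw]
    · simp [hG, hw]
  have hGI : Integrable G := by
    rw [hG, integrable_indicator_iff hms]
    rcases U.eq_empty_or_nonempty with rfl | hne
    · simp
    obtain ⟨z, hz, hMz⟩ : ∃ z ∈ U, M z < ⊤ := by
      by_contra hcon
      push Not at hcon
      have : ∫⁻ z in U, M z ^ p * ENNReal.ofReal ((σ z ^ 2)⁻¹) = ∫⁻ z in U, ⊤ := by
        refine setLIntegral_congr_fun hms fun z hz => ?_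
        have h1 : M z = ⊤ := top_le_iff.1 (hcon z hz)
        have h2 := hM.scale_pos z hz
        have h3 : ENNReal.ofReal ((σ z ^ 2)⁻¹) ≠ 0 := by
          rw [Ne, ENNReal.ofReal_eq_zero, not_le]; positivity
        simp only [h1]
        rw [ENNReal.top_rpow_of_pos hp0, ENNReal.top_mul h3]
      rw [this, lintegral_const, ENNReal.top_mul] at hMfin
      · exact lt_irrefl _ hMfin
      · simpa using (hM.isOpen.measure_pos volume hne).ne'
    refine ⟨hgm, ?_⟩
    have hz1 : ‖z‖ < 1 := mem_ball_zero_iff.1 (hM.subset hz)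
    have hk : 0 < 1 - ‖z‖ ^ 2 := by nlinarith [norm_nonneg z]
    have hae : ∀ᵐ w : ℂ, w ≠ z := by
      simp [ae_iff]
    have hle : ENNReal.ofReal ((1 - ‖z‖ ^ 2) / 4) * ∫⁻ w in U, ‖g w‖ₑ ≤ M z := by
      rw [← lintegral_const_mul' _ _ ENNReal.ofReal_ne_top, hMd]
      refine lintegral_mono_ae ?_
      filter_upwards [ae_restrict_of_ae hae, ae_restrict_mem hms] with w hwz hw
      rw [← ofReal_norm]
      refine mul_le_mul_left (ENNReal.ofReal_le_ofReal ?_) _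
      have hw1 : ‖w‖ < 1 := mem_ball_zero_iff.1 (hM.subset hw)
      have h3 : 0 < ‖z - w‖ := norm_pos_iff.2 (sub_ne_zero.2 hwz.symm)
      have h5 : ‖1 - conj z * w‖ ≤ 2 := by
        refine (norm_sub_le _ _).trans ?_
        rw [norm_mul, RCLike.norm_conj, norm_one]
        nlinarith [norm_nonneg z, norm_nonneg w]
      have h6 := (pseudo_dist_le hz1 hw1).1
      rw [kern, ker0, div_eq_mul_inv]
      gcongr
      · exact mul_pos h3 (by linarith)
      · nlinarith
    have hlt := hle.trans_lt hMz
    rw [HasFiniteIntegral]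
    by_contra htop
    rw [not_lt, top_le_iff] at htop
    rw [htop, ENNReal.mul_top] at hlt
    · exact lt_irrefl _ hlt
    · rw [Ne, ENNReal.ofReal_eq_zero, not_le]; positivity
  obtain ⟨A, hA, hAe⟩ := hW.exists_holomorphic hM.isOpen hGI
  have hz1 : ∀ z ∈ U, ‖z‖ < 1 := fun z hz => mem_ball_zero_iff.1 (hM.subset hz)
  have hB : ∀ z ∈ U, HasDerivAt (bergT G) _ z := fun z hz => hasDerivAt_bergT hGI hG0 (hz1 z hz)
  refine ⟨fun w => A w + conj (bergT G w), isHarmonicOn_add_conj hM.isOpen hA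
    (fun z hz => (hB z hz).differentiableAt.differentiableWithinAt), ?_, ?_⟩
  · calc _ ≤ ∫⁻ z in U, ENNReal.ofReal C₀ ^ p * (M z ^ p * ENNReal.ofReal ((σ z ^ 2)⁻¹)) := by
          refine setLIntegral_mono' hms fun z hz => ?_
          have hs := hM.scale_pos z hz
          rw [ofReal_mul_rpow (by positivity) (by positivity) hp0.le, ← mul_assoc,
            ← ENNReal.mul_rpow_of_nonneg _ _ hp0.le]
          gcongr
          rw [dbar_add_conj (hA.differentiableAt (hM.isOpen.mem_nhds hz)).hasDerivAt (hB z hz),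
            RCLike.norm_conj, mul_comm, ENNReal.ofReal_mul hs.le, ofReal_norm]
          have h1 := enorm_deriv_bergT_le hG0 (hz1 z hz)
          rw [← hMG] at h1
          refine (mul_le_mul_left (ENNReal.ofReal_le_ofReal (hσ z hz)) _).trans ?_
          rw [ENNReal.ofReal_mul hC₀.le, mul_assoc]
          exact mul_le_mul_right h1 _
      _ ≤ _ := by
          rw [lintegral_const_mul' _ _ (ENNReal.rpow_ne_top_of_nonneg hp0.le ENNReal.ofReal_ne_top),
            mul_assoc]
          exact mul_le_mul_right hME _
  · refine lt_of_le_of_lt ?_ hMfin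
    refine lintegral_mono_ae ?_
    filter_upwards [ae_restrict_mem hms, ae_restrict_of_ae hAe,
      ae_restrict_of_ae (enorm_cauchyT_sub_bergT_le hGI hG0)] with z hz h1 h2
    rw [ofReal_mul_rpow (by positivity) (by positivity) hp0.le]
    gcongr
    rw [ofReal_norm, hMG, h1 hz]
    have e : u z - (u z - cauchyT (U.indicator g) z + conj (bergT G z)) = cauchyT G z - conj (bergT G z) := by
      rw [hG]; ring
    rw [e]
    exact h2 (hz1 z hz)

lemma integrable_smul_of_tsupport {θ : ℂ → ℝ} {u : ℂ → ℂ} {U : Set ℂ} (hθ : Continuous θ)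
    (hc : HasCompactSupport θ) (hs : tsupport θ ⊆ U) (hu : LocallyIntegrableOn u U) :
    Integrable (fun z => θ z • u z) := by
  have h1 : IntegrableOn u (tsupport θ) := hu.integrableOn_compact_subset hs hc
  have h2 : IntegrableOn (fun z => θ z • u z) (tsupport θ) :=
    h1.continuousOn_smul hθ.continuousOn hc
  refine (integrableOn_iff_integrable_of_support_subset fun z hz => ?_).1 h2
  by_contra h
  exact hz (by simp [image_eq_zero_of_notMem_tsupport h])

lemma test_fderiv {ψ : ℂ → ℝ} (hψ : ContDiff ℝ (⊤ : ℕ∞) ψ) (hc : HasCompactSupport ψ) (v : ℂ) :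
    Continuous (fun z => fderiv ℝ ψ z v) ∧ HasCompactSupport (fun z => fderiv ℝ ψ z v) ∧
      tsupport (fun z => fderiv ℝ ψ z v) ⊆ tsupport ψ := by
  refine ⟨((hψ.of_le (by simp : (1 : WithTop ℕ∞) ≤ _)).continuous_fderiv (by norm_num)).clm_apply
    continuous_const, hc.fderiv_apply (𝕜 := ℝ) v, ?_⟩
  exact closure_minimal (fun z hz => by
    by_contra h
    exact hz (by simp [fderiv_of_notMem_tsupport ℝ h])) (isClosed_tsupport _)

lemma HasWeakFDerivOn.conj_comp {f : ℂ → ℂ} {f' : ℂ → ℂ →L[ℝ] ℂ} {U : Set ℂ}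
    (h : HasWeakFDerivOn f f' U) :
    HasWeakFDerivOn (fun z => conj (f z)) (fun z => (conjCLE : ℂ →L[ℝ] ℂ).comp (f' z)) U := by
  have hl : ∀ {F : ℂ → ℂ}, LocallyIntegrableOn F U → LocallyIntegrableOn (fun z => conj (F z)) U :=
    fun hF z hz => by
      obtain ⟨s, hs, hi⟩ := hF z hz
      exact ⟨s, hs, (conjCLE : ℂ →L[ℝ] ℂ).integrable_comp hi⟩
  refine ⟨hl h.1, fun v => by simpa using hl (h.2.1 v), fun ψ hψ hc hs v => ?_⟩
  have h1 := congrArg conj (h.2.2 ψ hψ hc hs v)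
  rw [map_neg, ← integral_conj, ← integral_conj] at h1
  simpa using h1

lemma HasWeakFDerivOn.sub {f g : ℂ → ℂ} {f' g' : ℂ → ℂ →L[ℝ] ℂ} {U : Set ℂ}
    (hf : HasWeakFDerivOn f f' U) (hg : HasWeakFDerivOn g g' U) :
    HasWeakFDerivOn (fun z => f z - g z) (fun z => f' z - g' z) U := by
  refine ⟨hf.1.sub hg.1, fun v => (hf.2.1 v).sub (hg.2.1 v),
    fun ψ hψ hc hs v => ?_⟩
  obtain ⟨c1, c2, c3⟩ := test_fderiv hψ hc v
  simp only [_root_.sub_apply, smul_sub]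
  rw [integral_sub (integrable_smul_of_tsupport hψ.continuous hc hs (hf.2.1 v)).integrableOn
    (integrable_smul_of_tsupport hψ.continuous hc hs (hg.2.1 v)).integrableOn,
    integral_sub (integrable_smul_of_tsupport c1 c2 (c3.trans hs) hf.1).integrableOn
    (integrable_smul_of_tsupport c1 c2 (c3.trans hs) hg.1).integrableOn,
    hf.2.2 ψ hψ hc hs v, hg.2.2 ψ hψ hc hs v]
  ring

lemma hasWeakFDerivOn_of_contDiffOn {f : ℂ → ℂ} {U : Set ℂ} (hU : IsOpen U)
    (hf : ContDiffOn ℝ 1 f U) : HasWeakFDerivOn f (fderiv ℝ f) U := by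
  have h2 : ∀ v : ℂ, LocallyIntegrableOn (fun z => fderiv ℝ f z v) U := fun v =>
    ((hf.continuousOn_fderiv_of_isOpen hU (by norm_num)).clm_apply
      continuousOn_const).locallyIntegrableOn hU.measurableSet
  have h1 : LocallyIntegrableOn f U := hf.continuousOn.locallyIntegrableOn hU.measurableSet
  refine ⟨h1, h2, fun ψ hψ hc hs v => ?_⟩
  obtain ⟨c1, c2, c3⟩ := test_fderiv hψ hc v
  rw [setIntegral_eq_of_tsupport hs fun z hz => by simp [hz],
    setIntegral_eq_of_tsupport (c3.trans hs) fun z hz => by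
      simp [hz]]
  exact integral_smul_fderiv_eq_neg_fderiv_smul_of_integrable
    (integrable_smul_of_tsupport c1 c2 (c3.trans hs) h1)
    (integrable_smul_of_tsupport hψ.continuous hc hs (h2 v))
    (integrable_smul_of_tsupport hψ.continuous hc hs h1)
    (fun z _ => hψ.differentiable (by simp) z)
    (fun z hz => (hf.contDiffAt (hU.mem_nhds (hs hz))).differentiableAt (by norm_num))

lemma gradNormL_conj_comp (L : ℂ →L[ℝ] ℂ) :
    gradNormL ((conjCLE : ℂ →L[ℝ] ℂ).comp L) = gradNormL L := by
  simp [gradNormL]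

lemma IsHarmonicOn.differentiableAt {h : ℂ → ℂ} {U : Set ℂ} (hU : IsOpen U)
    (hh : IsHarmonicOn h U) {z : ℂ} (hz : z ∈ U) : DifferentiableAt ℝ h z :=
  (hh.1.contDiffAt (hU.mem_nhds hz)).differentiableAt (by norm_num)

lemma IsHarmonicOn.conj_comp {h : ℂ → ℂ} {U : Set ℂ} (hU : IsOpen U) (hh : IsHarmonicOn h U) :
    IsHarmonicOn (fun z => conj (h z)) U := by
  refine ⟨(conjCLE : ℂ →L[ℝ] ℂ).contDiff.comp_contDiffOn hh.1, fun z hz => ?_⟩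
  have hcj : ∀ {F : ℂ → ℂ} {w : ℂ} (v : ℂ), DifferentiableAt ℝ F w →
      fderiv ℝ (fun z => conj (F z)) w v = conj (fderiv ℝ F w v) := fun {F w} v hF => by
    have : fderiv ℝ (fun z => conj (F z)) w = _ :=
      ((conjCLE : ℂ →L[ℝ] ℂ).hasFDerivAt.comp w hF.hasFDerivAt).fderiv
    rw [this]; simp
  have h1 : ∀ v : ℂ, (fun w => fderiv ℝ (fun z => conj (h z)) w v) =ᶠ[𝓝 z]
      fun w => conj (fderiv ℝ h w v) := fun v => by
    filter_upwards [hU.mem_nhds hz] with w hw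
    exact hcj v (hh.differentiableAt hU hw)
  have h2 : ∀ v : ℂ, DifferentiableAt ℝ (fun w => fderiv ℝ h w v) z := fun v =>
    (((hh.1.contDiffAt (hU.mem_nhds hz)).fderiv_right (m := 1) (by norm_num)).clm_apply
      contDiffAt_const).differentiableAt (by norm_num)
  rw [(h1 1).fderiv_eq, (h1 I).fderiv_eq, hcj _ (h2 1), hcj _ (h2 I), ← map_add, hh.2 z hz,
    map_zero]

lemma IsHarmonicOn.sub {h k : ℂ → ℂ} {U : Set ℂ} (hU : IsOpen U) (hh : IsHarmonicOn h U)
    (hk : IsHarmonicOn k U) : IsHarmonicOn (fun z => h z - k z) U := by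
  refine ⟨hh.1.sub hk.1, fun z hz => ?_⟩
  have h1 : ∀ v : ℂ, (fun w => fderiv ℝ (fun z => h z - k z) w v) =ᶠ[𝓝 z]
      fun w => fderiv ℝ h w v - fderiv ℝ k w v := fun v => by
    filter_upwards [hU.mem_nhds hz] with w hw
    rw [fderiv_fun_sub (hh.differentiableAt hU hw) (hk.differentiableAt hU hw)]; rfl
  have h2 : ∀ {F : ℂ → ℂ}, IsHarmonicOn F U → ∀ v : ℂ,
      DifferentiableAt ℝ (fun w => fderiv ℝ F w v) z := fun hF v =>
    (((hF.1.contDiffAt (hU.mem_nhds hz)).fderiv_right (m := 1) (by norm_num)).clm_apply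
      contDiffAt_const).differentiableAt (by norm_num)
  rw [(h1 1).fderiv_eq, (h1 I).fderiv_eq, fderiv_fun_sub (h2 hh 1) (h2 hk 1),
    fderiv_fun_sub (h2 hh I) (h2 hk I)]
  have := hh.2 z hz
  have := hk.2 z hz
  simp only [_root_.sub_apply]
  linear_combination hh.2 z hz - hk.2 z hz

lemma wirtingerD_conj_comp (L : ℂ →L[ℝ] ℂ) :
    wirtingerD ((conjCLE : ℂ →L[ℝ] ℂ).comp L) = conj (wirtingerDBar L) := by
  have h2 : conj (2 : ℂ) = 2 := by simpa using conj_ofReal 2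
  simp [wirtingerD, wirtingerDBar, sub_eq_add_neg, h2]

lemma lintegral_add_rpow_le {μ : Measure ℂ} {σ a b c : ℂ → ℝ} {p : ℝ} (hp : 1 < p)
    (hσ : ∀ᵐ z ∂μ, 0 ≤ σ z) (ha : ∀ᵐ z ∂μ, 0 ≤ a z) (hb : ∀ᵐ z ∂μ, 0 ≤ b z)
    (hc : ∀ᵐ z ∂μ, 0 ≤ c z)
    (habc : ∀ᵐ z ∂μ, c z ≤ a z + b z)
    (hm : AEMeasurable (fun z => ENNReal.ofReal (a z ^ p * σ z)) μ) :
    ∫⁻ z, ENNReal.ofReal (c z ^ p * σ z) ∂μ ≤ 2 ^ (p - 1) *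
      (∫⁻ z, ENNReal.ofReal (a z ^ p * σ z) ∂μ + ∫⁻ z, ENNReal.ofReal (b z ^ p * σ z) ∂μ) := by
  rw [← lintegral_add_left' hm, ← lintegral_const_mul' _ _ (by simp)]
  refine lintegral_mono_ae ?_
  filter_upwards [hσ, habc, ha, hb, hc] with z h1 h2 ha hb hc
  rw [ofReal_mul_rpow ha h1 (by linarith), ofReal_mul_rpow hb h1 (by linarith),
    ofReal_mul_rpow hc h1 (by linarith), ← add_mul, ← mul_assoc]
  gcongr
  refine le_trans ?_ (ENNReal.rpow_add_le_mul_rpow_add_rpow _ _ hp.le)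
  rw [← ENNReal.ofReal_add ha hb]
  gcongr

lemma IsModel.ae_scale_pos {U : Set ℂ} {σ y : ℂ → ℝ} (hM : IsModel U σ y) :
    ∀ᵐ z ∂volume.restrict U, 0 < σ z := by
  filter_upwards [ae_restrict_mem hM.isOpen.measurableSet] with z hz using hM.scale_pos z hz

lemma IsModel.aemeasurable_scale {U : Set ℂ} {σ y : ℂ → ℝ} (hM : IsModel U σ y) :
    AEMeasurable (fun z => (σ z ^ 2)⁻¹) (volume.restrict U) :=
  (((hM.scale_cont.aestronglyMeasurable hM.isOpen.measurableSet).aemeasurable).pow_const 2).inv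

lemma sobolevEnergyW_inv (p : ℝ) (σ : ℂ → ℝ) (f' : ℂ → ℂ →L[ℝ] ℂ) (U : Set ℂ) :
    sobolevEnergyW p (fun z => (σ z)⁻¹) f' U =
      ∫⁻ z in U, ENNReal.ofReal ((gradNormL (f' z) * σ z) ^ p * (σ z ^ 2)⁻¹) := by
  simp only [sobolevEnergyW, inv_inv, inv_pow]

lemma dirichletEnergy_eq (p : ℝ) (ρ : ℂ → ℝ) (f : ℂ → ℂ) (U : Set ℂ) :
    dirichletEnergy p ρ f U = sobolevEnergyW p ρ (fderiv ℝ f) U := rfl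

lemma IsModel.core {U : Set ℂ} {σ y : ℂ → ℝ} (hM : IsModel U σ y) {p : ℝ} (hp : 1 < p) :
    ∃ C : ℝ≥0∞, C < ⊤ ∧ ∀ (u : ℂ → ℂ) (u' : ℂ → ℂ →L[ℝ] ℂ), HasWeakFDerivOn u u' U →
      sobolevEnergyW p (fun z => (σ z)⁻¹) u' U < ⊤ → ∃ h : ℂ → ℂ, IsHarmonicOn h U ∧
        dirichletEnergy p (fun z => (σ z)⁻¹) h U ≤
          C * sobolevEnergyW p (fun z => (σ z)⁻¹) u' U ∧
        ∫⁻ z in U, ENNReal.ofReal (‖u z - h z‖ ^ p * (σ z ^ 2)⁻¹) < ⊤ := by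
  obtain ⟨C, hC, hhalf⟩ := hM.half hp
  have hms := hM.isOpen.measurableSet
  have h2p : (2 : ℝ≥0∞) ^ (p - 1) < ⊤ :=
    ENNReal.rpow_lt_top_of_nonneg (by linarith) ENNReal.ofNat_ne_top
  refine ⟨ENNReal.ofReal (2 ^ p) * (2 ^ (p - 1) * (C + C)),
    ENNReal.mul_lt_top ENNReal.ofReal_lt_top (ENNReal.mul_lt_top h2p (ENNReal.add_lt_top.2 ⟨hC, hC⟩)),
    fun u u' hu hE => ?_⟩
  have hEc : sobolevEnergyW p (fun z => (σ z)⁻¹)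
      (fun z => (conjCLE : ℂ →L[ℝ] ℂ).comp (u' z)) U =
      sobolevEnergyW p (fun z => (σ z)⁻¹) u' U := by
    simp only [sobolevEnergyW, gradNormL_conj_comp]
  obtain ⟨h, hh, hd, hL⟩ := hhalf u u' hu hE
  obtain ⟨k, hk, hkd, hkL⟩ := hhalf _ _ hu.conj_comp (hEc.trans_lt hE)
  rw [hEc] at hkd
  have hk' := hk.conj_comp hM.isOpen
  have hσ0 : ∀ᵐ z ∂volume.restrict U, 0 ≤ (σ z ^ 2)⁻¹ :=
    Eventually.of_forall fun z => by positivity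
  have hsub : ∫⁻ z in U, ENNReal.ofReal (‖h z - conj (k z)‖ ^ p * (σ z ^ 2)⁻¹) < ⊤ := by
    refine (lintegral_add_rpow_le hp (a := fun z => ‖u z - h z‖)
      (b := fun z => ‖conj (u z) - k z‖) hσ0 (Eventually.of_forall fun _ => norm_nonneg _)
      (Eventually.of_forall fun _ => norm_nonneg _) (Eventually.of_forall fun _ => norm_nonneg _)
      (Eventually.of_forall fun z => ?_) ?_).trans_lt
      (ENNReal.mul_lt_top h2p (ENNReal.add_lt_top.2 ⟨hL, hkL⟩))
    · have e : h z - conj (k z) = -(u z - h z) + conj (conj (u z) - k z) := by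
        simp
      rw [e]
      refine (norm_add_le _ _).trans ?_
      rw [norm_neg, RCLike.norm_conj]
    · refine AEMeasurable.ennreal_ofReal (AEMeasurable.mul ?_ hM.aemeasurable_scale)
      exact ((hu.1.aestronglyMeasurable.sub
        (hh.1.continuousOn.aestronglyMeasurable hms)).norm.aemeasurable).pow_const p
  obtain ⟨c, hc⟩ := hM.liouville hp (hh.sub hM.isOpen hk') hsub
  have hfd : ∀ z ∈ U, wirtingerD (fderiv ℝ h z) = conj (dbar k z) := fun z hz => by
    have h1 : (fun w => h w) =ᶠ[𝓝 z] fun w => conj (k w) + c := by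
      filter_upwards [hM.isOpen.mem_nhds hz] with w hw
      rw [← hc w hw]; ring
    have h2 : fderiv ℝ h z = (conjCLE : ℂ →L[ℝ] ℂ).comp (fderiv ℝ k z) := by
      rw [show fderiv ℝ h z = _ from h1.fderiv_eq, fderiv_add_const]
      exact ((conjCLE : ℂ →L[ℝ] ℂ).hasFDerivAt.comp z
        (hk.differentiableAt hM.isOpen hz).hasFDerivAt).fderiv
    rw [h2, wirtingerD_conj_comp]; rfl
  refine ⟨h, hh, ?_, hL⟩
  have hmem := ae_restrict_mem (μ := volume) hms
  have hdc : ContinuousOn (dbar h) U :=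
    continuous_wirtingerDBar.comp_continuousOn
      (hh.1.continuousOn_fderiv_of_isOpen hM.isOpen (by norm_num))
  have hadd := lintegral_add_rpow_le (μ := volume.restrict U) hp (a := fun z => ‖dbar h z‖ * σ z)
      (b := fun z => ‖dbar k z‖ * σ z) (c := fun z => gradNorm h z / 2 * σ z) hσ0
      (hM.ae_scale_pos.mono fun z hz => by positivity)
      (hM.ae_scale_pos.mono fun z hz => by positivity)
      (hM.ae_scale_pos.mono fun z hz => by
        have := gradNormL_nonneg (fderiv ℝ h z)
        rw [← gradNorm_eq] at this
        positivity)
      (by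
        filter_upwards [hmem] with z hz
        have hs := hM.scale_pos z hz
        have h1 := gradNormL_le (fderiv ℝ h z)
        rw [← gradNorm_eq, hfd z hz, RCLike.norm_conj] at h1
        change _ ≤ 2 * (‖dbar k z‖ + ‖dbar h z‖) at h1
        rw [← add_mul]
        gcongr
        linarith)
      (AEMeasurable.ennreal_ofReal (AEMeasurable.mul
        (((hdc.norm.mul hM.scale_cont).aestronglyMeasurable hms).aemeasurable.pow_const p)
        hM.aemeasurable_scale))
  rw [dirichletEnergy_eq, sobolevEnergyW_inv]
  calc _ ≤ ∫⁻ z in U, ENNReal.ofReal (2 ^ p) *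
        ENNReal.ofReal ((gradNorm h z / 2 * σ z) ^ p * (σ z ^ 2)⁻¹) := by
        refine setLIntegral_mono' hms fun z hz => ?_
        have hs := hM.scale_pos z hz
        have := gradNormL_nonneg (fderiv ℝ h z)
        rw [← ENNReal.ofReal_mul (by positivity), gradNorm_eq, ← mul_assoc,
          ← Real.mul_rpow (by norm_num) (by positivity)]
        apply le_of_eq
        congr 3
        ring
    _ = ENNReal.ofReal (2 ^ p) * ∫⁻ z in U,
        ENNReal.ofReal ((gradNorm h z / 2 * σ z) ^ p * (σ z ^ 2)⁻¹) :=
        lintegral_const_mul' _ _ ENNReal.ofReal_ne_top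
    _ ≤ ENNReal.ofReal (2 ^ p) * (2 ^ (p - 1) * (C * sobolevEnergyW p (fun z => (σ z)⁻¹) u' U +
        C * sobolevEnergyW p (fun z => (σ z)⁻¹) u' U)) := by
        gcongr
        exact hadd.trans (by gcongr)
    _ = _ := by rw [← add_mul]; ring

/-- Mollification of `f` by the normalised bump `φ`. -/
def mollify (φ : ContDiffBump (0 : ℂ)) (f : ℂ → ℂ) (z : ℂ) : ℂ :=
  ∫ w, φ.normed volume (z - w) • f w

lemma mollify_eq (φ : ContDiffBump (0 : ℂ)) (f : ℂ → ℂ) :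
    mollify φ f = convolution (φ.normed volume) f (ContinuousLinearMap.lsmul ℝ ℝ) volume := by
  ext z
  rw [convolution_eq_swap]
  rfl

lemma lintegral_mollify_rpow_le (φ : ContDiffBump (0 : ℂ)) {p : ℝ} (hp : 1 < p) {f : ℂ → ℂ}
    (hf : AEStronglyMeasurable f volume) :
    ∫⁻ z, ‖mollify φ f z‖ₑ ^ p ≤ ∫⁻ z, ‖f z‖ₑ ^ p := by
  have hpq := Real.HolderConjugate.conjExponent hp
  have hone : ∫⁻ w, ENNReal.ofReal (φ.normed volume w) = 1 := by
    rw [← ofReal_integral_eq_lintegral_ofReal φ.integrable_normed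
      (Eventually.of_forall fun x => φ.nonneg_normed x), φ.integral_normed, ENNReal.ofReal_one]
  have hc : Continuous (φ.normed (volume : Measure ℂ)) := φ.continuous_normed
  have hS := schur_test (μ := (volume : Measure ℂ)) hpq
    (k := fun z w => ENNReal.ofReal (φ.normed volume (z - w)))
    (by
      refine (Continuous.measurable ?_).ennreal_ofReal
      exact hc.comp (continuous_fst.sub continuous_snd))
    (g := fun w => ‖f w‖ₑ) (A := fun _ => 1) (B := fun w => ‖f w‖ₑ ^ p) (D := fun _ => 1)
    (F := fun _ => 1) (X := fun _ => 1) (S := fun _ => 1) (N := fun w => ‖f w‖ₑ ^ p)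
    (C₁ := 1) (C₂ := 1) aemeasurable_const (hf.enorm.pow_const p) aemeasurable_const
    ENNReal.one_ne_top
    (Eventually.of_forall fun z => by
      simp only [mul_one]
      rw [lintegral_sub_left_eq_self (fun w => ENNReal.ofReal (φ.normed volume w)) z, hone])
    (Eventually.of_forall fun z => by
      simp only [mul_one]
      rw [lintegral_sub_right_eq_self (fun w => ENNReal.ofReal (φ.normed volume w)) z, hone])
    (Eventually.of_forall fun z => by
      have hp0 : p ≠ 0 := by linarith
      simp [hp0])
    (Eventually.of_forall fun z => by simp) (Eventually.of_forall fun z => by simp)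
  simp only [mul_one, ENNReal.one_rpow, one_mul] at hS
  refine le_trans (lintegral_mono fun z => ?_) hS
  gcongr
  refine (enorm_integral_le_lintegral_enorm _).trans (lintegral_mono fun w => ?_)
  rw [enorm_smul, Real.enorm_of_nonneg (φ.nonneg_normed _)]

lemma mollify_sub (φ : ContDiffBump (0 : ℂ)) {f g : ℂ → ℂ} (hf : LocallyIntegrable f volume)
    (hg : LocallyIntegrable g volume) (z : ℂ) :
    mollify φ (fun w => f w - g w) z = mollify φ f z - mollify φ g z := by
  have key : ∀ {h : ℂ → ℂ}, LocallyIntegrable h volume →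
      Integrable (fun w => φ.normed volume (z - w) • h w) := fun {h} hh =>
    hh.integrable_smul_left_of_hasCompactSupport (φ.continuous_normed.comp (by fun_prop))
      (φ.hasCompactSupport_normed.comp_homeomorph (Homeomorph.subLeft z))
  simp only [mollify, smul_sub]
  exact integral_sub (key hf) (key hg)

lemma mollify_eq_zero (φ : ContDiffBump (0 : ℂ)) {f : ℂ → ℂ} {K : Set ℂ}
    (hf : ∀ z ∉ K, f z = 0) {z : ℂ} (hz : z ∉ cthickening φ.rOut K) : mollify φ f z = 0 := by
  refine integral_eq_zero_of_ae (Eventually.of_forall fun w => ?_)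
  by_cases hw : w ∈ K
  · have : φ.normed volume (z - w) = 0 := by
      rw [← Function.notMem_support, φ.support_normed_eq]
      intro h
      rw [mem_ball_zero_iff, ← dist_eq_norm] at h
      exact hz (mem_cthickening_of_dist_le z w _ K hw h.le)
    simp [this]
  · simp [hf w hw]

lemma exists_mollify_close {p : ℝ} (hp : 1 < p) {f : ℂ → ℂ} (hf : MemLp f (ENNReal.ofReal p) volume)
    {ε : ℝ≥0∞} (hε : 0 < ε) :
    ∃ r : ℝ, 0 < r ∧ ∀ φ : ContDiffBump (0 : ℂ), φ.rOut < r →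
      ∫⁻ z, ‖mollify φ f z - f z‖ₑ ^ p ≤ ε := by
  have hp0 : 0 < p := by linarith
  have hpne : ENNReal.ofReal p ≠ 0 := by simpa using hp0
  have h3 : (3 : ℝ≥0∞) ^ p ≠ ⊤ := by simp
  have h30 : (3 : ℝ≥0∞) ^ p ≠ 0 := by simp
  set δ : ℝ≥0∞ := ε / (3 * 3 ^ p) with hδ
  have hδ0 : δ ≠ 0 := by
    rw [hδ]; exact (ENNReal.div_pos hε.ne' (ENNReal.mul_ne_top (by simp) h3)).ne'
  have hδ0' : δ ^ (1 / p) ≠ 0 := by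
    simp [hδ0, hp0, hp0.le]
  obtain ⟨g, hgc, hg, hgcont, hgL⟩ := hf.exists_hasCompactSupport_eLpNorm_sub_le
    ENNReal.ofReal_ne_top hδ0'
  have hfl : LocallyIntegrable f volume := hf.locallyIntegrable (by simpa using hp.le)
  have hgl : LocallyIntegrable g volume := hgcont.locallyIntegrable
  have hfg : ∫⁻ z, ‖f z - g z‖ₑ ^ p ≤ δ := by
    rw [eLpNorm_eq_lintegral_rpow_enorm_toReal hpne ENNReal.ofReal_ne_top,
      ENNReal.toReal_ofReal hp0.le] at hg
    have := (ENNReal.rpow_le_rpow_iff (z := 1 / p) (by positivity)).1 hg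
    simpa using this
  set K := tsupport g
  have hK : IsCompact K := hgc
  have hK1 : IsCompact (cthickening 1 K) := hK.cthickening
  have hVol : volume (cthickening 1 K) ≠ ⊤ := hK1.measure_lt_top.ne
  obtain ⟨η, hη0, hη⟩ : ∃ η : ℝ, 0 < η ∧
      ENNReal.ofReal η ^ p * volume (cthickening 1 K) ≤ δ := by
    have ht : Tendsto (fun η : ℝ => ENNReal.ofReal η ^ p * volume (cthickening 1 K)) (𝓝[>] 0)
        (𝓝 0) := by
      have h1 : Tendsto (fun η : ℝ => ENNReal.ofReal η ^ p) (𝓝[>] 0) (𝓝 0) := by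
        have := ((ENNReal.continuous_rpow_const (y := p)).comp ENNReal.continuous_ofReal).tendsto
          (0 : ℝ)
        simp only [Function.comp_def, ENNReal.ofReal_zero, ENNReal.zero_rpow_of_pos hp0] at this
        exact this.mono_left nhdsWithin_le_nhds
      simpa using ENNReal.Tendsto.mul_const h1 (Or.inr hVol)
    have := (ht.eventually_le_const (pos_iff_ne_zero.2 hδ0)).and self_mem_nhdsWithin
    obtain ⟨η, h1, h2⟩ := this.exists
    exact ⟨η, h2, h1⟩
  obtain ⟨r, hr0, hr⟩ := Metric.uniformContinuous_iff.1
    (hgc.uniformContinuous_of_continuous hgcont) η hη0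
  refine ⟨min r 1, by positivity, fun φ hφ => ?_⟩
  have hg2 : ∫⁻ z, ‖mollify φ g z - g z‖ₑ ^ p ≤ δ := by
    refine le_trans ?_ hη
    rw [← setLIntegral_const, ← lintegral_indicator hK1.measurableSet]
    refine lintegral_mono fun z => ?_
    by_cases hz : z ∈ cthickening 1 K
    · rw [indicator_of_mem hz]
      gcongr
      rw [← ofReal_norm, mollify_eq, ← dist_eq_norm]
      refine ENNReal.ofReal_le_ofReal ?_
      refine φ.dist_normed_convolution_le hgcont.aestronglyMeasurable fun x hx => ?_
      refine (hr ?_).le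
      exact (mem_ball.1 hx).trans (hφ.trans_le (min_le_left _ _))
    · rw [indicator_of_notMem hz]
      have h1 : mollify φ g z = 0 := by
        refine mollify_eq_zero φ (K := K) (fun w hw => image_eq_zero_of_notMem_tsupport hw) ?_
        exact fun h => hz (cthickening_mono (hφ.le.trans (min_le_right _ _)) K h)
      have h2 : g z = 0 :=
        image_eq_zero_of_notMem_tsupport fun h => hz (self_subset_cthickening K h)
      simp [h1, h2, hp0]
  have hfg2 : ∫⁻ z, ‖mollify φ (fun w => f w - g w) z‖ₑ ^ p ≤ δ :=
    (lintegral_mollify_rpow_le φ hp (hfl.sub hgl).aestronglyMeasurable).trans hfg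
  have hmp : ∀ {h : ℂ → ℂ}, LocallyIntegrable h volume → Continuous (mollify φ h) := fun {h} hh => by
    rw [mollify_eq]
    exact φ.hasCompactSupport_normed.continuous_convolution_left _ φ.continuous_normed hh
  have hm1 : AEMeasurable (fun z => ‖mollify φ (fun w => f w - g w) z‖ₑ ^ p) volume :=
    ((hmp (hfl.sub hgl)).enorm.measurable.pow_const p).aemeasurable
  calc ∫⁻ z, ‖mollify φ f z - f z‖ₑ ^ p
      ≤ ∫⁻ z, 3 ^ p * (‖mollify φ (fun w => f w - g w) z‖ₑ ^ p +
          ‖mollify φ g z - g z‖ₑ ^ p + ‖f z - g z‖ₑ ^ p) := by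
        refine lintegral_mono fun z => ?_
        have e : mollify φ f z - f z = mollify φ (fun w => f w - g w) z +
            (mollify φ g z - g z) - (f z - g z) := by
          rw [mollify_sub φ hfl hgl]; ring
        rw [e]
        set a := mollify φ (fun w => f w - g w) z
        set b := mollify φ g z - g z
        set c := f z - g z
        set m := max (max ‖a‖ₑ ‖b‖ₑ) ‖c‖ₑ with hm
        have h1 : ‖a + b - c‖ₑ ≤ 3 * m := by
          refine (enorm_sub_le).trans ?_
          refine (add_le_add (enorm_add_le a b) le_rfl).trans ?_
          have ha : ‖a‖ₑ ≤ m := (le_max_left _ _).trans (le_max_left _ _)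
          have hb : ‖b‖ₑ ≤ m := (le_max_right _ _).trans (le_max_left _ _)
          have hc : ‖c‖ₑ ≤ m := le_max_right _ _
          calc _ ≤ m + m + m := add_le_add (add_le_add ha hb) hc
            _ = 3 * m := by ring
        refine (ENNReal.rpow_le_rpow h1 hp0.le).trans ?_
        rw [ENNReal.mul_rpow_of_nonneg _ _ hp0.le]
        gcongr
        rcases max_choice (max ‖a‖ₑ ‖b‖ₑ) ‖c‖ₑ with h | h
        · rcases max_choice ‖a‖ₑ ‖b‖ₑ with h' | h'
          · rw [hm, h, h', add_assoc]; exact le_self_add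
          · rw [hm, h, h', add_comm (‖a‖ₑ ^ p), add_assoc]; exact le_self_add
        · rw [hm, h]; exact le_add_self
    _ = 3 ^ p * ((∫⁻ z, ‖mollify φ (fun w => f w - g w) z‖ₑ ^ p) +
          (∫⁻ z, ‖mollify φ g z - g z‖ₑ ^ p) + ∫⁻ z, ‖f z - g z‖ₑ ^ p) := by
        rw [lintegral_const_mul' _ _ h3, lintegral_add_left', lintegral_add_left']
        · exact hm1
        · exact hm1.add (((hmp hgl).sub hgcont).enorm.measurable.pow_const p).aemeasurable
    _ ≤ 3 ^ p * (δ + δ + δ) := by gcongr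
    _ = (3 * 3 ^ p) * δ := by ring
    _ ≤ ε := by rw [hδ]; exact ENNReal.mul_div_le

lemma HasWeakFDerivOn.smul_test {v : ℂ → ℂ} {v' : ℂ → ℂ →L[ℝ] ℂ} {U : Set ℂ} {χ : ℂ → ℝ}
    (hv : HasWeakFDerivOn v v' U) (hχ : ContDiff ℝ (⊤ : ℕ∞) χ) (hc : HasCompactSupport χ)
    (hs : tsupport χ ⊆ U) :
    HasWeakFDerivOn (fun z => χ z • v z)
      (fun z => χ z • v' z + (fderiv ℝ χ z).smulRight (v z)) univ := by
  have i1 : Integrable (fun z => χ z • v z) :=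
    integrable_smul_of_tsupport hχ.continuous hc hs hv.1
  have i2 : ∀ e, Integrable (fun z => χ z • v' z e) := fun e =>
    integrable_smul_of_tsupport hχ.continuous hc hs (hv.2.1 e)
  have i3 : ∀ e, Integrable (fun z => fderiv ℝ χ z e • v z) := fun e => by
    obtain ⟨c1, c2, c3⟩ := test_fderiv hχ hc e
    exact integrable_smul_of_tsupport c1 c2 (c3.trans hs) hv.1
  refine ⟨i1.locallyIntegrable.locallyIntegrableOn _, fun e =>
    ((i2 e).add (i3 e)).locallyIntegrable.locallyIntegrableOn _, fun ψ hψ hψc _ e => ?_⟩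
  have hψχ : ContDiff ℝ (⊤ : ℕ∞) (fun z => ψ z * χ z) := hψ.mul hχ
  have hts : tsupport (fun z => ψ z * χ z) ⊆ U := tsupport_mul_subset_right.trans hs
  have key := hv.2.2 (fun z => ψ z * χ z) hψχ hc.mul_left hts e
  have hfd : ∀ z, fderiv ℝ (fun z => ψ z * χ z) z e = ψ z * fderiv ℝ χ z e + fderiv ℝ ψ z e * χ z :=
    fun z => by
      rw [fderiv_fun_mul (hψ.differentiable (by simp) z) (hχ.differentiable (by simp) z)]
      simp [mul_comm]
  obtain ⟨c1, c2, c3⟩ := test_fderiv hψχ hc.mul_left e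
  rw [setIntegral_eq_of_tsupport hts fun z hz => by simp only [hz, zero_smul],
    setIntegral_eq_of_tsupport (c3.trans hts) fun z hz => by
      simp only [hz, zero_smul]] at key
  simp only [hfd, add_smul, mul_smul] at key
  have bd : ∀ {F : ℂ → ℂ}, Integrable F → Integrable (fun z => ψ z • F z) := fun {F} hF =>
    integrable_smul_of_tsupport (U := univ) hψ.continuous hψc (subset_univ _)
      (hF.locallyIntegrable.locallyIntegrableOn _)
  have bd2 : ∀ {F : ℂ → ℂ}, Integrable F → Integrable (fun z => fderiv ℝ ψ z e • F z) :=
    fun {F} hF => by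
      obtain ⟨c1, c2, c3⟩ := test_fderiv hψ hψc e
      exact integrable_smul_of_tsupport (U := univ) c1 c2 (subset_univ _)
        (hF.locallyIntegrable.locallyIntegrableOn _)
  rw [integral_add (bd (i3 e)) (bd2 i1)] at key
  simp only [Measure.restrict_univ, _root_.add_apply, _root_.smul_apply,
    ContinuousLinearMap.smulRight_apply, smul_add]
  rw [integral_add (bd (i2 e)) (bd (i3 e)), key]
  ring

lemma contDiff_mollify (φ : ContDiffBump (0 : ℂ)) {f : ℂ → ℂ} (hf : LocallyIntegrable f volume) :
    ContDiff ℝ (⊤ : ℕ∞) (mollify φ f) := by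
  rw [mollify_eq]
  exact φ.hasCompactSupport_normed.contDiff_convolution_left _ φ.contDiff_normed hf

lemma fderiv_mollify (φ : ContDiffBump (0 : ℂ)) {f : ℂ → ℂ} {f' : ℂ → ℂ →L[ℝ] ℂ}
    (hf : HasWeakFDerivOn f f' univ) (z e : ℂ) :
    fderiv ℝ (mollify φ f) z e = mollify φ (fun w => f' w e) z := by
  have hfl : LocallyIntegrable f volume := locallyIntegrableOn_univ.1 hf.1
  have hd := φ.hasCompactSupport_normed.hasFDerivAt_convolution_left
    (ContinuousLinearMap.lsmul ℝ ℝ) (φ.contDiff_normed (μ := volume) (n := 1)) hfl z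
  rw [← mollify_eq] at hd
  rw [hd.fderiv, convolution_eq_swap, ContinuousLinearMap.integral_apply]
  · have hψ : ContDiff ℝ (⊤ : ℕ∞) (fun w => φ.normed volume (z - w)) :=
      φ.contDiff_normed.comp (contDiff_const.sub contDiff_id)
    have := hf.2.2 (fun w => φ.normed volume (z - w)) hψ
      (φ.hasCompactSupport_normed.comp_homeomorph (Homeomorph.subLeft z)) (subset_univ _) e
    simp only [Measure.restrict_univ] at this
    rw [mollify, this, ← integral_neg]
    refine integral_congr_ae (Eventually.of_forall fun w => ?_)
    have h2 : fderiv ℝ (fun w => φ.normed volume (z - w)) w e =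
        -fderiv ℝ (φ.normed volume) (z - w) e := by
      have h3 : HasFDerivAt (fun w : ℂ => z - w) (-(ContinuousLinearMap.id ℝ ℂ)) w :=
        (hasFDerivAt_id w).const_sub z
      have h4 : HasFDerivAt (φ.normed volume) (fderiv ℝ (φ.normed volume) (z - w)) (z - w) :=
        ((φ.contDiff_normed (μ := volume) (n := 1)).differentiable (by norm_num) _).hasFDerivAt
      rw [show fderiv ℝ (fun w => φ.normed volume (z - w)) w = _ from (h4.comp w h3).fderiv]
      simp
    simp only [h2, neg_smul, neg_neg]
    rfl
  · exact ((φ.hasCompactSupport_normed.fderiv ℝ).convolutionExists_left _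
      ((φ.contDiff_normed (n := 1)).continuous_fderiv (by norm_num)) hfl z).integrable_swap

lemma exists_test_close {p : ℝ} (hp : 1 < p) {f : ℂ → ℂ} {f' : ℂ → ℂ →L[ℝ] ℂ}
    (hf : HasWeakFDerivOn f f' univ) (hL : ∀ e, MemLp (fun z => f' z e) (ENNReal.ofReal p) volume)
    {K : Set ℂ} (hK : IsCompact K) (hfK : ∀ z ∉ K, f z = 0) {δ : ℝ} (hδ : 0 < δ)
    {ε : ℝ≥0∞} (hε : 0 < ε) :
    ∃ ψ : ℂ → ℂ, ContDiff ℝ (⊤ : ℕ∞) ψ ∧ HasCompactSupport ψ ∧ tsupport ψ ⊆ cthickening δ K ∧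
      ∫⁻ z, ‖f' z 1 - fderiv ℝ ψ z 1‖ₑ ^ p ≤ ε ∧ ∫⁻ z, ‖f' z I - fderiv ℝ ψ z I‖ₑ ^ p ≤ ε := by
  obtain ⟨r₁, hr₁, h₁⟩ := exists_mollify_close hp (hL 1) hε
  obtain ⟨r₂, hr₂, h₂⟩ := exists_mollify_close hp (hL I) hε
  set r := min δ (min r₁ r₂) / 2 with hr
  have hr0 : 0 < r := by positivity
  have hrδ : r < δ := (half_lt_self (by positivity)).trans_le (min_le_left _ _)
  have hrr₁ : r < r₁ :=
    (half_lt_self (by positivity)).trans_le ((min_le_right _ _).trans (min_le_left _ _))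
  have hrr₂ : r < r₂ :=
    (half_lt_self (by positivity)).trans_le ((min_le_right _ _).trans (min_le_right _ _))
  let φ : ContDiffBump (0 : ℂ) := ⟨r / 2, r, by positivity, half_lt_self hr0⟩
  have hts : tsupport (mollify φ f) ⊆ cthickening δ K := by
    refine closure_minimal (fun z hz => ?_) isClosed_cthickening
    by_contra h
    exact hz (mollify_eq_zero φ hfK fun h' => h (cthickening_mono hrδ.le K h'))
  refine ⟨mollify φ f, contDiff_mollify φ (locallyIntegrableOn_univ.1 hf.1),
    HasCompactSupport.of_support_subset_isCompact (hK.cthickening (r := δ))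
      ((subset_tsupport _).trans hts), hts, ?_, ?_⟩
  · refine le_trans (le_of_eq ?_) (h₁ φ hrr₁)
    refine lintegral_congr fun z => ?_
    rw [fderiv_mollify φ hf, ← enorm_neg, neg_sub]
  · refine le_trans (le_of_eq ?_) (h₂ φ hrr₂)
    refine lintegral_congr fun z => ?_
    rw [fderiv_mollify φ hf, ← enorm_neg, neg_sub]

lemma aemeasurable_gradNormL {f' : ℂ → ℂ →L[ℝ] ℂ} {U : Set ℂ} 
    (h : ∀ v : ℂ, LocallyIntegrableOn (fun z => f' z v) U volume) :
    AEMeasurable (fun z => gradNormL (f' z)) (volume.restrict U) := by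
  have h1 := fun v => (h v).aestronglyMeasurable.norm.aemeasurable
  exact (((h1 1).pow_const 2).add ((h1 I).pow_const 2)).sqrt

lemma gradNormL_le_add (L : ℂ →L[ℝ] ℂ) : gradNormL L ≤ ‖L 1‖ + ‖L I‖ := by
  rw [gradNormL, Real.sqrt_le_left (by positivity)]
  nlinarith [mul_nonneg (norm_nonneg (L 1)) (norm_nonneg (L I))]

lemma gradNormL_triangle (L M : ℂ →L[ℝ] ℂ) : gradNormL (L + M) ≤ gradNormL L + gradNormL M := by
  have e : ∀ L : ℂ →L[ℝ] ℂ, gradNormL L = ‖(⟨‖L 1‖, ‖L I‖⟩ : ℂ)‖ := fun L => by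
    rw [gradNormL, Complex.norm_def (⟨‖L 1‖, ‖L I‖⟩ : ℂ), Complex.normSq_mk, sq, sq]
  rw [e L, e M]
  refine le_trans ?_ (norm_add_le _ _)
  have h2 : ((⟨‖L 1‖, ‖L I‖⟩ : ℂ) + ⟨‖M 1‖, ‖M I‖⟩) = ⟨‖L 1‖ + ‖M 1‖, ‖L I‖ + ‖M I‖⟩ := by
    apply Complex.ext <;> simp
  rw [h2, e, Complex.norm_def (⟨‖(L + M) 1‖, _⟩ : ℂ), Complex.norm_def (⟨‖L 1‖ + _, _⟩ : ℂ),
    Complex.normSq_mk, Complex.normSq_mk]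
  refine Real.sqrt_le_sqrt ?_
  have h3 := norm_add_le (L 1) (M 1)
  have h4 := norm_add_le (L I) (M I)
  simp only [_root_.add_apply]
  gcongr

lemma IsModel.energy_le_add {U : Set ℂ} {σ y : ℂ → ℝ} (hM : IsModel U σ y) {p : ℝ} (hp : 1 < p)
    {h' : ℂ → ℂ →L[ℝ] ℂ} {a b : ℂ → ℝ} (ha : ∀ z, 0 ≤ a z) (hb : ∀ z, 0 ≤ b z)
    (hab : ∀ z ∈ U, gradNormL (h' z) ≤ a z + b z) (hm : AEMeasurable a (volume.restrict U)) :
    sobolevEnergyW p (fun z => (σ z)⁻¹) h' U ≤ 2 ^ (p - 1) *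
      ((∫⁻ z in U, ENNReal.ofReal ((a z * σ z) ^ p * (σ z ^ 2)⁻¹)) +
        ∫⁻ z in U, ENNReal.ofReal ((b z * σ z) ^ p * (σ z ^ 2)⁻¹)) := by
  have hms := hM.isOpen.measurableSet
  have hmem := ae_restrict_mem (μ := volume) hms
  rw [sobolevEnergyW_inv]
  refine lintegral_add_rpow_le hp (σ := fun z => (σ z ^ 2)⁻¹)
    (Eventually.of_forall fun z => by positivity)
    (hM.ae_scale_pos.mono fun z hz => mul_nonneg (ha z) hz.le)
    (hM.ae_scale_pos.mono fun z hz => mul_nonneg (hb z) hz.le)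
    (hM.ae_scale_pos.mono fun z hz => mul_nonneg (gradNormL_nonneg _) hz.le) ?_ ?_
  · filter_upwards [hmem] with z hz
    have := hM.scale_pos z hz
    rw [← add_mul]
    exact mul_le_mul_of_nonneg_right (hab z hz) this.le
  · exact (((hm.mul (hM.scale_cont.aestronglyMeasurable hms).aemeasurable).pow_const p).mul
      hM.aemeasurable_scale).ennreal_ofReal

lemma IsModel.approx {U : Set ℂ} {σ y : ℂ → ℝ} (hM : IsModel U σ y) {p : ℝ} (hp : 1 < p)
    {v : ℂ → ℂ} {v' : ℂ → ℂ →L[ℝ] ℂ} (hv : HasWeakFDerivOn v v' U)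
    (hE : sobolevEnergyW p (fun z => (σ z)⁻¹) v' U < ⊤)
    (hL : ∫⁻ z in U, ENNReal.ofReal (‖v z‖ ^ p * (σ z ^ 2)⁻¹) < ⊤) :
    ApproxByTest p (fun z => (σ z)⁻¹) v' U := by
  intro ε hε
  have hp0 : 0 < p := by linarith
  have hms := hM.isOpen.measurableSet
  have hmem := ae_restrict_mem (μ := volume) hms
  set P : ℝ≥0∞ := 2 ^ (p - 1) with hP
  have hPtop : P ≠ ⊤ := ENNReal.rpow_ne_top_of_nonneg (by linarith) ENNReal.ofNat_ne_top
  have mv := aemeasurable_gradNormL hv.2.1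
  have mσ : AEMeasurable σ (volume.restrict U) :=
    (hM.scale_cont.aestronglyMeasurable hms).aemeasurable
  obtain ⟨C, hC, hcut⟩ := hM.exists_cutoff
  choose χ hχ hχc hχs hχ0 hχ1 hχe hχd using fun n : ℕ => hcut (n + 1) n.succ_pos
  -- the cut-off error
  set err : ℕ → ℝ≥0∞ := fun n =>
    (∫⁻ z in U, ENNReal.ofReal (((1 - χ n z) * gradNormL (v' z) * σ z) ^ p * (σ z ^ 2)⁻¹)) +
      ENNReal.ofReal ((2 * C / ((n + 1 : ℕ) : ℝ)) ^ p) *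
        ∫⁻ z in U, ENNReal.ofReal (‖v z‖ ^ p * (σ z ^ 2)⁻¹) with herr
  have hgr : ∀ n, ∫⁻ z in U, ENNReal.ofReal
      ((2 * ‖fderiv ℝ (χ n) z‖ * ‖v z‖ * σ z) ^ p * (σ z ^ 2)⁻¹) ≤
      ENNReal.ofReal ((2 * C / ((n + 1 : ℕ) : ℝ)) ^ p) *
        ∫⁻ z in U, ENNReal.ofReal (‖v z‖ ^ p * (σ z ^ 2)⁻¹) := fun n => by
    rw [← lintegral_const_mul' _ _ ENNReal.ofReal_ne_top]
    refine setLIntegral_mono' hms fun z hz => ?_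
    have hs := hM.scale_pos z hz
    rw [← ENNReal.ofReal_mul (by positivity), ← mul_assoc,
      ← Real.mul_rpow (by positivity) (by positivity)]
    refine ENNReal.ofReal_le_ofReal (mul_le_mul_of_nonneg_right
      (Real.rpow_le_rpow (by positivity) ?_ hp0.le) (by positivity))
    have := hχd n z hz
    calc 2 * ‖fderiv ℝ (χ n) z‖ * ‖v z‖ * σ z
        = 2 * (‖fderiv ℝ (χ n) z‖ * σ z) * ‖v z‖ := by ring
      _ ≤ 2 * (C / ((n + 1 : ℕ) : ℝ)) * ‖v z‖ := by gcongr
      _ = _ := by ring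
  have hlim : Tendsto err atTop (𝓝 0) := by
    have t1 : Tendsto (fun n => ∫⁻ z in U, ENNReal.ofReal
        (((1 - χ n z) * gradNormL (v' z) * σ z) ^ p * (σ z ^ 2)⁻¹)) atTop
        (𝓝 (∫⁻ _ in U, 0)) := by
      refine tendsto_lintegral_of_dominated_convergence' (fun z => ENNReal.ofReal
        ((gradNormL (v' z) * σ z) ^ p * (σ z ^ 2)⁻¹)) (fun n => ?_) (fun n => ?_) ?_ ?_
      · exact ((((((measurable_const.sub (hχ n).continuous.measurable).aemeasurable).mul mv).mul
          mσ).pow_const p).mul hM.aemeasurable_scale).ennreal_ofReal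
      · filter_upwards [hmem] with z hz
        have hs := hM.scale_pos z hz
        have h0 := hχ0 n z
        have h1 := hχ1 n z
        have hg := gradNormL_nonneg (v' z)
        have h2 : 0 ≤ 1 - χ n z := by linarith
        gcongr
        exact mul_le_of_le_one_left hg (by linarith)
      · rw [← sobolevEnergyW_inv]; exact hE.ne
      · filter_upwards [hmem] with z hz
        obtain ⟨N, hN⟩ := exists_nat_ge |y z|
        refine tendsto_const_nhds.congr' ?_
        filter_upwards [eventually_ge_atTop N] with n hn
        have : χ n z = 1 := hχe n z hz (hN.trans (by
          have : (N : ℝ) ≤ n := by exact_mod_cast hn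
          push_cast; linarith))
        simp [this, Real.zero_rpow hp0.ne']
    have t2 : Tendsto (fun n : ℕ => ENNReal.ofReal ((2 * C / ((n + 1 : ℕ) : ℝ)) ^ p) *
        ∫⁻ z in U, ENNReal.ofReal (‖v z‖ ^ p * (σ z ^ 2)⁻¹)) atTop (𝓝 (0 * 
        ∫⁻ z in U, ENNReal.ofReal (‖v z‖ ^ p * (σ z ^ 2)⁻¹))) := by
      refine ENNReal.Tendsto.mul_const ?_ (Or.inr hL.ne)
      have h1 : Tendsto (fun n : ℕ => 2 * C / ((n + 1 : ℕ) : ℝ)) atTop (𝓝 0) :=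
        (tendsto_const_div_atTop_nhds_zero_nat (2 * C)).comp (tendsto_add_atTop_nat 1)
      have h2 := ENNReal.tendsto_ofReal (h1.rpow_const (Or.inr hp0.le) (p := p))
      simpa [Real.zero_rpow hp0.ne'] using h2
    have := t1.add t2
    rwa [zero_mul, lintegral_zero, add_zero] at this
  -- choice of the cut-off
  set e₀ : ℝ≥0∞ := ENNReal.ofReal ε / (P * (P + 1) * 4) with he₀
  have hPP : P * (P + 1) * 4 ≠ ⊤ := by finiteness
  have he₀0 : 0 < e₀ := ENNReal.div_pos (by simpa using hε) hPP
  obtain ⟨n, hn⟩ := (hlim.eventually_le_const he₀0).exists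
  set w : ℂ → ℂ := fun z => χ n z • v z with hw
  set w' : ℂ → ℂ →L[ℝ] ℂ := fun z => χ n z • v' z + (fderiv ℝ (χ n) z).smulRight (v z) with hw'
  have hww : HasWeakFDerivOn w w' univ := hv.smul_test (hχ n) (hχc n) (hχs n)
  have hfd : Continuous (fderiv ℝ (χ n)) := (hχ n).continuous_fderiv (by simp)
  have hsr : ∀ z, gradNormL ((fderiv ℝ (χ n) z).smulRight (v z)) ≤
      2 * ‖fderiv ℝ (χ n) z‖ * ‖v z‖ := fun z => by
    refine (gradNormL_le_norm _).trans ?_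
    rw [ContinuousLinearMap.norm_smulRight_apply, mul_assoc]
  have hE1 : sobolevEnergyW p (fun z => (σ z)⁻¹) (fun z => v' z - w' z) U ≤ P * e₀ := by
    refine (hM.energy_le_add hp (a := fun z => (1 - χ n z) * gradNormL (v' z))
      (b := fun z => 2 * ‖fderiv ℝ (χ n) z‖ * ‖v z‖)
      (fun z => mul_nonneg (by linarith [hχ1 n z]) (gradNormL_nonneg _))
      (fun z => by positivity) (fun z hz => ?_) ?_).trans ?_
    · have e : v' z - w' z = (1 - χ n z) • v' z + -((fderiv ℝ (χ n) z).smulRight (v z)) := by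
        simp only [hw']; module
      rw [e]
      refine (gradNormL_triangle _ _).trans (add_le_add (le_of_eq ?_) (le_of_eq_of_le ?_ (hsr z)))
      · have : 0 ≤ 1 - χ n z := by linarith [hχ1 n z]
        have h2 : ‖(1 : ℂ) - χ n z‖ = 1 - χ n z := by
          rw [← Complex.ofReal_one, ← Complex.ofReal_sub, Complex.norm_real, Real.norm_of_nonneg this]
        simp only [gradNormL, _root_.smul_apply, norm_smul, Real.norm_of_nonneg this, mul_pow,
          ← mul_add]
        rw [Real.sqrt_mul (sq_nonneg _), Real.sqrt_sq this]
      · simp [gradNormL]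
    · exact ((measurable_const.sub (hχ n).continuous.measurable).aemeasurable).mul mv
    · rw [← hP]
      gcongr
      refine le_trans ?_ hn
      rw [herr]
      exact add_le_add le_rfl (hgr n)
  have hE2 : sobolevEnergyW p (fun z => (σ z)⁻¹) w' U < ⊤ := by
    refine (hM.energy_le_add hp (a := fun z => gradNormL (v' z))
      (b := fun z => 2 * ‖fderiv ℝ (χ n) z‖ * ‖v z‖)
      (fun z => gradNormL_nonneg _)
      (fun z => by positivity) (fun z hz => ?_) mv).trans_lt ?_
    · refine (gradNormL_triangle _ _).trans (add_le_add ?_ (hsr z))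
      simp only [gradNormL, _root_.smul_apply, norm_smul, Real.norm_of_nonneg (hχ0 n z), mul_pow,
          ← mul_add]
      rw [Real.sqrt_mul (sq_nonneg _), Real.sqrt_sq (hχ0 n z)]
      exact mul_le_of_le_one_left (Real.sqrt_nonneg _) (hχ1 n z)
    · rw [← hP]
      refine ENNReal.mul_lt_top hPtop.lt_top (ENNReal.add_lt_top.2 ⟨?_, ?_⟩)
      · rw [← sobolevEnergyW_inv]; exact hE
      · exact (hgr n).trans_lt (ENNReal.mul_lt_top ENNReal.ofReal_lt_top hL)
  -- compact sets
  set K := tsupport (χ n) with hKdef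
  have hK : IsCompact K := hχc n
  obtain ⟨δ, hδ, hδU⟩ := hK.exists_cthickening_subset_open hM.isOpen (hχs n)
  set K' := cthickening δ K with hK'def
  have hK' : IsCompact K' := hK.cthickening
  have hKK' : K ⊆ K' := self_subset_cthickening K
  have hσK : ContinuousOn (fun z => σ z ^ p * (σ z ^ 2)⁻¹) K' := by
    have h1 := hM.scale_cont.mono hδU
    refine (h1.rpow_const fun z hz => Or.inr hp0.le).mul ((h1.pow 2).inv₀ fun z hz => ?_)
    have := hM.scale_pos z (hδU hz)
    exact pow_ne_zero 2 this.ne'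
  obtain ⟨M, hM'⟩ := hK'.exists_bound_of_continuousOn hσK
  have hσK2 : ContinuousOn (fun z => (σ z ^ p * (σ z ^ 2)⁻¹)⁻¹) K' := hσK.inv₀ fun z hz => by
    have := hM.scale_pos z (hδU hz)
    change σ z ^ p * (σ z ^ 2)⁻¹ ≠ 0
    positivity
  obtain ⟨m, hm⟩ := hK'.exists_bound_of_continuousOn hσK2
  have hw0 : ∀ z ∉ K, w z = 0 := fun z hz => by
    simp [hw, image_eq_zero_of_notMem_tsupport hz]
  have hw'0 : ∀ z ∉ K, w' z = 0 := fun z hz => by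
    ext e
    simp [hw', image_eq_zero_of_notMem_tsupport hz, fderiv_of_notMem_tsupport ℝ hz]
  have hLp : ∀ e, MemLp (fun z => w' z e) (ENNReal.ofReal p) volume := fun e => by
    refine ⟨(locallyIntegrableOn_univ.1 (hww.2.1 e)).aestronglyMeasurable, ?_⟩
    rw [eLpNorm_lt_top_iff_lintegral_rpow_enorm_lt_top (by simpa using hp0) ENNReal.ofReal_ne_top,
      ENNReal.toReal_ofReal hp0.le]
    have e1 : ∫⁻ z, ‖w' z e‖ₑ ^ p = ∫⁻ z in U, ‖w' z e‖ₑ ^ p := by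
      rw [← lintegral_indicator hms]
      refine lintegral_congr fun z => ?_
      by_cases hz : z ∈ U
      · rw [indicator_of_mem hz]
      · rw [indicator_of_notMem hz, hw'0 z fun h => hz (hχs n h)]
        simp [hp0]
    rw [e1]
    refine lt_of_le_of_lt ?_ (ENNReal.mul_lt_top (a := ENNReal.ofReal ((2 * ‖e‖) ^ p * |m|))
      ENNReal.ofReal_lt_top hE2)
    rw [sobolevEnergyW_inv, ← lintegral_const_mul' _ _ ENNReal.ofReal_ne_top]
    refine setLIntegral_mono' hms fun z hz => ?_
    by_cases hzK : z ∈ K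
    · have hs := hM.scale_pos z hz
      have hg := gradNormL_nonneg (w' z)
      rw [← ofReal_norm, ENNReal.ofReal_rpow_of_nonneg (norm_nonneg _) hp0.le,
        ← ENNReal.ofReal_mul (by positivity)]
      refine ENNReal.ofReal_le_ofReal ?_
      have h1 : ‖w' z e‖ ≤ (2 * ‖e‖) * gradNormL (w' z) :=
        ((w' z).le_opNorm e).trans (by
          nlinarith [norm_le_gradNormL (w' z), norm_nonneg e])
      have h2 := hm z (hKK' hzK)
      rw [Real.norm_of_nonneg (by positivity)] at h2
      have h3 : 1 ≤ |m| * (σ z ^ p * (σ z ^ 2)⁻¹) := by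
        rw [← div_le_iff₀ (by positivity), one_div]
        exact h2.trans (le_abs_self m)
      calc ‖w' z e‖ ^ p ≤ ((2 * ‖e‖) * gradNormL (w' z)) ^ p := by gcongr
        _ = (2 * ‖e‖) ^ p * gradNormL (w' z) ^ p * 1 := by
          rw [Real.mul_rpow (by positivity) hg, mul_one]
        _ ≤ (2 * ‖e‖) ^ p * gradNormL (w' z) ^ p * (|m| * (σ z ^ p * (σ z ^ 2)⁻¹)) := by gcongr
        _ = _ := by rw [Real.mul_rpow hg hs.le]; ring
    · rw [hw'0 z hzK]; simp [hp0]
  set e₁ : ℝ≥0∞ := e₀ / (P * (ENNReal.ofReal |M| + 1) * 2) with he₁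
  have hPM : P * (ENNReal.ofReal |M| + 1) * 2 ≠ ⊤ := by finiteness
  have he₁0 : 0 < e₁ := ENNReal.div_pos he₀0.ne' hPM
  obtain ⟨ψ, hψ, hψc, hψs, h1, hI⟩ := exists_test_close hp hww hLp hK hw0 hδ he₁0
  refine ⟨ψ, hψ, hψc, hψs.trans hδU, ?_⟩
  have hψd : Continuous (fderiv ℝ ψ) := hψ.continuous_fderiv (by simp)
  have hmw : ∀ e, AEMeasurable (fun z => ‖(w' z - fderiv ℝ ψ z) e‖) (volume.restrict U) := fun e =>
    ((hLp e).1.sub (hψd.clm_apply continuous_const).aestronglyMeasurable).norm.aemeasurable.restrict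
  have hE3 : sobolevEnergyW p (fun z => (σ z)⁻¹) (fun z => w' z - fderiv ℝ ψ z) U ≤ e₀ := by
    have bd : ∀ e, ∫⁻ z, ‖w' z e - fderiv ℝ ψ z e‖ₑ ^ p ≤ e₁ →
        ∫⁻ z in U, ENNReal.ofReal ((‖(w' z - fderiv ℝ ψ z) e‖ * σ z) ^ p * (σ z ^ 2)⁻¹) ≤
          (ENNReal.ofReal |M| + 1) * e₁ := fun e he => by
      refine le_trans ?_ (mul_le_mul_right (he) (ENNReal.ofReal |M| + 1))
      rw [← lintegral_const_mul' _ _ (by finiteness)]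
      refine le_trans (setLIntegral_mono' hms fun z hz => ?_) (setLIntegral_le_lintegral U _)
      have hs := hM.scale_pos z hz
      by_cases hzK : z ∈ K'
      · have h2 := hM' z hzK
        rw [Real.norm_of_nonneg (by positivity)] at h2
        refine le_trans ?_ (mul_le_mul_left (le_self_add) _)
        rw [← ofReal_norm, ENNReal.ofReal_rpow_of_nonneg (norm_nonneg _) hp0.le,
          ← ENNReal.ofReal_mul (by positivity)]
        refine ENNReal.ofReal_le_ofReal ?_
        rw [Real.mul_rpow (by positivity) hs.le, mul_assoc, mul_comm, _root_.sub_apply]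
        gcongr
        exact h2.trans (le_abs_self M)
      · have h3 : fderiv ℝ ψ z = 0 := fderiv_of_notMem_tsupport ℝ fun h => hzK (hψs h)
        rw [hw'0 z fun h => hzK (hKK' h), h3]
        simp [Real.zero_rpow hp0.ne']
    refine (hM.energy_le_add hp (a := fun z => ‖(w' z - fderiv ℝ ψ z) 1‖)
      (b := fun z => ‖(w' z - fderiv ℝ ψ z) I‖) (fun _ => norm_nonneg _) (fun _ => norm_nonneg _)
      (fun z _ => gradNormL_le_add _) (hmw 1)).trans ?_
    calc _ ≤ P * ((ENNReal.ofReal |M| + 1) * e₁ + (ENNReal.ofReal |M| + 1) * e₁) := by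
          rw [← hP]
          gcongr
          exacts [bd 1 h1, bd I hI]
      _ = (P * (ENNReal.ofReal |M| + 1) * 2) * e₁ := by ring
      _ ≤ e₀ := by rw [he₁]; exact ENNReal.mul_div_le
  have hmvw : AEMeasurable (fun z => gradNormL (v' z - w' z)) (volume.restrict U) :=
    aemeasurable_gradNormL fun e => (hv.2.1 e).sub ((hww.2.1 e).mono_set (subset_univ U))
  have hfin : sobolevEnergyW p (fun z => (σ z)⁻¹) (fun z => v' z - fderiv ℝ ψ z) U ≤
      P * (P * e₀ + e₀) := by
    refine (hM.energy_le_add hp (a := fun z => gradNormL (v' z - w' z))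
      (b := fun z => gradNormL (w' z - fderiv ℝ ψ z)) (fun _ => gradNormL_nonneg _)
      (fun _ => gradNormL_nonneg _) (fun z _ => ?_) hmvw).trans ?_
    · rw [← sub_add_sub_cancel (v' z) (w' z) (fderiv ℝ ψ z)]
      exact gradNormL_triangle _ _
    · rw [← hP, ← sobolevEnergyW_inv, ← sobolevEnergyW_inv p σ]
      gcongr
  refine hfin.trans_lt ?_
  have hPpos : 0 < P := ENNReal.rpow_pos (by norm_num) ENNReal.ofNat_ne_top
  have h4 : P * (P * e₀ + e₀) * 4 ≤ ENNReal.ofReal ε := by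
    calc P * (P * e₀ + e₀) * 4 = (P * (P + 1) * 4) * e₀ := by ring
      _ ≤ _ := by rw [he₀]; exact ENNReal.mul_div_le
  have h5 : P * (P * e₀ + e₀) ≤ ENNReal.ofReal (ε / 4) := by
    rw [ENNReal.ofReal_div_of_pos (by norm_num), ENNReal.le_div_iff_mul_le (by simp) (by simp)]
    simpa using h4
  exact h5.trans_lt ((ENNReal.ofReal_lt_ofReal_iff hε).2 (by linarith))

/-- The direct sum decomposition of the weighted Sobolev space of density `ρ` on `Ω` into its
harmonic part and the closure of the test functions. -/
def HasDecomposition (p : ℝ) (ρ : ℂ → ℝ) (Ω : Set ℂ) : Prop :=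
  ∃ C : ℝ≥0∞, 0 < C ∧ C < ⊤ ∧ ∀ (f : ℂ → ℂ) (f' : ℂ → ℂ →L[ℝ] ℂ), HasWeakFDerivOn f f' Ω →
    sobolevEnergyW p ρ f' Ω < ⊤ → ∃ hF : ℂ → ℂ, MemHD p ρ hF Ω ∧
      dirichletEnergy p ρ hF Ω ≤ C * sobolevEnergyW p ρ f' Ω ∧
      ApproxByTest p ρ (fun z => f' z - fderiv ℝ hF z) Ω ∧
      ∀ hF₂ : ℂ → ℂ, MemHD p ρ hF₂ Ω →
        ApproxByTest p ρ (fun z => f' z - fderiv ℝ hF₂ z) Ω → ∃ c : ℂ, ∀ z ∈ Ω, hF₂ z = hF z + c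

lemma IsModel.energy_sub_le {U : Set ℂ} {σ y : ℂ → ℝ} (hM : IsModel U σ y) {p : ℝ} (hp : 1 < p)
    {a' b' c' : ℂ → ℂ →L[ℝ] ℂ} (h : ∀ z ∈ U, c' z = a' z - b' z)
    (hm : ∀ v : ℂ, LocallyIntegrableOn (fun z => a' z v) U volume) :
    sobolevEnergyW p (fun z => (σ z)⁻¹) c' U ≤ 2 ^ (p - 1) *
      (sobolevEnergyW p (fun z => (σ z)⁻¹) a' U + sobolevEnergyW p (fun z => (σ z)⁻¹) b' U) := by
  rw [sobolevEnergyW_inv p σ a', sobolevEnergyW_inv p σ b']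
  refine hM.energy_le_add hp (fun _ => gradNormL_nonneg _) (fun _ => gradNormL_nonneg _)
    (fun z hz => ?_) (aemeasurable_gradNormL hm)
  rw [h z hz, sub_eq_add_neg]
  refine (gradNormL_triangle _ _).trans (add_le_add le_rfl (le_of_eq ?_))
  simp [gradNormL]

lemma sobolevEnergyW_congr {p : ℝ} {ρ : ℂ → ℝ} {f' g' : ℂ → ℂ →L[ℝ] ℂ} {U : Set ℂ}
    (hU : MeasurableSet U) (h : ∀ z ∈ U, f' z = g' z) :
    sobolevEnergyW p ρ f' U = sobolevEnergyW p ρ g' U :=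
  setLIntegral_congr_fun hU fun z hz => by simp only [h z hz]

lemma IsHarmonicOn.hasWeakFDerivOn {h : ℂ → ℂ} {U : Set ℂ} (hU : IsOpen U)
    (hh : IsHarmonicOn h U) : HasWeakFDerivOn h (fderiv ℝ h) U :=
  hasWeakFDerivOn_of_contDiffOn hU (hh.1.of_le (by norm_num))

lemma hasWeakFDerivOn_of_contDiff {ψ : ℂ → ℂ} (U : Set ℂ) (hU : IsOpen U)
    (hψ : ContDiff ℝ (⊤ : ℕ∞) ψ) : HasWeakFDerivOn ψ (fderiv ℝ ψ) U :=
  hasWeakFDerivOn_of_contDiffOn hU ((hψ.of_le (by simp)).contDiffOn)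

lemma IsModel.eq_const_of_energy_eq_zero {U : Set ℂ} {σ y : ℂ → ℝ} (hM : IsModel U σ y) {p : ℝ}
    (hp : 1 < p) {k : ℂ → ℂ} (hk : IsHarmonicOn k U)
    (hE : dirichletEnergy p (fun z => (σ z)⁻¹) k U = 0) : ∃ c, ∀ z ∈ U, k z = c := by
  have hp0 : 0 < p := by linarith
  have hU := hM.isOpen
  have hcont : ContinuousOn (fderiv ℝ k) U := hk.1.continuousOn_fderiv_of_isOpen hU (by norm_num)
  have hw := hk.hasWeakFDerivOn hU
  have hm : AEMeasurable (fun z => ENNReal.ofReal ((gradNormL (fderiv ℝ k z) * σ z) ^ p *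
      (σ z ^ 2)⁻¹)) (volume.restrict U) :=
    (((aemeasurable_gradNormL hw.2.1).mul
      (hM.scale_cont.aestronglyMeasurable hU.measurableSet).aemeasurable).pow_const p).mul
      hM.aemeasurable_scale |>.ennreal_ofReal
  rw [dirichletEnergy_eq, sobolevEnergyW_inv, lintegral_eq_zero_iff' hm] at hE
  have hz : EqOn (fderiv ℝ k) (fun _ => 0) U := by
    refine Measure.eqOn_open_of_ae_eq (μ := volume) ?_ hU hcont continuousOn_const
    filter_upwards [hE, ae_restrict_mem hU.measurableSet] with z h1 hz
    have hs := hM.scale_pos z hz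
    have hg := gradNormL_nonneg (fderiv ℝ k z)
    rw [Pi.zero_apply, ENNReal.ofReal_eq_zero] at h1
    have h2 : gradNormL (fderiv ℝ k z) = 0 := by
      by_contra hne
      have : 0 < gradNormL (fderiv ℝ k z) := lt_of_le_of_ne hg (Ne.symm hne)
      have : 0 < (gradNormL (fderiv ℝ k z) * σ z) ^ p * (σ z ^ 2)⁻¹ := by positivity
      linarith
    have := norm_le_gradNormL (fderiv ℝ k z)
    rw [h2, mul_zero] at this
    exact norm_le_zero_iff.1 this
  exact hU.exists_is_const_of_fderiv_eq_zero (𝕜 := ℝ) hM.preconn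
    (fun z hz => (hk.differentiableAt hU hz).differentiableWithinAt) hz

lemma IsModel.hasDecomposition {U : Set ℂ} {σ y : ℂ → ℝ} (hM : IsModel U σ y) {p : ℝ}
    (hp : 1 < p) : HasDecomposition p (fun z => (σ z)⁻¹) U := by
  obtain ⟨C, hC, hcore⟩ := hM.core hp
  have hp0 : 0 < p := by linarith
  have hU := hM.isOpen
  have hms := hU.measurableSet
  set P : ℝ≥0∞ := 2 ^ (p - 1) with hP
  have hPtop : P ≠ ⊤ := ENNReal.rpow_ne_top_of_nonneg (by linarith) ENNReal.ofNat_ne_top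
  refine ⟨C + 1, by simp, ENNReal.add_lt_top.2 ⟨hC, by simp⟩, fun f f' hf hE => ?_⟩
  obtain ⟨h, hh, hd, hL⟩ := hcore f f' hf hE
  have hhE : dirichletEnergy p (fun z => (σ z)⁻¹) h U < ⊤ :=
    hd.trans_lt (ENNReal.mul_lt_top hC hE)
  have hwd := hf.sub (hh.hasWeakFDerivOn hU)
  refine ⟨h, ⟨hh, hhE⟩, hd.trans (mul_le_mul_left le_self_add _), ?_, ?_⟩
  · refine hM.approx hp hwd ?_ hL
    refine (hM.energy_sub_le hp (fun _ _ => rfl) hf.2.1).trans_lt ?_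
    exact ENNReal.mul_lt_top hPtop.lt_top (ENNReal.add_lt_top.2 ⟨hE, hhE⟩)
  · intro h₂ hh₂ hA₂
    have hA : ApproxByTest p (fun z => (σ z)⁻¹) (fun z => f' z - fderiv ℝ h z) U := by
      refine hM.approx hp hwd ?_ hL
      refine (hM.energy_sub_le hp (fun _ _ => rfl) hf.2.1).trans_lt ?_
      exact ENNReal.mul_lt_top hPtop.lt_top (ENNReal.add_lt_top.2 ⟨hE, hhE⟩)
    have hk : IsHarmonicOn (fun z => h₂ z - h z) U := hh₂.1.sub hU hh
    have hkd : ∀ z ∈ U, fderiv ℝ (fun z => h₂ z - h z) z = fderiv ℝ h₂ z - fderiv ℝ h z :=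
      fun z hz => fderiv_fun_sub (hh₂.1.differentiableAt hU hz) (hh.differentiableAt hU hz)
    have key : ∀ ε : ℝ, 0 < ε → dirichletEnergy p (fun z => (σ z)⁻¹) (fun z => h₂ z - h z) U ≤
        C * (P * 2) * ENNReal.ofReal ε := fun ε hε => by
      obtain ⟨ψ₁, hψ₁, hψ₁c, hψ₁s, hψ₁E⟩ := hA ε hε
      obtain ⟨ψ₂, hψ₂, hψ₂c, hψ₂s, hψ₂E⟩ := hA₂ ε hε
      set ψ : ℂ → ℂ := fun z => ψ₁ z - ψ₂ z with hψdef
      have hψ : ContDiff ℝ (⊤ : ℕ∞) ψ := hψ₁.sub hψ₂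
      have hψc : HasCompactSupport ψ := hψ₁c.sub hψ₂c
      have hψd : ∀ z, fderiv ℝ ψ z = fderiv ℝ ψ₁ z - fderiv ℝ ψ₂ z := fun z =>
        fderiv_fun_sub (hψ₁.differentiable (by simp) z) (hψ₂.differentiable (by simp) z)
      have hw₁ : HasWeakFDerivOn _ _ U :=
        (hk.hasWeakFDerivOn hU).sub (hasWeakFDerivOn_of_contDiff U hU hψ)
      have hE1 : sobolevEnergyW p (fun z => (σ z)⁻¹)
          (fun z => fderiv ℝ (fun z => h₂ z - h z) z - fderiv ℝ ψ z) U ≤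
          P * (ENNReal.ofReal ε + ENNReal.ofReal ε) := by
        refine (hM.energy_sub_le hp (a' := fun z => f' z - fderiv ℝ h z - fderiv ℝ ψ₁ z)
          (b' := fun z => f' z - fderiv ℝ h₂ z - fderiv ℝ ψ₂ z) (fun z hz => ?_)
          (hwd.sub (hasWeakFDerivOn_of_contDiff U hU hψ₁)).2.1).trans ?_
        · rw [hkd z hz, hψd]; abel
        · gcongr
      obtain ⟨g, hg, hgd, hgL⟩ := hcore _ _ hw₁ (hE1.trans_lt (by finiteness))
      have hψL : ∫⁻ z in U, ENNReal.ofReal (‖ψ z‖ ^ p * (σ z ^ 2)⁻¹) < ⊤ := by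
        have hK : IsCompact (tsupport ψ) := hψc
        have hKU : tsupport ψ ⊆ U := (tsupport_sub _ _).trans (union_subset hψ₁s hψ₂s)
        have hc : ContinuousOn (fun z => ‖ψ z‖ ^ p * (σ z ^ 2)⁻¹) (tsupport ψ) := by
          refine (hψ.continuous.norm.continuousOn.rpow_const fun z hz => Or.inr hp0.le).mul
            (((hM.scale_cont.mono hKU).pow 2).inv₀ fun z hz => ?_)
          exact pow_ne_zero 2 (hM.scale_pos z (hKU hz)).ne'
        have h1 : IntegrableOn (fun z => ‖ψ z‖ ^ p * (σ z ^ 2)⁻¹) (tsupport ψ) :=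
          hc.integrableOn_compact hK
        refine lt_of_le_of_lt ?_ h1.lintegral_lt_top
        rw [← lintegral_indicator (isClosed_tsupport ψ).measurableSet]
        refine (setLIntegral_le_lintegral U _).trans (lintegral_mono fun z => ?_)
        by_cases hz : z ∈ tsupport ψ
        · rw [indicator_of_mem hz]
        · simp [image_eq_zero_of_notMem_tsupport hz, Real.zero_rpow hp0.ne']
      have hkg : ∫⁻ z in U, ENNReal.ofReal (‖(h₂ z - h z) - g z‖ ^ p * (σ z ^ 2)⁻¹) < ⊤ := by
        refine (lintegral_add_rpow_le hp (a := fun z => ‖h₂ z - h z - ψ z - g z‖)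
          (b := fun z => ‖ψ z‖) (Eventually.of_forall fun z => by positivity)
          (Eventually.of_forall fun _ => norm_nonneg _)
          (Eventually.of_forall fun _ => norm_nonneg _)
          (Eventually.of_forall fun _ => norm_nonneg _)
          (Eventually.of_forall fun z => ?_) ?_).trans_lt
          (ENNReal.mul_lt_top hPtop.lt_top (ENNReal.add_lt_top.2 ⟨hgL, hψL⟩))
        · refine le_trans (le_of_eq ?_) (norm_add_le _ _)
          congr 1; ring
        · refine AEMeasurable.ennreal_ofReal (AEMeasurable.mul ?_ hM.aemeasurable_scale)
          exact ((hw₁.1.aestronglyMeasurable.sub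
            (hg.1.continuousOn.aestronglyMeasurable hms)).norm.aemeasurable).pow_const p
      obtain ⟨c, hc⟩ := hM.liouville hp (hk.sub hU hg) hkg
      have hfe : dirichletEnergy p (fun z => (σ z)⁻¹) (fun z => h₂ z - h z) U =
          dirichletEnergy p (fun z => (σ z)⁻¹) g U := by
        rw [dirichletEnergy_eq, dirichletEnergy_eq]
        refine sobolevEnergyW_congr hms fun z hz => ?_
        have h1 : (fun w => h₂ w - h w) =ᶠ[𝓝 z] fun w => g w + c := by
          filter_upwards [hU.mem_nhds hz] with w hw
          rw [← hc w hw]; ring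
        rw [h1.fderiv_eq, fderiv_add_const]
      rw [hfe]
      refine hgd.trans ?_
      calc _ ≤ C * (P * (ENNReal.ofReal ε + ENNReal.ofReal ε)) := by gcongr
        _ = _ := by ring
    have hzero : dirichletEnergy p (fun z => (σ z)⁻¹) (fun z => h₂ z - h z) U = 0 := by
      have ht : Tendsto (fun ε : ℝ => C * (P * 2) * ENNReal.ofReal ε) (𝓝[>] 0) (𝓝 0) := by
        have h1 := ENNReal.tendsto_ofReal (tendsto_id.mono_left
          (nhdsWithin_le_nhds : 𝓝[>] (0 : ℝ) ≤ 𝓝 0))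
        have := ENNReal.Tendsto.const_mul (a := C * (P * 2)) h1
          (Or.inr (by finiteness))
        simpa using this
      exact le_antisymm (ge_of_tendsto ht (by
        filter_upwards [self_mem_nhdsWithin] with ε hε using key ε hε)) zero_le
    obtain ⟨c, hc⟩ := hM.eq_const_of_energy_eq_zero hp hk hzero
    exact ⟨c, fun z hz => by rw [← hc z hz]; ring⟩

lemma SchurLeft.congr {U : Set ℂ} (hU : MeasurableSet U) {σ x x' : ℂ → ℝ} (h : SchurLeft U σ x)
    (hx : ∀ z ∈ U, x z = x' z) : SchurLeft U σ x' := by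
  intro s h0 h1
  obtain ⟨C, hC, hb⟩ := h s h0 h1
  refine ⟨C, hC, ?_⟩
  filter_upwards [hb] with z hz hzU
  rw [← hx z hzU, ← setLIntegral_congr_fun hU fun w hw => by rw [← hx w hw]]
  exact hz hzU

lemma SchurRight.congr {U : Set ℂ} (hU : MeasurableSet U) {σ x x' : ℂ → ℝ} (h : SchurRight U σ x)
    (hx : ∀ z ∈ U, x z = x' z) : SchurRight U σ x' := by
  intro s h0 h1
  obtain ⟨C, hC, hb⟩ := h s h0 h1
  refine ⟨C, hC, ?_⟩
  filter_upwards [hb] with w hw hwU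
  rw [← hx w hwU, ← setLIntegral_congr_fun hU fun z hz => by rw [← hx z hz]]
  exact hw hwU

lemma diskX_pos {z : ℂ} (hz : z ∈ ball (0 : ℂ) 1) : 0 < diskX z := by
  rw [mem_ball_zero_iff] at hz
  have := norm_nonneg z
  simp only [diskX]
  nlinarith

lemma contDiff_diskX {n : WithTop ℕ∞} : ContDiff ℝ n diskX :=
  contDiff_const.sub (contDiff_norm_sq ℝ)

lemma isModel_disk : IsModel (ball (0 : ℂ) 1) diskX (fun z => Real.log (diskX z)) := by
  refine ⟨isOpen_ball, (convex_ball _ _).isPreconnected, subset_rfl,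
    (contDiff_diskX (n := 0)).continuous.continuousOn, fun z hz => diskX_pos hz,
    ⟨1, one_pos, fun z _ => by simp [diskX]⟩,
    fun z hz => ((contDiff_diskX.contDiffAt).log (diskX_pos hz).ne').contDiffWithinAt,
    ⟨2, two_pos, fun z hz => ?_⟩, fun n => ?_, ?_, ?_⟩
  · have hp := diskX_pos hz
    have h1 : HasFDerivAt diskX (-(2 • innerSL ℝ z)) z :=
      (hasStrictFDerivAt_norm_sq z).hasFDerivAt.const_sub 1
    have hz' : ‖z‖ < 1 := by simpa using hz
    rw [(h1.log hp.ne').fderiv, norm_smul, norm_neg, norm_inv, Real.norm_of_nonneg hp.le,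
      mul_comm, ← mul_assoc, mul_inv_cancel₀ hp.ne', one_mul]
    refine (norm_nsmul_le).trans ?_
    rw [innerSL_apply_norm]
    simp
    linarith
  · have e : {z | z ∈ ball (0 : ℂ) 1 ∧ |Real.log (diskX z)| ≤ n} =
        closedBall 0 1 ∩ {z | Real.exp (-n) ≤ diskX z ∧ diskX z ≤ Real.exp n} := by
      ext z
      simp only [mem_ofPred_eq, mem_inter_iff, mem_closedBall_zero_iff]
      constructor
      · rintro ⟨hz, h⟩
        have hp := diskX_pos hz
        rw [abs_le] at h
        exact ⟨(mem_ball_zero_iff.1 hz).le, (Real.le_log_iff_exp_le hp).1 h.1,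
          (Real.log_le_iff_le_exp hp).1 h.2⟩
      · rintro ⟨hz, h1, h2⟩
        have hp : 0 < diskX z := (Real.exp_pos _).trans_le h1
        refine ⟨?_, abs_le.2 ⟨(Real.le_log_iff_exp_le hp).2 h1, (Real.log_le_iff_le_exp hp).2 h2⟩⟩
        rw [mem_ball_zero_iff]
        have := norm_nonneg z
        simp only [diskX] at hp
        nlinarith
    rw [e]
    refine (isCompact_closedBall _ _).inter_right ?_
    have hc := (contDiff_diskX (n := 0)).continuous
    exact (isClosed_le continuous_const hc).inter (isClosed_le hc continuous_const)
  · exact disk_schurLeft.congr measurableSet_ball fun z hz => (Real.exp_log (diskX_pos hz)).symm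
  · exact disk_schurRight.congr measurableSet_ball fun z hz => (Real.exp_log (diskX_pos hz)).symm

lemma exp_image_leftHalf : Complex.exp '' {w : ℂ | w.re < 0} = ball (0 : ℂ) 1 \ {0} := by
  ext z
  constructor
  · rintro ⟨w, hw, rfl⟩
    refine ⟨?_, Complex.exp_ne_zero w⟩
    rw [mem_ball_zero_iff, Complex.norm_exp]
    exact Real.exp_lt_one_iff.2 hw
  · rintro ⟨h1, h2⟩
    refine ⟨Complex.log z, ?_, Complex.exp_log h2⟩
    rw [mem_ofPred_eq, Complex.log_re]
    exact Real.log_neg (norm_pos_iff.2 h2) (mem_ball_zero_iff.1 h1)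

lemma isModel_punct :
    IsModel (ball (0 : ℂ) 1 \ {0}) punctSigma (fun z => Real.log (punctX z)) := by
  have hop : IsOpen (ball (0 : ℂ) 1 \ {0}) := isOpen_ball.sdiff isClosed_singleton
  have hsm : ∀ z : ℂ, z ≠ 0 → ContDiffAt ℝ (⊤ : ℕ∞) punctX z := fun z hz =>
    ((contDiffAt_norm ℝ hz).log (norm_ne_zero_iff.2 hz)).neg
  refine ⟨hop, ?_, Set.sdiff_subset, fun z hz => ?_, fun z hz => ?_, ⟨1, one_pos, fun z hz => ?_⟩,
    fun z hz => ((hsm z hz.2).log (punctX_pos hz).ne').contDiffWithinAt,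
    ⟨1, one_pos, fun z hz => ?_⟩, fun n => ?_, ?_, ?_⟩
  · rw [← exp_image_leftHalf]
    refine (Convex.isPreconnected ?_).image _ Complex.continuous_exp.continuousOn
    exact convex_halfSpace_re_lt 0
  · exact (continuous_norm.continuousAt.mul (hsm z hz.2).continuousAt).continuousWithinAt
  · exact mul_pos (norm_pos_iff.2 hz.2) (punctX_pos hz)
  · have h0 : 0 < ‖z‖ := norm_pos_iff.2 hz.2
    have h1 : ‖z‖ < 1 := mem_ball_zero_iff.1 hz.1
    have h2 := Real.one_sub_inv_le_log_of_pos h0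
    simp only [punctSigma, punctX]
    have h3 : ‖z‖ * -Real.log ‖z‖ ≤ ‖z‖ * (‖z‖⁻¹ - 1) := by
      apply mul_le_mul_of_nonneg_left _ h0.le; linarith
    rw [mul_sub, mul_inv_cancel₀ h0.ne'] at h3
    nlinarith
  · have h0 : 0 < ‖z‖ := norm_pos_iff.2 hz.2
    have hp := punctX_pos hz
    have hd : DifferentiableAt ℝ (fun z : ℂ => ‖z‖) z :=
      (contDiffAt_norm ℝ hz.2 (n := 1)).differentiableAt (by norm_num)
    have h1 : HasFDerivAt punctX (-((‖z‖)⁻¹ • fderiv ℝ (fun z : ℂ => ‖z‖) z)) z :=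
      (hd.hasFDerivAt.log h0.ne').neg
    rw [(h1.log hp.ne').fderiv, norm_smul, norm_neg, norm_smul, norm_inv, norm_inv, norm_norm,
      Real.norm_of_nonneg hp.le, punctSigma]
    have h2 : ‖fderiv ℝ (fun z : ℂ => ‖z‖) z‖ ≤ 1 := by
      have := norm_fderiv_le_of_lipschitz ℝ (f := fun z : ℂ => ‖z‖) (x₀ := z) lipschitzWith_one_norm
      simpa using this
    calc (punctX z)⁻¹ * (‖z‖⁻¹ * ‖fderiv ℝ (fun z : ℂ => ‖z‖) z‖) * (‖z‖ * punctX z)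
        = (punctX z)⁻¹ * punctX z * (‖z‖⁻¹ * ‖z‖) * ‖fderiv ℝ (fun z : ℂ => ‖z‖) z‖ := by ring
      _ ≤ 1 := by rw [inv_mul_cancel₀ hp.ne', inv_mul_cancel₀ h0.ne']; simpa using h2
  · have e : {z | z ∈ ball (0 : ℂ) 1 \ {0} ∧ |Real.log (punctX z)| ≤ n} =
        closedBall 0 1 ∩ {z | Real.exp (-Real.exp n) ≤ ‖z‖ ∧
          ‖z‖ ≤ Real.exp (-Real.exp (-n))} := by
      ext z
      simp only [mem_ofPred_eq, mem_inter_iff, mem_closedBall_zero_iff]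
      constructor
      · rintro ⟨hz, h⟩
        have hp := punctX_pos hz
        have h0 : 0 < ‖z‖ := norm_pos_iff.2 hz.2
        rw [abs_le] at h
        have h1 := (Real.le_log_iff_exp_le hp).1 h.1
        have h2 := (Real.log_le_iff_le_exp hp).1 h.2
        simp only [punctX] at h1 h2
        exact ⟨(mem_ball_zero_iff.1 hz.1).le, (Real.le_log_iff_exp_le h0).1 (by linarith),
          (Real.log_le_iff_le_exp h0).1 (by linarith)⟩
      · rintro ⟨hz, h1, h2⟩
        have h0 : 0 < ‖z‖ := (Real.exp_pos _).trans_le h1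
        have hlt : ‖z‖ < 1 := h2.trans_lt (Real.exp_lt_one_iff.2 (by simpa using Real.exp_pos (-n)))
        have hzz : z ∈ ball (0 : ℂ) 1 \ {0} := ⟨mem_ball_zero_iff.2 hlt, norm_pos_iff.1 h0⟩
        have hp := punctX_pos hzz
        have h3 := (Real.le_log_iff_exp_le h0).2 h1
        have h4 := (Real.log_le_iff_le_exp h0).2 h2
        refine ⟨hzz, abs_le.2 ⟨(Real.le_log_iff_exp_le hp).2 ?_,
          (Real.log_le_iff_le_exp hp).2 ?_⟩⟩ <;> simp only [punctX] <;> linarith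
    rw [e]
    refine (isCompact_closedBall _ _).inter_right ?_
    exact (isClosed_le continuous_const continuous_norm).inter
      (isClosed_le continuous_norm continuous_const)
  · exact punct_schurLeft.congr hop.measurableSet fun z hz => (Real.exp_log (punctX_pos hz)).symm
  · exact punct_schurRight.congr hop.measurableSet fun z hz => (Real.exp_log (punctX_pos hz)).symm

structure Biholo (φ η : ℂ → ℂ) (U Ω : Set ℂ) : Prop where
  isOpen_left : IsOpen U
  isOpen_right : IsOpen Ω
  diff : DifferentiableOn ℂ φ U
  diff_inv : DifferentiableOn ℂ η Ω
  mapsTo : MapsTo φ U Ω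
  mapsTo_inv : MapsTo η Ω U
  left_inv : ∀ w ∈ U, η (φ w) = w
  right_inv : ∀ z ∈ Ω, φ (η z) = z

lemma Biholo.symm {φ η : ℂ → ℂ} {U Ω : Set ℂ} (h : Biholo φ η U Ω) : Biholo η φ Ω U :=
  ⟨h.isOpen_right, h.isOpen_left, h.diff_inv, h.diff, h.mapsTo_inv, h.mapsTo, h.right_inv,
    h.left_inv⟩

def pullD (φ : ℂ → ℂ) (f' : ℂ → ℂ →L[ℝ] ℂ) (w : ℂ) : ℂ →L[ℝ] ℂ :=
  (f' (φ w)).comp (deriv φ w • (1 : ℂ →L[ℝ] ℂ))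

lemma pullD_apply (φ : ℂ → ℂ) (f' : ℂ → ℂ →L[ℝ] ℂ) (w v : ℂ) :
    pullD φ f' w v = f' (φ w) (deriv φ w * v) := by
  simp [pullD]

lemma clm_apply_re_im (L : ℂ →L[ℝ] ℂ) (v : ℂ) : L v = v.re * L 1 + v.im * L I := by
  have : v = v.re • (1 : ℂ) + v.im • I := by simp
  conv_lhs => rw [this, map_add, map_smul, map_smul]
  simp

lemma det_smul_one (a : ℂ) : |(a • (1 : ℂ →L[ℝ] ℂ)).det| = ‖a‖ ^ 2 := by
  have : ((a • (1 : ℂ →L[ℝ] ℂ) : ℂ →L[ℝ] ℂ) : ℂ →ₗ[ℝ] ℂ) = LinearMap.mul ℝ ℂ a := by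
    ext
    simp
  rw [ContinuousLinearMap.det, this]
  have h2 := Algebra.norm_complex_apply a
  rw [Algebra.norm_apply] at h2
  have e : LinearMap.mul ℝ ℂ a = Algebra.lmul ℝ ℂ a := rfl
  rw [e, h2, Complex.normSq_eq_norm_sq, abs_of_nonneg (by positivity)]

lemma gradNormL_comp_smul (L : ℂ →L[ℝ] ℂ) (a : ℂ) :
    gradNormL (L.comp (a • (1 : ℂ →L[ℝ] ℂ))) = gradNormL L * ‖a‖ := by
  have h1 := clm_apply_re_im L a
  have h2 := clm_apply_re_im L (a * I)
  have : ‖L a‖ ^ 2 + ‖L (a * I)‖ ^ 2 = (‖L 1‖ ^ 2 + ‖L I‖ ^ 2) * ‖a‖ ^ 2 := by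
    rw [h1, h2]
    simp only [← Complex.normSq_eq_norm_sq, Complex.normSq_apply]
    simp
    ring
  simp only [gradNormL, ContinuousLinearMap.comp_apply, _root_.smul_apply,
    one_apply_eq_self, smul_eq_mul, mul_one]
  rw [this, Real.sqrt_mul (by positivity), Real.sqrt_sq (norm_nonneg _)]

namespace Biholo

variable {φ η : ℂ → ℂ} {U Ω : Set ℂ}

lemma hasDerivAt (h : Biholo φ η U Ω) {w : ℂ} (hw : w ∈ U) : HasDerivAt φ (deriv φ w) w :=
  (h.diff.differentiableAt (h.isOpen_left.mem_nhds hw)).hasDerivAt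

lemma deriv_mul (h : Biholo φ η U Ω) {w : ℂ} (hw : w ∈ U) : deriv η (φ w) * deriv φ w = 1 := by
  have h1 := (h.symm.hasDerivAt (h.mapsTo hw)).comp w (h.hasDerivAt hw)
  have h2 : HasDerivAt (η ∘ φ) 1 w := (hasDerivAt_id w).congr_of_eventuallyEq
    (by filter_upwards [h.isOpen_left.mem_nhds hw] with x hx using h.left_inv x hx)
  exact h1.unique h2

lemma deriv_ne_zero (h : Biholo φ η U Ω) {w : ℂ} (hw : w ∈ U) : deriv φ w ≠ 0 :=
  right_ne_zero_of_mul_eq_one (h.deriv_mul hw)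

lemma injOn (h : Biholo φ η U Ω) : InjOn φ U :=
  fun a ha b hb e => by rw [← h.left_inv a ha, e, h.left_inv b hb]

lemma image_eq (h : Biholo φ η U Ω) : φ '' U = Ω :=
  Subset.antisymm h.mapsTo.image_subset fun z hz => ⟨η z, h.mapsTo_inv hz, h.right_inv z hz⟩

lemma hasFDerivAt (h : Biholo φ η U Ω) {w : ℂ} (hw : w ∈ U) :
    HasFDerivAt φ (deriv φ w • (1 : ℂ →L[ℝ] ℂ)) w :=
  (h.hasDerivAt hw).complexToReal_fderiv

lemma integral_eq (h : Biholo φ η U Ω) (g : ℂ → ℂ) :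
    ∫ z in Ω, g z = ∫ w in U, ‖deriv φ w‖ ^ 2 • g (φ w) := by
  have := integral_image_eq_integral_abs_det_fderiv_smul volume h.isOpen_left.measurableSet
    (fun w hw => (h.hasFDerivAt hw).hasFDerivWithinAt) h.injOn g
  rw [h.image_eq] at this
  simpa only [det_smul_one] using this

lemma lintegral_eq (h : Biholo φ η U Ω) (g : ℂ → ℝ≥0∞) :
    ∫⁻ z in Ω, g z = ∫⁻ w in U, ENNReal.ofReal (‖deriv φ w‖ ^ 2) * g (φ w) := by
  have := lintegral_image_eq_lintegral_abs_det_fderiv_mul volume h.isOpen_left.measurableSet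
    (fun w hw => (h.hasFDerivAt hw).hasFDerivWithinAt) h.injOn g
  rw [h.image_eq] at this
  simpa only [det_smul_one] using this

lemma contDiffOn (h : Biholo φ η U Ω) {n : WithTop ℕ∞} : ContDiffOn ℝ n φ U :=
  (h.diff.contDiffOn h.isOpen_left).restrict_scalars ℝ

lemma contDiffOn_deriv (h : Biholo φ η U Ω) {n : WithTop ℕ∞} : ContDiffOn ℝ n (deriv φ) U :=
  ((h.diff.deriv h.isOpen_left).contDiffOn h.isOpen_left).restrict_scalars ℝ

lemma locallyIntegrableOn_comp (h : Biholo φ η U Ω) {g : ℂ → ℂ} (hg : LocallyIntegrableOn g Ω) :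
    LocallyIntegrableOn (fun w => g (φ w)) U := by
  rw [locallyIntegrableOn_iff h.isOpen_left.isLocallyClosed]
  intro K hKU hK
  have hφK : IsCompact (φ '' K) := hK.image_of_continuousOn (h.diff.continuousOn.mono hKU)
  have hi : IntegrableOn g (φ '' K) :=
    hg.integrableOn_compact_subset ((image_mono hKU).trans h.image_eq.subset) hφK
  rw [integrableOn_image_iff_integrableOn_abs_det_fderiv_smul volume hK.measurableSet
    (fun w hw => (h.hasFDerivAt (hKU hw)).hasFDerivWithinAt) (h.injOn.mono hKU)] at hi
  simp only [det_smul_one] at hi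
  have hc : ContinuousOn (fun w => (‖deriv φ w‖ ^ 2)⁻¹) K := by
    refine ContinuousOn.inv₀ ?_ fun w hw => ?_
    · exact (((h.diff.deriv h.isOpen_left).continuousOn.mono hKU).norm.pow 2)
    · exact pow_ne_zero _ (norm_ne_zero_iff.2 (h.deriv_ne_zero (hKU hw)))
  refine (hi.continuousOn_smul hc hK).congr_fun (fun w hw => ?_) hK.measurableSet
  have := norm_ne_zero_iff.2 (h.deriv_ne_zero (hKU hw))
  simp only [smul_smul]
  rw [inv_mul_cancel₀ (pow_ne_zero _ this), one_smul]

lemma energy_eq (h : Biholo φ η U Ω) (p : ℝ) {ρ ρ' : ℂ → ℝ}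
    (hρ : ∀ w ∈ U, ρ (φ w) * ‖deriv φ w‖ = ρ' w) (f' : ℂ → ℂ →L[ℝ] ℂ) :
    sobolevEnergyW p ρ f' Ω = sobolevEnergyW p ρ' (pullD φ f') U := by
  rw [sobolevEnergyW, h.lintegral_eq, sobolevEnergyW]
  refine setLIntegral_congr_fun h.isOpen_left.measurableSet fun w hw => ?_
  have hn := norm_ne_zero_iff.2 (h.deriv_ne_zero hw)
  rw [← ENNReal.ofReal_mul (by positivity), ← hρ w hw, pullD, gradNormL_comp_smul]
  congr 1
  rw [show gradNormL (f' (φ w)) * ‖deriv φ w‖ * (ρ (φ w) * ‖deriv φ w‖)⁻¹ =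
    gradNormL (f' (φ w)) * (ρ (φ w))⁻¹ by rw [mul_inv]; field_simp]
  ring

lemma pullD_pullD (h : Biholo φ η U Ω) (f' : ℂ → ℂ →L[ℝ] ℂ) {z : ℂ} (hz : z ∈ Ω) :
    pullD η (pullD φ f') z = f' z := by
  ext1 v
  rw [pullD_apply, pullD_apply, h.right_inv z hz, ← mul_assoc]
  have := h.symm.deriv_mul hz
  rw [this, one_mul]

lemma fderiv_comp (h : Biholo φ η U Ω) {f : ℂ → ℂ} {w : ℂ} (hw : w ∈ U)
    (hf : DifferentiableAt ℝ f (φ w)) :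
    fderiv ℝ (fun w => f (φ w)) w = pullD φ (fderiv ℝ f) w :=
  (hf.hasFDerivAt.comp w (h.hasFDerivAt hw)).fderiv

lemma isHarmonicOn_comp (h : Biholo φ η U Ω) {f : ℂ → ℂ} (hf : IsHarmonicOn f Ω) :
    IsHarmonicOn (fun w => f (φ w)) U := by
  refine ⟨hf.1.comp h.contDiffOn h.mapsTo, fun w hw => ?_⟩
  have hfd : ∀ v : ℂ, DifferentiableAt ℝ (fun z => fderiv ℝ f z v) (φ w) := fun v =>
    (((hf.1.contDiffAt (h.isOpen_right.mem_nhds (h.mapsTo hw))).fderiv_right (m := 1)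
      (by norm_num)).clm_apply contDiffAt_const).differentiableAt (by norm_num)
  obtain ⟨b, hb⟩ : ∃ b : ℂ, HasDerivAt (deriv φ) b w :=
    ⟨_, ((h.diff.deriv h.isOpen_left).differentiableAt (h.isOpen_left.mem_nhds hw)).hasDerivAt⟩
  have key : ∀ v : ℂ, fderiv ℝ (fun w => fderiv ℝ (fun w => f (φ w)) w v) w v =
      (deriv φ w * v).re * (fderiv ℝ (fun z => fderiv ℝ f z 1) (φ w) (deriv φ w * v)) +
      (deriv φ w * v).im * (fderiv ℝ (fun z => fderiv ℝ f z I) (φ w) (deriv φ w * v)) +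
      fderiv ℝ f (φ w) (b * v * v) := by
    intro v
    have e : (fun w => fderiv ℝ (fun w => f (φ w)) w v) =ᶠ[𝓝 w] fun w =>
        (deriv φ w * v).re • fderiv ℝ f (φ w) 1 + (deriv φ w * v).im • fderiv ℝ f (φ w) I := by
      filter_upwards [h.isOpen_left.mem_nhds hw] with x hx
      rw [h.fderiv_comp hx ((hf.1.contDiffAt (h.isOpen_right.mem_nhds
        (h.mapsTo hx))).differentiableAt (by norm_num)), pullD_apply, clm_apply_re_im]
      simp
    have hd : HasFDerivAt (fun w => deriv φ w * v) ((b * v) • (1 : ℂ →L[ℝ] ℂ)) w :=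
      (hb.mul_const v).complexToReal_fderiv
    have hre := Complex.reCLM.hasFDerivAt.comp w hd
    have him := Complex.imCLM.hasFDerivAt.comp w hd
    have g1 := (hfd 1).hasFDerivAt.comp w (h.hasFDerivAt hw)
    have g2 := (hfd I).hasFDerivAt.comp w (h.hasFDerivAt hw)
    have := (hre.smul g1).add (him.smul g2)
    rw [e.fderiv_eq]
    refine (congrArg (fun L : ℂ →L[ℝ] ℂ => L v) (HasFDerivAt.fderiv this)).trans ?_
    rw [clm_apply_re_im (fderiv ℝ f (φ w)) (b * v * v)]
    simp
    ring
  rw [key 1, key I]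
  have h0 := hf.2 _ (h.mapsTo hw)
  have h1 : b * I * I = -(b * 1 * 1) := by rw [mul_assoc, I_mul_I]; ring
  rw [h1, map_neg]
  simp only [clm_apply_re_im (fderiv ℝ (fun z => fderiv ℝ f z 1) (φ w)) (_ * _),
    clm_apply_re_im (fderiv ℝ (fun z => fderiv ℝ f z I) (φ w)) (_ * _)]
  simp
  linear_combination (((deriv φ w).re : ℂ) ^ 2 + ((deriv φ w).im : ℂ) ^ 2) * h0

end Biholo

namespace Biholo

variable {φ η : ℂ → ℂ} {U Ω : Set ℂ}

/-- Functions of the form `ψ ∘ η` with `ψ` a test function on `U`, multiplied by a smooth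
function, extend by zero to test functions on `Ω`. -/
lemma exists_test {E : Type*} [NormedAddCommGroup E] [NormedSpace ℝ E] (h : Biholo φ η U Ω)
    {ψ : ℂ → E} (hψ : ContDiff ℝ (⊤ : ℕ∞) ψ) (hc : HasCompactSupport ψ) (hs : tsupport ψ ⊆ U)
    {a : ℂ → ℝ} (ha : ContDiffOn ℝ (⊤ : ℕ∞) a Ω) :
    ∃ θ : ℂ → E, ContDiff ℝ (⊤ : ℕ∞) θ ∧ HasCompactSupport θ ∧ tsupport θ ⊆ Ω ∧
      ∀ z ∈ Ω, θ z = a z • ψ (η z) := by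
  classical
  set K := φ '' tsupport ψ with hK
  have hKc : IsCompact K := hc.isCompact.image_of_continuousOn (h.diff.continuousOn.mono hs)
  have hKΩ : K ⊆ Ω := (image_mono hs).trans h.image_eq.subset
  set θ : ℂ → E := fun z => if z ∈ Ω then a z • ψ (η z) else 0 with hθ
  have h0 : ∀ z, z ∉ K → θ z = 0 := by
    intro z hz
    by_cases hzΩ : z ∈ Ω
    · have : η z ∉ tsupport ψ := fun hh => hz ⟨η z, hh, h.right_inv z hzΩ⟩
      simp only [hθ, if_pos hzΩ]
      rw [image_eq_zero_of_notMem_tsupport this, smul_zero]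
    · simp only [hθ, if_neg hzΩ]
  have hts : tsupport θ ⊆ K := closure_minimal
    (fun z hz => by by_contra hh; exact hz (h0 z hh)) hKc.isClosed
  refine ⟨θ, ?_, hKc.of_isClosed_subset (isClosed_tsupport _) hts, hts.trans hKΩ,
    fun z hz => by simp only [hθ, if_pos hz]⟩
  rw [contDiff_iff_contDiffAt]
  intro z
  by_cases hz : z ∈ Ω
  · have hn := h.isOpen_right.mem_nhds hz
    have e : θ =ᶠ[𝓝 z] fun z => a z • ψ (η z) := by
      filter_upwards [hn] with x hx
      simp only [hθ, if_pos hx]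
    refine ContDiffAt.congr_of_eventuallyEq ?_ e
    exact (ha.contDiffAt hn).smul (hψ.contDiffAt.comp z (h.symm.contDiffOn.contDiffAt hn))
  · have hz' : z ∉ tsupport θ := fun hh => hz (hKΩ (hts hh))
    exact contDiffAt_const.congr_of_eventuallyEq (notMem_tsupport_iff_eventuallyEq.1 hz')

lemma hasWeakFDerivOn (h : Biholo φ η U Ω) {f : ℂ → ℂ} {f' : ℂ → ℂ →L[ℝ] ℂ}
    (hf : HasWeakFDerivOn f f' Ω) : HasWeakFDerivOn (fun w => f (φ w)) (pullD φ f') U := by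
  refine ⟨h.locallyIntegrableOn_comp hf.1, fun v => ?_, fun ψ hψ hc hs v => ?_⟩
  · have hcont : ContinuousOn (fun w => deriv φ w * v) U :=
      (h.diff.deriv h.isOpen_left).continuousOn.mul continuousOn_const
    have e : (fun w => pullD φ f' w v) = fun w => ((deriv φ w * v).re : ℂ) * f' (φ w) 1 +
        ((deriv φ w * v).im : ℂ) * f' (φ w) I := by
      funext w; rw [pullD_apply, clm_apply_re_im]
    rw [e]
    have hlc := h.isOpen_left.isLocallyClosed
    refine LocallyIntegrableOn.add ?_ ?_
    · exact (h.locallyIntegrableOn_comp (hf.2.1 1)).continuousOn_mul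
        (continuous_ofReal.comp_continuousOn (continuous_re.comp_continuousOn hcont)) hlc
    · exact (h.locallyIntegrableOn_comp (hf.2.1 I)).continuousOn_mul
        (continuous_ofReal.comp_continuousOn (continuous_im.comp_continuousOn hcont)) hlc
  · have hηc : ContDiffOn ℝ (⊤ : ℕ∞) (fun z => conj (deriv η z) * v) Ω :=
      (conjCLE.contDiff.comp_contDiffOn h.symm.contDiffOn_deriv).mul contDiffOn_const
    obtain ⟨θ₁, h1, hc1, hs1, e1⟩ := h.exists_test hψ hc hs
      (Complex.reCLM.contDiff.comp_contDiffOn hηc)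
    obtain ⟨θ₂, h2, hc2, hs2, e2⟩ := h.exists_test hψ hc hs
      (Complex.imCLM.contDiff.comp_contDiffOn hηc)
    have A1 := hf.2.2 θ₁ h1 hc1 hs1 1
    have A2 := hf.2.2 θ₂ h2 hc2 hs2 I
    have i1 := integrable_smul_of_tsupport h1.continuous hc1 hs1 (hf.2.1 1)
    have i2 := integrable_smul_of_tsupport h2.continuous hc2 hs2 (hf.2.1 I)
    obtain ⟨d1, dc1, ds1⟩ := test_fderiv h1 hc1 1
    obtain ⟨d2, dc2, ds2⟩ := test_fderiv h2 hc2 I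
    have j1 := integrable_smul_of_tsupport d1 dc1 (ds1.trans hs1) hf.1
    have j2 := integrable_smul_of_tsupport d2 dc2 (ds2.trans hs2) hf.1
    have L : ∫ w in U, ψ w • pullD φ f' w v =
        ∫ z in Ω, (θ₁ z • f' z 1 + θ₂ z • f' z I) := by
      rw [h.symm.integral_eq]
      refine setIntegral_congr_fun h.isOpen_right.measurableSet fun z hz => ?_
      rw [pullD_apply, h.right_inv z hz, e1 z hz, e2 z hz]
      have hd := h.symm.deriv_mul hz
      have e3 : (‖deriv η z‖ ^ 2 : ℝ) • (ψ (η z) • f' z (deriv φ (η z) * v)) =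
          ψ (η z) • f' z (conj (deriv η z) * v) := by
        rw [smul_comm, ← map_smul]
        congr 2
        rw [Complex.real_smul]
        push_cast
        rw [← Complex.mul_conj']
        linear_combination (conj (deriv η z) * v) * hd
      rw [e3, clm_apply_re_im (f' z) (conj (deriv η z) * v)]
      simp
      ring
    have R : ∫ w in U, fderiv ℝ ψ w v • f (φ w) =
        ∫ z in Ω, (fderiv ℝ θ₁ z 1 • f z + fderiv ℝ θ₂ z I • f z) := by
      rw [h.symm.integral_eq]
      refine setIntegral_congr_fun h.isOpen_right.measurableSet fun z hz => ?_
      rw [h.right_inv z hz, ← add_smul, smul_smul]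
      congr 1
      have hn := h.isOpen_right.mem_nhds hz
      obtain ⟨b, hb⟩ : ∃ b : ℂ, HasDerivAt (deriv η) b z :=
        ⟨_, ((h.diff_inv.deriv h.isOpen_right).differentiableAt hn).hasDerivAt⟩
      have hV : HasFDerivAt (fun z => conj (deriv η z) * v)
          (v • ((conjCLE : ℂ →L[ℝ] ℂ).comp (b • (1 : ℂ →L[ℝ] ℂ)))) z :=
        ((conjCLE : ℂ →L[ℝ] ℂ).hasFDerivAt.comp z hb.complexToReal_fderiv).mul_const v
      have hψη := (hψ.differentiable (by simp) (η z)).hasFDerivAt.comp z (h.symm.hasFDerivAt hz)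
      have f1 : HasFDerivAt θ₁ _ z := ((Complex.reCLM.hasFDerivAt.comp z hV).mul hψη)
        |>.congr_of_eventuallyEq (by filter_upwards [hn] with x hx using e1 x hx)
      have f2 : HasFDerivAt θ₂ _ z := ((Complex.imCLM.hasFDerivAt.comp z hV).mul hψη)
        |>.congr_of_eventuallyEq (by filter_upwards [hn] with x hx using e2 x hx)
      rw [f1.fderiv, f2.fderiv]
      have hlin : ∀ c : ℂ, fderiv ℝ ψ (η z) c =
          c.re * fderiv ℝ ψ (η z) 1 + c.im * fderiv ℝ ψ (η z) I := by
        intro c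
        have : c = c.re • (1 : ℂ) + c.im • I := by simp
        conv_lhs => rw [this, map_add, map_smul, map_smul]
        simp
      simp [hlin v, hlin (deriv η z), hlin (deriv η z * I), ← Complex.normSq_eq_norm_sq,
        Complex.normSq_apply]
      ring
    rw [L, R, integral_add i1.integrableOn i2.integrableOn,
      integral_add j1.integrableOn j2.integrableOn, A1, A2, neg_add]

lemma approxByTest (h : Biholo φ η U Ω) {p : ℝ} {ρ ρ' : ℂ → ℝ}
    (hρ : ∀ w ∈ U, ρ (φ w) * ‖deriv φ w‖ = ρ' w) {g' : ℂ → ℂ →L[ℝ] ℂ}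
    (hg : ApproxByTest p ρ g' Ω) : ApproxByTest p ρ' (pullD φ g') U := by
  intro ε hε
  obtain ⟨ψ, hψ, hc, hs, hE⟩ := hg ε hε
  obtain ⟨θ, h1, h2, h3, h4⟩ := h.symm.exists_test hψ hc hs (a := fun _ => 1) contDiffOn_const
  refine ⟨θ, h1, h2, h3, ?_⟩
  rw [h.energy_eq p hρ] at hE
  refine lt_of_eq_of_lt (sobolevEnergyW_congr h.isOpen_left.measurableSet fun w hw => ?_) hE
  have e : θ =ᶠ[𝓝 w] fun w => ψ (φ w) := by
    filter_upwards [h.isOpen_left.mem_nhds hw] with x hx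
    rw [h4 x hx, one_smul]
  rw [e.fderiv_eq, h.fderiv_comp hw (hψ.differentiable (by simp) _)]
  ext1 v
  simp [pullD_apply]

lemma scale_symm (h : Biholo φ η U Ω) {ρ ρ' : ℂ → ℝ}
    (hρ : ∀ w ∈ U, ρ (φ w) * ‖deriv φ w‖ = ρ' w) {z : ℂ} (hz : z ∈ Ω) :
    ρ' (η z) * ‖deriv η z‖ = ρ z := by
  rw [← hρ _ (h.mapsTo_inv hz), h.right_inv z hz, mul_assoc, ← norm_mul, h.symm.deriv_mul hz,
    norm_one, mul_one]

end Biholo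

lemma ApproxByTest.congr {p : ℝ} {ρ : ℂ → ℝ} {g' k' : ℂ → ℂ →L[ℝ] ℂ} {Ω : Set ℂ}
    (hΩ : MeasurableSet Ω) (hg : ApproxByTest p ρ g' Ω) (h : ∀ z ∈ Ω, g' z = k' z) :
    ApproxByTest p ρ k' Ω := fun ε hε => by
  obtain ⟨ψ, h1, h2, h3, h4⟩ := hg ε hε
  exact ⟨ψ, h1, h2, h3, lt_of_eq_of_lt
    (sobolevEnergyW_congr hΩ fun z hz => by rw [h z hz]) h4⟩

namespace Biholo

variable {φ η : ℂ → ℂ} {U Ω : Set ℂ}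

lemma memHD (h : Biholo φ η U Ω) {p : ℝ} {ρ ρ' : ℂ → ℝ}
    (hρ : ∀ w ∈ U, ρ (φ w) * ‖deriv φ w‖ = ρ' w) {f : ℂ → ℂ} (hf : MemHD p ρ f Ω) :
    MemHD p ρ' (fun w => f (φ w)) U ∧
      dirichletEnergy p ρ' (fun w => f (φ w)) U = dirichletEnergy p ρ f Ω := by
  have e : dirichletEnergy p ρ' (fun w => f (φ w)) U = dirichletEnergy p ρ f Ω := by
    rw [dirichletEnergy_eq, dirichletEnergy_eq, h.energy_eq p hρ]
    exact sobolevEnergyW_congr h.isOpen_left.measurableSet fun w hw =>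
      h.fderiv_comp hw (hf.1.differentiableAt h.isOpen_right (h.mapsTo hw))
  exact ⟨⟨h.isHarmonicOn_comp hf.1, e.trans_lt hf.2⟩, e⟩

lemma pullD_sub (h : Biholo φ η U Ω) {k : ℂ → ℂ} (hk : IsHarmonicOn k Ω)
    (f' : ℂ → ℂ →L[ℝ] ℂ) {w : ℂ} (hw : w ∈ U) :
    pullD φ (fun z => f' z - fderiv ℝ k z) w =
      pullD φ f' w - fderiv ℝ (fun w => k (φ w)) w := by
  rw [h.fderiv_comp hw (hk.differentiableAt h.isOpen_right (h.mapsTo hw))]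
  ext1 v
  simp [pullD_apply]

theorem hasDecomposition (h : Biholo φ η U Ω) {p : ℝ} {ρ ρ' : ℂ → ℝ}
    (hρ : ∀ w ∈ U, ρ (φ w) * ‖deriv φ w‖ = ρ' w) (hD : HasDecomposition p ρ' U) :
    HasDecomposition p ρ Ω := by
  obtain ⟨C, hC0, hC, H⟩ := hD
  have hρ' : ∀ z ∈ Ω, ρ' (η z) * ‖deriv η z‖ = ρ z := fun z hz => h.scale_symm hρ hz
  refine ⟨C, hC0, hC, fun f f' hf hE => ?_⟩
  obtain ⟨k, hk, hkE, hkA, hkU⟩ := H _ _ (h.hasWeakFDerivOn hf)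
    (lt_of_eq_of_lt (h.energy_eq p hρ f').symm hE)
  obtain ⟨m1, m2⟩ := h.symm.memHD hρ' hk
  refine ⟨fun z => k (η z), m1, ?_, ?_, fun k₂ hk₂ hA₂ => ?_⟩
  · rw [m2, h.energy_eq p hρ f']
    exact hkE
  · refine (h.symm.approxByTest hρ' hkA).congr h.isOpen_right.measurableSet fun z hz => ?_
    rw [h.symm.pullD_sub hk.1 _ hz, h.pullD_pullD f' hz]
  · obtain ⟨c, hc⟩ := hkU (fun w => k₂ (φ w)) (h.memHD hρ hk₂).1
      ((h.approxByTest hρ hA₂).congr h.isOpen_left.measurableSet fun w hw =>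
        h.pullD_sub hk₂.1 f' hw)
    exact ⟨c, fun z hz => by rw [← hc _ (h.mapsTo_inv hz), h.right_inv z hz]⟩

end Biholo

lemma sobolevEnergyW_le_of_le {p : ℝ} (hp : 0 ≤ p) {ρ ρ' : ℂ → ℝ} {Ω : Set ℂ}
    (hΩ : MeasurableSet Ω) {c : ℝ} (hρ : ∀ z ∈ Ω, 0 < ρ z) (hρ' : ∀ z ∈ Ω, 0 < ρ' z)
    (h1 : ∀ z ∈ Ω, ρ z ≤ c * ρ' z) (h2 : ∀ z ∈ Ω, ρ' z ≤ c * ρ z) (hc : 0 ≤ c)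
    (f' : ℂ → ℂ →L[ℝ] ℂ) :
    sobolevEnergyW p ρ' f' Ω ≤ ENNReal.ofReal (c ^ p * c ^ 2) * sobolevEnergyW p ρ f' Ω := by
  rw [sobolevEnergyW, sobolevEnergyW, ← lintegral_const_mul' _ _ ENNReal.ofReal_ne_top]
  refine setLIntegral_mono' hΩ fun z hz => ?_
  rw [← ENNReal.ofReal_mul (by positivity)]
  refine ENNReal.ofReal_le_ofReal ?_
  have a := hρ z hz
  have b := hρ' z hz
  have g := gradNormL_nonneg (f' z)
  have e1 : (gradNormL (f' z) * (ρ' z)⁻¹) ^ p ≤ c ^ p * (gradNormL (f' z) * (ρ z)⁻¹) ^ p := by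
    rw [← Real.mul_rpow hc (by positivity)]
    refine Real.rpow_le_rpow (by positivity) ?_ hp
    rw [mul_left_comm]
    refine mul_le_mul_of_nonneg_left ?_ g
    rw [inv_eq_one_div, div_le_iff₀ b]
    calc (1 : ℝ) = ρ z * (ρ z)⁻¹ := (mul_inv_cancel₀ a.ne').symm
      _ ≤ (c * ρ' z) * (ρ z)⁻¹ := mul_le_mul_of_nonneg_right (h1 z hz) (by positivity)
      _ = c * (ρ z)⁻¹ * ρ' z := by ring
  have e2 : ρ' z ^ 2 ≤ c ^ 2 * ρ z ^ 2 := by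
    rw [← mul_pow]; exact pow_le_pow_left₀ b.le (h2 z hz) 2
  calc _ ≤ (c ^ p * (gradNormL (f' z) * (ρ z)⁻¹) ^ p) * (c ^ 2 * ρ z ^ 2) :=
        mul_le_mul e1 e2 (by positivity) (by positivity)
    _ = _ := by ring

theorem HasDecomposition.of_comparable {p : ℝ} (hp : 0 ≤ p) {ρ ρ' : ℂ → ℝ} {Ω : Set ℂ}
    (hΩ : MeasurableSet Ω) {c : ℝ} (hρ : ∀ z ∈ Ω, 0 < ρ z) (hρ' : ∀ z ∈ Ω, 0 < ρ' z)
    (h1 : ∀ z ∈ Ω, ρ z ≤ c * ρ' z) (h2 : ∀ z ∈ Ω, ρ' z ≤ c * ρ z) (hc : 0 < c)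
    (hD : HasDecomposition p ρ Ω) : HasDecomposition p ρ' Ω := by
  obtain ⟨C, hC0, hC, H⟩ := hD
  set K : ℝ := c ^ p * c ^ 2 with hK
  have hKpos : 0 < K := by positivity
  have E1 := sobolevEnergyW_le_of_le hp hΩ hρ hρ' h1 h2 hc.le
  have E2 := sobolevEnergyW_le_of_le hp hΩ hρ' hρ h2 h1 hc.le
  rw [← hK] at E1 E2
  have A1 : ∀ g', ApproxByTest p ρ g' Ω → ApproxByTest p ρ' g' Ω := by
    intro g' hg ε hε
    obtain ⟨ψ, a1, a2, a3, a4⟩ := hg (ε / K) (by positivity)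
    refine ⟨ψ, a1, a2, a3, (E1 _).trans_lt ?_⟩
    have := ENNReal.mul_lt_mul_right (a := ENNReal.ofReal K) (by simpa using hKpos)
      ENNReal.ofReal_ne_top a4
    rwa [← ENNReal.ofReal_mul hKpos.le, mul_div_cancel₀ _ hKpos.ne'] at this
  have A2 : ∀ g', ApproxByTest p ρ' g' Ω → ApproxByTest p ρ g' Ω := by
    intro g' hg ε hε
    obtain ⟨ψ, a1, a2, a3, a4⟩ := hg (ε / K) (by positivity)
    refine ⟨ψ, a1, a2, a3, (E2 _).trans_lt ?_⟩
    have := ENNReal.mul_lt_mul_right (a := ENNReal.ofReal K) (by simpa using hKpos)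
      ENNReal.ofReal_ne_top a4
    rwa [← ENNReal.ofReal_mul hKpos.le, mul_div_cancel₀ _ hKpos.ne'] at this
  have hKe : ENNReal.ofReal K ≠ 0 := by simpa using hKpos
  refine ⟨ENNReal.ofReal K * C * ENNReal.ofReal K, ?_, ?_, fun f f' hf hE => ?_⟩
  · exact pos_iff_ne_zero.2 (mul_ne_zero (mul_ne_zero hKe hC0.ne') hKe)
  · finiteness
  obtain ⟨k, hk, hkE, hkA, hkU⟩ := H f f' hf ((E2 f').trans_lt
    (ENNReal.mul_lt_top ENNReal.ofReal_lt_top hE))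
  have m : dirichletEnergy p ρ' k Ω ≤ ENNReal.ofReal K * dirichletEnergy p ρ k Ω := by
    rw [dirichletEnergy_eq, dirichletEnergy_eq]; exact E1 _
  refine ⟨k, ⟨hk.1, m.trans_lt (ENNReal.mul_lt_top ENNReal.ofReal_lt_top hk.2)⟩, ?_, A1 _ hkA,
    fun k₂ hk₂ hA₂ => hkU k₂ ⟨hk₂.1, ?_⟩ (A2 _ hA₂)⟩
  · calc _ ≤ ENNReal.ofReal K * dirichletEnergy p ρ k Ω := m
      _ ≤ ENNReal.ofReal K * (C * (ENNReal.ofReal K * sobolevEnergyW p ρ' f' Ω)) := by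
          refine mul_le_mul_right (hkE.trans (mul_le_mul_right (E2 _) _)) _
      _ = _ := by ring
  · rw [dirichletEnergy_eq]
    exact (E2 _).trans_lt (ENNReal.mul_lt_top ENNReal.ofReal_lt_top hk₂.2)

def hypScales (Ω : Set ℂ) (z : ℂ) : Set ℝ :=
  {r : ℝ | ∃ f : ℂ → ℂ, DifferentiableOn ℂ f unitDiskSet ∧
    MapsTo f unitDiskSet Ω ∧ f 0 = z ∧ r = ‖deriv f 0‖}

lemma hypDensity_eq (Ω : Set ℂ) (z : ℂ) : hypDensity Ω z = (sSup (hypScales Ω z))⁻¹ := rfl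

lemma zero_mem_unitDiskSet : (0 : ℂ) ∈ unitDiskSet := mem_ball_self one_pos

open scoped Pointwise in
lemma Biholo.hypDensity_comp {φ η : ℂ → ℂ} {U Ω : Set ℂ} (h : Biholo φ η U Ω) {w : ℂ}
    (hw : w ∈ U) : hypDensity Ω (φ w) * ‖deriv φ w‖ = hypDensity U w := by
  have key : ∀ {φ η : ℂ → ℂ} {U Ω : Set ℂ} (_ : Biholo φ η U Ω) {w : ℂ} (_ : w ∈ U),
      ‖deriv φ w‖ • hypScales U w ⊆ hypScales Ω (φ w) := by
    rintro φ η U Ω h w hw _ ⟨r, ⟨f, h1, h2, h3, rfl⟩, rfl⟩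
    refine ⟨fun ζ => φ (f ζ), h.diff.comp h1 h2, h.mapsTo.comp h2, congrArg φ h3, ?_⟩
    have hf := (h1.differentiableAt (isOpen_ball.mem_nhds zero_mem_unitDiskSet)).hasDerivAt
    have := HasDerivAt.comp (0 : ℂ) (h₂ := φ) (h₂' := deriv φ w)
      (by rw [h3]; exact h.hasDerivAt hw) hf
    simp only [Function.comp_def] at this
    rw [this.deriv]
    simp
  have hn := norm_ne_zero_iff.2 (h.deriv_ne_zero hw)
  have e : hypScales Ω (φ w) = ‖deriv φ w‖ • hypScales U w := by
    refine Subset.antisymm ?_ (key h hw)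
    have := key h.symm (h.mapsTo hw)
    rw [h.left_inv w hw] at this
    intro r hr
    refine ⟨‖deriv η (φ w)‖ • r, this ⟨r, hr, rfl⟩, ?_⟩
    simp only [smul_eq_mul, ← mul_assoc]
    rw [← norm_mul, mul_comm, mul_comm (deriv φ w), h.deriv_mul hw, norm_one, mul_one]
  rw [hypDensity_eq, hypDensity_eq, e, Real.sSup_smul_of_nonneg (norm_nonneg _), smul_eq_mul,
    mul_inv]
  field_simp

/-- A form of the Borel–Carathéodory inequality for the derivative at the centre. -/
lemma norm_deriv_le_of_re_lt {g : ℂ → ℂ} {M : ℝ} (hg : DifferentiableOn ℂ g (ball 0 1))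
    (hre : ∀ z ∈ ball (0 : ℂ) 1, (g z).re < (g 0).re + M) : ‖deriv g 0‖ ≤ 2 * M := by
  have h0 : (0 : ℂ) ∈ ball (0 : ℂ) 1 := mem_ball_self one_pos
  have hM : 0 < M := by have := hre 0 h0; linarith
  set k : ℂ → ℂ := fun z => g z - g 0 with hk
  have hkre : ∀ z ∈ ball (0 : ℂ) 1, (k z).re < M := fun z hz => by
    have := hre z hz
    simp only [hk, sub_re]; linarith
  have hne : ∀ z ∈ ball (0 : ℂ) 1, (2 * M : ℂ) - k z ≠ 0 := fun z hz h => by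
    have := congrArg Complex.re h
    simp at this
    have := hkre z hz
    linarith
  have hkd : DifferentiableOn ℂ k (ball 0 1) := hg.sub_const _
  set F : ℂ → ℂ := fun z => k z / (2 * M - k z) with hF
  have hFd : DifferentiableOn ℂ F (ball 0 1) := hkd.div (hkd.const_sub _) hne
  have hk0 : k 0 = 0 := by simp [hk]
  have hF0 : F 0 = 0 := by simp [hF, hk0]
  have hmaps : MapsTo F (ball 0 1) (closedBall (F 0) 1) := by
    intro z hz
    rw [hF0, mem_closedBall_zero_iff, hF, norm_div, div_le_one (norm_pos_iff.2 (hne z hz))]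
    rw [← sq_le_sq₀ (norm_nonneg _) (norm_nonneg _), ← Complex.normSq_eq_norm_sq,
      ← Complex.normSq_eq_norm_sq, Complex.normSq_apply, Complex.normSq_apply]
    have := hkre z hz
    simp
    nlinarith
  have h1 := norm_deriv_le_one_of_mapsTo_ball hFd hmaps one_pos
  have hkdiff := (hkd.differentiableAt (isOpen_ball.mem_nhds h0)).hasDerivAt
  have h2 : HasDerivAt F _ 0 := hkdiff.div (hkdiff.const_sub (2 * M : ℂ)) (hne 0 h0)
  have e : deriv k 0 = deriv g 0 := by simp [hk]
  have hMc : (M : ℂ) ≠ 0 := by exact_mod_cast hM.ne'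
  have h3 : deriv F 0 = deriv g 0 / (2 * M) := by
    rw [HasDerivAt.deriv h2, hk0, e]; field_simp; ring
  rw [h3, norm_div, div_le_one (by simpa using hM.ne')] at h1
  simpa [abs_of_pos hM] using h1

lemma exists_log_of_exact {U : Set ℂ} (hU : IsOpen U) (hc : IsPreconnected U) {f : ℂ → ℂ}
    (hf : DifferentiableOn ℂ f U) (hne : ∀ z ∈ U, f z ≠ 0)
    (hex : IsExactOn (fun z => deriv f z / f z) U) :
    ∃ g : ℂ → ℂ, DifferentiableOn ℂ g U ∧ ∀ z ∈ U, Complex.exp (g z) = f z := by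
  obtain ⟨G, hG⟩ := hex
  rcases U.eq_empty_or_nonempty with rfl | ⟨z₀, hz₀⟩
  · exact ⟨0, by simp, by simp⟩
  have hd : ∀ z ∈ U, HasDerivAt (fun z => f z * Complex.exp (-G z)) 0 z := by
    intro z hz
    have h1 := (hf.differentiableAt (hU.mem_nhds hz)).hasDerivAt.mul (hG z hz).neg.cexp
    refine HasDerivAt.congr_deriv h1 ?_
    simp only [mul_neg]
    rw [mul_left_comm, mul_div_cancel₀ _ (hne z hz), mul_comm, add_neg_cancel]
  obtain ⟨c, hcst⟩ := hU.exists_is_const_of_deriv_eq_zero hc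
    (fun z hz => (hd z hz).differentiableAt.differentiableWithinAt) (fun z hz => (hd z hz).deriv)
  have hc0 : c ≠ 0 := by
    rw [← hcst z₀ hz₀]; exact mul_ne_zero (hne z₀ hz₀) (Complex.exp_ne_zero _)
  refine ⟨fun z => G z + Complex.log c, fun z hz =>
    ((hG z hz).differentiableAt.add_const _).differentiableWithinAt, fun z hz => ?_⟩
  rw [Complex.exp_add, Complex.exp_log hc0, ← hcst z hz, Complex.exp_neg]
  have := Complex.exp_ne_zero (G z)
  field_simp

lemma hypScales_disk_le {w : ℂ} {r : ℝ} (hr : r ∈ hypScales (ball 0 1) w) :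
    r ≤ 2 * (1 - ‖w‖) := by
  obtain ⟨f, h1, h2, h3, rfl⟩ := hr
  obtain ⟨u, hu, huw⟩ : ∃ u : ℂ, ‖u‖ = 1 ∧ u * w = ‖w‖ := by
    rcases eq_or_ne w 0 with rfl | hw
    · exact ⟨1, by simp, by simp⟩
    · have hn : (‖w‖ : ℂ) ≠ 0 := by exact_mod_cast norm_ne_zero_iff.2 hw
      refine ⟨conj w / ‖w‖, by simp [hw], ?_⟩
      rw [div_mul_eq_mul_div, Complex.conj_mul', sq, mul_div_assoc, div_self hn, mul_one]
  have := norm_deriv_le_of_re_lt (g := fun z => u * f z) (M := 1 - ‖w‖)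
    (DifferentiableOn.const_mul h1 u) (fun z hz => by
      simp only [h3, huw, ofReal_re]
      have h4 := (Complex.re_le_norm (u * f z))
      rw [norm_mul, hu, one_mul] at h4
      have := mem_ball_zero_iff.1 (h2 hz)
      linarith)
  have hd := h1.differentiableAt (isOpen_ball.mem_nhds zero_mem_unitDiskSet)
  rwa [deriv_const_mul _ hd, norm_mul, hu, one_mul] at this

lemma hypScales_punct_le {w : ℂ} {r : ℝ}
    (hr : r ∈ hypScales (ball 0 1 \ {0}) w) : r ≤ 2 * punctSigma w := by
  obtain ⟨f, h1, h2, h3, rfl⟩ := hr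
  have hne : ∀ z ∈ ball (0 : ℂ) 1, f z ≠ 0 := fun z hz => (h2 hz).2
  have hdd : DifferentiableOn ℂ (fun z => deriv f z / f z) (ball 0 1) :=
    (DifferentiableOn.deriv h1 isOpen_ball).div h1 hne
  obtain ⟨g, hg, hge⟩ := exists_log_of_exact isOpen_ball (convex_ball _ _).isPreconnected h1 hne
    hdd.isExactOn_ball
  have hre : ∀ z ∈ ball (0 : ℂ) 1, (g z).re = Real.log ‖f z‖ := fun z hz => by
    rw [← hge z hz, Complex.norm_exp, Real.log_exp]
  have h0 := zero_mem_unitDiskSet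
  have := norm_deriv_le_of_re_lt (M := punctX w) hg (fun z hz => by
    rw [hre z hz, hre 0 h0, h3, punctX, add_neg_cancel]
    exact Real.log_neg (norm_pos_iff.2 (hne z hz)) (mem_ball_zero_iff.1 (h2 hz).1))
  have hgd := (hg.differentiableAt (isOpen_ball.mem_nhds h0)).hasDerivAt.cexp
  have e : (fun z => Complex.exp (g z)) =ᶠ[𝓝 0] f := by
    filter_upwards [isOpen_ball.mem_nhds h0] with z hz using hge z hz
  rw [← e.deriv_eq, hgd.deriv, hge 0 h0, h3, norm_mul, punctSigma]
  nlinarith [norm_nonneg w]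

lemma mem_hypScales_disk {w : ℂ} (hw : w ∈ ball (0 : ℂ) 1) :
    1 - ‖w‖ ∈ hypScales (ball 0 1) w := by
  have h1 : ‖w‖ < 1 := mem_ball_zero_iff.1 hw
  refine ⟨fun ζ => w + ((1 - ‖w‖ : ℝ) : ℂ) * ζ, by fun_prop, fun ζ hζ => ?_, by simp, ?_⟩
  · rw [mem_ball_zero_iff]
    have h2 : ‖ζ‖ < 1 := mem_ball_zero_iff.1 hζ
    refine (norm_add_le _ _).trans_lt ?_
    rw [norm_mul, Complex.norm_real, Real.norm_of_nonneg (by linarith)]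
    nlinarith
  · have : HasDerivAt (fun ζ : ℂ => w + ((1 - ‖w‖ : ℝ) : ℂ) * ζ) ((1 - ‖w‖ : ℝ) : ℂ) 0 := by
      simpa using ((hasDerivAt_id (0 : ℂ)).const_mul ((1 - ‖w‖ : ℝ) : ℂ)).const_add w
    rw [this.deriv, Complex.norm_real, Real.norm_of_nonneg (by linarith)]

lemma mem_hypScales_punct {w : ℂ} (hw : w ∈ ball (0 : ℂ) 1 \ {0}) :
    punctSigma w ∈ hypScales (ball 0 1 \ {0}) w := by
  have hp := punctX_pos hw
  refine ⟨fun ζ => Complex.exp (Complex.log w + (punctX w : ℂ) * ζ), by fun_prop,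
    fun ζ hζ => ?_, by simp [Complex.exp_log hw.2], ?_⟩
  · refine ⟨?_, Complex.exp_ne_zero _⟩
    rw [mem_ball_zero_iff, Complex.norm_exp, Real.exp_lt_one_iff]
    have h2 : ‖ζ‖ < 1 := mem_ball_zero_iff.1 hζ
    have h3 := Complex.re_le_norm ζ
    have e : (Complex.log w + (punctX w : ℂ) * ζ).re = -punctX w + punctX w * ζ.re := by
      simp [punctX, Complex.log_re]
    rw [e]
    nlinarith
  · have : HasDerivAt (fun ζ : ℂ => Complex.exp (Complex.log w + (punctX w : ℂ) * ζ))
        (w * punctX w) 0 := by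
      have := ((((hasDerivAt_id (0 : ℂ)).const_mul (punctX w : ℂ)).const_add
        (Complex.log w))).cexp
      simpa [Complex.exp_log hw.2] using this
    rw [this.deriv, norm_mul, Complex.norm_real, Real.norm_of_nonneg hp.le, punctSigma]

lemma hasDecomposition_disk {p : ℝ} (hp : 1 < p) :
    HasDecomposition p (hypDensity (ball 0 1)) (ball 0 1) := by
  have B : ∀ z ∈ ball (0 : ℂ) 1, 1 - ‖z‖ ≤ sSup (hypScales (ball 0 1) z) ∧
      sSup (hypScales (ball 0 1) z) ≤ 2 * (1 - ‖z‖) := fun z hz =>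
    ⟨le_csSup ⟨_, fun r hr => hypScales_disk_le hr⟩ (mem_hypScales_disk hz),
      csSup_le ⟨_, mem_hypScales_disk hz⟩ fun r hr => hypScales_disk_le hr⟩
  have N : ∀ z ∈ ball (0 : ℂ) 1, ‖z‖ < 1 := fun z hz => mem_ball_zero_iff.1 hz
  have hX : ∀ z ∈ ball (0 : ℂ) 1, 1 - ‖z‖ ≤ diskX z ∧ diskX z ≤ 2 * (1 - ‖z‖) := fun z hz => by
    have := N z hz
    have := norm_nonneg z
    simp only [diskX]
    constructor <;> nlinarith
  refine (isModel_disk.hasDecomposition hp).of_comparable (by linarith) (c := 2)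
    measurableSet_ball (fun z hz => inv_pos.2 (diskX_pos hz)) ?_ ?_ ?_ two_pos
  all_goals
    intro z hz
    have a := B z hz
    have b := N z hz
    have c := hX z hz
    have d := diskX_pos hz
    have e : 0 < sSup (hypScales (ball 0 1) z) := by linarith
    rw [hypDensity_eq]
  · exact inv_pos.2 e
  · rw [inv_le_iff_one_le_mul₀ d, ← div_eq_mul_inv, div_mul_eq_mul_div, le_div_iff₀ e]
    linarith
  · rw [inv_le_iff_one_le_mul₀ e, ← div_eq_mul_inv, div_mul_eq_mul_div, le_div_iff₀ d]
    linarith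

lemma hasDecomposition_punct {p : ℝ} (hp : 1 < p) :
    HasDecomposition p (hypDensity (ball 0 1 \ {0})) (ball 0 1 \ {0}) := by
  have B : ∀ z ∈ ball (0 : ℂ) 1 \ {0}, punctSigma z ≤ sSup (hypScales (ball 0 1 \ {0}) z) ∧
      sSup (hypScales (ball 0 1 \ {0}) z) ≤ 2 * punctSigma z := fun z hz =>
    ⟨le_csSup ⟨_, fun r hr => hypScales_punct_le hr⟩ (mem_hypScales_punct hz),
      csSup_le ⟨_, mem_hypScales_punct hz⟩ fun r hr => hypScales_punct_le hr⟩
  refine (isModel_punct.hasDecomposition hp).of_comparable (by linarith) (c := 2)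
    (measurableSet_ball.diff (measurableSet_singleton 0))
    (fun z hz => inv_pos.2 (isModel_punct.scale_pos z hz)) ?_ ?_ ?_ two_pos
  all_goals
    intro z hz
    have a := B z hz
    have d := isModel_punct.scale_pos z hz
    have e : 0 < sSup (hypScales (ball 0 1 \ {0}) z) := by linarith
    rw [hypDensity_eq]
  · exact inv_pos.2 e
  · rw [inv_le_iff_one_le_mul₀ d, ← div_eq_mul_inv, div_mul_eq_mul_div, le_div_iff₀ e]
    linarith
  · rw [inv_le_iff_one_le_mul₀ e, ← div_eq_mul_inv, div_mul_eq_mul_div, le_div_iff₀ d]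
    linarith

theorem Biholo.hasDecomposition_hyp {φ η : ℂ → ℂ} {U Ω : Set ℂ} (h : Biholo φ η U Ω) {p : ℝ}
    (hU : HasDecomposition p (hypDensity U) U) : HasDecomposition p (hypDensity Ω) Ω :=
  h.hasDecomposition (fun _ hw => h.hypDensity_comp hw) hU

/-- No bounded nonempty relatively clopen piece can be split off the set `S`. -/
def NoBoundedPiece (S : Set ℂ) : Prop :=
  ∀ V₁ V₂ : Set ℂ, IsOpen V₁ → IsOpen V₂ → Disjoint V₁ V₂ → S ⊆ V₁ ∪ V₂ →
    (S ∩ V₁).Nonempty → ¬ IsBounded (S ∩ V₁)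

lemma hasDerivAt_shift_log {P : ℂ → ℂ} {w w' z : ℂ} (hP : HasDerivAt P (z - w)⁻¹ z)
    (h : ‖w' - w‖ < ‖z - w‖) :
    HasDerivAt (fun z => P z + log (1 - (w' - w) / (z - w))) (z - w')⁻¹ z := by
  have h0 : z - w ≠ 0 := norm_pos_iff.1 ((norm_nonneg _).trans_lt h)
  have h1 : z - w' ≠ 0 := by
    intro e
    rw [sub_eq_zero.1 e] at h
    exact lt_irrefl _ h
  have hs : 1 - (w' - w) / (z - w) ∈ slitPlane := by
    refine Or.inl ?_
    have : ((w' - w) / (z - w)).re < 1 := by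
      refine (re_le_norm _).trans_lt ?_
      rwa [norm_div, div_lt_one (norm_pos_iff.2 h0)]
    rw [sub_re, one_re]
    linarith
  have hd : HasDerivAt (fun z => 1 - (w' - w) / (z - w)) ((w' - w) / (z - w) ^ 2) z := by
    have := ((hasDerivAt_id z).sub_const w).inv h0
    have := (this.const_mul (w' - w)).const_sub 1
    refine HasDerivAt.congr_deriv this ?_
    simp only [id]
    ring
  refine HasDerivAt.congr_deriv (hP.add (hd.clog hs)) ?_
  have e : 1 - (w' - w) / (z - w) = (z - w') / (z - w) := by
    field_simp
    ring
  rw [e]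
  field_simp
  ring

lemma isExactOn_shift {W : Set ℂ} {w w' : ℂ} (h : ∀ z ∈ W, ‖w' - w‖ < ‖z - w‖)
    (hw : IsExactOn (fun z => (z - w)⁻¹) W) : IsExactOn (fun z => (z - w')⁻¹) W := by
  obtain ⟨P, hP⟩ := hw
  exact ⟨_, fun z hz => hasDerivAt_shift_log (hP z hz) (h z hz)⟩

lemma isExactOn_inv_sub {S W : Set ℂ} (hS : NoBoundedPiece S) (hne : S.Nonempty) {δ R : ℝ}
    (hW : ∀ z ∈ W, δ ≤ infDist z S ∧ ‖z‖ < R) {w : ℂ} (hw : infDist w S < δ ∨ R ≤ ‖w‖) :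
    IsExactOn (fun z => (z - w)⁻¹) W := by
  have far : ∀ w : ℂ, R ≤ ‖w‖ → IsExactOn (fun z => (z - w)⁻¹) W := by
    intro w hw
    have : DifferentiableOn ℂ (fun z => (z - w)⁻¹) (ball 0 R) := fun z hz => by
      refine ((differentiableAt_id.sub_const w).inv ?_).differentiableWithinAt
      intro e
      simp only [id, sub_eq_zero] at e
      rw [e, mem_ball_zero_iff] at hz
      linarith
    obtain ⟨g, hg⟩ := this.isExactOn_ball
    exact ⟨g, fun z hz => hg z (mem_ball_zero_iff.2 (hW z hz).2)⟩
  have near : ∀ s ∈ S, ∀ w, dist w s < δ → IsExactOn (fun z => (z - s)⁻¹) W →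
      IsExactOn (fun z => (z - w)⁻¹) W := by
    intro s hs w hws
    refine isExactOn_shift fun z hz => ?_
    rw [← dist_eq_norm, ← dist_eq_norm]
    exact hws.trans_le ((hW z hz).1.trans (infDist_le_dist_of_mem hs))
  rcases hw with hw | hw
  swap
  · exact far w hw
  obtain ⟨s, hs, hws⟩ := (infDist_lt_iff hne).1 hw
  refine near s hs w hws ?_
  have hδ : 0 < δ := dist_nonneg.trans_lt hws
  by_contra hbad
  have open_thick : ∀ p : ℂ → Prop, IsOpen (⋃ t ∈ {t | t ∈ S ∧ p t}, ball t (δ / 2)) := fun p =>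
    isOpen_biUnion fun _ _ => isOpen_ball
  have key : ∀ t ∈ S, ∀ t' ∈ S, ∀ x, x ∈ ball t (δ / 2) → x ∈ ball t' (δ / 2) →
      IsExactOn (fun z => (z - t)⁻¹) W → IsExactOn (fun z => (z - t')⁻¹) W := by
    intro t ht t' ht' x hx hx'
    refine near t ht t' ?_
    rw [mem_ball'] at hx'
    rw [mem_ball] at hx
    linarith [dist_triangle t' x t]
  refine hS _ _ (open_thick fun t => ¬ IsExactOn (fun z => (z - t)⁻¹) W)
    (open_thick fun t => IsExactOn (fun z => (z - t)⁻¹) W) ?_ ?_ ?_ ?_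
  · rw [Set.disjoint_left]
    intro x hx hx'
    simp only [mem_iUnion, exists_prop, mem_ofPred_eq] at hx hx'
    obtain ⟨t, ⟨ht, hb⟩, hxt⟩ := hx
    obtain ⟨t', ⟨ht', hb'⟩, hxt'⟩ := hx'
    exact hb (key t' ht' t ht x hxt' hxt hb')
  · intro x hx
    simp only [mem_union, mem_iUnion, exists_prop, mem_ofPred_eq]
    by_cases h : IsExactOn (fun z => (z - x)⁻¹) W
    · exact Or.inr ⟨x, ⟨hx, h⟩, mem_ball_self (by linarith)⟩
    · exact Or.inl ⟨x, ⟨hx, h⟩, mem_ball_self (by linarith)⟩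
  · refine ⟨s, hs, ?_⟩
    simp only [mem_iUnion, exists_prop, mem_ofPred_eq]
    exact ⟨s, ⟨hs, hbad⟩, mem_ball_self (by linarith)⟩
  · refine (isBounded_ball (x := (0 : ℂ)) (r := R)).subset ?_
    rintro x ⟨hxS, hx⟩
    simp only [mem_iUnion, exists_prop, mem_ofPred_eq] at hx
    obtain ⟨t, ⟨ht, hb⟩, hxt⟩ := hx
    rw [mem_ball_zero_iff]
    by_contra hR
    exact hb (key x hxS t ht x (mem_ball_self (by linarith)) hxt (far x (not_lt.1 hR)))

lemma eqOn_of_hasDerivAt {U : Set ℂ} (hU : IsOpen U) (hc : IsPreconnected U) {F G f : ℂ → ℂ}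
    (hF : ∀ z ∈ U, HasDerivAt F (f z) z) (hG : ∀ z ∈ U, HasDerivAt G (f z) z) {z₀ : ℂ}
    (hz₀ : z₀ ∈ U) (h : F z₀ = G z₀) : ∀ z ∈ U, F z = G z := by
  have hd : ∀ z ∈ U, HasDerivAt (fun z => F z - G z) 0 z := fun z hz =>
    ((hF z hz).sub (hG z hz)).congr_deriv (sub_self _)
  obtain ⟨c, hc⟩ := hU.exists_is_const_of_deriv_eq_zero hc
    (fun z hz => (hd z hz).differentiableAt.differentiableWithinAt) (fun z hz => (hd z hz).deriv)
  intro z hz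
  have h1 := hc z hz
  have h2 := hc z₀ hz₀
  simp only [h, sub_self] at h2
  rwa [← h2, sub_eq_zero] at h1

lemma continuousOn_primitive_param {W K : Set ℂ} (hWo : IsOpen W) (hWc : IsPreconnected W)
    (hK : IsClosed K) (hWK : W ⊆ K) {z₀ : ℂ} (hz₀ : z₀ ∈ W) {P : ℂ → ℂ → ℂ}
    (hP : ∀ w ∈ Kᶜ, P w z₀ = 0 ∧ ∀ z ∈ W, HasDerivAt (P w) (z - w)⁻¹ z) {z : ℂ} (hz : z ∈ W) :
    ContinuousOn (fun w => P w z) Kᶜ := by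
  intro w₀ hw₀
  obtain ⟨r, hr, hball⟩ := Metric.isOpen_iff.1 hK.isOpen_compl w₀ hw₀
  have hlt : ∀ w ∈ ball w₀ r, ∀ x ∈ W, ‖w - w₀‖ < ‖x - w₀‖ := by
    intro w hw x hx
    rw [← dist_eq_norm, ← dist_eq_norm]
    refine (mem_ball.1 hw).trans_le (not_lt.1 fun h => hball (mem_ball.2 h) (hWK hx))
  have hform : ∀ w ∈ ball w₀ r, P w z = P w₀ z + log (1 - (w - w₀) / (z - w₀)) -
      log (1 - (w - w₀) / (z₀ - w₀)) := by
    intro w hw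
    refine eqOn_of_hasDerivAt hWo hWc (G := fun z => P w₀ z + log (1 - (w - w₀) / (z - w₀)) -
      log (1 - (w - w₀) / (z₀ - w₀))) (hP w (hball hw)).2 (fun x hx => ?_) hz₀ ?_ z hz
    · exact (hasDerivAt_shift_log ((hP w₀ hw₀).2 x hx) (hlt w hw x hx)).sub_const _
    · rw [(hP w (hball hw)).1, (hP w₀ hw₀).1]
      ring
  have hc : ∀ x ∈ W, ContinuousAt (fun w => log (1 - (w - w₀) / (x - w₀))) w₀ := by
    intro x hx
    refine ContinuousAt.clog (by fun_prop) ?_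
    simp
  refine ContinuousAt.continuousWithinAt ?_
  refine ContinuousAt.congr (f := fun w => P w₀ z + log (1 - (w - w₀) / (z - w₀)) -
      log (1 - (w - w₀) / (z₀ - w₀))) ((continuousAt_const.add (hc z hz)).sub (hc z₀ hz₀)) ?_
  filter_upwards [ball_mem_nhds w₀ hr] with w hw using (hform w hw).symm

lemma exists_cutoff_eq_one {K U : Set ℂ} (hK : IsCompact K) (hU : IsOpen U) (h : K ⊆ U) :
    ∃ χ : ℂ → ℝ, ContDiff ℝ 1 χ ∧ HasCompactSupport χ ∧ tsupport χ ⊆ U ∧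
      ∀ z ∈ K, χ =ᶠ[𝓝 z] fun _ => 1 := by
  obtain ⟨T, hT, hKT, hTU⟩ := exists_compact_between hK hU h
  obtain ⟨χ, h1, h0, -⟩ := exists_contMDiffMap_one_nhds_of_subset_interior (n := 1)
    (modelWithCornersSelf ℝ ℂ) hK.isClosed hKT
  have hs : tsupport χ ⊆ T := closure_minimal (fun x hx => by
    by_contra hxT
    exact hx (h0 x hxT)) hT.isClosed
  refine ⟨χ, χ.contMDiff.contDiff, hT.of_isClosed_subset (isClosed_tsupport _) hs, hs.trans hTU,
    fun z hz => ?_⟩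
  exact Filter.Eventually.filter_mono (nhds_le_nhdsSet hz) h1

lemma cauchy_pompeiu {h : ℂ → ℂ} (hh : ContDiff ℝ 1 h) (hc : HasCompactSupport h) (z : ℂ) :
    ∫ w, dbar h w * (z - w)⁻¹ = π * h z := by
  have h1 := integral_dbar_div (φ := fun u => h (u + z)) (hh.comp (contDiff_id.add contDiff_const))
    (hc.comp_homeomorph (Homeomorph.addRight z))
  have h2 : ∀ u, dbar (fun u => h (u + z)) u = dbar h (u + z) := fun u => by
    rw [dbar, fderiv_comp_add_right, dbar]
  simp only [h2, zero_add] at h1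
  have h3 := integral_add_right_eq_self (μ := volume) (fun u => dbar h u / (u - z)) z
  simp only [add_sub_cancel_right] at h3
  rw [h3] at h1
  rw [← neg_eq_iff_eq_neg] at h1
  rw [← h1, ← integral_neg]
  refine integral_congr_ae (Eventually.of_forall fun w => ?_)
  simp only
  rw [div_eq_mul_inv, ← mul_neg, ← inv_neg, neg_sub]

lemma dbar_eq_zero_of_differentiableAt {f : ℂ → ℂ} {z : ℂ} (h : DifferentiableAt ℂ f z) :
    dbar f z = 0 := by
  rw [dbar, h.fderiv_restrictScalars ℝ, wirtingerDBar]
  have : fderiv ℂ f z I = I * fderiv ℂ f z 1 := by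
    rw [← smul_eq_mul, ← map_smul]
    simp
  simp only [ContinuousLinearMap.coe_restrictScalars']
  rw [this, ← mul_assoc, I_mul_I]
  ring

lemma isExactOn_of_noBoundedPiece_aux {S W : Set ℂ} (hS : NoBoundedPiece S) (hSc : IsClosed S)
    (hne : S.Nonempty) {δ R : ℝ} (hδ : 0 < δ) (hWo : IsOpen W) (hWc : IsPreconnected W)
    (hW : ∀ z ∈ W, δ ≤ infDist z S ∧ ‖z‖ < R) {f : ℂ → ℂ} (hf : DifferentiableOn ℂ f Sᶜ) :
    IsExactOn f W := by
  rcases W.eq_empty_or_nonempty with rfl | ⟨z₀, hz₀⟩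
  · exact ⟨0, by simp⟩
  set K : Set ℂ := {z | δ ≤ infDist z S} ∩ closedBall 0 R with hKdef
  have hK : IsCompact K := (isCompact_closedBall _ _).inter_left
    (isClosed_le continuous_const (continuous_infDist_pt S))
  have hKS : K ⊆ Sᶜ := fun z hz hzS => by
    have : δ ≤ infDist z S := hz.1
    rw [infDist_zero_of_mem hzS] at this
    linarith
  have hWK : W ⊆ K := fun z hz => ⟨(hW z hz).1, mem_closedBall_zero_iff.2 (hW z hz).2.le⟩
  have hgood : ∀ w ∈ Kᶜ, IsExactOn (fun z => (z - w)⁻¹) W := by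
    intro w hw
    refine isExactOn_inv_sub hS hne hW ?_
    by_contra hcon
    push Not at hcon
    exact hw ⟨hcon.1, mem_closedBall_zero_iff.2 hcon.2.le⟩
  have hP' : ∀ w, ∃ P : ℂ → ℂ, w ∈ Kᶜ → P z₀ = 0 ∧ ∀ z ∈ W, HasDerivAt P (z - w)⁻¹ z := by
    intro w
    by_cases hw : w ∈ Kᶜ
    · obtain ⟨P, h1, h2⟩ := (hgood w hw).with_val_at z₀ 0
      exact ⟨P, fun _ => ⟨h1, h2⟩⟩
    · exact ⟨0, fun h => absurd h hw⟩
  choose P hP using hP'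
  obtain ⟨χ, hχ, hχc, hχs, hχ1⟩ := exists_cutoff_eq_one hK hSc.isOpen_compl hKS
  set h : ℂ → ℂ := fun z => χ z • f z with hh
  have hts : tsupport h ⊆ tsupport χ := tsupport_smul_subset_left _ _
  have hhc : HasCompactSupport h := hχc.smul_right
  have hfd : ∀ z ∈ Sᶜ, ContDiffAt ℝ 1 f z := fun z hz =>
    ((hf.contDiffOn hSc.isOpen_compl).restrict_scalars ℝ).contDiffAt
      (hSc.isOpen_compl.mem_nhds hz)
  have hhd : ContDiff ℝ 1 h := by
    rw [contDiff_iff_contDiffAt]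
    intro z
    by_cases hz : z ∈ tsupport χ
    · exact hχ.contDiffAt.smul (hfd z (hχs hz))
    · exact (contDiffAt_const (c := (0 : ℂ))).congr_of_eventuallyEq
        (notMem_tsupport_iff_eventuallyEq.1 fun h => hz (hts h))
  have hheq : ∀ z ∈ K, h =ᶠ[𝓝 z] f := fun z hz => by
    filter_upwards [hχ1 z hz] with w hw
    simp [hh, hw]
  set g := dbar h with hg
  have hgc : Continuous g := dbar_continuous hhd
  have hgs : HasCompactSupport g := dbar_hasCompactSupport hhc
  have hgK : tsupport g ⊆ Kᶜ := by
    intro z hz hzK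
    refine (notMem_tsupport_iff_eventuallyEq.2 ?_) hz
    filter_upwards [(hheq z hzK).eventuallyEq_nhds, hSc.isOpen_compl.mem_nhds (hKS hzK)]
      with w hw hwS
    have : dbar f w = 0 := dbar_eq_zero_of_differentiableAt
      (hf.differentiableAt (hSc.isOpen_compl.mem_nhds hwS))
    rw [hg, dbar, hw.fderiv_eq, ← dbar, this]
    rfl
  have cont : ∀ u : ℂ → ℂ, ContinuousOn u Kᶜ → Continuous (fun w => g w * u w) := by
    intro u hu
    rw [continuous_iff_continuousAt]
    intro w
    by_cases hw : w ∈ tsupport g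
    · exact hgc.continuousAt.mul (hu.continuousAt (hK.isClosed.isOpen_compl.mem_nhds (hgK hw)))
    · refine (continuousAt_const (y := (0 : ℂ))).congr ?_
      filter_upwards [notMem_tsupport_iff_eventuallyEq.1 hw] with x hx
      simp [hx]
  have integ : ∀ u : ℂ → ℂ, ContinuousOn u Kᶜ → Integrable (fun w => g w * u w) := fun u hu =>
    (cont u hu).integrable_of_hasCompactSupport hgs.mul_right
  refine ⟨fun z => (π : ℂ)⁻¹ * ∫ w, g w * P w z, fun z hz => ?_⟩
  have hcontP : ∀ x ∈ W, ContinuousOn (fun w => P w x) Kᶜ := fun x hx =>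
    continuousOn_primitive_param hWo hWc hK.isClosed hWK hz₀ hP hx
  have hcontI : ∀ x ∈ W, ContinuousOn (fun w => (x - w)⁻¹) Kᶜ := fun x hx =>
    (continuousOn_const.sub continuousOn_id).inv₀ fun w hw => by
      intro e
      have e' : x = w := sub_eq_zero.1 e
      exact hw (e' ▸ hWK hx)
  obtain ⟨ε, hε, hball⟩ := Metric.isOpen_iff.1 hWo z hz
  have hε2 : 0 < ε / 2 := by linarith
  have hsub : ball z (ε / 2) ⊆ W := (ball_subset_ball (by linarith)).trans hball
  have main := hasDerivAt_integral_of_dominated_loc_of_deriv_le (μ := volume)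
    (F := fun x w => g w * P w x) (F' := fun x w => g w * (x - w)⁻¹) (x₀ := z)
    (s := ball z (ε / 2)) (bound := fun w => ‖g w‖ * (ε / 2)⁻¹) (ball_mem_nhds z hε2)
    (by
      filter_upwards [hWo.mem_nhds hz] with x hx
      exact (integ _ (hcontP x hx)).aestronglyMeasurable)
    (integ _ (hcontP z hz)) (integ _ (hcontI z hz)).aestronglyMeasurable
    (by
      refine Eventually.of_forall fun w x hx => ?_
      by_cases hw : w ∈ Kᶜ
      · rw [norm_mul, norm_inv]
        refine mul_le_mul_of_nonneg_left (inv_anti₀ hε2 ?_) (norm_nonneg _)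
        have : ε ≤ dist w z := not_lt.1 fun h => hw (hWK (hball h))
        rw [mem_ball] at hx
        rw [← dist_eq_norm, dist_comm]
        linarith [dist_triangle w x z]
      · rw [image_eq_zero_of_notMem_tsupport fun h => hw (hgK h)]
        simp)
    ((hgc.norm.integrable_of_hasCompactSupport hgs.norm).mul_const _)
    (by
      refine Eventually.of_forall fun w x hx => ?_
      by_cases hw : w ∈ Kᶜ
      · exact ((hP w hw).2 x (hsub hx)).const_mul (g w)
      · rw [image_eq_zero_of_notMem_tsupport fun h => hw (hgK h)]
        simpa using hasDerivAt_const x (0 : ℂ))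
  refine (main.2.const_mul (π : ℂ)⁻¹).congr_deriv ?_
  rw [cauchy_pompeiu hhd hhc, (hheq z (hWK hz)).eq_of_nhds, inv_mul_cancel_left₀]
  exact_mod_cast Real.pi_ne_zero

lemma isExactOn_iUnion_of_monotone {W : ℕ → Set ℂ} (hm : Monotone W) (ho : ∀ n, IsOpen (W n))
    (hc : ∀ n, IsPreconnected (W n)) {z₀ : ℂ} (hz₀ : ∀ n, (W n).Nonempty → z₀ ∈ W n)
    {f : ℂ → ℂ} (hf : ∀ n, IsExactOn f (W n)) : IsExactOn f (⋃ n, W n) := by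
  have h1 : ∀ n, ∃ F : ℂ → ℂ, F z₀ = 0 ∧ ∀ z ∈ W n, HasDerivAt F (f z) z := fun n =>
    (hf n).with_val_at z₀ 0
  choose F hF0 hF using h1
  have agree : ∀ m n, m ≤ n → ∀ z ∈ W m, F m z = F n z := fun m n hmn z hz =>
    eqOn_of_hasDerivAt (ho m) (hc m) (hF m) (fun x hx => hF n x (hm hmn hx)) (hz₀ m ⟨z, hz⟩)
      ((hF0 m).trans (hF0 n).symm) z hz
  have agree' : ∀ m n, ∀ z ∈ W m, z ∈ W n → F m z = F n z := fun m n z h h' => by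
    rcases le_total m n with hmn | hmn
    · exact agree m n hmn z h
    · exact (agree n m hmn z h').symm
  have h2 : ∀ z, ∃ n, z ∈ (⋃ n, W n) → z ∈ W n := fun z => by
    by_cases hz : z ∈ ⋃ n, W n
    · obtain ⟨n, hn⟩ := mem_iUnion.1 hz
      exact ⟨n, fun _ => hn⟩
    · exact ⟨0, fun h => absurd h hz⟩
  choose N hN using h2
  refine ⟨fun z => F (N z) z, fun z hz => ?_⟩
  refine (hF (N z) z (hN z hz)).congr_of_eventuallyEq ?_
  filter_upwards [(ho (N z)).mem_nhds (hN z hz)] with x hx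
  exact agree' _ _ x (hN x (mem_iUnion.2 ⟨_, hx⟩)) hx

/-- Cauchy's theorem on the complement of a closed set without bounded clopen pieces. -/
theorem isExactOn_compl_of_noBoundedPiece {S : Set ℂ} (hS : NoBoundedPiece S) (hSc : IsClosed S)
    (hne : S.Nonempty) (hU : IsPreconnected Sᶜ) {f : ℂ → ℂ} (hf : DifferentiableOn ℂ f Sᶜ) :
    IsExactOn f Sᶜ := by
  rcases (Sᶜ).eq_empty_or_nonempty with he | ⟨z₀, hz₀⟩
  · exact ⟨0, by simp [he]⟩
  set V : ℕ → Set ℂ := fun n => {z | ((n : ℝ) + 1)⁻¹ < infDist z S ∧ ‖z‖ < n} with hV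
  have hVo : ∀ n, IsOpen (V n) := fun n =>
    (isOpen_lt continuous_const (continuous_infDist_pt S)).inter
      (isOpen_lt continuous_norm continuous_const)
  have hVm : Monotone V := fun m n hmn z hz => by
    have hmn' : (m : ℝ) ≤ n := by exact_mod_cast hmn
    refine ⟨lt_of_le_of_lt (inv_anti₀ (by positivity) (by linarith)) hz.1, hz.2.trans_le hmn'⟩
  have hVu : Sᶜ ⊆ ⋃ n, V n := fun z hz => by
    have hpos : 0 < infDist z S := (hSc.notMem_iff_infDist_pos hne).1 hz
    obtain ⟨n, hn⟩ := exists_nat_gt (max ‖z‖ (infDist z S)⁻¹)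
    refine mem_iUnion.2 ⟨n, ?_, (le_max_left _ _).trans_lt hn⟩
    rw [inv_lt_comm₀ (by positivity) hpos]
    linarith [le_max_right ‖z‖ (infDist z S)⁻¹]
  have hVS : ∀ n, V n ⊆ Sᶜ := fun n z hz hzS => by
    have := hz.1
    rw [infDist_zero_of_mem hzS] at this
    have h2 : (0 : ℝ) < ((n : ℝ) + 1)⁻¹ := by positivity
    linarith
  set W : ℕ → Set ℂ := fun n => connectedComponentIn (V n) z₀ with hW
  have hWm : Monotone W := fun m n hmn => connectedComponentIn_mono z₀ (hVm hmn)
  have hWz : ∀ n, (W n).Nonempty → z₀ ∈ W n := fun n h =>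
    mem_connectedComponentIn (connectedComponentIn_nonempty_iff.1 h)
  have hWu : (⋃ n, W n) = Sᶜ := by
    refine subset_antisymm (iUnion_subset fun n =>
      (connectedComponentIn_subset _ _).trans (hVS n)) fun z hz => ?_
    have hpc : IsPathConnected Sᶜ :=
      hSc.isOpen_compl.isConnected_iff_isPathConnected.1 ⟨⟨z₀, hz₀⟩, hU⟩
    obtain ⟨γ, hγ⟩ := hpc.joinedIn z₀ hz₀ z hz
    have hcomp : IsCompact (range γ) := isCompact_range γ.continuous
    obtain ⟨n, hn⟩ := hcomp.elim_directed_cover V hVo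
      ((range_subset_iff.2 hγ).trans hVu) hVm.directed_le
    refine mem_iUnion.2 ⟨n, ?_⟩
    exact (isPreconnected_range γ.continuous).subset_connectedComponentIn
      ⟨0, γ.source⟩ hn ⟨1, γ.target⟩
  rw [← hWu]
  refine isExactOn_iUnion_of_monotone hWm (fun n => (hVo n).connectedComponentIn)
    (fun n => isPreconnected_connectedComponentIn) hWz fun n => ?_
  exact isExactOn_of_noBoundedPiece_aux hS hSc hne (δ := ((n : ℝ) + 1)⁻¹) (R := n)
    (by positivity) (hVo n).connectedComponentIn isPreconnected_connectedComponentIn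
    (fun z hz => ⟨(connectedComponentIn_subset _ _ hz).1.le,
      (connectedComponentIn_subset _ _ hz).2⟩) hf

/-- Hurwitz's theorem: values of a locally uniform limit are attained nearby by the sequence. -/
lemma hurwitz {ι : Type*} {l : Filter ι} {U : Set ℂ} (hU : IsOpen U) {F : ι → ℂ → ℂ} {f : ℂ → ℂ}
    (hF : ∀ n, DifferentiableOn ℂ (F n) U) (hlim : TendstoLocallyUniformlyOn F f l U)
    [l.NeBot] {b : ℂ} (hb : b ∈ U) (hconst : ¬ ∀ᶠ z in 𝓝 b, f z = f b) {c : ι → ℂ}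
    (hc : Tendsto c l (𝓝 (f b))) {N : Set ℂ} (hN : N ∈ 𝓝 b) : ∀ᶠ n in l, c n ∈ F n '' N := by
  have hfd : DifferentiableOn ℂ f U := hlim.differentiableOn (Eventually.of_forall hF) hU
  have hfa : AnalyticAt ℂ f b := hfd.analyticAt (hU.mem_nhds hb)
  have hne : ∀ᶠ z in 𝓝[≠] b, f z ≠ f b :=
    (hfa.eventually_eq_or_eventually_ne analyticAt_const).resolve_left hconst
  rw [eventually_nhdsWithin_iff] at hne
  obtain ⟨r, hr, hball⟩ := Metric.nhds_basis_closedBall.mem_iff.1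
    (inter_mem (inter_mem hN (hU.mem_nhds hb)) hne)
  have hsph : ∀ z ∈ sphere b r, f z ≠ f b := fun z hz =>
    (hball (sphere_subset_closedBall hz)).2 (ne_of_mem_sphere hz hr.ne')
  have hcbU : closedBall b r ⊆ U := fun z hz => (hball hz).1.2
  obtain ⟨z₁, hz₁, hmin⟩ := (isCompact_sphere b r).exists_isMinOn
    (NormedSpace.sphere_nonempty.2 hr.le) (f := fun z => ‖f z - f b‖)
    ((hfd.continuousOn.mono (sphere_subset_closedBall.trans hcbU)).sub continuousOn_const).norm
  obtain ⟨ε, hε, hεe⟩ : ∃ ε : ℝ, 0 < ε ∧ ‖f z₁ - f b‖ = 4 * ε :=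
    ⟨‖f z₁ - f b‖ / 4, by
      have := norm_pos_iff.2 (sub_ne_zero.2 (hsph z₁ hz₁))
      linarith, by ring⟩
  have hunif : TendstoUniformlyOn F f l (closedBall b r) :=
    (tendstoLocallyUniformlyOn_iff_forall_isCompact hU).1 hlim _ hcbU (isCompact_closedBall _ _)
  filter_upwards [Metric.tendstoUniformlyOn_iff.1 hunif (ε / 2) (by linarith),
    Metric.tendsto_nhds.1 hc (ε / 2) (by linarith)] with n hn hcn
  have hlow : ∀ z ∈ sphere b r, 2 * ε ≤ ‖F n z - F n b‖ := by
    intro z hz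
    have h1 : 4 * ε ≤ ‖f z - f b‖ := hεe ▸ hmin hz
    have h2 := hn z (sphere_subset_closedBall hz)
    have h3 := hn b (mem_closedBall_self hr.le)
    rw [← dist_eq_norm] at h1 ⊢
    have h4 := dist_triangle4 (f z) (F n z) (F n b) (f b)
    rw [dist_comm (F n b) (f b)] at h4
    linarith
  have himg := DiffContOnCl.ball_subset_image_closedBall (f := F n) (z₀ := b)
    ((hF n).diffContOnCl_ball hcbU) hr hlow (by
      intro hcon
      push Not at hcon
      have han : AnalyticOnNhd ℂ (F n) (closedBall b r) := fun z hz =>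
        (hF n).analyticAt (hU.mem_nhds (hcbU hz))
      have := han.eqOn_of_preconnected_of_eventuallyEq (g := fun _ => F n b)
        (fun z _ => analyticAt_const) (convex_closedBall b r).isPreconnected
        (mem_closedBall_self hr.le) hcon
      have h1 := hlow z₁ hz₁
      rw [this (sphere_subset_closedBall hz₁), sub_self, norm_zero] at h1
      linarith)
  have hmem : c n ∈ ball (F n b) (2 * ε / 2) := by
    rw [mem_ball]
    have h3 := hn b (mem_closedBall_self hr.le)
    linarith [dist_triangle (c n) (f b) (F n b)]
  obtain ⟨z, hz, hzc⟩ := himg hmem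
  exact ⟨z, (hball hz).1.1, hzc⟩

/-- The disc automorphism sending `a` to the origin. -/
def discAut (a z : ℂ) : ℂ := (z - a) / (1 - conj a * z)

lemma discAut_denom_ne {a z : ℂ} (ha : ‖a‖ < 1) (hz : ‖z‖ < 1) : 1 - conj a * z ≠ 0 := by
  intro h
  have h1 : conj a * z = 1 := (sub_eq_zero.1 h).symm
  have h2 : ‖a‖ * ‖z‖ = 1 := by
    rw [← norm_conj a, ← norm_mul, h1, norm_one]
  nlinarith [norm_nonneg a, norm_nonneg z]

lemma norm_discAut_lt {a z : ℂ} (ha : ‖a‖ < 1) (hz : ‖z‖ < 1) : ‖discAut a z‖ < 1 := by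
  rw [discAut, norm_div, div_lt_one (norm_pos_iff.2 (discAut_denom_ne ha hz))]
  refine lt_of_pow_lt_pow_left₀ 2 (norm_nonneg _) ?_
  have e1 : ‖a‖ ^ 2 < 1 := by nlinarith [norm_nonneg a]
  have e2 : ‖z‖ ^ 2 < 1 := by nlinarith [norm_nonneg z]
  rw [← normSq_eq_norm_sq] at e1 e2 ⊢
  rw [← normSq_eq_norm_sq]
  simp only [normSq_apply, sub_re, sub_im, mul_re, mul_im, conj_re, conj_im, one_re, one_im] at *
  nlinarith [mul_pos (sub_pos.2 e1) (sub_pos.2 e2)]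

lemma discAut_injOn {a : ℂ} (ha : ‖a‖ < 1) : InjOn (discAut a) (ball 0 1) := by
  intro z hz w hw h
  rw [mem_ball_zero_iff] at hz hw
  rw [discAut, discAut, div_eq_div_iff (discAut_denom_ne ha hz) (discAut_denom_ne ha hw)] at h
  have h1 : (1 - conj a * a) * (z - w) = 0 := by linear_combination h
  exact sub_eq_zero.1 ((mul_eq_zero.1 h1).resolve_left (discAut_denom_ne ha ha))

lemma hasDerivAt_discAut {a z : ℂ} (ha : ‖a‖ < 1) (hz : ‖z‖ < 1) :
    HasDerivAt (discAut a) ((1 - conj a * a) / (1 - conj a * z) ^ 2) z := by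
  have h := ((hasDerivAt_id z).sub_const a).div
    (((hasDerivAt_id z).const_mul (conj a)).const_sub 1) (discAut_denom_ne ha hz)
  refine HasDerivAt.congr_deriv h ?_
  simp only [id]
  congr 1
  ring

lemma norm_one_sub_conj_mul_self {a : ℂ} (ha : ‖a‖ < 1) : ‖1 - conj a * a‖ = 1 - ‖a‖ ^ 2 := by
  rw [mul_comm, mul_conj, normSq_eq_norm_sq]
  have e1 : 0 ≤ 1 - ‖a‖ ^ 2 := by nlinarith [norm_nonneg a]
  rw [show (1 : ℂ) - ((‖a‖ ^ 2 : ℝ) : ℂ) = ((1 - ‖a‖ ^ 2 : ℝ) : ℂ) by push_cast; ring,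
    norm_real, Real.norm_of_nonneg e1]

/-- Holomorphic injections with nonvanishing derivative from `U` into the unit disc. -/
structure IsDiscInjection (f : ℂ → ℂ) (U : Set ℂ) : Prop where
  diff : DifferentiableOn ℂ f U
  mapsTo : MapsTo f U (ball 0 1)
  injOn : InjOn f U
  deriv_ne : ∀ z ∈ U, deriv f z ≠ 0

lemma IsDiscInjection.discAut_comp {f : ℂ → ℂ} {U : Set ℂ} (hU : IsOpen U)
    (h : IsDiscInjection f U) {a : ℂ} (ha : ‖a‖ < 1) :
    IsDiscInjection (fun z => discAut a (f z)) U ∧ ∀ z ∈ U, deriv (fun z => discAut a (f z)) z =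
      (1 - conj a * a) / (1 - conj a * f z) ^ 2 * deriv f z := by
  have hd : ∀ z ∈ U, HasDerivAt (fun z => discAut a (f z))
      ((1 - conj a * a) / (1 - conj a * f z) ^ 2 * deriv f z) z := fun z hz =>
    (hasDerivAt_discAut ha (mem_ball_zero_iff.1 (h.mapsTo hz))).comp z
      (h.diff.differentiableAt (hU.mem_nhds hz)).hasDerivAt
  refine ⟨⟨fun z hz => (hd z hz).differentiableAt.differentiableWithinAt, fun z hz => ?_, ?_,
    fun z hz => ?_⟩, fun z hz => (hd z hz).deriv⟩
  · exact mem_ball_zero_iff.2 (norm_discAut_lt ha (mem_ball_zero_iff.1 (h.mapsTo hz)))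
  · exact fun z hz w hw e => h.injOn hz hw (discAut_injOn ha (h.mapsTo hz) (h.mapsTo hw) e)
  · rw [(hd z hz).deriv]
    exact mul_ne_zero (div_ne_zero (discAut_denom_ne ha ha)
      (pow_ne_zero _ (discAut_denom_ne ha (mem_ball_zero_iff.1 (h.mapsTo hz))))) (h.deriv_ne z hz)

lemma IsDiscInjection.sqrt {f g : ℂ → ℂ} {U : Set ℂ} (hU : IsOpen U) (h : IsDiscInjection f U)
    (hg : DifferentiableOn ℂ g U) (hgf : ∀ z ∈ U, g z ^ 2 = f z) :
    IsDiscInjection g U ∧ ∀ z ∈ U, 2 * g z * deriv g z = deriv f z := by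
  have hd : ∀ z ∈ U, 2 * g z * deriv g z = deriv f z := fun z hz => by
    have h1 := (hg.differentiableAt (hU.mem_nhds hz)).hasDerivAt.pow 2
    have h2 : f =ᶠ[𝓝 z] fun z => g z ^ 2 := by
      filter_upwards [hU.mem_nhds hz] with w hw using (hgf w hw).symm
    have h3 : HasDerivAt (fun z => g z ^ 2) _ z := h1
    rw [h2.deriv_eq, h3.deriv]
    ring
  refine ⟨⟨hg, fun z hz => ?_, fun z hz w hw e => h.injOn hz hw ?_, fun z hz e => ?_⟩, hd⟩
  · have h1 := h.mapsTo hz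
    rw [mem_ball_zero_iff, ← hgf z hz, norm_pow] at h1
    rw [mem_ball_zero_iff]
    nlinarith [norm_nonneg (g z)]
  · rw [← hgf z hz, ← hgf w hw, e]
  · apply h.deriv_ne z hz
    rw [← hd z hz, e, mul_zero]

lemma exists_ultralimit {U : Set ℂ} (hU : IsOpen U) {F : ℕ → ℂ → ℂ}
    (hF : ∀ n, DifferentiableOn ℂ (F n) U) (hm : ∀ n, MapsTo (F n) U (ball 0 1)) :
    ∃ f : ℂ → ℂ, TendstoLocallyUniformlyOn F f (hyperfilter ℕ : Filter ℕ) U := by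
  have h1 : ∀ z, ∃ x : ℂ, z ∈ U → Tendsto (fun n => F n z) (hyperfilter ℕ : Filter ℕ) (𝓝 x) := by
    intro z
    by_cases hz : z ∈ U
    · obtain ⟨x, -, hx⟩ := (isCompact_closedBall (0 : ℂ) 1).ultrafilter_le_nhds
        ((hyperfilter ℕ).map fun n => F n z) (by
          rw [le_principal_iff, Ultrafilter.mem_coe, Ultrafilter.mem_map]
          exact Filter.univ_mem' fun n => ball_subset_closedBall (hm n hz))
      exact ⟨x, fun _ => hx⟩
    · exact ⟨0, fun h => absurd h hz⟩
  choose f hf using h1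
  refine ⟨f, Metric.tendstoLocallyUniformlyOn_iff.2 fun ε hε x hx => ?_⟩
  obtain ⟨r, hr, hball⟩ := Metric.isOpen_iff.1 hU x hx
  have lip : ∀ n, ∀ y ∈ ball x r, dist (F n y) (F n x) ≤ 2 / r * dist y x := fun n y hy =>
    dist_le_div_mul_dist_of_mapsTo_ball ((hF n).mono hball) (fun z hz => by
      have h1 := hm n (hball hz)
      have h2 := hm n hx
      rw [mem_ball] at h1 h2
      rw [mem_closedBall]
      linarith [dist_triangle_right (F n z) (F n x) 0]) hy
  have lipf : ∀ y ∈ ball x r, dist (f y) (f x) ≤ 2 / r * dist y x := fun y hy =>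
    le_of_tendsto ((hf y (hball hy)).dist (hf x hx)) (Eventually.of_forall fun n => lip n y hy)
  have hρ : 0 < min r (ε * r / 8) := by positivity
  refine ⟨ball x (min r (ε * r / 8)), mem_nhdsWithin_of_mem_nhds (ball_mem_nhds x hρ), ?_⟩
  filter_upwards [Metric.tendsto_nhds.1 (hf x hx) (ε / 4) (by linarith)] with n hn y hy
  have hy1 : y ∈ ball x r := ball_subset_ball (min_le_left _ _) hy
  have hy2 : dist y x < ε * r / 8 := (mem_ball.1 hy).trans_le (min_le_right _ _)
  have h3 : 2 / r * dist y x ≤ ε / 4 := by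
    calc 2 / r * dist y x ≤ 2 / r * (ε * r / 8) := by gcongr
      _ = ε / 4 := by field_simp; ring
  have h4 := lip n y hy1
  have h5 := lipf y hy1
  have h6 := dist_triangle4 (f y) (f x) (F n x) (F n y)
  rw [dist_comm (f x) (F n x), dist_comm (F n x) (F n y)] at h6
  linarith

lemma IsDiscInjection.of_tendsto {ι : Type*} {l : Filter ι} [l.NeBot] {U : Set ℂ} (hU : IsOpen U)
    (hc : IsPreconnected U) {F : ι → ℂ → ℂ} {f : ℂ → ℂ} (hF : ∀ n, IsDiscInjection (F n) U)
    (hlim : TendstoLocallyUniformlyOn F f l U) {z₀ : ℂ} (hz₀ : z₀ ∈ U) (h0 : ∀ n, F n z₀ = 0)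
    (hd : deriv f z₀ ≠ 0) : IsDiscInjection f U ∧ f z₀ = 0 := by
  have hfd : DifferentiableOn ℂ f U :=
    hlim.differentiableOn (Eventually.of_forall fun n => (hF n).diff) hU
  have hf0 : f z₀ = 0 := by
    have := hlim.tendsto_at hz₀
    simp only [h0] at this
    exact (tendsto_nhds_unique this tendsto_const_nhds)
  have hle : ∀ z ∈ U, ‖f z‖ ≤ 1 := fun z hz =>
    le_of_tendsto (hlim.tendsto_at hz).norm (Eventually.of_forall fun n =>
      (mem_ball_zero_iff.1 ((hF n).mapsTo hz)).le)
  have nonconst : ∀ b ∈ U, ¬ ∀ᶠ z in 𝓝 b, f z = f b := by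
    intro b hb hcon
    have h1 := (hfd.analyticOnNhd hU).eqOn_of_preconnected_of_eventuallyEq (g := fun _ => f b)
      (fun z _ => analyticAt_const) hc hb hcon
    have h2 : f =ᶠ[𝓝 z₀] fun _ => f b := by
      filter_upwards [hU.mem_nhds hz₀] with z hz using h1 hz
    exact hd (by rw [h2.deriv_eq, deriv_const])
  have hFd := hlim.deriv (Eventually.of_forall fun n => (hF n).diff) hU
  have hfdd : DifferentiableOn ℂ (deriv f) U := hfd.deriv hU
  refine ⟨⟨hfd, fun z hz => ?_, fun a ha b hb hab => ?_, fun b hb hb0 => ?_⟩, hf0⟩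
  · rw [mem_ball_zero_iff]
    refine lt_of_le_of_ne (hle z hz) fun h1 => ?_
    have := eqOn_of_isPreconnected_of_isMaxOn_norm hc hU hfd hz (fun w hw => by
      simp only [Function.comp, mem_ofPred_eq, h1]
      exact hle w hw) hz₀
    rw [hf0, Function.const_apply] at this
    rw [← this, norm_zero] at h1
    exact zero_ne_one h1
  · by_contra hne
    have := hurwitz hU (fun n => (hF n).diff) hlim hb (nonconst b hb) (c := fun n => F n a)
      (hab ▸ hlim.tendsto_at ha)
      (N := ball b (dist a b) ∩ U) (inter_mem (ball_mem_nhds b (dist_pos.2 hne)) (hU.mem_nhds hb))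
    obtain ⟨n, z, ⟨hz1, hzU⟩, hz2⟩ := this.exists
    have : z = a := (hF n).injOn hzU ha hz2
    rw [this, mem_ball] at hz1
    exact lt_irrefl _ hz1
  · have := hurwitz hU (fun n => (hF n).diff.deriv hU) hFd hb (fun hcon => ?_)
      (c := fun _ => 0) (hb0 ▸ tendsto_const_nhds) (hU.mem_nhds hb)
    · obtain ⟨n, z, hzU, hz2⟩ := this.exists
      exact (hF n).deriv_ne z hzU hz2
    · have h1 := (hfdd.analyticOnNhd hU).eqOn_of_preconnected_of_eventuallyEq
        (g := fun _ => deriv f b) (fun z _ => analyticAt_const) hc hb hcon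
      exact hd ((h1 hz₀).trans hb0)

lemma norm_deriv_le_of_isDiscInjection {U : Set ℂ} {z₀ : ℂ} {r : ℝ} (hr : 0 < r)
    (hball : ball z₀ r ⊆ U) {f : ℂ → ℂ} (hf : IsDiscInjection f U) (h0 : f z₀ = 0) :
    ‖deriv f z₀‖ ≤ 1 / r :=
  norm_deriv_le_div_of_mapsTo_ball (hf.diff.mono hball) (fun z hz => by
    rw [h0]
    exact ball_subset_closedBall (hf.mapsTo (hball hz))) hr

/-- The derivative at the base point attains its supremum among normalized disc injections. -/
lemma exists_extremal_isDiscInjection {U : Set ℂ} (hU : IsOpen U) (hc : IsPreconnected U) {z₀ : ℂ}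
    (hz₀ : z₀ ∈ U) (hne : ∃ f, IsDiscInjection f U ∧ f z₀ = 0) :
    ∃ f, IsDiscInjection f U ∧ f z₀ = 0 ∧
      ∀ g, IsDiscInjection g U → g z₀ = 0 → ‖deriv g z₀‖ ≤ ‖deriv f z₀‖ := by
  obtain ⟨r, hr, hball⟩ := Metric.isOpen_iff.1 hU z₀ hz₀
  set S : Set ℝ := {x | ∃ f, IsDiscInjection f U ∧ f z₀ = 0 ∧ ‖deriv f z₀‖ = x} with hS
  have hbdd : BddAbove S := ⟨1 / r, by
    rintro x ⟨f, hf, h0, rfl⟩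
    exact norm_deriv_le_of_isDiscInjection hr hball hf h0⟩
  obtain ⟨f₁, hf₁, hf₁0⟩ := hne
  obtain ⟨u, -, hu, huS⟩ := exists_seq_tendsto_sSup (S := S) ⟨_, f₁, hf₁, hf₁0, rfl⟩ hbdd
  choose F hF hF0 hFu using huS
  obtain ⟨f, hlim⟩ := exists_ultralimit hU (fun n => (hF n).diff) (fun n => (hF n).mapsTo)
  have hder := ((hlim.deriv (Eventually.of_forall fun n => (hF n).diff) hU).tendsto_at hz₀).norm
  have hderiv : ‖deriv f z₀‖ = sSup S := by
    refine tendsto_nhds_unique hder ?_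
    simp only [Function.comp, hFu]
    exact hu.mono_left Nat.hyperfilter_le_atTop
  have hle : ∀ g, IsDiscInjection g U → g z₀ = 0 → ‖deriv g z₀‖ ≤ ‖deriv f z₀‖ := fun g hg hg0 =>
    hderiv ▸ le_csSup hbdd ⟨g, hg, hg0, rfl⟩
  have hd : deriv f z₀ ≠ 0 := by
    have := hle f₁ hf₁ hf₁0
    have h2 := norm_pos_iff.2 (hf₁.deriv_ne z₀ hz₀)
    exact norm_pos_iff.1 (h2.trans_le this)
  obtain ⟨h1, h2⟩ := IsDiscInjection.of_tendsto hU hc hF hlim hz₀ hF0 hd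
  exact ⟨f, h1, h2, hle⟩

/-- Holomorphic square roots exist on `U`. -/
def HasSquareRoots (U : Set ℂ) : Prop :=
  ∀ f : ℂ → ℂ, DifferentiableOn ℂ f U → (∀ z ∈ U, f z ≠ 0) →
    ∃ g : ℂ → ℂ, DifferentiableOn ℂ g U ∧ ∀ z ∈ U, g z ^ 2 = f z

lemma hasSquareRoots_of_isExactOn {U : Set ℂ} (hU : IsOpen U) (hc : IsPreconnected U)
    (hex : ∀ f : ℂ → ℂ, DifferentiableOn ℂ f U → IsExactOn f U) : HasSquareRoots U := by
  intro f hf hne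
  obtain ⟨g, hg, hge⟩ := exists_log_of_exact hU hc hf hne (hex _ ((hf.deriv hU).div hf hne))
  refine ⟨fun z => Complex.exp (g z / 2), (hg.div_const 2).cexp, fun z hz => ?_⟩
  rw [← hge z hz, ← Complex.exp_nat_mul]
  congr 1
  push_cast
  ring

/-- The Koebe step: a disc injection which omits a value is not extremal. -/
lemma IsDiscInjection.exists_larger {U : Set ℂ} (hU : IsOpen U) (hsq : HasSquareRoots U) {z₀ : ℂ}
    (hz₀ : z₀ ∈ U) {f : ℂ → ℂ} (hf : IsDiscInjection f U) (h0 : f z₀ = 0) {w : ℂ}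
    (hw : ‖w‖ < 1) (hwf : ∀ z ∈ U, f z ≠ w) :
    ∃ g, IsDiscInjection g U ∧ g z₀ = 0 ∧ ‖deriv f z₀‖ < ‖deriv g z₀‖ := by
  obtain ⟨hF, hFd⟩ := hf.discAut_comp hU hw
  obtain ⟨s, hs, hsF⟩ := hsq _ hF.diff (fun z hz => by
    rw [discAut]
    exact div_ne_zero (sub_ne_zero.2 (hwf z hz))
      (discAut_denom_ne hw (mem_ball_zero_iff.1 (hf.mapsTo hz))))
  obtain ⟨hs', hsd⟩ := hF.sqrt hU hs hsF
  have hb : ‖s z₀‖ < 1 := mem_ball_zero_iff.1 (hs'.mapsTo hz₀)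
  obtain ⟨hG, hGd⟩ := hs'.discAut_comp hU hb
  refine ⟨_, hG, by simp [discAut], ?_⟩
  have hw0 : w ≠ 0 := fun h => hwf z₀ hz₀ (h0.trans h.symm)
  have e1 : ‖s z₀‖ ^ 2 = ‖w‖ := by
    rw [← norm_pow, hsF z₀ hz₀, h0, discAut]
    simp
  have e2 : 2 * ‖s z₀‖ * ‖deriv s z₀‖ = (1 - ‖w‖ ^ 2) * ‖deriv f z₀‖ := by
    have h1 := congrArg norm (hsd z₀ hz₀)
    rw [hFd z₀ hz₀, h0, norm_mul, norm_mul, norm_mul, norm_div, norm_one_sub_conj_mul_self hw] at h1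
    simpa using h1
  have e3 : ‖deriv (fun z => discAut (s z₀) (s z)) z₀‖ * (1 - ‖s z₀‖ ^ 2) = ‖deriv s z₀‖ := by
    have hp : 0 < 1 - ‖s z₀‖ ^ 2 := by nlinarith [norm_nonneg (s z₀)]
    rw [hGd z₀ hz₀, norm_mul, norm_div, norm_pow, norm_one_sub_conj_mul_self hb]
    field_simp
  have hd := norm_pos_iff.2 (hf.deriv_ne z₀ hz₀)
  have hwp := norm_pos_iff.2 hw0
  have hβ : 0 < ‖s z₀‖ := by
    by_contra h
    have : ‖s z₀‖ = 0 := le_antisymm (not_lt.1 h) (norm_nonneg _)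
    rw [this] at e1
    simp [← e1] at hwp
  set β := ‖s z₀‖
  set G := ‖deriv (fun z => discAut (s z₀) (s z)) z₀‖
  set D := ‖deriv f z₀‖
  rw [← e3, ← e1] at e2
  have hp : 0 < 1 - β ^ 2 := by nlinarith
  have e4 : 2 * β * G = (1 + β ^ 2) * D := by
    have : (1 - β ^ 2) * (2 * β * G - (1 + β ^ 2) * D) = 0 := by linear_combination e2
    have := (mul_eq_zero.1 this).resolve_left hp.ne'
    linarith
  have e5 : 2 * β * D < 2 * β * G := by
    rw [e4]
    nlinarith [mul_pos (pow_pos (sub_pos.2 hb) 2) hd]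
  exact lt_of_mul_lt_mul_left e5 (by positivity)

lemma exists_isDiscInjection {U : Set ℂ} (hU : IsOpen U) (hsq : HasSquareRoots U) {z₀ : ℂ}
    (hz₀ : z₀ ∈ U) {a : ℂ} (ha : a ∉ U) : ∃ f, IsDiscInjection f U ∧ f z₀ = 0 := by
  obtain ⟨g, hg, hga⟩ := hsq (fun z => z - a) (differentiableOn_id.sub_const a) (fun z hz h =>
    ha (sub_eq_zero.1 h ▸ hz))
  have hgd : ∀ z ∈ U, 2 * g z * deriv g z = 1 := fun z hz => by
    have h1 := (hg.differentiableAt (hU.mem_nhds hz)).hasDerivAt.pow 2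
    have h2 : (fun z => z - a) =ᶠ[𝓝 z] fun z => g z ^ 2 := by
      filter_upwards [hU.mem_nhds hz] with w hw using (hga w hw).symm
    have h3 : HasDerivAt (fun z => g z ^ 2) _ z := h1
    have h4 := h3.unique (((hasDerivAt_id z).sub_const a).congr_of_eventuallyEq h2.symm)
    rw [← h4]
    ring
  have hgd0 : ∀ z ∈ U, deriv g z ≠ 0 := fun z hz h => by
    have := hgd z hz
    rw [h, mul_zero] at this
    exact zero_ne_one this
  have hg0 : ∀ z ∈ U, g z ≠ 0 := fun z hz h => by
    have := hgd z hz
    rw [h, mul_zero, zero_mul] at this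
    exact zero_ne_one this
  have hsd : HasStrictDerivAt g (deriv g z₀) z₀ :=
    (hg.analyticAt (hU.mem_nhds hz₀)).hasStrictDerivAt
  have himg : g '' U ∈ 𝓝 (g z₀) := by
    rw [← hsd.map_nhds_eq (hgd0 z₀ hz₀)]
    exact image_mem_map (hU.mem_nhds hz₀)
  obtain ⟨r, hr, hball⟩ := Metric.mem_nhds_iff.1 himg
  have hsep : ∀ z ∈ U, r ≤ ‖g z + g z₀‖ := by
    intro z hz
    by_contra hlt
    rw [not_le] at hlt
    obtain ⟨x, hx, hxe⟩ := hball (show -g z ∈ ball (g z₀) r by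
      rw [mem_ball, dist_eq_norm, ← norm_neg]
      simpa [add_comm] using hlt)
    have e : x = z := by
      have h1 := hga x hx
      rw [hxe, neg_sq, hga z hz] at h1
      exact (sub_left_inj.1 h1).symm
    rw [e] at hxe
    refine hg0 z hz ?_
    linear_combination hxe / 2
  have hne : ∀ z ∈ U, g z + g z₀ ≠ 0 := fun z hz => norm_pos_iff.1 (hr.trans_le (hsep z hz))
  have hr2 : ((r / 2 : ℝ) : ℂ) ≠ 0 := by
    rw [Ne, ofReal_eq_zero]
    positivity
  have hder : ∀ z ∈ U, HasDerivAt (fun z => ((r / 2 : ℝ) : ℂ) / (g z + g z₀))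
      (((r / 2 : ℝ) : ℂ) * (-deriv g z / (g z + g z₀) ^ 2)) z := fun z hz => by
    have := (((hg.differentiableAt (hU.mem_nhds hz)).hasDerivAt.add_const (g z₀)).inv
      (hne z hz)).const_mul ((r / 2 : ℝ) : ℂ)
    exact this
  have hin : IsDiscInjection (fun z => ((r / 2 : ℝ) : ℂ) / (g z + g z₀)) U := by
    refine ⟨fun z hz => (hder z hz).differentiableAt.differentiableWithinAt, fun z hz => ?_,
      fun z hz w hw e => ?_, fun z hz => ?_⟩
    · rw [mem_ball_zero_iff, norm_div, norm_real, Real.norm_of_nonneg (by positivity),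
        div_lt_one (hr.trans_le (hsep z hz))]
      linarith [hsep z hz]
    · simp only [div_eq_mul_inv] at e
      have h1 := inv_injective (mul_left_cancel₀ hr2 e)
      have h2 := add_right_cancel h1
      have h3 := hga z hz
      rw [h2, hga w hw] at h3
      exact (sub_left_inj.1 h3).symm
    · rw [(hder z hz).deriv]
      exact mul_ne_zero hr2 (div_ne_zero (neg_ne_zero.2 (hgd0 z hz)) (pow_ne_zero _ (hne z hz)))
  exact ⟨_, (hin.discAut_comp hU (mem_ball_zero_iff.1 (hin.mapsTo hz₀))).1, by simp [discAut]⟩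

lemma biholo_of_injOn {f : ℂ → ℂ} {U V : Set ℂ} (hU : IsOpen U) (hV : IsOpen V)
    (hf : DifferentiableOn ℂ f U) (hd : ∀ z ∈ U, deriv f z ≠ 0) (hi : InjOn f U)
    (hm : f '' U = V) : Biholo f (Function.invFunOn f U) U V := by
  have hsurj : ∀ w ∈ V, ∃ z ∈ U, f z = w := fun w hw => by rwa [← hm] at hw
  have hr : ∀ w ∈ V, f (Function.invFunOn f U w) = w := fun w hw =>
    Function.invFunOn_eq (hsurj w hw)
  have hmem : ∀ w ∈ V, Function.invFunOn f U w ∈ U := fun w hw =>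
    Function.invFunOn_mem (hsurj w hw)
  have hl : ∀ z ∈ U, Function.invFunOn f U (f z) = z := fun z hz =>
    hi.leftInvOn_invFunOn hz
  refine ⟨hU, hV, hf, fun w hw => ?_, fun z hz => hm ▸ mem_image_of_mem f hz, hmem, hl, hr⟩
  set z := Function.invFunOn f U w with hz
  have hzU : z ∈ U := hmem w hw
  have hsd : HasStrictDerivAt f (deriv f z) z :=
    (hf.analyticAt (hU.mem_nhds hzU)).hasStrictDerivAt
  have hcont : ContinuousAt (Function.invFunOn f U) w := by
    rw [ContinuousAt, ← hz, tendsto_def]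
    intro N hN
    have : f '' (N ∩ U) ∈ 𝓝 w := by
      have h1 := hsd.map_nhds_eq (hd z hzU)
      rw [hr w hw] at h1
      rw [← h1]
      exact image_mem_map (inter_mem hN (hU.mem_nhds hzU))
    filter_upwards [this] with y hy
    obtain ⟨x, ⟨hxN, hxU⟩, rfl⟩ := hy
    rw [mem_preimage, hl x hxU]
    exact hxN
  have := HasDerivAt.of_local_left_inverse hcont (hz ▸ hsd.hasDerivAt) (hd z hzU)
    (by filter_upwards [hV.mem_nhds hw] with y hy using hr y hy)
  exact this.differentiableAt.differentiableWithinAt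

/-- The Riemann mapping theorem, for proper connected domains with square roots. -/
theorem exists_biholo_ball {U : Set ℂ} (hU : IsOpen U) (hc : IsPreconnected U)
    (hsq : HasSquareRoots U) {z₀ a : ℂ} (hz₀ : z₀ ∈ U) (ha : a ∉ U) :
    ∃ φ η, Biholo φ η (ball 0 1) U ∧ φ 0 = z₀ := by
  obtain ⟨f, hf, h0, hmax⟩ := exists_extremal_isDiscInjection hU hc hz₀
    (exists_isDiscInjection hU hsq hz₀ ha)
  have himg : f '' U = ball 0 1 := by
    refine subset_antisymm hf.mapsTo.image_subset fun w hw => ?_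
    by_contra hcon
    obtain ⟨g, hg, hg0, hlt⟩ := hf.exists_larger hU hsq hz₀ h0 (mem_ball_zero_iff.1 hw)
      (fun z hz e => hcon ⟨z, hz, e⟩)
    exact absurd (hmax g hg hg0) (not_le.2 hlt)
  have hB := biholo_of_injOn hU isOpen_ball hf.diff hf.deriv_ne hf.injOn himg
  refine ⟨_, _, hB.symm, ?_⟩
  rw [← h0]
  exact hB.left_inv z₀ hz₀

lemma isPreconnected_of_frontier {S : Set ℂ} (hS : IsClosed S) (hf : IsPreconnected (frontier S))
    (hne : (frontier S).Nonempty) : IsPreconnected S := by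
  have key : ∀ u v : Set ℂ, IsOpen u → IsOpen v → S ⊆ u ∪ v → S ∩ (u ∩ v) = ∅ →
      frontier S ⊆ v → S ⊆ v := by
    intro u v hu hv hcov hdis hfv x hx
    by_contra hxv
    have e : S ∩ u = S \ v := by
      ext y
      constructor
      · rintro ⟨hy, hyu⟩
        exact ⟨hy, fun hyv => notMem_empty y (hdis ▸ ⟨hy, hyu, hyv⟩)⟩
      · rintro ⟨hy, hyv⟩
        exact ⟨hy, (hcov hy).resolve_right hyv⟩
    have hcl : IsClosed (S ∩ u) := e ▸ hS.sdiff hv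
    have hop : IsOpen (S ∩ u) := by
      have : S ∩ u = interior S ∩ u := by
        refine subset_antisymm (fun y hy => ⟨?_, hy.2⟩) (inter_subset_inter_left _ interior_subset)
        by_contra hyi
        have hyf : y ∈ frontier S := ⟨subset_closure hy.1, hyi⟩
        exact (e ▸ hy : y ∈ S \ v).2 (hfv hyf)
      exact this ▸ isOpen_interior.inter hu
    have huniv : S ∩ u = univ := IsClopen.eq_univ ⟨hcl, hop⟩ ⟨x, e ▸ ⟨hx, hxv⟩⟩
    obtain ⟨y, hy⟩ := hne
    have hy' : y ∈ S \ v := e ▸ (huniv ▸ mem_univ y)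
    exact hy'.2 (hfv hy)
  have hfS : frontier S ⊆ S := hS.frontier_subset
  rw [isPreconnected_iff_subset_of_disjoint]
  intro u v hu hv hcov hdis
  have hdis' : frontier S ∩ (u ∩ v) = ∅ := by
    rw [← subset_empty_iff, ← hdis]
    exact inter_subset_inter_left _ hfS
  rcases (isPreconnected_iff_subset_of_disjoint.1 hf) u v hu hv (hfS.trans hcov) hdis' with h | h
  · exact Or.inl (key v u hv hu (union_comm u v ▸ hcov) (inter_comm u v ▸ hdis) h)
  · exact Or.inr (key u v hu hv hcov hdis h)

lemma isPreconnected_compl_closedBall {R : ℝ} (hR : 0 < R) :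
    IsPreconnected (closedBall (0 : ℂ) R)ᶜ := by
  have e : (closedBall (0 : ℂ) R)ᶜ = Complex.exp '' {w : ℂ | Real.log R < w.re} := by
    ext z
    simp only [mem_compl_iff, mem_closedBall_zero_iff, not_le, mem_image, mem_ofPred_eq]
    constructor
    · intro h
      have hz : z ≠ 0 := norm_pos_iff.1 (hR.trans h)
      exact ⟨log z, by rw [log_re]; exact Real.log_lt_log hR h, exp_log hz⟩
    · rintro ⟨w, hw, rfl⟩
      rw [norm_exp, ← Real.log_lt_iff_lt_exp hR]
      exact hw
  rw [e]
  exact (convex_halfSpace_re_gt _).isPreconnected.image _ continuous_exp.continuousOn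

lemma subset_of_disjoint_frontier {T Ω : Set ℂ} (hT : IsPreconnected T) (hΩ : IsOpen Ω)
    (hd : Disjoint T (frontier Ω)) (hne : (T ∩ Ω).Nonempty) : T ⊆ Ω := by
  refine hT.subset_left_of_subset_union hΩ isClosed_closure.isOpen_compl
    (disjoint_compl_right.mono_left subset_closure |>.mono_right (by exact subset_rfl))
    (fun x hx => ?_) hne
  by_contra h
  rw [mem_union, not_or, notMem_compl_iff] at h
  exact Set.disjoint_left.1 hd hx ⟨h.2, by rw [hΩ.interior_eq]; exact h.1⟩

lemma IsPreconnected.noBoundedPiece {S : Set ℂ} (hS : IsPreconnected S) (hb : ¬ IsBounded S) :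
    NoBoundedPiece S := by
  intro V₁ V₂ h1 h2 hd hcov hne hbd
  refine hb ?_
  have : S ⊆ V₁ := hS.subset_left_of_subset_union h1 h2 hd hcov hne
  rwa [inter_eq_left.2 this] at hbd

theorem exists_biholo_ball_of_noBoundedPiece {U : Set ℂ} (hU : IsOpen U) (hc : IsPreconnected U)
    (hS : NoBoundedPiece Uᶜ) {z₀ a : ℂ} (hz₀ : z₀ ∈ U) (ha : a ∉ U) :
    ∃ φ η, Biholo φ η (ball 0 1) U ∧ φ 0 = z₀ := by
  refine exists_biholo_ball hU hc (hasSquareRoots_of_isExactOn hU hc fun f hf => ?_) hz₀ ha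
  rw [← compl_compl U] at hc hf ⊢
  exact isExactOn_compl_of_noBoundedPiece hS hU.isClosed_compl ⟨a, ha⟩ hc hf

/-- Inversion at `a` of `Ω`, with the point at infinity added. -/
def inversion (Ω : Set ℂ) (a : ℂ) : Set ℂ := {u | u = 0 ∨ a + u⁻¹ ∈ Ω}

section Inversion

variable {Ω : Set ℂ} {a : ℂ}

lemma inversion_image (ha : a ∉ Ω) :
    (fun z => (z - a)⁻¹) '' Ω = inversion Ω a \ {0} := by
  ext u
  constructor
  · rintro ⟨z, hz, rfl⟩
    have : z - a ≠ 0 := fun h => ha (sub_eq_zero.1 h ▸ hz)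
    refine ⟨Or.inr ?_, inv_ne_zero this⟩
    simpa using hz
  · rintro ⟨h | h, hu⟩
    · exact absurd h hu
    · exact ⟨_, h, by simp⟩

lemma isOpen_inversion (hΩ : IsOpen Ω) {R : ℝ} (hR : (closedBall (0 : ℂ) R)ᶜ ⊆ Ω) :
    IsOpen (inversion Ω a) := by
  rw [isOpen_iff_mem_nhds]
  intro u hu
  by_cases h0 : u = 0
  · subst h0
    have h1 : Tendsto (fun u : ℂ => ‖a + u⁻¹‖) (𝓝[≠] 0) atTop :=
      tendsto_norm_cobounded_atTop.comp
        ((tendsto_const_add_cobounded a).comp tendsto_inv₀_nhdsNE_zero)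
    have h2 := h1.eventually_gt_atTop R
    rw [eventually_nhdsWithin_iff] at h2
    filter_upwards [h2] with x hx
    by_cases hx0 : x = 0
    · exact Or.inl hx0
    · exact Or.inr (hR (by simpa using hx hx0))
  · have hu' : a + u⁻¹ ∈ Ω := hu.resolve_left h0
    have hc : ContinuousAt (fun u : ℂ => a + u⁻¹) u :=
      continuousAt_const.add (continuousAt_inv₀ h0)
    filter_upwards [hc.preimage_mem_nhds (hΩ.mem_nhds hu')] with x hx using Or.inr hx

lemma isPreconnected_inversion (ha : a ∉ Ω) (hc : IsPreconnected Ω)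
    (ho : IsOpen (inversion Ω a)) : IsPreconnected (inversion Ω a) := by
  have h1 : IsPreconnected (inversion Ω a \ {0}) := by
    rw [← inversion_image ha]
    refine hc.image _ ((continuousOn_id.sub continuousOn_const).inv₀ fun z hz h => ?_)
    have e : z = a := sub_eq_zero.1 h
    exact ha (e ▸ hz)
  refine h1.subset_closure Set.sdiff_subset fun u hu => ?_
  by_cases h0 : u = 0
  · subst h0
    rw [mem_closure_iff_nhdsWithin_neBot]
    have : 𝓝[inversion Ω a \ {0}] (0 : ℂ) = 𝓝[≠] 0 := by
      rw [Set.sdiff_eq, nhdsWithin_inter_of_mem (mem_nhdsWithin_of_mem_nhds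
        (ho.mem_nhds hu))]
    rw [this]
    infer_instance
  · exact subset_closure ⟨hu, h0⟩

lemma noBoundedPiece_inversion (ha : a ∉ Ω) (hS : IsPreconnected Ωᶜ) :
    NoBoundedPiece (inversion Ω a)ᶜ := by
  intro V₁ V₂ h1 h2 hd hcov ⟨u, huS, huV⟩ hb
  obtain ⟨M, hM, hle⟩ := hb.exists_pos_norm_le
  have hmem : ∀ z ∈ Ωᶜ, z ≠ a → (z - a)⁻¹ ∈ (inversion Ω a)ᶜ := by
    rintro z hz hza (h | h)
    · exact hza (sub_eq_zero.1 (inv_eq_zero.1 h))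
    · exact hz (by simpa using h)
  have hop : ∀ V : Set ℂ, IsOpen V → IsOpen {z : ℂ | z ≠ a ∧ (z - a)⁻¹ ∈ V} := fun V hV =>
    ContinuousOn.isOpen_inter_preimage (s := {z : ℂ | z ≠ a})
      ((continuousOn_id.sub continuousOn_const).inv₀ fun z hz => sub_ne_zero.2 hz)
      isOpen_ne hV
  have hu0 : u ≠ 0 := fun h => huS (Or.inl h)
  have hsub : Ωᶜ ⊆ {z : ℂ | z ≠ a ∧ (z - a)⁻¹ ∈ V₁} ∪
      ({z : ℂ | z ≠ a ∧ (z - a)⁻¹ ∈ V₂} ∪ ball a M⁻¹) := by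
    intro z hz
    by_cases hza : z = a
    · exact Or.inr (Or.inr (hza ▸ mem_ball_self (inv_pos.2 hM)))
    · rcases hcov (hmem z hz hza) with h | h
      · exact Or.inl ⟨hza, h⟩
      · exact Or.inr (Or.inl ⟨hza, h⟩)
  have hdisj : Ωᶜ ∩ ({z : ℂ | z ≠ a ∧ (z - a)⁻¹ ∈ V₁} ∩
      ({z : ℂ | z ≠ a ∧ (z - a)⁻¹ ∈ V₂} ∪ ball a M⁻¹)) = ∅ := by
    rw [eq_empty_iff_forall_notMem]
    rintro z ⟨hz, ⟨hza, hz1⟩, ⟨-, hz2⟩ | hz2⟩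
    · exact Set.disjoint_left.1 hd hz1 hz2
    · have h3 := hle _ ⟨hmem z hz hza, hz1⟩
      have hp : 0 < ‖z - a‖ := norm_pos_iff.2 (sub_ne_zero.2 hza)
      rw [norm_inv] at h3
      rw [mem_ball, dist_eq_norm] at hz2
      exact absurd ((inv_le_comm₀ hp hM).1 h3) (not_le.2 hz2)
  rcases (isPreconnected_iff_subset_of_disjoint.1 hS) _ _ (hop V₁ h1)
    ((hop V₂ h2).union isOpen_ball) hsub hdisj with h | h
  · exact (h ha).1 rfl
  · have huΩ : a + u⁻¹ ∈ Ωᶜ := fun h => huS (Or.inr h)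
    rcases h huΩ with h | h
    · have := h.2
      simp only [add_sub_cancel_left, inv_inv] at this
      exact Set.disjoint_left.1 hd huV this
    · rw [mem_ball, dist_eq_norm, add_sub_cancel_left, norm_inv] at h
      exact absurd (hle u ⟨huS, huV⟩) (not_le.2 ((inv_lt_inv₀ (norm_pos_iff.2 hu0) hM).1 h))

lemma exists_biholo_punct_ball (hΩ : IsOpen Ω) (hc : IsPreconnected Ω) (hS : IsPreconnected Ωᶜ)
    (ha : a ∉ Ω) {b : ℂ} (hb : b ∉ Ω) (hab : b ≠ a) {R : ℝ} (hR : (closedBall (0 : ℂ) R)ᶜ ⊆ Ω) :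
    ∃ φ η, Biholo φ η (ball 0 1 \ {0}) Ω := by
  have ho := isOpen_inversion (a := a) hΩ hR
  have hbS : (b - a)⁻¹ ∉ inversion Ω a := by
    rintro (h | h)
    · exact hab (sub_eq_zero.1 (inv_eq_zero.1 h))
    · exact hb (by simpa using h)
  obtain ⟨φ, η, hB, h0⟩ := exists_biholo_ball_of_noBoundedPiece ho
    (isPreconnected_inversion ha hc ho) (noBoundedPiece_inversion ha hS) (Or.inl rfl : (0 : ℂ) ∈ _) hbS
  have hz0 : (0 : ℂ) ∈ ball (0 : ℂ) 1 := mem_ball_self one_pos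
  have hφ0 : ∀ w ∈ ball (0 : ℂ) 1 \ {0}, φ w ≠ 0 := fun w hw h => hw.2 (by
    have h3 := hB.left_inv w hw.1
    have h4 := hB.left_inv 0 hz0
    rw [h] at h3
    rw [h0] at h4
    exact h3.symm.trans h4)
  have hza : ∀ z ∈ Ω, z - a ≠ 0 := fun z hz h => ha (sub_eq_zero.1 h ▸ hz)
  have hmem : ∀ z ∈ Ω, (z - a)⁻¹ ∈ inversion Ω a := fun z hz => Or.inr (by simpa using hz)
  refine ⟨fun w => a + (φ w)⁻¹, fun z => η (z - a)⁻¹, isOpen_ball.sdiff isClosed_singleton, hΩ,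
    ?_, ?_, ?_, ?_, ?_, ?_⟩
  · exact ((hB.diff.mono Set.sdiff_subset).inv hφ0).const_add a
  · exact hB.diff_inv.comp ((differentiableOn_id.sub_const a).inv hza) hmem
  · exact fun w hw => (hB.mapsTo hw.1).resolve_left (hφ0 w hw)
  · refine fun z hz => ⟨hB.mapsTo_inv (hmem z hz), fun h => ?_⟩
    have h1 := hB.right_inv _ (hmem z hz)
    have h2 : η (z - a)⁻¹ = 0 := h
    rw [h2, h0] at h1
    exact inv_ne_zero (hza z hz) h1.symm
  · intro w hw
    simp only [add_sub_cancel_left, inv_inv]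
    exact hB.left_inv w hw.1
  · intro z hz
    rw [hB.right_inv _ (hmem z hz), inv_inv, add_sub_cancel]

end Inversion

theorem IsJordanComplComponent.hasDecomposition {p : ℝ} (hp : 1 < p) {Ω Γ : Set ℂ}
    (h : IsJordanComplComponent Ω Γ) : HasDecomposition p (hypDensity Ω) Ω := by
  obtain ⟨⟨f, hfc, hfi, hfΓ⟩, hΩ, hc, hd, hfr⟩ := h
  have h1 : (1 : ℂ) ∈ unitCircleSet := by simp [unitCircleSet]
  have h2 : (-1 : ℂ) ∈ unitCircleSet := by simp [unitCircleSet]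
  have hmem : ∀ z ∈ unitCircleSet, f z ∈ Γ := fun z hz => hfΓ ▸ mem_image_of_mem f hz
  have hout : ∀ z ∈ Γ, z ∉ Ω := fun z hz hzΩ => notMem_empty z (hd ▸ ⟨hzΩ, hz⟩)
  have hab : f (-1) ≠ f 1 := fun e => by
    have := hfi h2 h1 e
    norm_num at this
  have hΓc : IsPreconnected Γ := hfΓ ▸
    (isPreconnected_sphere (by simp) (0 : ℂ) 1).image f hfc
  have hΓk : IsCompact Γ := hfΓ ▸ (isCompact_sphere (0 : ℂ) 1).image_of_continuousOn hfc
  have hS : IsPreconnected Ωᶜ := isPreconnected_of_frontier hΩ.isClosed_compl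
    (by rwa [frontier_compl, hfr]) (by rw [frontier_compl, hfr]; exact ⟨_, hmem 1 h1⟩)
  have ha := hout _ (hmem 1 h1)
  by_cases hbd : IsBounded Ω
  · have hne : Ω.Nonempty := by
      rw [nonempty_iff_ne_empty]
      rintro rfl
      rw [frontier_empty] at hfr
      exact notMem_empty _ (hfr ▸ hmem 1 h1)
    obtain ⟨z₀, hz₀⟩ := hne
    have hS' : ¬ IsBounded Ωᶜ := fun hb => by
      have := hbd.union hb
      rw [union_compl_self] at this
      exact NormedSpace.unbounded_univ ℝ ℂ this
    obtain ⟨φ, η, hB, -⟩ := exists_biholo_ball_of_noBoundedPiece hΩ hc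
      (IsPreconnected.noBoundedPiece hS hS') hz₀ ha
    exact hB.hasDecomposition_hyp (hasDecomposition_disk hp)
  · obtain ⟨R, hR, hΓR⟩ := hΓk.isBounded.exists_pos_norm_le
    have hsub : (closedBall (0 : ℂ) R)ᶜ ⊆ Ω := by
      refine subset_of_disjoint_frontier (isPreconnected_compl_closedBall hR) hΩ ?_ ?_
      · rw [hfr, Set.disjoint_left]
        exact fun z hz hzΓ => hz (mem_closedBall_zero_iff.2 (hΓR z hzΓ))
      · by_contra hcon
        refine hbd ((isBounded_closedBall (x := (0 : ℂ)) (r := R)).subset fun z hz => ?_)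
        by_contra hz'
        exact hcon ⟨z, hz', hz⟩
    obtain ⟨φ, η, hB⟩ := exists_biholo_punct_ball hΩ hc hS ha (hout _ (hmem _ h2)) hab hsub
    exact hB.hasDecomposition_hyp (hasDecomposition_punct hp)

/-- **p-Dirichlet principle.** For any `p > 1` and any Jordan domain
`Ω`, the homogeneous Sobolev space `D_p(Ω)` admits the topological direct sum
decomposition `D_p(Ω) = HD_p(Ω) ⊕ closure(C₀^∞(Ω))`: every `f ∈ D_p(Ω)` (given with
a weak derivative `f'` of finite weighted `p`-Dirichlet energy) decomposes, with a
bounded harmonic projection, and the decomposition is unique modulo constants. -/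
theorem statement13 (p : ℝ) (hp : 1 < p) (Ω Γ : Set ℂ)
    (hΩ : IsJordanComplComponent Ω Γ) :
    ∃ C : ℝ≥0∞, 0 < C ∧ C < ⊤ ∧
    ∀ (f : ℂ → ℂ) (f' : ℂ → ℂ →L[ℝ] ℂ), HasWeakFDerivOn f f' Ω →
      sobolevEnergyW p (hypDensity Ω) f' Ω < ⊤ →
      ∃ hF : ℂ → ℂ, MemHD p (hypDensity Ω) hF Ω ∧
        -- the harmonic projection is bounded
        dirichletEnergy p (hypDensity Ω) hF Ω ≤
          C * sobolevEnergyW p (hypDensity Ω) f' Ω ∧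
        -- f - hF lies in the closure of C₀^∞(Ω)
        ApproxByTest p (hypDensity Ω) (fun z => f' z - fderiv ℝ hF z) Ω ∧
        -- uniqueness of the decomposition modulo constants
        (∀ hF₂ : ℂ → ℂ, MemHD p (hypDensity Ω) hF₂ Ω →
          ApproxByTest p (hypDensity Ω) (fun z => f' z - fderiv ℝ hF₂ z) Ω →
          ∃ c : ℂ, ∀ z ∈ Ω, hF₂ z = hF z + c) :=
  hΩ.hasDecomposition hp

end WPPaper
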